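/- Let X be a Stein space of pure dimension n, D = {x ∈ X : ψ(x) < c} for some c ∈ ℝ and a real analytic strongly plurisubharmonic exhaustion function ψ on X, K ⋐ D compact, and U ⊆ D \ K open. Assume h*_{K,D} is continuous, and let u ∈ PSH(U) ∩ L^∞(U) with u ≤ 1 satisfy liminf_{U∋z→z₀} (h*_{K,D}(z) − u(z)) ≥ 0 for all z₀ ∈ ∂U ∩ D. Then u ≤ h*_{K,D} on U. -/

import Mathlib

/-!
Plurisubharmonic functions, complex spaces, relative extremal functions, Stein spaces.
-/

open Set Filter Topology Metric

noncomputable section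

/-- `ℂⁿ`, modeled as functions `Fin n → ℂ`. -/
abbrev Cn (n : ℕ) : Type := Fin n → ℂ

/-- A real-valued function is harmonic on a subset of `ℂ` if it is locally
the real part of a holomorphic function. -/
def HarmonicOnCC (h : ℂ → ℝ) (Ω : Set ℂ) : Prop :=
  ∀ z ∈ Ω, ∃ W : Set ℂ, IsOpen W ∧ z ∈ W ∧ W ⊆ Ω ∧
    ∃ f : ℂ → ℂ, DifferentiableOn ℂ f W ∧ ∀ w ∈ W, h w = (f w).re

/-- Upper semicontinuity together with domination on closed discs by harmonic functions. -/
def SubharmonicOnCC (u : ℂ → EReal) (Ω : Set ℂ) : Prop :=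
  UpperSemicontinuousOn u Ω ∧
  ∀ (a : ℂ) (r : ℝ), 0 < r → closedBall a r ⊆ Ω →
    ∀ h : ℂ → ℝ, ContinuousOn h (closedBall a r) → HarmonicOnCC h (ball a r) →
      (∀ z ∈ sphere a r, u z ≤ (h z : EReal)) →
      ∀ z ∈ closedBall a r, u z ≤ (h z : EReal)

section NormedE

variable {E : Type*} [NormedAddCommGroup E] [NormedSpace ℂ E]

/-- Plurisubharmonicity on an open subset `Ω` of a complex normed space: `u` is not
identically `-∞` on a nonempty open subset, and subharmonic along every complex line. -/
def PSHOnE (u : E → EReal) (Ω : Set E) : Prop :=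
  (∀ z ∈ Ω, u z < ⊤) ∧ UpperSemicontinuousOn u Ω ∧
  (¬ ∃ U : Set E, U ⊆ Ω ∧ IsOpen U ∧ U.Nonempty ∧ ∀ z ∈ U, u z = ⊥) ∧
  ∀ a b : E, SubharmonicOnCC (fun w : ℂ => u (a + w • b)) {w : ℂ | a + w • b ∈ Ω}

/-- Locally, subtracting a small multiple of `‖z‖²` preserves plurisubharmonicity. -/
def StronglyPSHOnE (u : E → ℝ) (Ω : Set E) : Prop :=
  ∀ x ∈ Ω, ∃ ε : ℝ, 0 < ε ∧ ∃ U : Set E, IsOpen U ∧ x ∈ U ∧ U ⊆ Ω ∧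
    PSHOnE (fun z => ((u z - ε * ‖z‖ ^ 2 : ℝ) : EReal)) U

/-- An analytic subvariety `B` of an open set `V`: locally the common zero locus of
finitely many holomorphic functions. -/
def IsSubvariety (B V : Set E) : Prop :=
  IsOpen V ∧ B ⊆ V ∧
  ∀ z ∈ V, ∃ W : Set E, IsOpen W ∧ z ∈ W ∧ W ⊆ V ∧
    ∃ (m : ℕ) (F : Fin m → E → ℂ), (∀ i, DifferentiableOn ℂ (F i) W) ∧
      B ∩ W = {w ∈ W | ∀ i, F i w = 0}

end NormedE

/-- A homeomorphism `φ` of an open set `U ⊆ X` onto an analytic subvariety `B` of an open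
subset `V` of a finite-dimensional complex normed space. -/
structure CChart (X : Type*) [TopologicalSpace X] where
  E : Type
  [nacg : NormedAddCommGroup E]
  [nsp : NormedSpace ℂ E]
  [fd : FiniteDimensional ℂ E]
  U : Set X
  V : Set E
  B : Set E
  φ : X → E
  openU : IsOpen U
  subvariety : IsSubvariety B V
  mapsToB : ∀ x ∈ U, φ x ∈ B
  injOn : Set.InjOn φ U
  image_eq : φ '' U = B
  contOn : ContinuousOn φ U
  open_image : ∀ W : Set X, W ⊆ U → IsOpen W → ∃ V'' : Set E, IsOpen V'' ∧ φ '' W = B ∩ V''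

attribute [instance] CChart.nacg CChart.nsp CChart.fd

/-- The transition map extends holomorphically near every point of the overlap. -/
def ChartCompat {X : Type*} [TopologicalSpace X] (c d : CChart X) : Prop :=
  ∀ x ∈ c.U ∩ d.U, ∃ W : Set c.E, IsOpen W ∧ c.φ x ∈ W ∧
    ∃ F : c.E → d.E, DifferentiableOn ℂ F W ∧
      ∀ y ∈ c.U ∩ d.U, c.φ y ∈ W → F (c.φ y) = d.φ y

/-- A (reduced) complex space structure on `X`: an atlas of compatible charts. -/
structure CSpace (X : Type*) [TopologicalSpace X] where
  atlas : Set (CChart X)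
  chart_cover : ∀ x : X, ∃ c ∈ atlas, x ∈ c.U
  compat : ∀ c ∈ atlas, ∀ d ∈ atlas, ChartCompat c d

section Space

variable {X : Type*} [TopologicalSpace X]

/-- `f` is locally, in some chart, the restriction of an ambient holomorphic function. -/
def SpaceHolOn (S : CSpace X) (f : X → ℂ) (D : Set X) : Prop :=
  ∀ x ∈ D, ∃ c ∈ S.atlas, x ∈ c.U ∧ ∃ V' : Set c.E, IsOpen V' ∧ V' ⊆ c.V ∧ c.φ x ∈ V' ∧
    {y ∈ c.U | c.φ y ∈ V'} ⊆ D ∧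
    ∃ F : c.E → ℂ, DifferentiableOn ℂ F V' ∧ ∀ y ∈ c.U, c.φ y ∈ V' → F (c.φ y) = f y

def HolMapTo (S : CSpace X) (f : ℂ → X) (Ω : Set ℂ) : Prop :=
  ContinuousOn f Ω ∧
  ∀ c ∈ S.atlas, DifferentiableOn ℂ (fun w => c.φ (f w)) (Ω ∩ f ⁻¹' c.U)

/-- `A` is locally cut out in `D` by finitely many holomorphic equations. -/
def IsAnalyticIn (S : CSpace X) (A D : Set X) : Prop :=
  A ⊆ D ∧ ∀ x ∈ D, ∃ c ∈ S.atlas, x ∈ c.U ∧ ∃ V' : Set c.E, IsOpen V' ∧ V' ⊆ c.V ∧ c.φ x ∈ V' ∧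
    ∃ (m : ℕ) (F : Fin m → c.E → ℂ), (∀ i, DifferentiableOn ℂ (F i) V') ∧
      ∀ y ∈ c.U, c.φ y ∈ V' → y ∈ D → (y ∈ A ↔ ∀ i, F i (c.φ y) = 0)

def IsIrreducibleIn (S : CSpace X) (D : Set X) : Prop :=
  D.Nonempty ∧ ∀ A₁ A₂ : Set X, IsAnalyticIn S A₁ D → IsAnalyticIn S A₂ D →
    A₁ ∪ A₂ = D → A₁ = D ∨ A₂ = D

/-- An irreducible analytic subset of `D`. -/
def IsIrreducibleAnalyticIn (S : CSpace X) (C D : Set X) : Prop :=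
  IsAnalyticIn S C D ∧ C.Nonempty ∧
  ∀ A₁ A₂ : Set X, IsAnalyticIn S A₁ D → IsAnalyticIn S A₂ D →
    C ⊆ A₁ ∪ A₂ → C ⊆ A₁ ∨ C ⊆ A₂

/-- An irreducible component of `D`: a maximal irreducible analytic subset. -/
def IsIrredComponentIn (S : CSpace X) (C D : Set X) : Prop :=
  IsIrreducibleAnalyticIn S C D ∧
  ∀ C' : Set X, IsIrreducibleAnalyticIn S C' D → C ⊆ C' → C' = C

def IsLocallyIrreducibleIn (S : CSpace X) (D : Set X) : Prop :=
  ∀ x ∈ D, ∀ W : Set X, IsOpen W → x ∈ W →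
    ∃ D' : Set X, IsOpen D' ∧ x ∈ D' ∧ D' ⊆ W ∩ D ∧ IsIrreducibleIn S D'

/-- `u` is not identically `-∞` on any irreducible component of `D` and locally the restriction
of an ambient plurisubharmonic function. -/
def SpacePSHOn (S : CSpace X) (u : X → EReal) (D : Set X) : Prop :=
  (∀ x ∈ D, u x < ⊤) ∧
  (∀ C : Set X, IsIrredComponentIn S C D → ∃ x ∈ C, u x ≠ ⊥) ∧
  ∀ x ∈ D, ∃ c ∈ S.atlas, x ∈ c.U ∧ ∃ V' : Set c.E, IsOpen V' ∧ V' ⊆ c.V ∧ c.φ x ∈ V' ∧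
    {y ∈ c.U | c.φ y ∈ V'} ⊆ D ∧
    ∃ ψ : c.E → EReal, PSHOnE ψ V' ∧ ∀ y ∈ c.U, c.φ y ∈ V' → ψ (c.φ y) = u y

/-- Real analyticity, via charts. -/
def SpaceRealAnalyticOn (S : CSpace X) (f : X → ℝ) (D : Set X) : Prop :=
  ∀ x ∈ D, ∃ c ∈ S.atlas, x ∈ c.U ∧ ∃ V' : Set c.E, IsOpen V' ∧ V' ⊆ c.V ∧ c.φ x ∈ V' ∧
    {y ∈ c.U | c.φ y ∈ V'} ⊆ D ∧
    ∃ g : c.E → ℝ, AnalyticOnNhd ℝ g V' ∧ ∀ y ∈ c.U, c.φ y ∈ V' → g (c.φ y) = f y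

/-- Strong plurisubharmonicity, via charts. -/
def SpaceStronglyPSHOn (S : CSpace X) (f : X → ℝ) (D : Set X) : Prop :=
  ∀ x ∈ D, ∃ c ∈ S.atlas, x ∈ c.U ∧ ∃ V' : Set c.E, IsOpen V' ∧ V' ⊆ c.V ∧ c.φ x ∈ V' ∧
    {y ∈ c.U | c.φ y ∈ V'} ⊆ D ∧
    ∃ g : c.E → ℝ, StronglyPSHOnE g V' ∧ ∀ y ∈ c.U, c.φ y ∈ V' → g (c.φ y) = f y

/-- `ψ` is an exhaustion function of `D`: all sublevel sets are relatively compact in `D`. -/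
def IsExhaustionOn (ψ : X → ℝ) (D : Set X) : Prop :=
  ∀ c : ℝ, IsCompact (closure {x ∈ D | ψ x < c}) ∧ closure {x ∈ D | ψ x < c} ⊆ D

/-- The holomorphically convex hull of `K` in `G`. -/
def holHull (S : CSpace X) (K G : Set X) : Set X :=
  {x ∈ G | ∀ f : X → ℂ, SpaceHolOn S f G → ‖f x‖ ≤ sSup ((fun y => ‖f y‖) '' K)}

/-- `G` is holomorphically convex and holomorphically separable. -/
def IsSteinIn (S : CSpace X) (G : Set X) : Prop :=
  (∀ K : Set X, K ⊆ G → IsCompact K → IsCompact (holHull S K G)) ∧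
  ∀ x ∈ G, ∀ y ∈ G, x ≠ y → ∃ f : X → ℂ, SpaceHolOn S f G ∧ f x ≠ f y

def IsManifoldIn (S : CSpace X) (D : Set X) : Prop :=
  ∀ x ∈ D, ∃ c ∈ S.atlas, x ∈ c.U ∧ c.B = c.V

/-- The function `h_{A,D}` (before regularization). -/
def relExtRaw (S : CSpace X) (A D : Set X) : X → EReal := fun z =>
  ⨆ u ∈ {u : X → EReal | SpacePSHOn S u D ∧ (∀ x ∈ D, u x ≤ 1) ∧ ∀ x ∈ A, u x ≤ 0}, u z

/-- The relative extremal function `h*_{A,D}`. -/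
def relExt (S : CSpace X) (A D : Set X) : X → EReal := fun z =>
  limsup (relExtRaw S A D) (𝓝[D] z)

def IsPluripolarIn (S : CSpace X) (P D : Set X) : Prop :=
  ∀ x ∈ P, ∃ U : Set X, IsOpen U ∧ x ∈ U ∧ U ⊆ D ∧
    ∃ u : X → EReal, SpacePSHOn S u U ∧ ∀ y ∈ P ∩ U, u y = ⊥

def PluriregularAt (S : CSpace X) (A : Set X) (a : X) : Prop :=
  a ∈ closure A ∧ ∀ U : Set X, IsOpen U → a ∈ U → relExt S (A ∩ U) U a = 0

def LocallyPluriregular (S : CSpace X) (A : Set X) : Prop :=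
  A.Nonempty ∧ ∀ a ∈ A, PluriregularAt S A a

def IsJosefsonManifold (S : CSpace X) : Prop :=
  IsManifoldIn S univ ∧ ∀ P : Set X, IsPluripolarIn S P univ →
    ∃ u : X → EReal, SpacePSHOn S u univ ∧ ∀ x ∈ P, u x = ⊥

def LocBoundedOn (u : X → EReal) (D : Set X) : Prop :=
  ∀ x ∈ D, ∃ U : Set X, IsOpen U ∧ x ∈ U ∧
    ∃ m M : ℝ, ∀ y ∈ U ∩ D, (m : EReal) ≤ u y ∧ u y ≤ (M : EReal)

/-- (Global) boundedness of an `EReal`-valued function on `D`. -/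
def BoundedOn (u : X → EReal) (D : Set X) : Prop :=
  ∃ m M : ℝ, ∀ y ∈ D, (m : EReal) ≤ u y ∧ u y ≤ (M : EReal)

def LocallyLRegular (S : CSpace X) (E : Set X) : Prop :=
  ∀ x ∈ E, ∀ W : Set X, IsOpen W → x ∈ W →
    ∃ U₀ : Set X, IsOpen U₀ ∧ x ∈ U₀ ∧ U₀ ⊆ W ∧
      ContinuousOn (relExt S (E ∩ U₀) U₀) U₀ ∧
      ∀ y ∈ E ∩ U₀, relExt S (E ∩ U₀) U₀ y = 0

end Space

open MeasureTheory

def d2 {n : ℕ} (u : Cn n → ℝ) (z v w : Cn n) : ℝ :=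
  fderiv ℝ (fun x => fderiv ℝ u x v) z w

def cHess {n : ℕ} (u : Cn n → ℝ) (z : Cn n) : Matrix (Fin n) (Fin n) ℂ :=
  Matrix.of fun j k =>
    (((d2 u z (Pi.single j 1) (Pi.single k 1) +
        d2 u z (Pi.single j Complex.I) (Pi.single k Complex.I) : ℝ) : ℂ) +
      Complex.I * ((d2 u z (Pi.single j 1) (Pi.single k Complex.I) -
        d2 u z (Pi.single j Complex.I) (Pi.single k 1) : ℝ) : ℂ)) / 4

def maDensity {n : ℕ} (u : Cn n → ℝ) (z : Cn n) : ℝ :=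
  (4 : ℝ) ^ n * (n.factorial : ℝ) * ((cHess u z).det).re

def smoothMA {n : ℕ} (u : Cn n → ℝ) : Measure (Cn n) :=
  volume.withDensity fun z => ENNReal.ofReal (maDensity u z)

def IsMAOn {n : ℕ} (u : Cn n → EReal) (Ω : Set (Cn n)) (μ : Measure (Cn n)) : Prop :=
  (∀ A : Set (Cn n), MeasurableSet A → Disjoint A Ω → μ A = 0) ∧
  ∀ v : ℕ → Cn n → ℝ, (∀ j, ContDiff ℝ (⊤ : ℕ∞) (v j)) →
    (∀ j, PSHOnE (fun z => ((v j z : ℝ) : EReal)) Ω) →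
    (∀ z ∈ Ω, Antitone fun j => v j z) →
    (∀ z ∈ Ω, Tendsto (fun j => ((v j z : ℝ) : EReal)) atTop (𝓝 (u z))) →
    ∀ f : Cn n → ℝ, Continuous f → HasCompactSupport f → tsupport f ⊆ Ω →
      Tendsto (fun j => ∫ z, f z ∂(smoothMA (v j))) atTop (𝓝 (∫ z, f z ∂μ))

section SpaceMA

variable {X : Type*} [TopologicalSpace X]

/-- A homeomorphism `ρ` of an open `U₀ ⊆ X` onto an open `Ω₀ ⊆ ℂⁿ` which identifies the
holomorphic functions on both sides. -/
def IsLocalCoord (S : CSpace X) (n : ℕ) (U₀ : Set X) (ρ : X → Cn n) (Ω₀ : Set (Cn n)) :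
    Prop :=
  IsOpen U₀ ∧ IsOpen Ω₀ ∧ ρ '' U₀ = Ω₀ ∧ InjOn ρ U₀ ∧ ContinuousOn ρ U₀ ∧
  (∀ W : Set X, W ⊆ U₀ → IsOpen W → IsOpen (ρ '' W)) ∧
  (∀ j : Fin n, SpaceHolOn S (fun x => ρ x j) U₀) ∧
  ∀ f : X → ℂ, SpaceHolOn S f U₀ →
    ∃ F : Cn n → ℂ, DifferentiableOn ℂ F Ω₀ ∧ ∀ x ∈ U₀, F (ρ x) = f x

/-- The set of regular points of dimension `n`. -/
def RegLocus (S : CSpace X) (n : ℕ) : Set X :=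
  {x | ∃ (U₀ : Set X) (ρ : X → Cn n) (Ω₀ : Set (Cn n)), IsLocalCoord S n U₀ ρ Ω₀ ∧ x ∈ U₀}

/-- The `n`-dimensional regular points are dense in `D`, and there are no others. -/
def PureDimensionIn (S : CSpace X) (D : Set X) (n : ℕ) : Prop :=
  D ⊆ closure (RegLocus S n ∩ D) ∧ ∀ k : ℕ, (RegLocus S k ∩ D).Nonempty → k = n

def IsMAOnSpace [MeasurableSpace X] (S : CSpace X) (n : ℕ) (u : X → EReal) (D : Set X)
    (μ : Measure X) : Prop :=
  (∀ A : Set X, MeasurableSet A → Disjoint A D → μ A = 0) ∧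
  (∀ A : Set X, MeasurableSet A → A ⊆ D → Disjoint A (RegLocus S n) → μ A = 0) ∧
  ∀ (U₀ : Set X) (ρ : X → Cn n) (Ω₀ : Set (Cn n)), IsLocalCoord S n U₀ ρ Ω₀ → U₀ ⊆ D →
    ∃ (uu : Cn n → EReal) (ν : Measure (Cn n)),
      (∀ x ∈ U₀, uu (ρ x) = u x) ∧ IsMAOn uu Ω₀ ν ∧
      ∀ A : Set X, MeasurableSet A → A ⊆ U₀ → μ A = ν (ρ '' A)

def elog (t : ℝ) : EReal := if t ≤ 0 then ⊥ else ((Real.log t : ℝ) : EReal)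

def WeaklyParabolicIn [MeasurableSpace X] (S : CSpace X) (n : ℕ) (g : X → ℝ) (D : Set X) :
    Prop :=
  (∀ x ∈ D, 0 ≤ g x) ∧ ContinuousOn g D ∧
  SpacePSHOn S (fun x => ((g x : ℝ) : EReal)) D ∧
  IsExhaustionOn g D ∧
  SpacePSHOn S (fun x => elog (g x)) D ∧
  IsMAOnSpace S n (fun x => elog (g x)) {x ∈ D | g x ≠ 0} (0 : Measure X)

end SpaceMA

section Pi

variable {ι : Type*} [Fintype ι] {Z : ι → Type*} [∀ i, TopologicalSpace (Z i)]

def PiHolOn (T : ∀ i, CSpace (Z i)) (f : (∀ i, Z i) → ℂ) (Ω : Set (∀ i, Z i)) : Prop :=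
  ∀ w ∈ Ω, ∃ c : ∀ i, CChart (Z i), (∀ i, c i ∈ (T i).atlas) ∧ (∀ i, w i ∈ (c i).U) ∧
    ∃ V' : Set (∀ i, (c i).E), IsOpen V' ∧ (fun i => (c i).φ (w i)) ∈ V' ∧
      {y : ∀ i, Z i | (∀ i, y i ∈ (c i).U) ∧ (fun i => (c i).φ (y i)) ∈ V'} ⊆ Ω ∧
      ∃ F : (∀ i, (c i).E) → ℂ, DifferentiableOn ℂ F V' ∧
        ∀ y : ∀ i, Z i, (∀ i, y i ∈ (c i).U) → ((fun i => (c i).φ (y i)) ∈ V') →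
          F (fun i => (c i).φ (y i)) = f y

def PiPSHOn (T : ∀ i, CSpace (Z i)) (u : (∀ i, Z i) → EReal) (Ω : Set (∀ i, Z i)) : Prop :=
  (∀ z ∈ Ω, u z < ⊤) ∧
  (¬ ∃ U : Set (∀ i, Z i), U ⊆ Ω ∧ IsOpen U ∧ U.Nonempty ∧ ∀ z ∈ U, u z = ⊥) ∧
  ∀ w ∈ Ω, ∃ c : ∀ i, CChart (Z i), (∀ i, c i ∈ (T i).atlas) ∧ (∀ i, w i ∈ (c i).U) ∧
    ∃ V' : Set (∀ i, (c i).E), IsOpen V' ∧ (fun i => (c i).φ (w i)) ∈ V' ∧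
      {y : ∀ i, Z i | (∀ i, y i ∈ (c i).U) ∧ (fun i => (c i).φ (y i)) ∈ V'} ⊆ Ω ∧
      ∃ ψ : (∀ i, (c i).E) → EReal, PSHOnE ψ V' ∧
        ∀ y : ∀ i, Z i, (∀ i, y i ∈ (c i).U) → ((fun i => (c i).φ (y i)) ∈ V') →
          ψ (fun i => (c i).φ (y i)) = u y

def PiRelExtRaw (T : ∀ i, CSpace (Z i)) (A D : Set (∀ i, Z i)) : (∀ i, Z i) → EReal :=
  fun z =>
    ⨆ u ∈ {u : (∀ i, Z i) → EReal |
      PiPSHOn T u D ∧ (∀ x ∈ D, u x ≤ 1) ∧ ∀ x ∈ A, u x ≤ 0}, u z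

def PiRelExt (T : ∀ i, CSpace (Z i)) (A D : Set (∀ i, Z i)) : (∀ i, Z i) → EReal :=
  fun z => limsup (PiRelExtRaw T A D) (𝓝[D] z)

def PiPluripolar (T : ∀ i, CSpace (Z i)) (P : Set (∀ i, Z i)) : Prop :=
  ∀ w ∈ P, ∃ U : Set (∀ i, Z i), IsOpen U ∧ w ∈ U ∧
    ∃ u : (∀ i, Z i) → EReal, PiPSHOn T u U ∧ ∀ y ∈ P ∩ U, u y = ⊥

end Pi

section Cross

variable {N : ℕ} {X : Fin N → Type*}

def idxCard (α : Fin N → Bool) : ℕ := (Finset.univ.filter fun j => α j = true).card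

def insertCoords (α : Fin N → Bool) (a : ∀ j : {j : Fin N // α j = false}, X j.1)
    (z : ∀ j : {j : Fin N // α j = true}, X j.1) : ∀ j, X j :=
  fun j => if h : α j = true then z ⟨j, h⟩ else a ⟨j, Bool.eq_false_iff.mpr h⟩

def proj0 (α : Fin N → Bool) (w : ∀ j, X j) : ∀ j : {j : Fin N // α j = false}, X j.1 :=
  fun j => w j.1

def piASet (A : ∀ j, Set (X j)) (α : Fin N → Bool) :
    Set (∀ j : {j : Fin N // α j = false}, X j.1) :=
  {a | ∀ j, a j ∈ A j.1}

def crossT (A : ∀ j, Set (X j)) (k : ℕ)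
    (Sig : ∀ α : Fin N → Bool, Set (∀ j : {j : Fin N // α j = false}, X j.1)) :
    Set (∀ j, X j) :=
  {w | ∃ α : Fin N → Bool, idxCard α = k ∧
    (∀ j : {j : Fin N // α j = false}, w j.1 ∈ A j.1) ∧ proj0 α w ∉ Sig α}

variable [∀ j, TopologicalSpace (X j)]

def SepHol (S : ∀ j, CSpace (X j)) (A : ∀ j, Set (X j)) (k : ℕ)
    (Sig : ∀ α : Fin N → Bool, Set (∀ j : {j : Fin N // α j = false}, X j.1))
    (f : (∀ j, X j) → ℂ) : Prop :=
  ∀ α : Fin N → Bool, idxCard α = k →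
    ∀ a : ∀ j : {j : Fin N // α j = false}, X j.1, a ∈ piASet A α → a ∉ Sig α →
      PiHolOn (fun j : {j : Fin N // α j = true} => S j.1)
        (fun z => f (insertCoords α a z)) univ

def SepHolC (S : ∀ j, CSpace (X j)) (A : ∀ j, Set (X j)) (k : ℕ)
    (Sig : ∀ α : Fin N → Bool, Set (∀ j : {j : Fin N // α j = false}, X j.1))
    (f : (∀ j, X j) → ℂ) : Prop :=
  SepHol S A k Sig f ∧
  ∀ α : Fin N → Bool, idxCard α = k →
    ∀ b : ∀ j : {j : Fin N // α j = true}, X j.1,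
      ContinuousOn (fun a : ∀ j : {j : Fin N // α j = false}, X j.1 =>
        f (insertCoords α a b)) (piASet A α \ Sig α)

def crossEnvelope (S : ∀ j, CSpace (X j)) (A : ∀ j, Set (X j))
    (k : ℝ) : Set (∀ j, X j) :=
  {z | (∑ j, relExt (S j) (A j) univ (z j)) < ((k : ℝ) : EReal)}

end Cross

open scoped ContDiff
open Complex (I)
open Function (update update_of_ne)
open Pi (single)
open Real (circleAverage circleAverage_fun_add circleAverage_mono circleAverage_const
  circleAverage_congr_sphere circleAverage_fun_smul norm_eq_abs norm_of_nonneg)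
open Finset (sum_congr mul_sum sum_add_distrib)

/-! ### Notation -/

notation "Smooth" => ContDiff ℝ ∞

/-- The real second derivative. -/
notation:max "D2" f:max => fderiv ℝ (fderiv ℝ f)

/-- Real functions on `ℂᵈ`. -/
notation:max "Fn" d:max => Cn d → ℝ

/-- Real bilinear forms on `ℂᵈ`. -/
notation:max "Bil" d:max => Cn d →L[ℝ] Cn d →L[ℝ] ℝ

notation:max "Mat" d:max => Matrix (Fin d) (Fin d) ℂ

/-- The sign of a permutation as a complex number. -/
notation:max "sgn" s:max => (((Equiv.Perm.sign s : ℤˣ) : ℤ) : ℂ)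

lemma ContDiff.fderiv_smooth {E F : Type*} [NormedAddCommGroup E] [NormedSpace ℝ E]
    [NormedAddCommGroup F] [NormedSpace ℝ F] {f : E → F} (h : Smooth f) : Smooth (fderiv ℝ f) :=
  h.fderiv_right (by norm_num)

lemma ContDiff.diff {E F : Type*} [NormedAddCommGroup E] [NormedSpace ℝ E] [NormedAddCommGroup F]
    [NormedSpace ℝ F] {f : E → F} (h : Smooth f) : Differentiable ℝ f :=
  h.differentiable (by norm_num)

/-! ### Subharmonic functions of one variable -/

lemma circleAverage_re {f : ℂ → ℂ} {a : ℂ} {r : ℝ} (hf : DiffContOnCl ℂ f (ball a |r|)) :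
    circleAverage (fun z => (f z).re) a r = (f a).re := by
  have h := Complex.reCLM.circleAverage_comp_comm
    (hf.continuousOn_ball.mono sphere_subset_closedBall).circleIntegrable'
  rw [hf.circleAverage] at h
  simpa [Function.comp_def] using h

lemma circleAverage_const_mul (c : ℝ) (f : ℂ → ℝ) (a : ℂ) (r : ℝ) :
    circleAverage (fun w => c * f w) a r = c * circleAverage f a r :=
  circleAverage_fun_smul (a := c) (f := f) (c := a) (R := r)

/-- Real parts of polynomials are dense in the continuous real functions on a circle. -/
lemma exists_polynomial_re_approx {g : ℂ → ℝ} {r : ℝ} (hr : 0 < r)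
    (hg : ContinuousOn g (sphere 0 r)) {ε : ℝ} (hb : 0 < ε) :
    ∃ P : Polynomial ℂ, ∀ z ∈ sphere (0 : ℂ) r, |g z - (P.eval z).re| ≤ ε := by
  have : Fact (0 < 2 * Real.pi) := ⟨Real.two_pi_pos⟩
  let e : AddCircle (2 * Real.pi) → ℂ := fun x => r * (AddCircle.toCircle x : ℂ)
  have hes : ∀ x, e x ∈ sphere (0 : ℂ) r := fun x => by
    simp [e, abs_of_pos hr, Circle.norm_coe]
  have hec : Continuous e := by
    have := AddCircle.continuous_toCircle (T := 2 * Real.pi)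
    fun_prop
  let G : C(AddCircle (2 * Real.pi), ℂ) :=
    ⟨fun x => ((g (e x) : ℝ) : ℂ), Complex.continuous_ofReal.comp
      (hg.comp_continuous hec hes)⟩
  have hmon : ∀ (m : ℕ) (c : ℂ), ∃ P : Polynomial ℂ, ∀ x,
      (c * fourier (m : ℤ) x).re = (P.eval (e x)).re := fun m c => by
    refine ⟨.C (c / r ^ m) * .X ^ m, fun x => ?_⟩
    have : (r : ℂ) ^ m ≠ 0 := by exact_mod_cast pow_ne_zero _ hr.ne'
    simp only [fourier_apply, e, Polynomial.eval_mul, Polynomial.eval_C, Polynomial.eval_pow,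
      Polynomial.eval_X, mul_pow, AddCircle.toCircle_zsmul]
    congr 1
    push_cast
    field_simp
    rw [zpow_natCast]
  have hpoly : ∀ p ∈ Submodule.span ℂ (range (@fourier (2 * Real.pi))),
      ∀ c : ℂ, ∃ P : Polynomial ℂ, ∀ x, (c * p x).re = (P.eval (e x)).re := by
    intro p hp
    induction hp using Submodule.span_induction with
    | mem p hp =>
      obtain ⟨n, rfl⟩ := hp
      intro c
      obtain ⟨m, rfl | rfl⟩ := n.eq_nat_or_neg
      · exact hmon m c
      · obtain ⟨P, hP⟩ := hmon m (starRingEnd ℂ c)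
        exact ⟨P, fun x => by rw [← hP, ← Complex.conj_re, map_mul, fourier_neg, Complex.conj_conj]⟩
    | zero => exact fun c => ⟨0, by simp⟩
    | add p q _ _ hp hq =>
      intro c
      obtain ⟨P, hP⟩ := hp c
      obtain ⟨Q, hQ⟩ := hq c
      refine ⟨P + Q, fun x => ?_⟩
      rw [Polynomial.eval_add, Complex.add_re, ← hP, ← hQ, ← Complex.add_re]
      simp [mul_add]
    | smul a p _ hp =>
      intro c
      obtain ⟨P, hP⟩ := hp (c * a)
      refine ⟨P, fun x => ?_⟩
      rw [← hP]
      simp [mul_assoc]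
  have hG : G ∈ (Submodule.span ℂ (range (@fourier (2 * Real.pi)))).topologicalClosure := by
    rw [span_fourier_closure_eq_top]; trivial
  rw [← SetLike.mem_coe, Submodule.topologicalClosure_coe, Metric.mem_closure_iff] at hG
  obtain ⟨p, hp, hGp⟩ := hG ε hb
  obtain ⟨P, hP⟩ := hpoly p hp 1
  refine ⟨P, fun z hz => ?_⟩
  obtain ⟨x, rfl⟩ : ∃ x, e x = z := by
    have hz' : ‖z‖ = r := by simpa using hz
    refine ⟨(Complex.arg z : AddCircle (2 * Real.pi)), ?_⟩
    simp only [e]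
    rw [AddCircle.toCircle_apply_mk]
    have := Complex.norm_mul_exp_arg_mul_I z
    rw [hz'] at this
    simp
    exact this
  rw [← hP, one_mul]
  calc |g (e x) - (p x).re| = |(G x - p x).re| := by simp [G]
    _ ≤ ‖G x - p x‖ := Complex.abs_re_le_norm _
    _ = dist (G x) (p x) := (dist_eq_norm _ _).symm
    _ ≤ dist G p := ContinuousMap.dist_apply_le_dist x
    _ ≤ ε := hGp.le

lemma measurable_comp_circleMap_of_usc {v : ℂ → ℝ} {c : ℂ} {ρ : ℝ}
    (h : UpperSemicontinuousOn v (sphere c |ρ|)) :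
    UpperSemicontinuous fun a => v (circleMap c ρ a) := by
  have := h.comp (g := circleMap c ρ) (t := univ) (continuous_circleMap c ρ).continuousOn
    (fun a _ => circleMap_mem_sphere' c ρ a)
  rwa [upperSemicontinuousOn_univ_iff] at this

lemma circleIntegrable_of_usc {v : ℂ → ℝ} {c : ℂ} {ρ : ℝ}
    (h : UpperSemicontinuousOn v (sphere c |ρ|)) (hb : ∃ m, ∀ z ∈ sphere c |ρ|, m ≤ v z) :
    CircleIntegrable v c ρ := by
  obtain ⟨m, hm'⟩ := hb
  obtain ⟨M, hM⟩ := h.bddAbove_of_isCompact (isCompact_sphere c |ρ|)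
  have hbd : ∀ t, ‖v (circleMap c ρ t)‖ ≤ max |m| |M| := by
    intro t
    rw [norm_eq_abs]
    exact abs_le_max_abs_abs (hm' _ (circleMap_mem_sphere' c ρ t)) (hM (mem_image_of_mem v (circleMap_mem_sphere' c ρ t)))
  unfold CircleIntegrable
  rw [intervalIntegrable_iff]
  exact Measure.integrableOn_of_bounded (by simp [ENNReal.mul_eq_top])
    ((measurable_comp_circleMap_of_usc h).measurable).aestronglyMeasurable (ae_of_all _ hbd)

/-- Lipschitz majorants of a bounded upper semicontinuous function on a compact set. -/
lemma exists_continuous_ge_tendsto {S : Set ℂ} (hS : IsCompact S) (hne : S.Nonempty) {v : ℂ → ℝ}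
    (hv : UpperSemicontinuousOn v S) :
    ∃ h : ℕ → ℂ → ℝ, (∀ k, ContinuousOn (h k) S) ∧ (∀ k, ∀ z ∈ S, v z ≤ h k z) ∧
      (∃ M, ∀ k, ∀ z ∈ S, h k z ≤ M) ∧ ∀ z ∈ S, Tendsto (fun k => h k z) atTop (𝓝 (v z)) := by
  obtain ⟨M, hM⟩ := hv.bddAbove_of_isCompact hS
  have hM' : ∀ z ∈ S, v z ≤ M := fun z hz => hM (mem_image_of_mem v hz)
  have : Nonempty S := hne.to_subtype
  let h : ℕ → ℂ → ℝ := fun k z => ⨆ s : S, (v s - k * dist z s)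
  have hk0 : ∀ (k : ℕ) (z : ℂ) (s : S), 0 ≤ (k : ℝ) * dist z s := fun k z s => by positivity
  have hb : ∀ (k : ℕ) (z : ℂ) (s : S), v s - k * dist z s ≤ M := fun k z s => by
    linarith [hM' s s.2, hk0 k z s]
  have hbdd : ∀ (k : ℕ) (z : ℂ), BddAbove (range fun s : S => v s - k * dist z (s : ℂ)) :=
    fun k z => ⟨M, forall_mem_range.2 (hb k z)⟩
  have hge : ∀ k, ∀ z ∈ S, v z ≤ h k z := by
    intro k z hz
    simpa using le_ciSup (hbdd k z) ⟨z, hz⟩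
  refine ⟨h, fun k => ?_, hge, ⟨M, fun k z _ => ciSup_le (hb k z)⟩, fun z hz => ?_⟩
  · have : LipschitzWith k (h k) := by
      refine LipschitzWith.of_le_add_mul _ fun x y => ?_
      refine ciSup_le fun s => ?_
      have h1 := le_ciSup (hbdd k y) s
      have h2 := dist_triangle y x s
      have h3 : (k : ℝ) * dist y s ≤ k * dist x y + k * dist x s := by
        rw [dist_comm x y, ← mul_add]; gcongr
      simp only [NNReal.coe_natCast]
      change _ ≤ (⨆ s : S, (v s - k * dist y s)) + _
      linarith
    exact this.continuous.continuousOn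
  · rw [tendsto_order]
    refine ⟨fun a ha => .of_forall fun k => ha.trans_le (hge k z hz), fun a ha => ?_⟩
    obtain ⟨a', ha1, ha2⟩ := exists_between ha
    have h1 := hv z hz a' ha1
    rw [eventually_nhdsWithin_iff, Metric.eventually_nhds_iff] at h1
    obtain ⟨d, hd, h1⟩ := h1
    obtain ⟨k0, hk⟩ := exists_nat_gt ((M - a') / d)
    filter_upwards [eventually_ge_atTop k0] with k hk1
    refine lt_of_le_of_lt (ciSup_le fun s => ?_) ha2
    by_cases hs : dist z s < d
    · linarith [h1 (by rwa [dist_comm] at hs) s.2, hk0 k z s]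
    · push Not at hs
      have h3 := hM' s s.2
      have h4 : (k : ℝ) * d ≤ k * dist z s := by gcongr
      have h5 : (k0 : ℝ) * d ≤ k * d := by gcongr
      rw [div_lt_iff₀ hd] at hk
      linarith

/-- Harmonic polynomial majorants of an upper semicontinuous function on a circle. -/
lemma exists_polynomial_re_ge {v : ℂ → ℝ} {a : ℂ} {r : ℝ} (hr : 0 < r)
    (hv : UpperSemicontinuousOn v (sphere a r)) {m : ℝ} (hm : ∀ z ∈ sphere a r, m ≤ v z)
    {ε : ℝ} (hb : 0 < ε) : ∃ P : Polynomial ℂ, (∀ z ∈ sphere a r, v z ≤ ((P.eval (z - a)).re)) ∧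
      (P.eval 0).re ≤ circleAverage v a r + ε := by
  obtain ⟨h, hc, hge, ⟨M, hM⟩, hlim⟩ := exists_continuous_ge_tendsto (isCompact_sphere a r)
    (NormedSpace.sphere_nonempty.2 hr.le) hv
  have hmem : ∀ t, circleMap a r t ∈ sphere a r := fun t => circleMap_mem_sphere a hr.le t
  have hint : ∀ k, CircleIntegrable (h k) a r := fun k => ContinuousOn.circleIntegrable hr.le (hc k)
  have hlim2 : Tendsto (fun k => circleAverage (h k) a r) atTop (𝓝 (circleAverage v a r)) := by
    unfold circleAverage
    refine Tendsto.const_smul ?_ _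
    refine intervalIntegral.tendsto_integral_filter_of_dominated_convergence
      (fun _ => max |m| |M|) ?_ ?_ ?_ ?_
    · refine .of_forall fun k => ?_
      have : Continuous fun t => h k (circleMap a r t) :=
        (hc k).comp_continuous (continuous_circleMap a r) hmem
      exact this.aestronglyMeasurable
    · refine .of_forall fun k => ae_of_all _ fun t _ => ?_
      rw [norm_eq_abs]
      exact abs_le_max_abs_abs ((hm _ (hmem t)).trans (hge k _ (hmem t))) (hM k _ (hmem t))
    · exact intervalIntegrable_const
    · exact ae_of_all _ fun t _ => hlim _ (hmem t)
  obtain ⟨k, hk⟩ := (hlim2.eventually_lt_const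
    (show circleAverage v a r < circleAverage v a r + ε / 2 by linarith)).exists
  obtain ⟨P, hP⟩ := exists_polynomial_re_approx (g := fun z => h k (a + z) + ε / 4) hr (by
      refine ContinuousOn.add ((hc k).comp (by fun_prop) fun z hz => ?_) continuousOn_const
      simpa using hz) (show 0 < ε / 4 by linarith)
  refine ⟨P, fun z hz => ?_, ?_⟩
  · have h1 := hP (z - a) (by simpa [dist_eq_norm] using hz)
    rw [abs_le] at h1
    have h2 := hge k z hz
    simp at h1
    linarith
  · have hd : Differentiable ℂ fun z : ℂ => P.eval (z - a) := by
      have := P.differentiable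
      fun_prop
    have hre := circleAverage_re (r := r) (a := a) hd.diffContOnCl
    rw [sub_self] at hre
    rw [← hre]
    have hlast : circleAverage (fun z => (P.eval (z - a)).re) a r
        ≤ circleAverage (fun z => h k z + ε / 2) a r := by
      refine circleAverage_mono ?_ ((hint k).add (circleIntegrable_const _ _ _)) fun z hz => ?_
      · exact ContinuousOn.circleIntegrable hr.le
          (Complex.continuous_re.comp hd.continuous).continuousOn
      · rw [abs_of_pos hr] at hz
        have h1 := hP (z - a) (by simpa [dist_eq_norm] using hz)
        rw [abs_le] at h1
        simp at h1
        linarith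
    rw [circleAverage_fun_add (hint k) (circleIntegrable_const _ _ _), circleAverage_const] at hlast
    linarith

lemma circleAverage_norm_sq_sub (a z : ℂ) (ρ : ℝ) :
    circleAverage (fun w => ‖w - a‖ ^ 2) z ρ = ‖z - a‖ ^ 2 + ρ ^ 2 := by
  have h1 : ∀ w ∈ sphere z |ρ|, ‖w - a‖ ^ 2
      = (((‖z - a‖ ^ 2 + ρ ^ 2 : ℝ) : ℂ) + 2 * starRingEnd ℂ (z - a) * (w - z)).re := by
    intro w hw
    rw [mem_sphere, dist_eq_norm] at hw
    rw [← sq_abs ρ, ← hw, show w - a = (z - a) + (w - z) by ring]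
    simp only [Complex.sq_norm, Complex.normSq_add]
    simp
    ring
  rw [circleAverage_congr_sphere h1, circleAverage_re (Differentiable.diffContOnCl (by fun_prop)),
    Complex.add_re, Complex.ofReal_re]
  simp

/-- Maximum principle: an upper semicontinuous function with the local submean value property lies
below every continuous function with the local mean value property that dominates it on the
boundary circle. -/
lemma le_of_local_submean {v h : ℂ → ℝ} {a : ℂ} {r : ℝ} (hr : 0 < r)
    (hv : UpperSemicontinuousOn v (closedBall a r)) {m : ℝ} (hm : ∀ z ∈ closedBall a r, m ≤ v z)
    (hsub : ∀ z ∈ ball a r, ∀ᶠ ρ in 𝓝[>] (0 : ℝ), v z ≤ circleAverage v z ρ)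
    (hh : ContinuousOn h (closedBall a r))
    (hmean : ∀ z ∈ ball a r, ∀ᶠ ρ in 𝓝[>] (0 : ℝ), circleAverage h z ρ = h z)
    (hbd : ∀ z ∈ sphere a r, v z ≤ h z) : ∀ z ∈ closedBall a r, v z ≤ h z := by
  intro z1 hz1
  refine le_of_forall_pos_le_add fun ε hg => ?_
  by_contra hcon
  push Not at hcon
  set η := ε / (2 * r ^ 2) with hd
  have hd0 : 0 < η := by positivity
  have hdr : η * r ^ 2 = ε / 2 := by rw [hd]; field_simp
  let F : ℂ → ℝ := fun z => (v z + -h z) + η * ‖z - a‖ ^ 2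
  have hF : UpperSemicontinuousOn F (closedBall a r) := (hv.add (hh.neg.upperSemicontinuousOn)).add
      ((by fun_prop : Continuous fun z : ℂ => η * ‖z - a‖ ^ 2).continuousOn.upperSemicontinuousOn)
  obtain ⟨z0, hz0, hmax⟩ := hF.exists_isMaxOn ⟨z1, hz1⟩ (isCompact_closedBall a r)
  have hFz1 : ε < F z1 := by
    have : 0 ≤ η * ‖z1 - a‖ ^ 2 := by positivity
    simp; linarith
  have hFz0 : ε < F z0 := hFz1.trans_le (hmax hz1)
  have hz0b : z0 ∈ ball a r := by
    rw [mem_ball]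
    refine lt_of_le_of_ne hz0 fun heq => ?_
    have h1 := hbd z0 heq
    have h2 : ‖z0 - a‖ = r := by rw [← dist_eq_norm]; exact heq
    simp only [F, h2] at hFz0
    linarith
  have hsmall : ∀ᶠ ρ in 𝓝[>] (0 : ℝ), closedBall z0 ρ ⊆ ball a r := by
    have hpos : 0 < r - dist z0 a := by rw [mem_ball] at hz0b; linarith
    filter_upwards [Ioo_mem_nhdsGT hpos] with ρ hb
    exact closedBall_subset_ball' (by linarith [hb.2])
  obtain ⟨ρ, hb1, hb2, hb3, hb0⟩ := ((hsub z0 hz0b).and ((hmean z0 hz0b).and (hsmall.and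
    self_mem_nhdsWithin))).exists
  have hb0' := hb0
  have habs := abs_of_pos hb0'
  have hsph : sphere z0 |ρ| ⊆ closedBall a r := by
    rw [habs]
    exact sphere_subset_closedBall.trans (hb3.trans ball_subset_closedBall)
  have iv := circleIntegrable_of_usc (hv.mono hsph) ⟨m, fun z hz => hm z (hsph hz)⟩
  have iq : CircleIntegrable (fun z : ℂ => η * ‖z - a‖ ^ 2) z0 ρ :=
    ContinuousOn.circleIntegrable hb0'.le (by fun_prop)
  have inh := (ContinuousOn.circleIntegrable hb0'.le (hh.mono (by rwa [habs] at hsph))).neg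
  have hF1 : circleAverage F z0 ρ ≤ F z0 :=
    Real.circleAverage_mono_on_of_le_circle ((iv.add inh).add iq) fun z hz => hmax (hsph hz)
  have hF2 : circleAverage F z0 ρ = circleAverage v z0 ρ - h z0 + η * (‖z0 - a‖ ^ 2 + ρ ^ 2) := by
    have e1 := circleAverage_fun_smul (a := (-1 : ℝ)) (f := h) (c := z0) (R := ρ)
    have e2 := circleAverage_fun_smul (a := η) (f := fun z : ℂ => ‖z - a‖ ^ 2) (c := z0) (R := ρ)
    simp only [smul_eq_mul, neg_one_mul, hb2, circleAverage_norm_sq_sub] at e1 e2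
    rw [← e2, sub_eq_add_neg, ← e1]
    exact (circleAverage_fun_add (iv.add inh) iq).trans (congrArg (· + _) (circleAverage_fun_add iv inh))
  have : 0 < η * ρ ^ 2 := by positivity
  simp only [F] at hF1 hF2
  linarith

/-- The local submean value property implies the submean value property on all discs. -/
lemma le_circleAverage_of_local_submean {v : ℂ → ℝ} {a : ℂ} {r : ℝ} (hr : 0 < r)
    (hv : UpperSemicontinuousOn v (closedBall a r)) {m : ℝ} (hm : ∀ z ∈ closedBall a r, m ≤ v z)
    (hsub : ∀ z ∈ ball a r, ∀ᶠ ρ in 𝓝[>] (0 : ℝ), v z ≤ circleAverage v z ρ) :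
    v a ≤ circleAverage v a r := by
  refine le_of_forall_pos_le_add fun ε hb => ?_
  obtain ⟨P, hP, hP0⟩ := exists_polynomial_re_ge hr (hv.mono sphere_subset_closedBall)
    (fun z hz => hm z (sphere_subset_closedBall hz)) hb
  have hd : Differentiable ℂ fun z : ℂ => P.eval (z - a) := by
    have := P.differentiable
    fun_prop
  have := le_of_local_submean (h := fun z => (P.eval (z - a)).re) hr hv hm hsub
    (Complex.continuous_re.comp hd.continuous).continuousOn
    (fun z _ => .of_forall fun ρ => circleAverage_re hd.diffContOnCl) hP a (mem_closedBall_self hr.le)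
  simp at this
  linarith

lemma HarmonicOnCC.eventually_circleAverage_eq {h : ℂ → ℝ} {Ω : Set ℂ} (hh : HarmonicOnCC h Ω)
    {z : ℂ} (hz : z ∈ Ω) : ∀ᶠ ρ in 𝓝[>] (0 : ℝ), circleAverage h z ρ = h z := by
  obtain ⟨W, hW, hzW, -, f, hf, hhf⟩ := hh z hz
  obtain ⟨ε, ha, hball⟩ := Metric.isOpen_iff.1 hW z hzW
  filter_upwards [Ioo_mem_nhdsGT ha] with ρ hr
  have hcl := (closedBall_subset_ball hr.2).trans hball
  rw [hhf z hzW, ← circleAverage_re (f := f) (DifferentiableOn.diffContOnCl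
    (hf.mono (by rw [abs_of_pos hr.1]; exact closure_ball_subset_closedBall.trans hcl)))]
  refine circleAverage_congr_sphere fun w hw => hhf w (hcl ?_)
  rw [abs_of_pos hr.1] at hw
  exact sphere_subset_closedBall hw

lemma harmonicOnCC_re {f : ℂ → ℂ} {Ω : Set ℂ} (hO : IsOpen Ω) (hf : DifferentiableOn ℂ f Ω) :
    HarmonicOnCC (fun z => (f z).re) Ω := fun _ hz => ⟨Ω, hO, hz, subset_rfl, f, hf, fun _ _ => rfl⟩

section Psh

variable {E F : Type*} [NormedAddCommGroup E] [NormedSpace ℂ E] [NormedAddCommGroup F]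
  [NormedSpace ℂ F]
variable {a b : E} {u v : E → ℝ} {r : ℝ} {V : Set E} {f : E → ℂ}

/-- Locally bounded plurisubharmonic functions: upper semicontinuous, locally bounded below, and
with the submean value property on small circles in complex lines. -/
structure PshOn (u : E → ℝ) (V : Set E) : Prop where
  usc : UpperSemicontinuousOn u V
  bdd : ∀ z ∈ V, ∃ m, ∀ᶠ y in 𝓝 z, m ≤ u y
  submean : ∀ a ∈ V, ∀ b, ∀ᶠ r in 𝓝[>] (0 : ℝ),
    u a ≤ circleAverage (fun ζ => u (a + ζ • b)) 0 r

lemma PshOn.mono {W : Set E} (h : PshOn u V) (hWV : W ⊆ V) : PshOn u W :=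
  ⟨h.usc.mono hWV, fun z hz => h.bdd z (hWV hz), fun a ha => h.submean a (hWV ha)⟩

lemma eventually_line_mem (hV : IsOpen V) (ha : a ∈ V) (b : E) :
    ∀ᶠ r in 𝓝[>] (0 : ℝ), ∀ w ∈ closedBall (0 : ℂ) r, a + w • b ∈ V := by
  have : (fun w : ℂ => a + w • b) ⁻¹' V ∈ 𝓝 (0 : ℂ) :=
    (hV.preimage (by fun_prop)).mem_nhds (by simpa using ha)
  obtain ⟨ε, hd, hb⟩ := Metric.mem_nhds_iff.1 this
  filter_upwards [Ioo_mem_nhdsGT hd] with r hr w hw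
  exact hb (closedBall_subset_ball hr.2 hw)

lemma eventually_sphere_mem (hV : IsOpen V) (ha : a ∈ V) (b : E) :
    ∀ᶠ r in 𝓝[>] (0 : ℝ), ∀ w ∈ sphere (0 : ℂ) |r|, a + w • b ∈ V := by
  filter_upwards [eventually_line_mem hV ha b, self_mem_nhdsWithin] with r hr hr0 w hw
  exact hr w (sphere_subset_closedBall (by rwa [abs_of_pos hr0] at hw))

lemma PshOn.of_local
    (h : ∀ x ∈ V, ∃ W : Set E, IsOpen W ∧ x ∈ W ∧ PshOn u W) : PshOn u V := by
  refine ⟨fun x hx y hy => ?_, fun x hx => ?_, fun x hx => ?_⟩ <;>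
    obtain ⟨W, hW, hxW, hu⟩ := h x hx
  · exact (hW.nhdsWithin_eq hxW ▸ hu.usc x hxW y hy).filter_mono nhdsWithin_le_nhds
  · exact hu.bdd x hxW
  · exact hu.submean x hxW

lemma PshOn.congr (hV : IsOpen V) (h : PshOn u V)
    (huv : ∀ x ∈ V, v x = u x) : PshOn v V := by
  refine ⟨fun x hx y hy => ?_, fun x hx => ?_, fun x hx b => ?_⟩
  · change v x < y at hy
    rw [huv x hx] at hy
    filter_upwards [h.usc x hx y hy, self_mem_nhdsWithin] with z hz hzV
    change v z < y
    rwa [huv z hzV]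
  · obtain ⟨m, hm⟩ := h.bdd x hx
    refine ⟨m, ?_⟩
    filter_upwards [hm, hV.mem_nhds hx] with z hz hzV
    rwa [huv z hzV]
  · filter_upwards [h.submean x hx b, eventually_sphere_mem hV hx b] with r hr hl
    rw [huv x hx]
    exact hr.trans_eq (circleAverage_congr_sphere fun w hw => (huv _ (hl w hw)).symm)

lemma PshOn.exists_lower_bound (h : PshOn u V) {C : Set E}
    (hC : IsCompact C) (hCV : C ⊆ V) : ∃ m, ∀ z ∈ C, m ≤ u z := by
  refine hC.induction_on (p := fun s => ∃ m, ∀ z ∈ s, m ≤ u z) ⟨0, by simp⟩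
    (fun s t hst ⟨m, hm⟩ => ⟨m, fun z hz => hm z (hst hz)⟩) ?_ ?_
  · rintro s t ⟨m, hm⟩ ⟨m', hm'⟩
    refine ⟨min m m', ?_⟩
    rintro z (hz | hz)
    · exact (min_le_left _ _).trans (hm z hz)
    · exact (min_le_right _ _).trans (hm' z hz)
  · intro x hx
    obtain ⟨m, hm⟩ := h.bdd x (hCV hx)
    exact ⟨{y | m ≤ u y}, mem_nhdsWithin_of_mem_nhds hm, m, fun z hz => hz⟩

lemma PshOn.comp_line_usc (h : PshOn u V) {C : Set ℂ}
    (hC : ∀ w ∈ C, a + w • b ∈ V) : UpperSemicontinuousOn (fun w : ℂ => u (a + w • b)) C :=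
  h.usc.comp (g := fun w : ℂ => a + w • b) (by fun_prop) hC

lemma PshOn.exists_lower_bound_line (h : PshOn u V) {C : Set ℂ} (hc : IsCompact C)
    (hC : ∀ w ∈ C, a + w • b ∈ V) : ∃ m, ∀ w ∈ C, m ≤ u (a + w • b) :=
  (h.exists_lower_bound (C := (fun w : ℂ => a + w • b) '' C) (hc.image (by fun_prop))
    (image_subset_iff.2 hC)).imp fun m hm z hz => hm _ ⟨z, hz, rfl⟩

lemma PshOn.circleIntegrable (h : PshOn u V) {c : ℂ}
    (hC : ∀ w ∈ sphere c |r|, a + w • b ∈ V) : CircleIntegrable (fun w => u (a + w • b)) c r :=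
  circleIntegrable_of_usc (h.comp_line_usc hC) (h.exists_lower_bound_line (isCompact_sphere _ _) hC)

lemma circleAverage_line_center (u : E → ℝ) (a b : E) (z : ℂ) (ρ : ℝ) :
    circleAverage (fun w => u (a + w • b)) z ρ
      = circleAverage (fun w => u ((a + z • b) + w • b)) 0 ρ := by
  rw [← Real.circleAverage_map_add_const]
  congr 1
  ext w
  congr 1
  rw [add_smul]; abel

lemma PshOn.local_submean_line (h : PshOn u V) {z : ℂ}
    (hz : a + z • b ∈ V) : ∀ᶠ ρ in 𝓝[>] (0 : ℝ),
      u (a + z • b) ≤ circleAverage (fun w => u (a + w • b)) z ρ := by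
  filter_upwards [h.submean _ hz b] with ρ hr
  rwa [circleAverage_line_center]

/-- The submean value property on every disc contained in the domain. -/
lemma PshOn.le_circleAverage (h : PshOn u V)
    (hr : 0 < r) (hC : ∀ w ∈ closedBall (0 : ℂ) r, a + w • b ∈ V) :
    u a ≤ circleAverage (fun w => u (a + w • b)) 0 r := by
  obtain ⟨m, hm⟩ := h.exists_lower_bound_line (isCompact_closedBall _ _) hC
  simpa using le_circleAverage_of_local_submean hr (h.comp_line_usc hC) hm
    fun z hz => h.local_submean_line (hC z (ball_subset_closedBall hz))

lemma UpperSemicontinuousOn.coe_ereal {α : Type*} [TopologicalSpace α] {f : α → ℝ} {s : Set α}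
    (hf : UpperSemicontinuousOn f s) : UpperSemicontinuousOn (fun x => (f x : EReal)) s :=
  continuous_coe_real_ereal.comp_upperSemicontinuousOn hf EReal.coe_strictMono.monotone

lemma PshOn.toPSHOnE (h : PshOn u V) : PSHOnE (fun z => (u z : EReal)) V := by
  refine ⟨fun z _ => EReal.coe_lt_top _, h.usc.coe_ereal, ?_, fun a b => ⟨?_, ?_⟩⟩
  · rintro ⟨W, -, -, ⟨z, hz⟩, hW⟩
    exact EReal.coe_ne_bot _ (hW z hz)
  · exact (h.comp_line_usc fun w hw => hw).coe_ereal
  · intro c r hr hsub g hg hgh hle z hz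
    obtain ⟨m, hm⟩ := h.exists_lower_bound_line (isCompact_closedBall _ _) fun w hw => hsub hw
    exact EReal.coe_le_coe_iff.2 (le_of_local_submean (v := fun w : ℂ => u (a + w • b)) hr
      (h.comp_line_usc hsub) hm
      (fun z hz => h.local_submean_line (hsub (ball_subset_closedBall hz))) hg
      (fun z hz => hgh.eventually_circleAverage_eq hz)
      (fun z hz => EReal.coe_le_coe_iff.1 (hle z hz)) z hz)

lemma PSHOnE.pshOn_max_toReal {p : E → EReal} (hV : IsOpen V) (h : PSHOnE p V) (m : ℝ) :
    PshOn (fun z => (max (p z) m).toReal) V := by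
  have hco : ∀ z ∈ V, ((max (p z) m).toReal : EReal) = max (p z) m := by
    exact fun z hz => EReal.coe_toReal (max_lt (h.1 z hz) (EReal.coe_lt_top m)).ne
      ((EReal.bot_lt_coe m).trans_le (le_max_right _ _)).ne'
  have hge : ∀ z ∈ V, m ≤ (max (p z) m).toReal := by
    intro z hz
    rw [← EReal.coe_le_coe_iff, hco z hz]
    exact le_max_right _ _
  have husc : UpperSemicontinuousOn (fun z => (max (p z) m).toReal) V := by
    intro z hz y hy
    have : max (p z) m < (y : EReal) := by rw [← hco z hz]; exact_mod_cast hy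
    obtain ⟨h1, h2⟩ := max_lt_iff.1 this
    filter_upwards [h.2.1 z hz y h1, self_mem_nhdsWithin] with w hw hwV
    rw [← EReal.coe_lt_coe_iff, hco w hwV]
    exact max_lt hw h2
  refine ⟨husc, fun z hz => ⟨m, ?_⟩, fun a ha b => ?_⟩
  · filter_upwards [hV.mem_nhds hz] with w hw using hge w hw
  · filter_upwards [eventually_line_mem hV ha b, self_mem_nhdsWithin] with r hl (hr : 0 < r)
    refine le_of_forall_pos_le_add fun ε hf => ?_
    obtain ⟨P, hP, hP0⟩ := exists_polynomial_re_ge (v := fun c => (max (p (a + c • b)) m).toReal)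
      (a := 0) hr
      (husc.comp (g := fun c : ℂ => a + c • b) (by fun_prop)
        fun c hc => hl c (sphere_subset_closedBall hc))
      (m := m) (fun z hz => hge _ (hl z (sphere_subset_closedBall hz))) hf
    refine le_trans ?_ hP0
    simp only [sub_zero] at hP
    have hd := P.differentiable
    have hharm : HarmonicOnCC (fun z => (P.eval z).re) (ball 0 r) :=
      harmonicOnCC_re isOpen_ball hd.differentiableOn
    have hcont : ContinuousOn (fun z => (P.eval z).re) (closedBall (0 : ℂ) r) :=
      (Complex.continuous_re.comp hd.continuous).continuousOn
    have h1 := (h.2.2.2 a b).2 0 r hr hl (fun z => (P.eval z).re) hcont hharm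
      (fun z hz => by
        have := EReal.coe_le_coe_iff.2 (hP z hz)
        rw [hco _ (hl z (sphere_subset_closedBall hz))] at this
        exact (le_max_left _ _).trans this) 0 (mem_closedBall_self hr.le)
    have h2 := le_of_local_submean (v := fun _ => m) (m := m) hr upperSemicontinuousOn_const
      (fun _ _ => le_rfl) (fun z _ => by simp [circleAverage_const]) hcont
      (fun z hz => hharm.eventually_circleAverage_eq hz)
      (fun z hz => (hge _ (hl z (sphere_subset_closedBall hz))).trans (hP z hz)) 0
      (mem_closedBall_self hr.le)
    rw [← EReal.coe_le_coe_iff, hco a ha]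
    simp at h1
    exact max_le h1 (EReal.coe_le_coe_iff.2 h2)

/-! #### Operations -/

lemma PshOn.add (hV : IsOpen V) (hu : PshOn u V) (hv : PshOn v V) :
    PshOn (fun z => u z + v z) V := by
  refine ⟨hu.usc.add hv.usc, fun z hz => ?_, fun a ha b => ?_⟩
  · obtain ⟨m, hm⟩ := hu.bdd z hz
    obtain ⟨m', hm'⟩ := hv.bdd z hz
    exact ⟨m + m', by filter_upwards [hm, hm'] with y h1 h2 using add_le_add h1 h2⟩
  · filter_upwards [hu.submean a ha b, hv.submean a ha b, eventually_sphere_mem hV ha b]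
      with r h1 h2 hl
    rw [circleAverage_fun_add (hu.circleIntegrable hl) (hv.circleIntegrable hl)]
    exact add_le_add h1 h2

lemma PshOn.sup (hV : IsOpen V) (hu : PshOn u V) (hv : PshOn v V) :
    PshOn (fun z => max (u z) (v z)) V := by
  refine ⟨hu.usc.sup hv.usc, fun z hz => (hu.bdd z hz).imp fun m hm => hm.mono fun y h1 =>
    h1.trans (le_max_left _ _), fun a ha b => ?_⟩
  filter_upwards [hu.submean a ha b, hv.submean a ha b, eventually_sphere_mem hV ha b]
    with r h1 h2 hl
  have i1 := hu.circleIntegrable hl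
  have i2 := hv.circleIntegrable hl
  have hi : CircleIntegrable (fun w => max (u (a + w • b)) (v (a + w • b))) 0 r := by
    unfold CircleIntegrable at *
    rw [intervalIntegrable_iff] at *
    exact i1.sup i2
  exact max_le (h1.trans (circleAverage_mono i1 hi fun w _ => le_max_left _ _))
    (h2.trans (circleAverage_mono i2 hi fun w _ => le_max_right _ _))

lemma PshOn.const_mul {c : ℝ} (hc : 0 ≤ c) (hu : PshOn u V) :
    PshOn (fun z => c * u z) V := by
  refine ⟨?_, fun z hz => ?_, fun a ha b => ?_⟩
  · exact (continuous_const_mul c).comp_upperSemicontinuousOn hu.usc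
      (monotone_mul_left_of_nonneg hc)
  · obtain ⟨m, hm⟩ := hu.bdd z hz
    exact ⟨c * m, by filter_upwards [hm] with y h1 using mul_le_mul_of_nonneg_left h1 hc⟩
  · filter_upwards [hu.submean a ha b] with r h1
    rw [circleAverage_const_mul]
    exact mul_le_mul_of_nonneg_left h1 hc

lemma pshOn_const (c : ℝ) (V : Set E) : PshOn (fun _ : E => c) V :=
  ⟨upperSemicontinuousOn_const, fun _ _ => ⟨c, .of_forall fun _ => le_rfl⟩,
    fun a _ b => .of_forall fun r => by rw [circleAverage_const]⟩

lemma PshOn.add_const (hV : IsOpen V) (hu : PshOn u V) (c : ℝ) :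
    PshOn (fun z => u z + c) V := hu.add hV (pshOn_const c V)

lemma pshOn_of_continuousOn (hV : IsOpen V) (hu : ContinuousOn u V)
    (h : ∀ a ∈ V, ∀ b, ∀ᶠ r in 𝓝[>] (0 : ℝ),
      u a ≤ circleAverage (fun w => u (a + w • b)) 0 r) : PshOn u V := by
  refine ⟨hu.upperSemicontinuousOn, fun z hz => ⟨u z - 1, ?_⟩, h⟩
  exact ((hu.continuousAt (hV.mem_nhds hz)).eventually (lt_mem_nhds (sub_one_lt _))).mono
    fun y hy => hy.le

lemma eventually_diffContOnCl_line {f : E → F} (hV : IsOpen V)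
    (hf : DifferentiableOn ℂ f V) (ha : a ∈ V) (b : E) :
    ∀ᶠ r in 𝓝[>] (0 : ℝ), DiffContOnCl ℂ (fun w : ℂ => f (a + w • b)) (ball 0 r) := by
  filter_upwards [eventually_line_mem hV ha b] with r hr
  refine DifferentiableOn.diffContOnCl (DifferentiableOn.comp (t := V) hf (by fun_prop) fun w hw => ?_)
  exact hr w (closure_ball_subset_closedBall hw)

lemma pshOn_re (hV : IsOpen V) (hf : DifferentiableOn ℂ f V) : PshOn (fun z => (f z).re) V := by
  refine pshOn_of_continuousOn hV (Complex.continuous_re.comp_continuousOn hf.continuousOn)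
    fun a ha b => ?_
  filter_upwards [eventually_diffContOnCl_line hV hf ha b, self_mem_nhdsWithin] with r hr hr0
  rw [circleAverage_re (by rwa [abs_of_pos hr0])]
  simp

/-- A continuous function dominating, with equality at each given point, the real part of
a holomorphic function, is plurisubharmonic. -/
lemma pshOn_of_re_support (hV : IsOpen V) (hu : ContinuousOn u V)
    (h : ∀ a ∈ V, ∃ f : E → ℂ, DifferentiableOn ℂ f V ∧ (f a).re = u a ∧
      ∀ z ∈ V, (f z).re ≤ u z) : PshOn u V := by
  refine pshOn_of_continuousOn hV hu fun a ha b => ?_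
  obtain ⟨f, hf, hfa, hfu⟩ := h a ha
  filter_upwards [eventually_diffContOnCl_line hV hf ha b, eventually_sphere_mem hV ha b,
    self_mem_nhdsWithin] with r hr hl hr0
  have h1 := circleAverage_re (by rwa [abs_of_pos hr0])
  simp at h1
  rw [← hfa, ← h1]
  exact circleAverage_mono (Complex.continuous_re.comp_continuousOn (hr.continuousOn_ball.mono (by
      rw [abs_of_pos hr0]; exact sphere_subset_closedBall))).circleIntegrable'
    (hu.comp (by fun_prop) hl).circleIntegrable' fun w hw => hfu _ (hl w hw)

lemma pshOn_norm_sq (hV : IsOpen V) (hf : DifferentiableOn ℂ f V) :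
    PshOn (fun z => ‖f z‖ ^ 2) V := by
  refine pshOn_of_re_support hV (hf.continuousOn.norm.pow 2) fun a ha =>
    ⟨fun z => 2 * starRingEnd ℂ (f a) * f z - Complex.normSq (f a),
      (hf.const_mul _).sub_const _, ?_, fun z hz => ?_⟩
  all_goals simp [Complex.sq_norm, Complex.normSq_apply]
  · ring
  · nlinarith [sq_nonneg ((f z).re - (f a).re), sq_nonneg ((f z).im - (f a).im)]

lemma pshOn_log_norm (hV : IsOpen V) (hf : DifferentiableOn ℂ f V)
    (h0 : ∀ z ∈ V, f z ≠ 0) : PshOn (fun z => Real.log ‖f z‖) V := by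
  refine PshOn.of_local fun a ha => ?_
  have hca : ContinuousAt (fun z => f z / f a) a :=
    (hf.continuousOn.continuousAt (hV.mem_nhds ha)).div_const _
  have hW : (fun z => f z / f a) ⁻¹' Complex.slitPlane ∈ 𝓝 a := by
    refine hca (Complex.isOpen_slitPlane.mem_nhds ?_)
    simp [div_self (h0 a ha)]
  obtain ⟨W, hWs, hWo, haW⟩ := _root_.mem_nhds_iff.1 (inter_mem hW (hV.mem_nhds ha))
  refine ⟨W, hWo, haW, ?_⟩
  have hd : DifferentiableOn ℂ (fun z => Complex.log (f z / f a) + Real.log ‖f a‖) W := by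
    refine DifferentiableOn.add_const _ (DifferentiableOn.clog ?_ fun z hz => (hWs hz).1)
    simpa only [div_eq_mul_inv] using (hf.mono fun z hz => (hWs hz).2).mul_const (f a)⁻¹
  refine (pshOn_re hWo hd).congr hWo fun z hz => ?_
  rw [Complex.add_re, Complex.ofReal_re, Complex.log_re, norm_div,
    Real.log_div (norm_ne_zero_iff.2 (h0 z (hWs hz).2)) (norm_ne_zero_iff.2 (h0 a ha))]
  ring

end Psh

/-! ### Mollification -/

section Mollify

variable {d : ℕ}
variable {c : ℂ} {g u v κ : Fn d} {a : ℝ} {n : ℕ∞} {w z : Cn d}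

/-- The squared Euclidean norm on `ℂᵈ`. -/
def sqn (z : Cn d) : ℝ := ∑ i, ‖z i‖ ^ 2

lemma sqn_nonneg (z : Cn d) : 0 ≤ sqn z := Finset.sum_nonneg fun _ _ => by positivity

@[simp] lemma sqn_zero : sqn (0 : Cn d) = 0 := by simp [sqn]

lemma contDiff_sqn {n : WithTop ℕ∞} : ContDiff ℝ n (sqn : Fn d) := by
  unfold sqn
  exact ContDiff.sum fun i _ => (contDiff_apply ℝ ℂ i).norm_sq ℝ

lemma continuous_sqn : Continuous (sqn : Fn d) := (contDiff_sqn (n := 0)).continuous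

lemma norm_sq_le_sqn (z : Cn d) : ‖z‖ ^ 2 ≤ sqn z := by
  have h : ‖z‖ ≤ √(sqn z) := by
    refine (pi_norm_le_iff_of_nonneg (Real.sqrt_nonneg _)).2 fun i => ?_
    refine Real.le_sqrt_of_sq_le ?_
    exact Finset.single_le_sum (f := fun i => ‖z i‖ ^ 2) (fun _ _ => by positivity)
      (Finset.mem_univ i)
  calc ‖z‖ ^ 2 ≤ √(sqn z) ^ 2 := by gcongr
    _ = sqn z := Real.sq_sqrt (sqn_nonneg z)

lemma norm_le_of_sqn_le {z : Cn d} {s : ℝ} (hs : 0 ≤ s) (h : sqn z ≤ s ^ 2) : ‖z‖ ≤ s :=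
  (abs_le_of_sq_le_sq' ((norm_sq_le_sqn z).trans h) hs).2

lemma sqn_le_norm_sq (z : Cn d) : sqn z ≤ d * ‖z‖ ^ 2 := by
  unfold sqn
  refine (Finset.sum_le_card_nsmul _ _ (‖z‖ ^ 2) fun i _ => ?_).trans_eq (by simp)
  gcongr
  exact norm_le_pi_norm z i

lemma sqn_smul (c : ℂ) (z : Cn d) : sqn (c • z) = ‖c‖ ^ 2 * sqn z := by simp [sqn, mul_pow, mul_sum]

/-- The unnormalized mollifier. -/
def preMoll (a : ℝ) (w : Cn d) : ℝ := Real.smoothTransition (1 - sqn w / a ^ 2)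

lemma preMoll_contDiff (a : ℝ) : ContDiff ℝ n (preMoll (d := d) a) :=
  Real.smoothTransition.contDiff.comp (contDiff_const.sub (contDiff_sqn.div_const _))

lemma preMoll_eq_zero (ha : 0 < a) (hw : w ∉ closedBall 0 a) : preMoll a w = 0 := by
  refine Real.smoothTransition.zero_of_nonpos ?_
  have h1 : a < ‖w‖ := by simpa using hw
  have h2 := norm_sq_le_sqn w
  have h3 : 1 ≤ sqn w / a ^ 2 := by rw [one_le_div (by positivity)]; nlinarith
  linarith

lemma preMoll_hasCompactSupport (ha : 0 < a) : HasCompactSupport (preMoll (d := d) a) :=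
  HasCompactSupport.intro (isCompact_closedBall 0 a) fun _ hw => preMoll_eq_zero ha hw

lemma preMoll_integral_pos (ha : 0 < a) : 0 < ∫ w : Cn d, preMoll a w := by
  refine (preMoll_contDiff a (n := 0)).continuous.integral_pos_of_hasCompactSupport_nonneg_nonzero
    (x := 0) (preMoll_hasCompactSupport ha) (fun w => Real.smoothTransition.nonneg _) ?_
  exact (Real.smoothTransition.pos_of_pos (by simp)).ne'

/-- The normalized mollifier, invariant under multiplication by unimodular scalars. -/
def moll (a : ℝ) (w : Cn d) : ℝ := (∫ w : Cn d, preMoll a w)⁻¹ * preMoll a w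

lemma moll_contDiff (a : ℝ) : ContDiff ℝ n (moll (d := d) a) :=
  contDiff_const.mul (preMoll_contDiff a)

lemma moll_continuous (a : ℝ) : Continuous (moll (d := d) a) :=
  (moll_contDiff a (n := 0)).continuous

lemma moll_eq_zero (ha : 0 < a) (hw : w ∉ closedBall 0 a) : moll a w = 0 := by
  simp [moll, preMoll_eq_zero ha hw]

lemma moll_hasCompactSupport (ha : 0 < a) : HasCompactSupport (moll (d := d) a) :=
  HasCompactSupport.intro (isCompact_closedBall 0 a) fun _ hw => moll_eq_zero ha hw

lemma moll_nonneg (ha : 0 < a) (w : Cn d) : 0 ≤ moll a w :=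
  mul_nonneg (inv_nonneg.2 (preMoll_integral_pos ha).le) (Real.smoothTransition.nonneg _)

lemma moll_integral (ha : 0 < a) : ∫ w : Cn d, moll a w = 1 := by
  simp only [moll]
  rw [integral_const_mul, inv_mul_cancel₀ (preMoll_integral_pos ha).ne']

lemma moll_integrable (ha : 0 < a) : Integrable (moll (d := d) a) :=
  (moll_continuous a).integrable_of_hasCompactSupport (moll_hasCompactSupport ha)

lemma moll_smul (a : ℝ) (hc : ‖c‖ = 1) (w : Cn d) : moll a (c • w) = moll a w := by
  simp [moll, preMoll, sqn_smul, hc]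

lemma measurePreserving_unimodular_smul (hc : ‖c‖ = 1) :
    MeasurePreserving (fun w : Cn d => c • w) volume volume := by
  let a : Circle := ⟨c, mem_sphere_zero_iff_norm.2 hc⟩
  exact volume_preserving_pi (f := fun (_ : Fin d) (z : ℂ) => c * z)
    fun _ => (rotation a).measurePreserving

lemma integral_unimodular_smul (hc : ‖c‖ = 1) (g : Fn d) : ∫ w, g (c • w) = ∫ w, g w := by
  refine (measurePreserving_unimodular_smul hc).integral_comp ?_ g
  exact (Homeomorph.smulOfNeZero c (by rintro rfl; simp at hc)).measurableEmbedding

/-- Convolution with the mollifier. -/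
def mollify (a : ℝ) (u : Fn d) (z : Cn d) : ℝ := ∫ w, moll a w * u (z - w)

lemma mollify_contDiff (ha : 0 < a) (hu : LocallyIntegrable u) : ContDiff ℝ n (mollify a u) :=
  (moll_hasCompactSupport ha).contDiff_convolution_left (ContinuousLinearMap.mul ℝ ℝ)
    (moll_contDiff a) hu

lemma PshOn.upperSemicontinuous (hu : PshOn u univ) : UpperSemicontinuous u :=
  upperSemicontinuousOn_univ_iff.1 hu.usc

lemma PshOn.measurable (hu : PshOn u univ) : Measurable u := hu.upperSemicontinuous.measurable

lemma PshOn.exists_bound (hu : PshOn u univ) {C : Set (Cn d)} (hC : IsCompact C) :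
    ∃ M, ∀ z ∈ C, |u z| ≤ M := by
  obtain ⟨m, hm⟩ := hu.exists_lower_bound hC (subset_univ _)
  obtain ⟨M, hM⟩ := (hu.usc.mono (subset_univ C)).bddAbove_of_isCompact hC
  exact ⟨max |m| |M|, fun z hz => abs_le_max_abs_abs (hm z hz) (hM (mem_image_of_mem u hz))⟩

lemma PshOn.locallyIntegrable (hu : PshOn u univ) : LocallyIntegrable u := by
  rw [locallyIntegrable_iff]
  intro k hk
  obtain ⟨M, hM⟩ := hu.exists_bound hk
  refine Measure.integrableOn_of_bounded (M := M) hk.measure_lt_top.ne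
    hu.measurable.aestronglyMeasurable ?_
  exact (ae_restrict_iff' hk.measurableSet).2 (ae_of_all _ hM)

/-- Integrability of the moll against a measurable function bounded on its support. -/
lemma integrable_moll_mul (ha : 0 < a) (hg : Measurable g) {M : ℝ}
    (hM : ∀ w ∈ closedBall 0 a, |g w| ≤ M) : Integrable fun w => moll a w * g w := by
  refine ((moll_integrable ha).mul_const M).mono'
    ((moll_continuous a).measurable.mul hg).aestronglyMeasurable (ae_of_all _ fun w => ?_)
  by_cases hw : w ∈ closedBall 0 a
  · rw [norm_mul, norm_of_nonneg (moll_nonneg ha w)]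
    exact mul_le_mul_of_nonneg_left (hM w hw) (moll_nonneg ha w)
  · simp [moll_eq_zero ha hw]

lemma PshOn.integrable_moll (hu : PshOn u univ) (ha : 0 < a)
    (z : Cn d) : Integrable fun w => moll a w * u (z - w) := by
  obtain ⟨M, hM⟩ := hu.exists_bound ((isCompact_closedBall (0 : Cn d) a).image
    (f := fun w => z - w) (by fun_prop))
  exact integrable_moll_mul ha (hu.measurable.comp (measurable_const.sub measurable_id))
    fun w hw => hM _ ⟨w, hw, rfl⟩

lemma moll_integral_mono (ha : 0 < a) {f : Fn d}
    (hf : Integrable fun w => moll a w * f w) (hg : Integrable fun w => moll a w * g w)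
    (h : ∀ w ∈ closedBall 0 a, f w ≤ g w) : ∫ w, moll a w * f w ≤ ∫ w, moll a w * g w := by
  refine integral_mono hf hg fun w => ?_
  by_cases hw : w ∈ closedBall 0 a
  · exact mul_le_mul_of_nonneg_left (h w hw) (moll_nonneg ha w)
  · simp [moll_eq_zero ha hw]

lemma mollify_const (ha : 0 < a) (c : ℝ) (z : Cn d) : mollify a (fun _ => c) z = c := by
  simp only [mollify]
  rw [integral_mul_const, moll_integral ha, one_mul]

lemma mollify_mono (ha : 0 < a) (hu : PshOn u univ) (hv : PshOn v univ)
    (h : ∀ y ∈ closedBall z a, u y ≤ v y) : mollify a u z ≤ mollify a v z := by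
  refine moll_integral_mono ha (hu.integrable_moll ha z) (hv.integrable_moll ha z)
    fun w hw => h _ ?_
  simpa [dist_eq_norm] using hw

lemma mollify_congr (ha : 0 < a)
    (h : ∀ y ∈ closedBall z a, u y = v y) : mollify a u z = mollify a v z := by
  refine integral_congr_ae (ae_of_all _ fun w => ?_)
  by_cases hw : w ∈ closedBall 0 a
  · have : z - w ∈ closedBall z a := by simpa [dist_eq_norm] using hw
    simp only [h _ this]
  · simp [moll_eq_zero ha hw]

lemma mollify_add (ha : 0 < a) (hu : PshOn u univ) (hv : PshOn v univ)
    (z : Cn d) : mollify a (fun y => u y + v y) z = mollify a u z + mollify a v z := by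
  simp only [mollify, mul_add]
  exact integral_add (hu.integrable_moll ha z) (hv.integrable_moll ha z)

lemma PshOn.circleAverage_integral_weight (hu : PshOn u univ) {b : ℝ}
    (hkm : Measurable κ) (hki : Integrable κ) (hk0 : ∀ w, 0 ≤ κ w)
    (hks : ∀ w, w ∉ closedBall 0 b → κ w = 0)
    {g : Cn d → ℂ → Cn d} (hg : Continuous fun p : Cn d × ℂ => g p.1 p.2) (r : ℝ) :
    Integrable (fun w => circleAverage (fun a => κ w * u (g w a)) 0 r) ∧
    circleAverage (fun a => ∫ w, κ w * u (g w a)) 0 r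
      = ∫ w, circleAverage (fun a => κ w * u (g w a)) 0 r := by
  have hint : Integrable (Function.uncurry fun (w : Cn d) (t : ℝ) =>
      κ w * u (g w (circleMap 0 r t))) (volume.prod (volume.restrict (Ioc 0 (2 * Real.pi)))) := by
    obtain ⟨M, hM⟩ := hu.exists_bound (((isCompact_closedBall (0 : Cn d) b).prod
      (isCompact_sphere (0 : ℂ) |r|)).image hg)
    have hc := hg.comp (continuous_fst.prodMk ((continuous_circleMap 0 r).comp continuous_snd))
    refine ((hki.mul_const M).comp_fst
      (volume.restrict (Ioc 0 (2 * Real.pi)))).mono' ?_ (ae_of_all _ ?_)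
    · exact ((hkm.comp measurable_fst).mul (hu.measurable.comp hc.measurable)).aestronglyMeasurable
    · rintro ⟨w, t⟩
      simp only [Function.uncurry]
      by_cases hw : w ∈ closedBall 0 b
      · rw [norm_mul, norm_of_nonneg (hk0 w)]
        refine mul_le_mul_of_nonneg_left (hM _ ⟨(w, circleMap 0 r t), ⟨hw, ?_⟩, rfl⟩) (hk0 w)
        exact circleMap_mem_sphere' 0 r t
      · simp [hks w hw]
  have h2 := Real.two_pi_pos.le
  constructor
  · simp only [circleAverage, intervalIntegral.integral_of_le h2]
    exact hint.integral_prod_left.smul ((2 * Real.pi)⁻¹ : ℝ)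
  · simp only [circleAverage, intervalIntegral.integral_of_le h2]
    rw [integral_smul, integral_integral_swap hint]

lemma PshOn.mul_le_integral_weight (hu : PshOn u univ) {h : ℝ}
    (hkm : Measurable κ) (hki : Integrable κ) (hk0 : ∀ w, 0 ≤ κ w)
    (hks : ∀ w, w ∉ closedBall 0 h → κ w = 0) (hkc : ∀ c : ℂ, ‖c‖ = 1 → ∀ w, κ (c • w) = κ w)
    (z : Cn d) : (∫ w, κ w) * u z ≤ ∫ w, κ w * u (z - w) := by
  have h1 : ∫ w, κ w * u (z - w) = circleAverage (fun f : ℂ => ∫ w, κ w * u (z - f • w)) 0 1 := by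
    have : ∀ f ∈ sphere (0 : ℂ) |1|, (fun f : ℂ => ∫ w, κ w * u (z - f • w)) f
        = ∫ w, κ w * u (z - w) := by
      intro f hf
      have hf' : ‖f‖ = 1 := by simpa using hf
      rw [← integral_unimodular_smul hf']
      simp only [hkc f hf']
    rw [circleAverage_congr_sphere (f₂ := fun _ => ∫ w, κ w * u (z - w)) this, circleAverage_const]
  obtain ⟨i1, e1⟩ := hu.circleAverage_integral_weight hkm hki hk0 hks
    (g := fun w f => z - f • w) (by fun_prop) 1
  rw [h1, e1, ← integral_mul_const]
  refine integral_mono (hki.mul_const _) i1 fun w => ?_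
  simp only [circleAverage_const_mul]
  refine mul_le_mul_of_nonneg_left ?_ (hk0 w)
  have := hu.le_circleAverage (a := z) (b := -w) one_pos (fun _ _ => mem_univ _)
  simpa [sub_eq_add_neg] using this

lemma PshOn.le_mollify (hu : PshOn u univ) (ha : 0 < a) (z : Cn d) : u z ≤ mollify a u z := by
  simpa only [moll_integral ha, one_mul, mollify] using
    hu.mul_le_integral_weight (moll_continuous a).measurable (moll_integrable ha)
      (moll_nonneg ha) (fun w hw => moll_eq_zero ha hw) (fun c hc => moll_smul a hc) z

lemma PshOn.le_setAverage_closedBall (hu : PshOn u univ) (ha : 0 < a)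
    (z : Cn d) : u z ≤ ⨍ y in closedBall z a, u y := by
  have hi := integrableOn_const (μ := (volume : Measure (Cn d))) (s := closedBall 0 a)
    measure_closedBall_lt_top.ne (C := (1 : ℝ))
  have h1 := hu.mul_le_integral_weight (κ := (closedBall (0 : Cn d) a).indicator fun _ => 1)
    (measurable_const.indicator measurableSet_closedBall)
    (hi.integrable_indicator measurableSet_closedBall)
    (fun w => indicator_nonneg (fun _ _ => zero_le_one) w) (fun w hw => indicator_of_notMem hw _)
    (fun c hc w => by simp [indicator, norm_smul, hc]) z
  have hm := Measure.measurePreserving_sub_left volume z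
  have h2 : ∫ w, (closedBall (0 : Cn d) a).indicator (fun _ => (1 : ℝ)) w * u (z - w)
      = ∫ y in closedBall z a, u y := by
    rw [← integral_indicator measurableSet_closedBall,
      ← hm.integral_comp (Homeomorph.subLeft z).measurableEmbedding]
    refine integral_congr_ae (ae_of_all _ fun w => ?_)
    simp [indicator, dist_eq_norm, norm_sub_rev z]
  rw [h2, integral_indicator measurableSet_closedBall, setIntegral_const, smul_eq_mul, mul_one] at h1
  have hv : volume.real (closedBall z a) = volume.real (closedBall (0 : Cn d) a) := by
    simp [measureReal_def, Measure.addHaar_closedBall_center volume z]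
  have hpos : 0 < volume.real (closedBall (0 : Cn d) a) := by
    rw [measureReal_def]
    exact ENNReal.toReal_pos (measure_closedBall_pos volume _ ha).ne' measure_closedBall_lt_top.ne
  rw [setAverage_eq, hv, smul_eq_mul, inv_mul_eq_div, le_div_iff₀ hpos, mul_comm]
  exact h1

lemma PshOn.pshOn_mollify (hu : PshOn u univ) {c : ℝ} (hc : 0 < c) : PshOn (mollify c u) univ := by
  refine pshOn_of_continuousOn isOpen_univ
    (mollify_contDiff hc hu.locallyIntegrable (n := 0)).continuous.continuousOn fun a _ b => ?_
  filter_upwards [self_mem_nhdsWithin] with r hr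
  obtain ⟨i1, e1⟩ := hu.circleAverage_integral_weight (moll_continuous c).measurable
    (moll_integrable hc) (moll_nonneg hc) (fun w hw => moll_eq_zero hc hw)
    (g := fun w f => a + f • b - w) (by fun_prop) r
  simp only [mollify]
  rw [e1]
  refine integral_mono (hu.integrable_moll hc a) i1 fun w => ?_
  simp only [circleAverage_const_mul]
  refine mul_le_mul_of_nonneg_left ?_ (moll_nonneg hc w)
  have := hu.le_circleAverage (a := a - w) (b := b) hr (fun _ _ => mem_univ _)
  have e : ∀ f : ℂ, a + f • b - w = a - w + f • b := fun f => by abel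
  simpa only [e] using this

lemma PshOn.tendsto_mollify (hu : PshOn u univ) (z : Cn d) :
    Tendsto (fun c => mollify c u z) (𝓝[>] 0) (𝓝 (u z)) := by
  rw [tendsto_order]
  refine ⟨fun a ha => ?_, fun a ha => ?_⟩
  · filter_upwards [self_mem_nhdsWithin] with c hc using ha.trans_le (hu.le_mollify hc z)
  · obtain ⟨a', h1, h2⟩ := exists_between ha
    obtain ⟨ε, hf, hb⟩ := Metric.eventually_nhds_iff.1 (hu.upperSemicontinuous z a' h1)
    filter_upwards [Ioo_mem_nhdsGT hf] with c hc
    refine lt_of_le_of_lt ?_ h2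
    rw [← mollify_const hc.1 a' z]
    exact mollify_mono hc.1 hu (pshOn_const _ _) fun y hy => (hb (lt_of_le_of_lt hy hc.2)).le

end Mollify

/-! ### Gluing and composition with holomorphic maps -/

section Compose

variable {E F : Type*} [NormedAddCommGroup E] [NormedSpace ℂ E] [NormedAddCommGroup F]
  [NormedSpace ℂ F] {d : ℕ}
variable {u : E → ℝ} {V W : Set E}

open Classical in
lemma PshOn.glue {v : E → ℝ} (hW : IsOpen W) (hV : IsOpen V) (hu : PshOn u W) (hv : PshOn v V)
    (hle : ∀ x ∈ V, x ∉ W → ∀ᶠ y in 𝓝 x, y ∈ W → u y ≤ v y) :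
    PshOn (fun z => if z ∈ W then max (u z) (v z) else v z) V := by
  refine PshOn.of_local fun x hx => ?_
  by_cases hxW : x ∈ W
  · refine ⟨W ∩ V, hW.inter hV, ⟨hxW, hx⟩, ?_⟩
    refine ((hu.mono inter_subset_left).sup (hW.inter hV) (hv.mono inter_subset_right)).congr
      (hW.inter hV) fun z hz => ?_
    rw [if_pos hz.1]
  · obtain ⟨O, hO, hOo, hxO⟩ := _root_.mem_nhds_iff.1 (hle x hx hxW)
    refine ⟨O ∩ V, hOo.inter hV, ⟨hxO, hx⟩, ?_⟩
    refine (hv.mono inter_subset_right).congr (hOo.inter hV) fun z hz => ?_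
    by_cases hzW : z ∈ W
    · rw [if_pos hzW, max_eq_right (hO hz.1 hzW)]
    · rw [if_neg hzW]

lemma pshOn_sum {q : Type*} (s : Finset q) {u : q → E → ℝ} (hV : IsOpen V)
    (hu : ∀ i ∈ s, PshOn (u i) V) : PshOn (fun z => ∑ i ∈ s, u i z) V := by
  classical
  induction s using Finset.induction_on with
  | empty => simpa using pshOn_const 0 V
  | insert a s ha ih =>
    simp only [Finset.sum_insert ha]
    exact (hu a (Finset.mem_insert_self _ _)).add hV
      (ih fun i hi => hu i (Finset.mem_insert_of_mem hi))

lemma pshOn_sqn_sub (p : Cn d) (V : Set (Cn d)) : PshOn (fun z => sqn (z - p)) V := by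
  refine PshOn.mono (V := univ) ?_ (subset_univ _)
  exact pshOn_sum _ isOpen_univ fun i _ => pshOn_norm_sq isOpen_univ
    (f := fun z : Cn d => (z - p) i) (by fun_prop)

lemma pshOn_sqn (V : Set (Cn d)) : PshOn sqn V := by simpa using pshOn_sqn_sub (0 : Cn d) V

/-- A plurisubharmonic function agrees near every point with a global one. -/
lemma PshOn.exists_global {u : Fn d} {p : Cn d} {V : Set (Cn d)} (hV : IsOpen V) (hp : p ∈ V)
    (hu : PshOn u V) : ∃ v : Fn d, PshOn v univ ∧ ∀ᶠ z in 𝓝 p, v z = u z := by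
  classical
  obtain ⟨R, hR, hRV⟩ := Metric.isOpen_iff.1 hV p hp
  have hsub : closedBall p (R / 2) ⊆ V := (closedBall_subset_ball (by linarith)).trans hRV
  obtain ⟨m, hm⟩ := hu.exists_lower_bound (isCompact_closedBall p (R / 2)) hsub
  obtain ⟨M, hM⟩ := (hu.usc.mono hsub).bddAbove_of_isCompact (isCompact_closedBall p (R / 2))
  have hM' : ∀ z ∈ closedBall p (R / 2), u z ≤ M := fun z hz => hM (mem_image_of_mem u hz)
  have hmM : m ≤ M :=
    (hm p (mem_closedBall_self (by linarith))).trans (hM' p (mem_closedBall_self (by linarith)))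
  set A := 9 * (M - m + 1) / R ^ 2 with hA
  have hA0 : 0 ≤ A := by
    have : 0 ≤ M - m + 1 := by linarith
    positivity
  have hq : PshOn (fun z => A * sqn (z - p) + (m - 1)) univ :=
    ((pshOn_sqn_sub p univ).const_mul hA0).add_const isOpen_univ _
  refine ⟨_, PshOn.glue (W := ball p (R / 2)) isOpen_ball isOpen_univ
    (hu.mono (ball_subset_closedBall.trans hsub)) hq fun x _ hx => ?_, ?_⟩
  · have h1 : R / 3 < dist x p := by
      have : R / 2 ≤ dist x p := by simpa using hx
      linarith
    have h2 : ∀ᶠ y in 𝓝 x, R / 3 < dist y p :=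
      (by fun_prop : Continuous fun y : Cn d => dist y p).continuousAt.eventually (lt_mem_nhds h1)
    filter_upwards [h2] with y hy hyW
    have h3 := hM' y (ball_subset_closedBall hyW)
    have h4 := norm_sq_le_sqn (y - p)
    rw [dist_eq_norm] at hy
    have h5 : (R / 3) ^ 2 ≤ ‖y - p‖ ^ 2 := by gcongr
    have h6 : A * (R / 3) ^ 2 = M - m + 1 := by rw [hA]; field_simp; ring
    have h7 : A * (R / 3) ^ 2 ≤ A * sqn (y - p) := by gcongr; linarith
    linarith
  · have hc : Continuous fun z => A * sqn (z - p) :=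
      continuous_const.mul (continuous_sqn.comp (by fun_prop))
    have h2 : ∀ᶠ z in 𝓝 p, A * sqn (z - p) < 1 := hc.continuousAt.eventually (gt_mem_nhds (by simp))
    filter_upwards [h2, ball_mem_nhds p (half_pos hR)] with z hz hzb
    rw [if_pos hzb, max_eq_left]
    have := hm z (ball_subset_closedBall hzb)
    linarith

/-- A continuous function of one variable whose means are at least its values up to `o(ρ²)` has
the submean value property. -/
lemma le_circleAverage_of_weak_submean {v : ℂ → ℝ} {a : ℂ} {r : ℝ} (hr : 0 < r)
    (hv : ContinuousOn v (closedBall a r)) (hsub : ∀ z ∈ ball a r, ∀ ε > 0, ∀ᶠ ρ in 𝓝[>] (0 : ℝ),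
      v z ≤ circleAverage v z ρ + ε * ρ ^ 2) : v a ≤ circleAverage v a r := by
  have hq : Continuous fun z : ℂ => ‖z - a‖ ^ 2 := by fun_prop
  have key : ∀ ε > 0, v a ≤ circleAverage v a r + ε * r ^ 2 := by
    intro ε hf
    have hc : ContinuousOn (fun z => v z + ε * ‖z - a‖ ^ 2) (closedBall a r) :=
      hv.add (continuous_const.mul hq).continuousOn
    have hsum : ∀ z ρ, 0 < ρ → closedBall z ρ ⊆ closedBall a r →
        circleAverage (fun z => v z + ε * ‖z - a‖ ^ 2) z ρ
          = circleAverage v z ρ + ε * (‖z - a‖ ^ 2 + ρ ^ 2) := by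
      intro z ρ hb hsub
      rw [circleAverage_fun_add, circleAverage_const_mul, circleAverage_norm_sq_sub]
      · exact ContinuousOn.circleIntegrable hb.le (hv.mono (sphere_subset_closedBall.trans hsub))
      · exact ContinuousOn.circleIntegrable hb.le (continuous_const.mul hq).continuousOn
    obtain ⟨m, hm⟩ := (isCompact_closedBall a r).bddBelow_image hc
    have := le_circleAverage_of_local_submean hr hc.upperSemicontinuousOn
      (fun z hz => hm (mem_image_of_mem _ hz)) (fun z hz => by
        have hpos : 0 < r - dist z a := by rw [mem_ball] at hz; linarith
        filter_upwards [hsub z hz ε hf, Ioo_mem_nhdsGT hpos] with ρ h1 hb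
        rw [hsum z ρ hb.1 (closedBall_subset_closedBall' (by linarith [hb.2]))]
        linarith)
    rw [hsum a r hr subset_rfl] at this
    simpa using this
  refine le_of_forall_pos_le_add fun ε hf => ?_
  have := key (ε / r ^ 2) (by positivity)
  rwa [div_mul_cancel₀ _ (by positivity)] at this

lemma weak_submean_comp {s : F → ℝ} (hs : PshOn s univ)
    (hd : ContDiff ℝ 2 s) {f : ℂ → F} {Ω : Set ℂ} (hA : IsOpen Ω)
    (hf : DifferentiableOn ℂ f Ω) [CompleteSpace F] {p : ℂ} (hp : p ∈ Ω) {ε : ℝ} (hi : 0 < ε) :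
    ∀ᶠ ρ in 𝓝[>] (0 : ℝ), s (f p) ≤ circleAverage (fun w => s (f w)) p ρ + ε * ρ ^ 2 := by
  set q := f p with hq
  set b := deriv f p with hb
  set l := fderiv ℝ s q with hl
  have hdiff : HasDerivAt f b p := (hf.differentiableAt (hA.mem_nhds hp)).hasDerivAt
  -- Lipschitz bound for the derivative of `s` at `q`
  have hs' : (fun y => fderiv ℝ s y - l) =O[𝓝 q] fun y => y - q := by
    have : DifferentiableAt ℝ (fderiv ℝ s) q :=
      (hd.fderiv_right (m := 1) (by norm_num)).differentiable (by norm_num) q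
    exact this.hasFDerivAt.isBigO_sub
  obtain ⟨C, hC0, hC⟩ := hs'.exists_pos
  rw [Asymptotics.isBigOWith_iff, Metric.eventually_nhds_iff] at hC
  obtain ⟨R, hR, hC⟩ := hC
  set η := min 1 (ε / (C * (‖b‖ + 1))) with hg
  have hg0 : 0 < η := lt_min one_pos (by positivity)
  have hgi : C * (‖b‖ + 1) * η ≤ ε := by
    have := min_le_right 1 (ε / (C * (‖b‖ + 1)))
    rw [← hg, le_div_iff₀ (by positivity)] at this
    linarith
  have hlo := hdiff.isLittleO.def hg0
  obtain ⟨R1, hR1, hlo⟩ := Metric.eventually_nhds_iff.1 hlo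
  obtain ⟨R2, hR2, hA2⟩ := Metric.isOpen_iff.1 hA p hp
  have hpos : 0 < min (min R1 R2) (R / (‖b‖ + 1)) := by positivity
  filter_upwards [Ioo_mem_nhdsGT hpos] with ρ hr
  have hr0 : 0 < ρ := hr.1
  have hr1 : ρ < R1 := hr.2.trans_le ((min_le_left _ _).trans (min_le_left _ _))
  have hr2 := hr.2.trans_le ((min_le_left _ _).trans (min_le_right _ _))
  have hr3 : (‖b‖ + 1) * ρ < R := by
    have := hr.2.trans_le (min_le_right _ _)
    rw [lt_div_iff₀ (by positivity)] at this
    linarith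
  have hsubA := (closedBall_subset_ball hr2).trans hA2
  have hfc := hf.continuousOn.mono (sphere_subset_closedBall.trans hsubA)
  have hsc := hd.continuous
  have hest : ∀ w ∈ sphere p ρ,
      s (q + (w - p) • b) + l (f w - q - (w - p) • b) - ε * ρ ^ 2 ≤ s (f w) := by
    intro w hw
    have hw' : ‖w - p‖ = ρ := by simpa [dist_eq_norm] using hw
    have h1 := hlo (y := w) (by rw [dist_eq_norm, hw']; exact hr1)
    rw [hw'] at h1
    have h2 : ‖(w - p) • b‖ = ρ * ‖b‖ := by rw [norm_smul, hw']
    have h3 : f w ∈ closedBall q ((‖b‖ + 1) * ρ) := by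
      rw [mem_closedBall, dist_eq_norm]
      calc ‖f w - q‖ = ‖(f w - f p - (w - p) • b) + (w - p) • b‖ := by rw [sub_add_cancel]
        _ ≤ η * ρ + ρ * ‖b‖ := (norm_add_le _ _).trans (by rw [h2]; gcongr)
        _ ≤ 1 * ρ + ρ * ‖b‖ := by gcongr; exact min_le_left _ _
        _ = _ := by ring
    have h4 : q + (w - p) • b ∈ closedBall q ((‖b‖ + 1) * ρ) := by
      rw [mem_closedBall, dist_eq_norm, add_sub_cancel_left, h2]
      nlinarith
    have h5 := (convex_closedBall q ((‖b‖ + 1) * ρ)).norm_image_sub_le_of_norm_hasFDerivWithin_le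
      (f := fun y => s y - l y) (f' := fun y => fderiv ℝ s y - l) (C := C * ((‖b‖ + 1) * ρ))
      (𝕜 := ℝ) (fun y _ => ((hd.differentiable (by norm_num) y).hasFDerivAt.sub
        l.hasFDerivAt).hasFDerivWithinAt) (fun y hy => by
        refine (hC (y := y) (lt_of_le_of_lt hy hr3)).trans ?_
        have : ‖y - q‖ ≤ (‖b‖ + 1) * ρ := by simpa [dist_eq_norm] using hy
        gcongr) h4 h3
    have h6 : ‖f w - (q + (w - p) • b)‖ ≤ η * ρ := by rw [← sub_sub]; exact h1
    have h7 : C * ((‖b‖ + 1) * ρ) * ‖f w - (q + (w - p) • b)‖ ≤ ε * ρ ^ 2 := by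
      calc _ ≤ C * ((‖b‖ + 1) * ρ) * (η * ρ) := by gcongr
        _ = C * (‖b‖ + 1) * η * ρ ^ 2 := by ring
        _ ≤ _ := by gcongr
    have h8 := (abs_le.1 (h5.trans h7)).1
    rw [sub_sub (f w), map_sub]
    linarith
  have i1 : CircleIntegrable (fun w => s (q + (w - p) • b)) p ρ :=
    ContinuousOn.circleIntegrable hr0.le (by fun_prop)
  have hcl : ContinuousOn (fun w => f w - q - (w - p) • b) (sphere p ρ) :=
    (hfc.sub continuousOn_const).sub (by fun_prop)
  have i2 : CircleIntegrable (fun w => l (f w - q - (w - p) • b)) p ρ :=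
    ContinuousOn.circleIntegrable hr0.le (l.continuous.comp_continuousOn hcl)
  have e1 : s q ≤ circleAverage (fun w => s (q + (w - p) • b)) p ρ := by
    have h1 := hs.le_circleAverage (a := q) (b := b) hr0 fun _ _ => mem_univ _
    rw [← Real.circleAverage_map_add_const (c := p)]
    simpa using h1
  have e2 : circleAverage (fun w => l (f w - q - (w - p) • b)) p ρ = 0 := by
    have hh : DiffContOnCl ℂ (fun w => f w - q - (w - p) • b) (ball p |ρ|) := by
      refine DifferentiableOn.diffContOnCl ?_
      rw [abs_of_pos hr0]
      refine DifferentiableOn.mono ?_ (closure_ball_subset_closedBall.trans hsubA)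
      exact (hf.sub_const q).sub (by fun_prop)
    have h1 := l.circleAverage_comp_comm (ContinuousOn.circleIntegrable hr0.le hcl)
    rw [hh.circleAverage] at h1
    simpa [Function.comp_def, hq] using h1
  have e3 : circleAverage (fun w => s (q + (w - p) • b) + l (f w - q - (w - p) • b)) p ρ
      ≤ circleAverage (fun w => s (f w) + ε * ρ ^ 2) p ρ := by
    refine circleAverage_mono (i1.add i2) (ContinuousOn.circleIntegrable hr0.le
      ((hsc.comp_continuousOn hfc).add continuousOn_const)) fun w hw => ?_
    rw [abs_of_pos hr0] at hw
    have := hest w hw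
    linarith
  have i3 : CircleIntegrable (fun w => s (f w)) p ρ :=
    ContinuousOn.circleIntegrable hr0.le (hsc.comp_continuousOn hfc)
  rw [circleAverage_fun_add i1 i2, circleAverage_fun_add i3
    (circleIntegrable_const _ _ _), circleAverage_const, e2] at e3
  linarith

lemma PshOn.comp_to_Cn {u : Fn d} {W : Set (Cn d)} (hW : IsOpen W) (hu : PshOn u W)
    {f : E → Cn d} (hV : IsOpen V) (hf : DifferentiableOn ℂ f V)
    (hm : ∀ z ∈ V, f z ∈ W) : PshOn (fun z => u (f z)) V := by
  refine ⟨hu.usc.comp hf.continuousOn hm, fun z hz => ?_, fun a ha b => ?_⟩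
  · obtain ⟨m, h⟩ := hu.bdd (f z) (hm z hz)
    exact ⟨m, (hf.continuousOn.continuousAt (hV.mem_nhds hz)).eventually h⟩
  obtain ⟨v, hv, hvu⟩ := hu.exists_global hW (hm a ha)
  obtain ⟨O, hO, hOo, haO⟩ := _root_.mem_nhds_iff.1
    ((hf.continuousOn.continuousAt (hV.mem_nhds ha)).eventually hvu)
  have hOV : IsOpen (O ∩ V) := hOo.inter hV
  filter_upwards [eventually_line_mem hOV ⟨haO, ha⟩ b, self_mem_nhdsWithin] with r hl hr0
  have hr : 0 < r := hr0
  set Ω : Set ℂ := (fun w : ℂ => a + w • b) ⁻¹' (O ∩ V) with hA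
  have hAo : IsOpen Ω := hOV.preimage (by fun_prop)
  have hfl : DifferentiableOn ℂ (fun w : ℂ => f (a + w • b)) Ω :=
    hf.comp (by fun_prop) fun w hw => hw.2
  have hcl := hfl.continuousOn.mono hl
  have hmoll : ∀ c > 0, v (f a) ≤ circleAverage (fun w => mollify c v (f (a + w • b))) 0 r := by
    intro c hc
    have hsm := mollify_contDiff hc hv.locallyIntegrable (n := 2)
    have := le_circleAverage_of_weak_submean hr (v := fun w => mollify c v (f (a + w • b)))
      (hsm.continuous.comp_continuousOn hcl)
      (fun z hz ε hg => weak_submean_comp (hv.pshOn_mollify hc) hsm hAo hfl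
        (hl z (ball_subset_closedBall hz)) hg)
    simp at this
    exact (hv.le_mollify hc _).trans this
  have hav := hO haO
  have hsph : ∀ t, circleMap 0 r t ∈ closedBall (0 : ℂ) r := fun t =>
    sphere_subset_closedBall (circleMap_mem_sphere 0 hr.le t)
  have heq : circleAverage (fun w => u (f (a + w • b))) 0 r
      = circleAverage (fun w => v (f (a + w • b))) 0 r := by
    refine circleAverage_congr_sphere fun w hw => ?_
    rw [abs_of_pos hr] at hw
    exact (hO (hl w (sphere_subset_closedBall hw)).1).symm
  rw [heq, ← hav]
  set C := (fun w : ℂ => f (a + w • b)) '' closedBall 0 r with hC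
  have hCc := (isCompact_closedBall _ _).image_of_continuousOn hcl
  obtain ⟨M, hM⟩ := hv.exists_bound (hCc.cthickening (r := 1))
  have hMb : ∀ c, 0 < c → c ≤ 1 → ∀ z ∈ C, |mollify c v z| ≤ M := by
    intro c hc hc1 z hz
    have hb : ∀ y ∈ closedBall z c, |v y| ≤ M := fun y hy =>
      hM y (mem_cthickening_of_dist_le y z 1 C hz (le_trans hy hc1))
    rw [abs_le]
    constructor
    · rw [← mollify_const hc (-M) z]
      exact mollify_mono hc (pshOn_const _ _) hv fun y hy => (abs_le.1 (hb y hy)).1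
    · rw [← mollify_const hc M z]
      exact mollify_mono hc hv (pshOn_const _ _) fun y hy => (abs_le.1 (hb y hy)).2
  have hlim : Tendsto (fun c => circleAverage (fun w => mollify c v (f (a + w • b))) 0 r)
      (𝓝[>] 0) (𝓝 (circleAverage (fun w => v (f (a + w • b))) 0 r)) := by
    unfold circleAverage
    refine Tendsto.const_smul ?_ _
    refine intervalIntegral.tendsto_integral_filter_of_dominated_convergence (fun _ => M) ?_ ?_ ?_ ?_
    · filter_upwards [self_mem_nhdsWithin] with c hc
      have : Continuous fun t => mollify c v (f (a + (circleMap 0 r t) • b)) :=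
        (mollify_contDiff hc hv.locallyIntegrable (n := 0)).continuous.comp
          (hcl.comp_continuous (continuous_circleMap 0 r) hsph)
      exact this.aestronglyMeasurable
    · filter_upwards [Ioc_mem_nhdsGT one_pos] with c hc
      exact ae_of_all _ fun t _ => hMb c hc.1 hc.2 _ ⟨_, hsph t, rfl⟩
    · exact intervalIntegrable_const
    · exact ae_of_all _ fun t _ => hv.tendsto_mollify _
  refine ge_of_tendsto hlim ?_
  filter_upwards [self_mem_nhdsWithin] with c hc using hmoll c hc

lemma PshOn.comp_continuousLinearEquiv (hu : PshOn u W) (e : F ≃L[ℂ] E) :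
    PshOn (fun z => u (e z)) (e ⁻¹' W) := by
  refine ⟨hu.usc.comp e.continuous.continuousOn fun z hz => hz, fun z hz => ?_, fun a ha b => ?_⟩
  · obtain ⟨m, h⟩ := hu.bdd (e z) hz
    exact ⟨m, e.continuous.continuousAt.eventually h⟩
  · simpa using hu.submean (e a) ha (e b)

/-- Plurisubharmonicity is preserved by composition with holomorphic maps. -/
lemma PshOn.comp_holomorphic [FiniteDimensional ℂ F] {u : F → ℝ} {W : Set F} (hW : IsOpen W)
    (hu : PshOn u W) {f : E → F} (hV : IsOpen V) (hf : DifferentiableOn ℂ f V)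
    (hm : ∀ z ∈ V, f z ∈ W) : PshOn (fun z => u (f z)) V := by
  let e : F ≃L[ℂ] Cn (Module.finrank ℂ F) := ContinuousLinearEquiv.ofFinrankEq (by simp)
  have h1 := (hu.comp_continuousLinearEquiv e.symm).comp_to_Cn (hW.preimage e.symm.continuous)
    (f := fun z => e (f z)) hV (e.differentiable.comp_differentiableOn hf)
    (fun z hz => by simpa using hm z hz)
  simpa using h1

end Compose

/-! ### Wirtinger derivatives -/

section Wirtinger

variable {d : ℕ}
variable {α α' β β' : ℂ} {f g : Cn d → ℂ} {j k : Fin d}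

/-- The first order operator `α ∂/∂x_j + β ∂/∂y_j`. -/
def wd (α β : ℂ) (j : Fin d) (f : Cn d → ℂ) (z : Cn d) : ℂ :=
  α * fderiv ℝ f z (single j 1) + β * fderiv ℝ f z (single j I)

lemma wd_contDiff (hf : Smooth f) : Smooth (wd α β j f) := by
  have h : Smooth (fderiv ℝ f) := hf.fderiv_right (by norm_num)
  unfold wd
  exact (contDiff_const.mul (h.clm_apply contDiff_const)).add
    (contDiff_const.mul (h.clm_apply contDiff_const))

lemma wd_hasCompactSupport (hf : HasCompactSupport f) : HasCompactSupport (wd α β j f) := by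
  unfold wd
  exact ((hf.fderiv_apply ℝ _).mul_left).add ((hf.fderiv_apply ℝ _).mul_left)

lemma wd_add (hf : Smooth f) (hg : Smooth g)
    (z : Cn d) : wd α β j (fun y => f y + g y) z = wd α β j f z + wd α β j g z := by
  have h1 := hf.diff z
  have h2 := hg.diff z
  simp only [wd]
  rw [fderiv_fun_add h1 h2]
  simp
  ring

lemma wd_const_mul (c : ℂ) (hf : Smooth f)
    (z : Cn d) : wd α β j (fun y => c * f y) z = c * wd α β j f z := by
  have h1 := hf.diff z
  simp only [wd]
  rw [fderiv_const_mul h1]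
  simp
  ring

lemma wd_mul (hf : Smooth f) (hg : Smooth g)
    (z : Cn d) : wd α β j (fun y => f y * g y) z = wd α β j f z * g z + f z * wd α β j g z := by
  have h1 := hf.diff z
  have h2 := hg.diff z
  simp only [wd]
  rw [fderiv_fun_mul h1 h2]
  simp
  ring

lemma wd_prod {q : Type*} [DecidableEq q] (s : Finset q) {f : q → Cn d → ℂ}
    (hf : ∀ i, Smooth (f i)) (z : Cn d) : wd α β j (fun y => ∏ i ∈ s, f i y) z
      = ∑ m ∈ s, wd α β j (f m) z * ∏ i ∈ s.erase m, f i z := by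
  have h1 : ∀ i ∈ s, DifferentiableAt ℝ (f i) z := fun i _ => (hf i).diff z
  simp only [wd]
  rw [fderiv_finsetProd h1]
  simp only [sum_apply, smul_apply, smul_eq_mul, mul_sum, ← sum_add_distrib]
  refine sum_congr rfl fun m _ => ?_
  ring

lemma wd_wd (hf : Smooth f) (z : Cn d) : wd α β j (wd α' β' k f) z
      = α * α' * D2 f z (single j 1) (single k 1) + α * β' * D2 f z (single j 1) (single k I)
        + β * α' * D2 f z (single j I) (single k 1)
        + β * β' * D2 f z (single j I) (single k I) := by
  have h := hf.fderiv_smooth.diff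
  have hv : ∀ v w : Cn d, fderiv ℝ (fun y => fderiv ℝ f y v) z w = D2 f z w v := by
    intro v w
    rw [fderiv_clm_apply (h z) (differentiableAt_const v)]
    simp
  have hd : ∀ v : Cn d, DifferentiableAt ℝ (fun y => fderiv ℝ f y v) z := fun v =>
    (h z).clm_apply (differentiableAt_const v)
  have he : ∀ w, fderiv ℝ (wd α' β' k f) z w = α' * D2 f z w (single k 1)
        + β' * D2 f z w (single k I) := by
    intro w
    change fderiv ℝ (fun y => α' * fderiv ℝ f y (single k 1)
      + β' * fderiv ℝ f y (single k I)) z w = _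
    rw [fderiv_fun_add ((hd _).const_mul _) ((hd _).const_mul _), fderiv_const_mul (hd _),
      fderiv_const_mul (hd _)]
    simp only [add_apply, smul_apply, smul_eq_mul, hv]
  rw [wd, he, he]
  ring

lemma wd_comm (hf : Smooth f) (z : Cn d) :
    wd α β j (wd α' β' k f) z = wd α' β' k (wd α β j f) z := by
  have hs : ∀ v w, D2 f z v w = D2 f z w v :=
    fun v w => (hf.contDiffAt.isSymmSndFDerivAt (by simp; exact WithTop.coe_le_coe.2 le_top)).eq v w
  rw [wd_wd hf, wd_wd hf, hs (single k 1), hs (single k 1), hs (single k I), hs (single k I)]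
  ring

lemma integrable_of_contDiff (hf : Smooth f) (hc : HasCompactSupport f) :
    Integrable f := hf.continuous.integrable_of_hasCompactSupport hc

lemma integral_mul_wd (hf : Smooth f)
    (hg : Smooth g) (hc : HasCompactSupport f ∨ HasCompactSupport g) :
    ∫ z, f z * wd α β j g z = -∫ z, wd α β j f z * g z := by
  have hf' : ∀ v, Smooth fun z => fderiv ℝ f z v := fun v =>
    hf.fderiv_smooth.clm_apply contDiff_const
  have hg' : ∀ v, Smooth fun z => fderiv ℝ g z v := fun v =>
    hg.fderiv_smooth.clm_apply contDiff_const
  have i1 : ∀ v, Integrable fun z => fderiv ℝ f z v * g z := fun v =>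
    integrable_of_contDiff ((hf' v).mul hg)
      (hc.elim (fun h => (h.fderiv_apply ℝ v).mul_right) fun h => h.mul_left)
  have i2 : ∀ v, Integrable fun z => f z * fderiv ℝ g z v := fun v =>
    integrable_of_contDiff (hf.mul (hg' v))
      (hc.elim (fun h => h.mul_right) fun h => (h.fderiv_apply ℝ v).mul_left)
  have i3 := integrable_of_contDiff (hf.mul hg) (hc.elim (fun h => h.mul_right) fun h => h.mul_left)
  have hp : ∀ v, ∫ z, f z * fderiv ℝ g z v = -∫ z, fderiv ℝ f z v * g z := fun v =>
    integral_mul_fderiv_eq_neg_fderiv_mul_of_integrable (i1 v) (i2 v) i3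
      (fun x _ => hf.diff x) (fun x _ => hg.diff x)
  have e1 : ∀ z, f z * wd α β j g z = α * (f z * fderiv ℝ g z (single j 1))
      + β * (f z * fderiv ℝ g z (single j I)) := fun z => by simp only [wd]; ring
  have e2 : ∀ z, wd α β j f z * g z = α * (fderiv ℝ f z (single j 1) * g z)
      + β * (fderiv ℝ f z (single j I) * g z) := fun z => by simp only [wd]; ring
  simp only [e1, e2]
  rw [integral_add ((i2 _).const_mul _) ((i2 _).const_mul _),
    integral_add ((i1 _).const_mul _) ((i1 _).const_mul _)]
  simp only [integral_const_mul]
  rw [hp, hp]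
  ring

end Wirtinger

/-! ### Mixed discriminants -/

section MixedDiscriminant

variable {d : ℕ}

open Equiv

/-- The mixed discriminant of `d` matrices of size `d` (times `d!`). -/
def mdisc (A : Fin d → Mat d) : ℂ := ∑ s : Perm (Fin d), ∑ τ : Perm (Fin d),
    sgn s * sgn τ * ∏ i, A i (s i) (τ i)

lemma mdisc_update (A : Fin d → Mat d) (i : Fin d) (B : Mat d) :
    mdisc (update A i B) = ∑ s : Perm (Fin d), ∑ τ : Perm (Fin d), sgn s * sgn τ *
        (B (s i) (τ i) * ∏ l ∈ Finset.univ.erase i, A l (s l) (τ l)) := by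
  refine sum_congr rfl fun s _ => sum_congr rfl fun τ _ => ?_
  rw [← Finset.mul_prod_erase _ _ (Finset.mem_univ i), Function.update_self]
  congr 2
  refine Finset.prod_congr rfl fun l hl => ?_
  rw [update_of_ne (Finset.ne_of_mem_erase hl)]

lemma mdisc_update_add (A : Fin d → Mat d) (i : Fin d) (B C : Mat d) : mdisc (update A i (B + C))
      = mdisc (update A i B) + mdisc (update A i C) := by
  simp only [mdisc_update, ← sum_add_distrib, Matrix.add_apply]
  refine sum_congr rfl fun s _ => sum_congr rfl fun τ _ => ?_
  ring

lemma mdisc_update_smul (A : Fin d → Mat d) (i : Fin d) (c : ℂ)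
    (B : Mat d) : mdisc (update A i (c • B)) = c * mdisc (update A i B) := by
  simp only [mdisc_update, mul_sum, Matrix.smul_apply, smul_eq_mul]
  refine sum_congr rfl fun s _ => sum_congr rfl fun τ _ => ?_
  ring

lemma mdisc_transpose (A : Fin d → Mat d) : mdisc (fun i => (A i).transpose) = mdisc A := by
  unfold mdisc
  rw [Finset.sum_comm]
  refine sum_congr rfl fun s _ => sum_congr rfl fun τ _ => ?_
  simp only [Matrix.transpose_apply]
  ring

lemma mdisc_const (A : Mat d) : mdisc (fun _ => A) = (d.factorial : ℂ) * A.det := by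
  have h : ∀ s : Perm (Fin d), ∑ τ : Perm (Fin d), sgn s * sgn τ * ∏ i, A (s i) (τ i) = A.det := by
    intro s
    rw [← Matrix.det_transpose, Matrix.det_apply', ← Equiv.sum_comp (Equiv.mulRight s)]
    refine sum_congr rfl fun τ _ => ?_
    simp
    rw [Equiv.prod_comp s (fun i => A i (τ i))]
    have : sgn s * sgn s = 1 := by rw [← Int.cast_mul, ← Units.val_mul, Int.units_mul_self]; simp
    linear_combination (sgn τ * ∏ i, A i (τ i)) * this
  simp only [mdisc, h]
  simp [Fintype.card_perm]

open scoped ComplexOrder MatrixOrder Matrix.Norms.L2Operator in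
lemma mdisc_nonneg {A : Fin d → Mat d} (hA : ∀ i, (A i).PosSemidef) : 0 ≤ mdisc A := by
  have hB : ∀ i, ∃ B : Mat d, A i = B.conjTranspose * B := fun i =>
    CStarAlgebra.nonneg_iff_eq_star_mul_self.mp (hA i).nonneg
  choose B hB using hB
  have key : mdisc A = ∑ r : Fin d → Fin d,
      star (Matrix.of fun a l => B l (r l) a).det * (Matrix.of fun a l => B l (r l) a).det := by
    have h1 : ∀ b τ : Perm (Fin d), ∏ i, A i (b i) (τ i)
        = ∑ r : Fin d → Fin d, (∏ i, star (B i (r i) (b i))) * ∏ i, B i (r i) (τ i) := by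
      intro b τ
      simp only [hB, Matrix.mul_apply, Matrix.conjTranspose_apply]
      rw [Finset.prod_univ_sum, Fintype.piFinset_univ]
      exact sum_congr rfl fun r _ => Finset.prod_mul_distrib
    have h2 : ∀ r : Fin d → Fin d,
        star (Matrix.of fun a l => B l (r l) a).det * (Matrix.of fun a l => B l (r l) a).det
        = ∑ b : Perm (Fin d), ∑ τ : Perm (Fin d), sgn b *
          sgn τ * ((∏ i, star (B i (r i) (b i))) * ∏ i, B i (r i) (τ i)) := by
      intro r
      simp only [Matrix.det_apply', star_sum, Finset.sum_mul_sum, star_mul', star_prod,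
        Matrix.of_apply, star_intCast]
      refine sum_congr rfl fun b _ => sum_congr rfl fun τ _ => ?_
      ring
    simp only [mdisc, h1, h2, mul_sum]
    rw [Finset.sum_comm (s := (Finset.univ : Finset (Fin d → Fin d)))]
    refine sum_congr rfl fun b _ => ?_
    rw [Finset.sum_comm (s := (Finset.univ : Finset (Fin d → Fin d)))]
  rw [key]
  exact Finset.sum_nonneg fun r _ => star_mul_self_nonneg _

end MixedDiscriminant

section MixedIntegral

variable {d : ℕ}

open Equiv

variable {α α' β β' : ℂ} {T : Fin d → Cn d → ℂ} {s t : Fn d} {z : Cn d}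

/-- The matrix of second derivatives with respect to two families of first order operators. -/
def glev (α β α' β' : ℂ) (f : Cn d → ℂ) (z : Cn d) : Mat d :=
  Matrix.of fun j k => wd α β j (wd α' β' k f) z

lemma sum_sign_mul_wd_prod_eq_zero
    (hT : ∀ l, Smooth (T l)) (i : Fin d) (τ : Perm (Fin d)) (z : Cn d) : ∑ s : Perm (Fin d), sgn s *
      wd α β (s i) (fun y => ∏ l ∈ Finset.univ.erase i, wd α β (s l) (wd α' β' (τ l) (T l)) y) z
      = 0 := by
  have hsm : ∀ j k l, Smooth (wd α β j (wd α' β' k (T l))) := fun j k l =>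
    wd_contDiff (wd_contDiff (hT l))
  have h1 : ∀ s : Perm (Fin d), wd α β (s i)
      (fun y => ∏ l ∈ Finset.univ.erase i, wd α β (s l) (wd α' β' (τ l) (T l)) y) z
      = ∑ m ∈ Finset.univ.erase i, wd α β (s i) (wd α β (s m) (wd α' β' (τ m) (T m))) z *
        ∏ l ∈ (Finset.univ.erase i).erase m, wd α β (s l) (wd α' β' (τ l) (T l)) z := fun s =>
    wd_prod _ (f := fun l => wd α β (s l) (wd α' β' (τ l) (T l))) (fun l => hsm _ _ l) z
  simp only [h1, mul_sum]
  rw [Finset.sum_comm]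
  refine Finset.sum_eq_zero fun m hm => ?_
  have hmi := Finset.ne_of_mem_erase hm
  set S := ∑ s : Perm (Fin d), sgn s * (wd α β (s i) (wd α β (s m) (wd α' β' (τ m) (T m))) z *
        ∏ l ∈ (Finset.univ.erase i).erase m, wd α β (s l) (wd α' β' (τ l) (T l)) z) with hS
  have hneg : S = -S := by
    conv_lhs => rw [hS, ← Equiv.sum_comp (Equiv.mulRight (swap i m))]
    rw [hS, ← Finset.sum_neg_distrib]
    refine sum_congr rfl fun s _ => ?_
    simp only [Equiv.coe_mulRight, Perm.sign_mul, Perm.sign_swap hmi.symm, Perm.mul_apply,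
      swap_apply_left, swap_apply_right]
    rw [wd_comm (wd_contDiff (hT m))]
    have : ∏ l ∈ (Finset.univ.erase i).erase m, wd α β (s (swap i m l)) (wd α' β' (τ l) (T l)) z
        = ∏ l ∈ (Finset.univ.erase i).erase m, wd α β (s l) (wd α' β' (τ l) (T l)) z := by
      refine Finset.prod_congr rfl fun l hl => ?_
      have h2 := Finset.ne_of_mem_erase hl
      have h3 := Finset.ne_of_mem_erase (Finset.mem_of_mem_erase hl)
      rw [swap_apply_of_ne_of_ne h3 h2]
    rw [this]
    push_cast
    ring
  exact self_eq_neg.1 hneg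

/-- Integration by parts for mixed discriminants of second derivatives. -/
lemma integral_mul_mdisc_update
    (hT : ∀ l, Smooth (T l)) (i : Fin d) {f g : Cn d → ℂ} (hf : Smooth f)
    (hg : Smooth g) (hc : HasCompactSupport f ∨ HasCompactSupport g) :
    ∫ z, f z * mdisc (update (fun l => glev α β α' β' (T l) z) i (glev α β α' β' g z))
      = -∫ z, mdisc (update (fun l => glev α β α' β' (T l) z) i
          (Matrix.of fun j k => wd α β j f z * wd α' β' k g z)) := by
  let P : Perm (Fin d) → Perm (Fin d) → Cn d → ℂ := fun s τ y =>
    ∏ l ∈ Finset.univ.erase i, wd α β (s l) (wd α' β' (τ l) (T l)) y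
  have hP : ∀ s τ, Smooth (P s τ) := fun s τ =>
    contDiff_prod fun l _ => wd_contDiff (wd_contDiff (hT l))
  have hfP : ∀ s τ, Smooth fun y => f y * P s τ y := fun s τ => hf.mul (hP s τ)
  have hcs : ∀ s τ : Perm (Fin d), (HasCompactSupport fun y => f y * P s τ y) ∨
      HasCompactSupport (wd α' β' (τ i) g) := fun s τ =>
    hc.imp (fun h => h.mul_right) fun h => wd_hasCompactSupport h
  have i1 : ∀ s τ : Perm (Fin d), Integrable fun z =>
      (f z * P s τ z) * wd α β (s i) (wd α' β' (τ i) g) z := fun s τ =>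
    integrable_of_contDiff ((hfP s τ).mul (wd_contDiff (wd_contDiff hg)))
      ((hcs s τ).elim (fun h => h.mul_right) fun h => (wd_hasCompactSupport h).mul_left)
  have i2 : ∀ s τ : Perm (Fin d), Integrable fun z =>
      wd α β (s i) (fun y => f y * P s τ y) z * wd α' β' (τ i) g z := fun s τ =>
    integrable_of_contDiff ((wd_contDiff (hfP s τ)).mul (wd_contDiff hg))
      ((hcs s τ).elim (fun h => (wd_hasCompactSupport h).mul_right) fun h => h.mul_left)
  have e1 : ∀ z, f z * mdisc (update (fun l => glev α β α' β' (T l) z) i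
      (glev α β α' β' g z)) = ∑ s : Perm (Fin d), ∑ τ : Perm (Fin d), sgn s * sgn τ *
        ((f z * P s τ z) * wd α β (s i) (wd α' β' (τ i) g) z) := by
    intro z
    rw [mdisc_update]
    simp only [mul_sum]
    refine sum_congr rfl fun s _ => sum_congr rfl fun τ _ => ?_
    simp only [glev, Matrix.of_apply, P]
    ring
  have e2 : ∀ z, mdisc (update (fun l => glev α β α' β' (T l) z) i
      (Matrix.of fun j k => wd α β j f z * wd α' β' k g z))
      = ∑ s : Perm (Fin d), ∑ τ : Perm (Fin d), sgn s * sgn τ *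
        (wd α β (s i) (fun y => f y * P s τ y) z * wd α' β' (τ i) g z) := by
    intro z
    rw [mdisc_update]
    have h1 : ∀ s τ : Perm (Fin d), sgn s * sgn τ *
        (wd α β (s i) (fun y => f y * P s τ y) z * wd α' β' (τ i) g z) = sgn s * sgn τ *
          ((wd α β (s i) f z * wd α' β' (τ i) g z) * P s τ z) + f z * sgn τ * wd α' β' (τ i) g z *
          (sgn s * wd α β (s i) (P s τ) z) := by
      intro s τ
      rw [wd_mul hf (hP s τ)]
      ring
    simp only [h1, sum_add_distrib]
    rw [Finset.sum_comm (f := fun s τ => f z * sgn τ * wd α' β' (τ i) g z *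
          (sgn s * wd α β (s i) (P s τ) z))]
    simp only [← mul_sum, P, sum_sign_mul_wd_prod_eq_zero hT, mul_zero,
      Finset.sum_const_zero, add_zero]
    simp only [glev, Matrix.of_apply]
  simp only [e1, e2]
  rw [integral_finsetSum _ fun s _ => integrable_finsetSum _ fun τ _ => (i1 s τ).const_mul _,
    integral_finsetSum _ fun s _ => integrable_finsetSum _ fun τ _ => (i2 s τ).const_mul _,
    ← Finset.sum_neg_distrib]
  refine sum_congr rfl fun s _ => ?_
  rw [integral_finsetSum _ fun τ _ => (i1 s τ).const_mul _,
    integral_finsetSum _ fun τ _ => (i2 s τ).const_mul _, ← Finset.sum_neg_distrib]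
  refine sum_congr rfl fun τ _ => ?_
  rw [integral_const_mul, integral_const_mul, integral_mul_wd (hfP s τ) (wd_contDiff hg) (hcs s τ)]
  ring

/-- The complex Hessian of a real function. -/
def lev (s : Fn d) (z : Cn d) : Mat d :=
  glev (1 / 2) (-I / 2) (1 / 2) (I / 2) (fun y => (s y : ℂ)) z

/-- The holomorphic gradient of a real function. -/
def grad (s : Fn d) (z : Cn d) (j : Fin d) : ℂ := wd (1 / 2) (-I / 2) j (fun y => (s y : ℂ)) z

lemma contDiff_ofReal (hs : Smooth s) : Smooth fun y => (s y : ℂ) :=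
  Complex.ofRealCLM.contDiff.comp hs

lemma fderiv_ofReal (hs : DifferentiableAt ℝ s z) (v : Cn d) :
    fderiv ℝ (fun y => (s y : ℂ)) z v = (fderiv ℝ s z v : ℝ) := by
  have := (Complex.ofRealCLM.hasFDerivAt.comp z hs.hasFDerivAt).fderiv
  change fderiv ℝ (Complex.ofRealCLM ∘ s) z v = _
  rw [this]
  rfl

lemma fderiv_fderiv_ofReal (hs : Smooth s) (z v w : Cn d) :
    D2 (fun y => (s y : ℂ)) z v w = (D2 s z v w : ℝ) := by
  have h := hs.fderiv_smooth.diff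
  have hC := ((contDiff_ofReal hs).fderiv_smooth).diff
  have h1 : fderiv ℝ (fun y => fderiv ℝ (fun x => (s x : ℂ)) y w) z v
      = D2 (fun y => (s y : ℂ)) z v w := by
    rw [fderiv_clm_apply (hC z) (differentiableAt_const w)]; simp
  have h2 : fderiv ℝ (fun y => fderiv ℝ s y w) z v = D2 s z v w := by
    rw [fderiv_clm_apply (h z) (differentiableAt_const w)]; simp
  rw [← h1, ← h2, ← fderiv_ofReal ((h z).clm_apply (differentiableAt_const w))]
  congr 2
  ext y
  rw [fderiv_ofReal (hs.diff y)]

lemma wd_conj_ofReal (hs : Smooth s) (j : Fin d) (z : Cn d) :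
    wd (1 / 2) (I / 2) j (fun y => (s y : ℂ)) z = star (grad s z j) := by
  have h := hs.diff z
  simp only [grad, wd, fderiv_ofReal h]
  simp

/-- The complex Hessian in terms of the real second derivative. -/
lemma lev_apply (hs : Smooth s) (z : Cn d) (j k : Fin d) :
    lev s z j k = ((D2 s z (single j 1) (single k 1) + D2 s z (single j I) (single k I) : ℝ)
      + I * (D2 s z (single j 1) (single k I) - D2 s z (single j I) (single k 1) : ℝ)) / 4 := by
  simp only [lev, glev, Matrix.of_apply, wd_wd (contDiff_ofReal hs), fderiv_fderiv_ofReal hs]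
  push_cast
  linear_combination (-1 / 4 * (D2 s z (single j I) (single k I) : ℂ)) * Complex.I_sq

lemma lev_continuous (hs : Smooth s) : Continuous (lev s) := by
  refine continuous_matrix fun j k => ?_
  exact (wd_contDiff (wd_contDiff (contDiff_ofReal hs))).continuous

lemma lev_add (hs : Smooth s) (ht : Smooth t) (z : Cn d) :
    lev (fun y => s y + t y) z = lev s z + lev t z := by
  ext j k
  simp only [lev, glev, Matrix.of_apply, Matrix.add_apply]
  rw [← wd_add (wd_contDiff (contDiff_ofReal hs)) (wd_contDiff (contDiff_ofReal ht))]
  congr 1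
  ext y
  rw [← wd_add (contDiff_ofReal hs) (contDiff_ofReal ht)]
  push_cast
  rfl

lemma lev_const_mul (c : ℝ) (hs : Smooth s) (z : Cn d) :
    lev (fun y => c * s y) z = (c : ℂ) • lev s z := by
  ext j k
  simp only [lev, glev, Matrix.of_apply, Matrix.smul_apply, smul_eq_mul]
  rw [← wd_const_mul (c : ℂ) (wd_contDiff (contDiff_ofReal hs))]
  congr 1
  ext y
  rw [← wd_const_mul (c : ℂ) (contDiff_ofReal hs)]
  push_cast
  rfl

lemma lev_congr (h : s =ᶠ[𝓝 z] t) : lev s z = lev t z := by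
  have h0 : (fun y => (s y : ℂ)) =ᶠ[𝓝 z] fun y => (t y : ℂ) := by
    filter_upwards [h] with y hy; rw [hy]
  have hw : ∀ {f g : Cn d → ℂ} {α β : ℂ} {j : Fin d}, f =ᶠ[𝓝 z] g →
      wd α β j f =ᶠ[𝓝 z] wd α β j g := by
    intro f g α β j hfg
    filter_upwards [hfg.fderiv (𝕜 := ℝ)] with y hy
    simp only [wd, hy]
  ext j k
  simp only [lev, glev, Matrix.of_apply]
  exact (hw (hw h0)).eq_of_nhds

lemma lev_const (c : ℝ) (z : Cn d) : lev (fun _ => c) z = 0 := by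
  ext j k
  rw [lev_apply contDiff_const]
  simp

/-- The density of the mixed complex Monge–Ampère operator. -/
def MD (T : Fin d → Fn d) (z : Cn d) : ℝ := (mdisc fun l => lev (T l) z).re

lemma lev_update (T : Fin d → Fn d) (i : Fin d) (g : Fn d) (z : Cn d) :
    (fun l => lev (update T i g l) z) = update (fun l => lev (T l) z) i (lev g z) := by
  ext1 l
  by_cases h : l = i
  · subst h; simp
  · simp [update_of_ne h]

lemma MD_continuous {T : Fin d → Fn d} (hT : ∀ l, Smooth (T l)) : Continuous (MD T) := by
  unfold MD mdisc
  refine Complex.continuous_re.comp (continuous_finsetSum _ fun s _ =>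
    continuous_finsetSum _ fun τ _ => continuous_const.mul (continuous_finsetProd _ fun l _ => ?_))
  exact (continuous_apply_apply (s l) (τ l)).comp (lev_continuous (hT l))

end MixedIntegral

/-! ### Second order expansions and the Levi form -/

section Taylor

variable {E : Type*} [NormedAddCommGroup E] [NormedSpace ℝ E]

/-- Second order Taylor expansion at a point where the derivative is differentiable. -/
lemma taylor_two {s : E → ℝ} {s' : E → E →L[ℝ] ℝ} {B : E →L[ℝ] E →L[ℝ] ℝ} {p : E}
    (h1 : ∀ᶠ y in 𝓝 p, HasFDerivAt s (s' y) y) (h2 : HasFDerivAt s' B p) {ε : ℝ} (ha : 0 < ε) :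
    ∀ᶠ h in 𝓝 (0 : E), |s (p + h) - s p - s' p h - B h h / 2| ≤ ε * ‖h‖ ^ 2 := by
  have hsymm := second_derivative_symmetric_of_eventually h1 h2
  have h3 := h2.isLittleO.def ha
  obtain ⟨R, hR, hball⟩ := Metric.eventually_nhds_iff.1 (h1.and h3)
  filter_upwards [ball_mem_nhds (0 : E) hR] with h hh
  have hh' : ‖h‖ < R := by simpa using hh
  have key := (convex_closedBall (0 : E) ‖h‖).norm_image_sub_le_of_norm_hasFDerivWithin_le (𝕜 := ℝ)
    (f := fun k => s (p + k) - s' p k - B k k / 2)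
    (f' := fun k => s' (p + k) - s' p - B k) (C := ε * ‖h‖) (x := 0) (y := h)
    (fun k hk => ?_) (fun k hk => ?_) (mem_closedBall_self (norm_nonneg _)) (by simp)
  · simp only [add_zero, map_zero, zero_div, sub_zero] at key
    rw [norm_eq_abs] at key
    refine (le_of_eq ?_).trans (key.trans_eq (by ring))
    congr 1; ring
  · have hk' : ‖k‖ ≤ ‖h‖ := by simpa using hk
    have hd := (hball (y := p + k) (by simpa using hk'.trans_lt hh')).1
    have e1 := (hasFDerivAt_comp_add_left p).2 hd
    have e2 : HasFDerivAt (fun k => B k k / 2) (B k) k := by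
      have := (B.hasFDerivAt (x := k)).clm_apply (hasFDerivAt_id k)
      have := this.mul_const (1 / 2 : ℝ)
      refine (this.congr_fderiv ?_).congr_of_eventuallyEq (.of_forall fun y => ?_)
      · ext v
        simp [hsymm v k]
        ring
      · simp; ring
    exact ((e1.sub (s' p).hasFDerivAt).sub e2).hasFDerivWithinAt
  · have hk' : ‖k‖ ≤ ‖h‖ := by simpa using hk
    have := (hball (y := p + k) (by simpa using hk'.trans_lt hh')).2
    simp at this
    exact this.trans (by gcongr)

end Taylor

section Levi

variable {d : ℕ}
variable {B : Bil d} {s : Fn d}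

lemma circleAverage_I_mul (F : ℂ → ℝ) (r : ℝ) :
    circleAverage (fun w => F (I * w)) 0 r = circleAverage F 0 r := by
  rw [Real.circleAverage_eq_integral_add (Real.pi / 2) (f := F), Real.circleAverage_def]
  congr 2
  ext t
  congr 1
  simp only [circleMap_zero]
  push_cast
  rw [add_mul, Complex.exp_add, show (Real.pi / 2 : ℂ) * I = Real.pi / 2 * I from rfl,
    Complex.exp_pi_div_two_mul_I]
  ring

/-- At a point with a second order expansion, the submean value property forces the Levi form to be
nonnegative. -/
lemma levi_nonneg_of_submean {E : Type*} [NormedAddCommGroup E] [NormedSpace ℂ E]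
    {s : E → ℝ} (hs : Continuous s) {p b : E} {l : E →L[ℝ] ℝ} {B : E →L[ℝ] E →L[ℝ] ℝ}
    (hT : ∀ ε > 0, ∀ᶠ h in 𝓝 (0 : E), |s (p + h) - s p - l h - B h h / 2| ≤ ε * ‖h‖ ^ 2)
    (hsub : ∀ᶠ r in 𝓝[>] (0 : ℝ), s p ≤ circleAverage (fun w => s (p + w • b)) 0 r) :
    0 ≤ B b b + B (I • b) (I • b) := by
  by_contra hcon
  push Not at hcon
  set c := B b b + B (I • b) (I • b) with hc
  have hb : b ≠ 0 := by
    rintro rfl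
    simp [hc] at hcon
  have hb0 : 0 < ‖b‖ := norm_pos_iff.2 hb
  set ε := -c / (8 * ‖b‖ ^ 2) with ha
  have ha0 : 0 < ε := div_pos (by linarith) (by positivity)
  obtain ⟨R, hR, hball⟩ := Metric.eventually_nhds_iff.1 (hT ε ha0)
  have hpos : 0 < R / ‖b‖ := by positivity
  obtain ⟨r, hr1, hr2⟩ := (hsub.and (Ioo_mem_nhdsGT hpos)).exists
  have hr0 := hr2.1
  have hrb : r * ‖b‖ < R := by rw [← lt_div_iff₀ hb0]; exact hr2.2
  let G : ℂ → ℝ := fun w => s p + l (w • b) + B (w • b) (w • b) / 2 + ε * (r * ‖b‖) ^ 2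
  have hGc : Continuous G := by fun_prop
  have hsG : circleAverage (fun w => s (p + w • b)) 0 r ≤ circleAverage G 0 r := by
    refine circleAverage_mono (ContinuousOn.circleIntegrable hr0.le (by fun_prop))
      (ContinuousOn.circleIntegrable hr0.le hGc.continuousOn) fun w hw => ?_
    have hw' : ‖w‖ = r := by simpa [abs_of_pos hr0] using hw
    have hn : ‖w • b‖ = r * ‖b‖ := by rw [norm_smul, hw']
    have := hball (y := w • b) (by rw [dist_zero_right, hn]; exact hrb)
    rw [hn] at this
    have := (abs_le.1 this).2
    simp only [G]
    linarith
  have hrot : ∀ F : ℂ → ℝ, Continuous F → 4 * circleAverage F 0 r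
      = circleAverage (fun w => F w + F (I * w) + F (I * (I * w)) + F (I * (I * (I * w)))) 0 r := by
    intro F hF
    have ci : ∀ {g : ℂ → ℝ}, Continuous g → CircleIntegrable g 0 r := fun hg =>
      ContinuousOn.circleIntegrable hr0.le hg.continuousOn
    rw [circleAverage_fun_add (ci (by fun_prop)) (ci (by fun_prop)),
      circleAverage_fun_add (ci (by fun_prop)) (ci (by fun_prop)),
      circleAverage_fun_add (ci (by fun_prop)) (ci (by fun_prop)),
      circleAverage_I_mul (fun w => F (I * (I * w))),
      circleAverage_I_mul (fun w => F (I * w)), circleAverage_I_mul F]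
    ring
  have hG4 : 4 * circleAverage G 0 r = 4 * s p + r ^ 2 * c + 4 * (ε * (r * ‖b‖) ^ 2) := by
    rw [hrot G hGc, circleAverage_congr_sphere
      (f₂ := fun _ => 4 * s p + r ^ 2 * c + 4 * (ε * (r * ‖b‖) ^ 2)), circleAverage_const]
    intro w hw
    have hw' : ‖w‖ = r := by simpa [abs_of_pos hr0] using hw
    have hI : ∀ w : ℂ, I * (I * w) = -w := fun w => by rw [← mul_assoc, Complex.I_mul_I]; ring
    have hQ : B (w • b) (w • b) + B ((I * w) • b) ((I * w) • b) = r ^ 2 * c := by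
      have e1 : w • b = w.re • b + w.im • (I • b) := by
        conv_lhs => rw [← Complex.re_add_im w]
        rw [add_smul, mul_smul, Complex.coe_smul, Complex.coe_smul]
      have e2 : (I * w) • b = w.re • (I • b) - w.im • b := by
        rw [mul_smul, e1, smul_add, smul_comm I w.re b,
          smul_comm I w.im (I • b), smul_smul I I, Complex.I_mul_I]
        simp [sub_eq_add_neg]
      have e3 : r ^ 2 = w.re ^ 2 + w.im ^ 2 := by
        rw [← hw', Complex.sq_norm, Complex.normSq_apply]; ring
      rw [e1, e2, e3, hc]
      simp
      ring
    simp only [G, hI, mul_neg, neg_smul, map_neg, neg_apply, neg_neg]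
    linarith
  have h8 : ε * (r * ‖b‖) ^ 2 = -c * r ^ 2 / 8 := by rw [ha]; field_simp
  have : r ^ 2 * c < 0 := mul_neg_of_pos_of_neg (by positivity) hcon
  rw [h8] at hG4
  linarith

/-- The complex Hessian matrix attached to a real bilinear form. -/
def levB (B : Bil d) : Mat d := Matrix.of fun j k => ((B (single j 1) (single k 1)
      + B (single j I) (single k I) : ℝ) + I * (B (single j 1) (single k I)
      - B (single j I) (single k 1) : ℝ)) / 4

lemma lev_eq_levB (hs : Smooth s) (z : Cn d) : lev s z = levB (D2 s z) := by
  ext j k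
  rw [lev_apply hs]
  rfl

lemma sum_wirtinger (l : Cn d →ₗ[ℝ] ℂ) (b : Cn d) : ∑ j, b j * (l (single j 1) - I * l (single j I))
      = l b - I * l (I • b) := by
  have h1 : ∀ (j : Fin d) (c : ℂ), (single j c : Cn d)
      = c.re • (single j 1 : Cn d) + c.im • (single j I : Cn d) := by
    intro j c
    ext i
    by_cases h : i = j
    · subst h
      apply Complex.ext <;> simp
    · simp [h]
  have h2 : ∀ c : Cn d, l c = ∑ j, (((c j).re : ℂ) * l (single j 1)
      + ((c j).im : ℂ) * l (single j I)) := by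
    intro c
    conv_lhs => rw [← Finset.univ_sum_single c]
    rw [map_sum]
    refine sum_congr rfl fun j _ => ?_
    rw [h1, map_add, map_smul, map_smul]
    simp
  rw [h2 b, h2 (I • b), mul_sum, ← Finset.sum_sub_distrib]
  refine sum_congr rfl fun j _ => ?_
  simp
  conv_lhs => rw [← Complex.re_add_im (b j)]
  linear_combination (-(b j).im * l (single j I) : ℂ) * Complex.I_sq

lemma levB_form (hB : ∀ v w, B v w = B w v) (b : Cn d) : ∑ j, ∑ k, b j * levB B j k * star (b k)
      = ((B b b + B (I • b) (I • b) : ℝ) : ℂ) / 4 := by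
  -- contract first in the antiholomorphic slot
  have h1 : ∀ v : Cn d, ∑ k, star (b k) * ((B v (single k 1) : ℂ) + I * (B v (single k I) : ℂ))
      = (B v b : ℂ) + I * (B v (I • b) : ℂ) := by
    intro v
    have := sum_wirtinger (Complex.ofRealCLM.toLinearMap.comp (B v).toLinearMap) b
    have := congrArg star this
    simp at this
    simpa using this
  have h2 := sum_wirtinger (IsLinearMap.mk' (fun v : Cn d => (B v b : ℂ)
      + I * (B v (I • b) : ℂ)) ⟨fun v w => by simp; ring, fun c v => by simp; ring⟩) b
  simp at h2
  have h3 : ∀ j k, b j * levB B j k * star (b k)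
      = b j * (star (b k) * ((B (single j 1) (single k 1) : ℂ)
          + I * (B (single j 1) (single k I) : ℂ))
        - I * (star (b k) * ((B (single j I) (single k 1) : ℂ)
          + I * (B (single j I) (single k I) : ℂ)))) / 4 := by
    intro j k
    simp only [levB, Matrix.of_apply]
    push_cast
    linear_combination (1 / 4 * b j * star (b k) * (B (single j I) (single k I) : ℂ)) * Complex.I_sq
  simp only [h3, ← Finset.sum_div, ← mul_sum, Finset.sum_sub_distrib, h1]
  rw [h2, hB (I • b) b]
  push_cast
  linear_combination (-1 / 4 * (B (I • b) (I • b) : ℂ)) * Complex.I_sq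

open scoped ComplexOrder in
lemma levB_posSemidef (hB : ∀ v w, B v w = B w v)
    (h : ∀ b, 0 ≤ B b b + B (I • b) (I • b)) : (levB B).PosSemidef := by
  refine Matrix.PosSemidef.of_dotProduct_mulVec_nonneg ?_ fun x => ?_
  · ext j k
    simp only [Matrix.conjTranspose_apply, levB, Matrix.of_apply]
    simp [hB (single k 1), hB (single k I)]
    ring
  · have h1 := levB_form hB (star x)
    have h2 : star x ⬝ᵥ (levB B).mulVec x = ∑ j, ∑ k, star x j * levB B j k * star (star x k) := by
      simp only [dotProduct, Matrix.mulVec, mul_sum, Pi.star_apply, star_star, mul_assoc]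
    rw [h2, h1]
    have := h (star x)
    rw [show (4 : ℂ) = ((4 : ℝ) : ℂ) by norm_num, ← Complex.ofReal_div]
    exact Complex.zero_le_real.2 (by positivity)

open scoped ComplexOrder in
lemma PshOn.lev_posSemidef (hs : Smooth s) (hp : PshOn s univ) (z : Cn d) :
    (lev s z).PosSemidef := by
  have hd := hs.fderiv_smooth.diff
  have h1 : ∀ᶠ y in 𝓝 z, HasFDerivAt s (fderiv ℝ s y) y :=
    .of_forall fun y => (hs.diff y).hasFDerivAt
  have h2 := (hd z).hasFDerivAt
  rw [lev_eq_levB hs]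
  exact levB_posSemidef (second_derivative_symmetric_of_eventually h1 h2) fun b =>
    levi_nonneg_of_submean hs.continuous (fun ε ha => taylor_two h1 h2 ha)
      (hp.submean z (mem_univ _) b)

end Levi

/-! ### Integral inequalities for mixed Monge–Ampère densities -/

section MixedReal

variable {d : ℕ}
variable {T : Fin d → Fn d} {f g : Fn d} {z : Cn d}

lemma glev_transpose {α β α' β' : ℂ} {f : Cn d → ℂ} (hf : Smooth f) (z : Cn d) :
    (glev α β α' β' f z).transpose = glev α' β' α β f z := by
  ext j k
  exact wd_comm hf z

lemma update_transpose (A : Fin d → Mat d) (i : Fin d) (B : Mat d) :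
    (fun l => (update A i B l).transpose) = update (fun l => (A l).transpose) i B.transpose := by
  ext1 l
  by_cases h : l = i
  · subst h; simp
  · simp [update_of_ne h]

/-- The mixed density with a pair of gradients in one slot. -/
def gradMD (T : Fin d → Fn d) (i : Fin d) (f g : Fn d) (z : Cn d) : ℂ :=
  mdisc (update (fun l => lev (T l) z) i (Matrix.of fun j k => grad f z j * star (grad g z k)))

lemma integral_ofReal_mul_mdisc (hT : ∀ l, Smooth (T l)) (i : Fin d) (hf : Smooth f) (hg : Smooth g)
    (hc : HasCompactSupport f ∨ HasCompactSupport g) :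
    ∫ z, (f z : ℂ) * mdisc (update (fun l => lev (T l) z) i (lev g z))
      = -∫ z, gradMD T i f g z := by
  have hc' := hc.imp (fun h => h.comp_left (g := Complex.ofReal) rfl)
      fun h => h.comp_left (g := Complex.ofReal) rfl
  have := integral_mul_mdisc_update (α := 1 / 2) (β := -I / 2) (α' := 1 / 2)
    (β' := I / 2) (fun l => contDiff_ofReal (hT l)) i (contDiff_ofReal hf) (contDiff_ofReal hg) hc'
  simp only [wd_conj_ofReal hg] at this
  exact this

lemma integral_ofReal_mul_mdisc' (hT : ∀ l, Smooth (T l)) (i : Fin d)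
    (hf : Smooth f) (hg : Smooth g) (hc : HasCompactSupport f ∨ HasCompactSupport g) :
    ∫ z, (g z : ℂ) * mdisc (update (fun l => lev (T l) z) i (lev f z))
      = -∫ z, gradMD T i f g z := by
  have hc' := hc.symm.imp (fun h => h.comp_left (g := Complex.ofReal) rfl)
      fun h => h.comp_left (g := Complex.ofReal) rfl
  have h1 := integral_mul_mdisc_update (α' := 1 / 2) (β' := -I / 2) (α := 1 / 2)
    (β := I / 2) (fun l => contDiff_ofReal (hT l)) i (contDiff_ofReal hg) (contDiff_ofReal hf) hc'
  have h2 : ∀ z, mdisc (update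
      (fun l => glev (1 / 2) (I / 2) (1 / 2) (-I / 2) (fun y => (T l y : ℂ)) z) i
      (glev (1 / 2) (I / 2) (1 / 2) (-I / 2) (fun y => (f y : ℂ)) z))
      = mdisc (update (fun l => lev (T l) z) i (lev f z)) := by
    intro z
    rw [← mdisc_transpose, update_transpose]
    simp only [glev_transpose (contDiff_ofReal (hT _)), glev_transpose (contDiff_ofReal hf)]
    rfl
  have h3 : ∀ z, mdisc (update
      (fun l => glev (1 / 2) (I / 2) (1 / 2) (-I / 2) (fun y => (T l y : ℂ)) z) i
      (Matrix.of fun j k => wd (1 / 2) (I / 2) j (fun y => (g y : ℂ)) z *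
        wd (1 / 2) (-I / 2) k (fun y => (f y : ℂ)) z)) = gradMD T i f g z := by
    intro z
    rw [← mdisc_transpose, update_transpose]
    simp only [glev_transpose (contDiff_ofReal (hT _)), wd_conj_ofReal hg]
    unfold gradMD
    congr 2
    ext j k
    simp only [Matrix.transpose_apply, Matrix.of_apply, grad]
    ring
  simpa only [h2, h3] using h1

lemma continuous_mdisc_lev (hT : ∀ l, Smooth (T l)) :
    Continuous fun z => mdisc fun l => lev (T l) z := by
  unfold mdisc
  refine continuous_finsetSum _ fun s _ =>
    continuous_finsetSum _ fun τ _ => continuous_const.mul (continuous_finsetProd _ fun l _ => ?_)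
  exact (continuous_apply_apply (s l) (τ l)).comp (lev_continuous (hT l))

lemma contDiff_update_slot (hT : ∀ l, Smooth (T l)) (i : Fin d)
    (hg : Smooth g) (l : Fin d) : Smooth (update T i g l) := by
  by_cases h : l = i
  · subst h; simpa using hg
  · simpa [update_of_ne h] using hT l

lemma mdisc_update_zero (A : Fin d → Mat d) (i : Fin d) : mdisc (update A i 0) = 0 := by
  simp [mdisc_update]

lemma MD_update_eq_zero {i : Fin d} {c : ℝ}
    (h : g =ᶠ[𝓝 z] fun _ => c) : MD (update T i g) z = 0 := by
  unfold MD
  rw [lev_update, lev_congr h, lev_const, mdisc_update_zero, Complex.zero_re]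

lemma MD_congr {S : Fin d → Fn d} (h : ∀ l, S l =ᶠ[𝓝 z] T l) : MD S z = MD T z := by
  unfold MD
  congr 2
  ext1 l
  exact lev_congr (h l)

lemma MD_update_add (T : Fin d → Fn d) (i : Fin d) (hf : Smooth f)
    (hg : Smooth g) (z : Cn d) : MD (update T i (fun y => f y + g y)) z
      = MD (update T i f) z + MD (update T i g) z := by
  simp only [MD, lev_update, lev_add hf hg, mdisc_update_add, Complex.add_re]

lemma MD_update_const_mul (T : Fin d → Fn d) (i : Fin d) (c : ℝ)
    (hf : Smooth f) (z : Cn d) : MD (update T i (fun y => c * f y)) z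
      = c * MD (update T i f) z := by
  simp only [MD, lev_update, lev_const_mul c hf, mdisc_update_smul, Complex.re_ofReal_mul]

lemma integrable_mul_MD (hf : Smooth f) (hT : ∀ l, Smooth (T l)) (hc : HasCompactSupport f) :
    Integrable fun z => f z * MD T z :=
  (hf.continuous.mul (MD_continuous hT)).integrable_of_hasCompactSupport hc.mul_right

lemma integral_mul_MD_eq (hT : ∀ l, Smooth (T l)) (i : Fin d) (hf : Smooth f) (hg : Smooth g)
    (hc : HasCompactSupport f ∨ HasCompactSupport g) : ∫ z, f z * MD (update T i g) z
      = (∫ z, (f z : ℂ) * mdisc (update (fun l => lev (T l) z) i (lev g z))).re := by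
  have hu := contDiff_update_slot hT i hg
  have hcont := (Complex.continuous_ofReal.comp hf.continuous).mul (continuous_mdisc_lev hu)
  have hcs : HasCompactSupport fun z => (f z : ℂ) * mdisc fun l => lev (update T i g l) z := by
    rcases hc with h | h
    · exact HasCompactSupport.mul_right (h.comp_left (g := Complex.ofReal) rfl)
    · refine HasCompactSupport.intro h fun z hz => ?_
      rw [lev_update, lev_congr (notMem_tsupport_iff_eventuallyEq.1 hz)]
      have := lev_const (0 : ℝ) z
      rw [show (0 : Fn d) = fun _ => (0 : ℝ) from rfl, this, mdisc_update_zero, mul_zero]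
  have hint := hcont.integrable_of_hasCompactSupport hcs (μ := volume)
  simp only [lev_update] at hint
  have := Complex.reCLM.integral_comp_comm hint
  simp at this
  rw [← this]
  simp only [MD, lev_update]

/-- Symmetry of the mixed Monge–Ampère form. -/
lemma integral_mul_MD_symm (hT : ∀ l, Smooth (T l)) (i : Fin d) (hf : Smooth f) (hg : Smooth g)
    (hc : HasCompactSupport f ∨ HasCompactSupport g) :
    ∫ z, f z * MD (update T i g) z = ∫ z, g z * MD (update T i f) z := by
  rw [integral_mul_MD_eq hT i hf hg hc, integral_mul_MD_eq hT i hg hf hc.symm,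
    integral_ofReal_mul_mdisc hT i hf hg hc, integral_ofReal_mul_mdisc' hT i hf hg hc]

open scoped ComplexOrder in
lemma MD_nonneg (hT : ∀ l, Smooth (T l)) (hp : ∀ l, PshOn (T l) univ) (z : Cn d) : 0 ≤ MD T z :=
  (Complex.le_def.1 (mdisc_nonneg fun l => (hp l).lev_posSemidef (hT l) z)).1

open scoped ComplexOrder in
lemma integral_mul_MD_self_nonpos (hT : ∀ l, Smooth (T l))
    (hp : ∀ l, PshOn (T l) univ) (i : Fin d) (hf : Smooth f)
    (hc : HasCompactSupport f) : ∫ z, f z * MD (update T i f) z ≤ 0 := by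
  rw [integral_mul_MD_eq hT i hf hf (Or.inl hc), integral_ofReal_mul_mdisc hT i hf hf (Or.inl hc)]
  rw [Complex.neg_re, neg_nonpos]
  by_cases hint : Integrable (gradMD T i f f)
  · have := Complex.reCLM.integral_comp_comm hint
    simp at this
    rw [← this]
    refine integral_nonneg fun z => ?_
    refine (Complex.le_def.1 (mdisc_nonneg fun l => ?_)).1
    by_cases h : l = i
    · subst h
      rw [Function.update_self]
      exact Matrix.posSemidef_vecMulVec_self_star _
    · rw [update_of_ne h]
      exact (hp l).lev_posSemidef (hT l) z
  · rw [integral_undef hint, Complex.zero_re]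

/-- Cauchy–Schwarz inequality. -/
lemma integral_mul_MD_cauchy_schwarz (hT : ∀ l, Smooth (T l))
    (hp : ∀ l, PshOn (T l) univ) (i : Fin d) (hf : Smooth f)
    (hg : Smooth g) (hfc : HasCompactSupport f) (hgc : HasCompactSupport g) :
    (∫ z, f z * MD (update T i g) z) ^ 2
      ≤ (-∫ z, f z * MD (update T i f) z) * (-∫ z, g z * MD (update T i g) z) := by
  set a := ∫ z, f z * MD (update T i f) z
  set b := ∫ z, f z * MD (update T i g) z with hb
  set c := ∫ z, g z * MD (update T i g) z
  have hb' := integral_mul_MD_symm hT i hg hf (Or.inl hgc)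
  have hq : ∀ t : ℝ, 0 ≤ (-c) * (t * t) + (-(2 * b)) * t + (-a) := by
    intro t
    have h1 := integral_mul_MD_self_nonpos hT hp i (f := fun y => f y + t * g y)
      (hf.add (contDiff_const.mul hg)) (hfc.add hgc.mul_left)
    have h2 : ∀ z, (f z + t * g z) * MD (update T i (fun y => f y + t * g y)) z
        = f z * MD (update T i f) z + t * (f z * MD (update T i g) z)
          + t * (g z * MD (update T i f) z) + t * t * (g z * MD (update T i g) z) := by
      intro z
      rw [MD_update_add T i hf (contDiff_const.mul hg), MD_update_const_mul T i t hg]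
      ring
    have iff' := integrable_mul_MD hf (contDiff_update_slot hT i hf) hfc
    have ifg := (integrable_mul_MD hf (contDiff_update_slot hT i hg) hfc).const_mul t
    have igf := (integrable_mul_MD hg (contDiff_update_slot hT i hf) hgc).const_mul t
    have igg := (integrable_mul_MD hg (contDiff_update_slot hT i hg) hgc).const_mul (t * t)
    simp only [h2] at h1
    have j1 : Integrable fun z => f z * MD (update T i f) z
        + t * (f z * MD (update T i g) z) := iff'.add ifg
    have j2 : Integrable fun z => f z * MD (update T i f) z + t * (f z * MD (update T i g) z)
        + t * (g z * MD (update T i f) z) := j1.add igf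
    rw [integral_add j2 igg, integral_add j1 igf,
      integral_add iff' ifg, integral_const_mul, integral_const_mul, integral_const_mul, hb'] at h1
    linarith
  have := discrim_le_zero hq
  unfold discrim at this
  nlinarith

lemma mdisc_smul_one (c : Fin d → ℝ) : mdisc (fun l => ((c l : ℝ) : ℂ) • (1 : Mat d))
      = ((d.factorial * ∏ l, c l : ℝ) : ℂ) := by
  have h1 : mdisc (fun l => ((c l : ℝ) : ℂ) • (1 : Mat d))
      = (∏ l, (c l : ℂ)) * mdisc fun _ => (1 : Mat d) := by
    unfold mdisc
    simp only [Matrix.smul_apply, smul_eq_mul, Finset.prod_mul_distrib, mul_sum]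
    refine sum_congr rfl fun s _ => sum_congr rfl fun τ _ => ?_
    ring
  rw [h1, mdisc_const, Matrix.det_one]
  push_cast
  ring

lemma fderiv_sqn (z v : Cn d) : fderiv ℝ sqn z v = ∑ i, 2 * (z i * star (v i)).re := by
  have h : HasFDerivAt (sqn : Fn d) (∑ i, 2 • (innerSL ℝ (z i)).comp
      (ContinuousLinearMap.proj (R := ℝ) (φ := fun _ : Fin d => ℂ) i)) z := by
    unfold sqn
    refine HasFDerivAt.fun_sum fun i _ => ?_
    exact ((ContinuousLinearMap.proj (R := ℝ) (φ := fun _ : Fin d => ℂ) i).hasFDerivAt (x := z)).norm_sq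
  rw [h.fderiv, sum_apply]
  refine sum_congr rfl fun i _ => ?_
  simp [Complex.inner]
  ring

lemma fderiv_fderiv_sqn (z v w : Cn d) :
    D2 (sqn : Fn d) z v w = ∑ i, 2 * (v i * star (w i)).re := by
  have hd : Differentiable ℝ (fderiv ℝ (sqn : Fn d)) :=
    ((contDiff_sqn (n := ∞)).fderiv_smooth).diff
  have h1 : fderiv ℝ (fun y => fderiv ℝ (sqn : Fn d) y w) z v = D2 (sqn : Fn d) z v w := by
    rw [fderiv_clm_apply (hd z) (differentiableAt_const w)]; simp
  rw [← h1]
  simp only [fderiv_sqn]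
  let L : Cn d →L[ℝ] ℝ := LinearMap.toContinuousLinearMap
    { toFun := fun y => ∑ i, 2 * (y i * star (w i)).re
      map_add' := fun x y => by
        simp only [Pi.add_apply, add_mul, Complex.add_re, mul_add, sum_add_distrib]
      map_smul' := fun c x => by
        simp only [Pi.smul_apply, Complex.real_smul, mul_assoc, Complex.re_ofReal_mul, RingHom.id_apply,
          smul_eq_mul, mul_sum]
        exact sum_congr rfl fun i _ => by ring }
  exact congrArg (fun M : Cn d →L[ℝ] ℝ => M v) (L.hasFDerivAt (x := z)).fderiv

lemma lev_sqn (z : Cn d) : lev (sqn : Fn d) z = 1 := by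
  ext j k
  rw [lev_apply contDiff_sqn]
  simp only [fderiv_fderiv_sqn]
  by_cases h : j = k
  · subst h
    have h1 : ∀ a b : ℂ, ∑ i, 2 * ((single j a : Cn d) i * star ((single j b : Cn d) i)).re
        = 2 * (a * star b).re := by
      intro a b
      rw [Finset.sum_eq_single j] <;> simp +contextual
    simp only [h1]
    simp
    norm_num
  · have h1 : ∀ a b : ℂ, ∑ i, 2 * ((single j a : Cn d) i * star ((single k b : Cn d) i)).re
        = 0 := by
      intro a b
      refine Finset.sum_eq_zero fun i _ => ?_
      by_cases hi : i = j
      · subst hi; simp [h]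
      · simp [hi]
    simp only [h1]
    simp [h]

lemma lev_quadratic (c k : ℝ) (z : Cn d) :
    lev (fun y : Cn d => c * sqn y + k) z = (c : ℂ) • (1 : Mat d) := by
  rw [lev_add (s := fun y => c * sqn y) (contDiff_const.mul contDiff_sqn) contDiff_const,
    lev_const_mul c contDiff_sqn, lev_const, lev_sqn, add_zero]

end MixedReal

section Energy

variable {d : ℕ}
variable {m t : ℝ} {f g u v w x : Fn d} {T : Fin d → Fn d} {k : ℕ}

/-- `f` vanishes off the set where the cutoff `χ` is locally equal to one. -/
def SuppIn (x f : Fn d) : Prop := ∀ z, (x =ᶠ[𝓝 z] fun _ => 1) ∨ (f =ᶠ[𝓝 z] fun _ => 0)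

lemma SuppIn.hasCompactSupport (h : SuppIn x f) (hx : HasCompactSupport x) :
    HasCompactSupport f := by
  refine hx.mono fun z hz => ?_
  rcases h z with h | h
  · simp [h.eq_of_nhds]
  · exact absurd h.eq_of_nhds hz

lemma SuppIn.sub {q : Fn d} (h1 : SuppIn x fun z => f z - q z)
    (h2 : SuppIn x fun z => g z - q z) : SuppIn x fun z => f z - g z := by
  intro z
  rcases h1 z with h | h1
  · exact Or.inl h
  rcases h2 z with h | h2
  · exact Or.inl h
  right
  filter_upwards [h1, h2] with y h1 h2
  linarith

/-- Smooth plurisubharmonic functions that agree with a quadratic `c|z|² + k`, `0 ≤ c ≤ t`, off the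
set where `χ` is locally one. -/
structure Adm (χ : Fn d) (t : ℝ) (u : Fn d) : Prop where
  smooth : Smooth u
  psh : PshOn u univ
  quad : ∃ c k, 0 ≤ c ∧ c ≤ t ∧ SuppIn χ fun z => u z - (c * sqn z + k)

lemma contDiff_quadratic (c k : ℝ) : Smooth fun y : Cn d => c * sqn y + k :=
  (contDiff_const.mul contDiff_sqn).add contDiff_const

/-- The mass of mixed densities is determined by the behaviour off `{χ = 1}`. -/
lemma integral_cutoff_MD_eq (hx : Smooth x) (hxc : HasCompactSupport x)
    (hT : ∀ l, Smooth (T l)) {c k : Fin d → ℝ}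
    (hck : ∀ l, SuppIn x fun z => T l z - (c l * sqn z + k l)) :
    ∫ z, x z * MD T z = d.factorial * (∏ l, c l) * ∫ z, x z := by
  classical
  let Q : Fin d → Fn d := fun l y => c l * sqn y + k l
  have hQ : ∀ l, Smooth (Q l) := fun l => contDiff_quadratic _ _
  have key : ∀ s : Finset (Fin d),
      ∫ z, x z * MD (fun l => if l ∈ s then Q l else T l) z = ∫ z, x z * MD T z := by
    intro s
    induction s using Finset.induction_on with
    | empty => simp
    | insert i s hi ih =>
      rw [← ih]
      set S : Fin d → Fn d := fun l => if l ∈ s then Q l else T l with hS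
      have hSs : ∀ l, Smooth (S l) := fun l => by
        by_cases h : l ∈ s
        · simpa [hS, h] using hQ l
        · simpa [hS, h] using hT l
      have e1 : (fun l => if l ∈ insert i s then Q l else T l) = update S i (Q i) := by
        ext1 l
        by_cases h : l = i
        · subst h; simp
        · simp [h, hS]
      have e2 : S = update S i (fun y => (T i y - Q i y) + Q i y) := by
        ext1 l
        by_cases h : l = i
        · subst h; simp [hS, hi]
        · simp [update_of_ne h]
      have hdiff := (hT i).sub (hQ i)
      rw [e1]
      conv_rhs => rw [e2]
      have e3 : ∀ z, x z * MD (update S i (fun y => (T i y - Q i y) + Q i y)) z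
          = x z * MD (update S i (fun y => T i y - Q i y)) z
            + x z * MD (update S i (Q i)) z := by
        intro z
        rw [MD_update_add S i hdiff (hQ i)]
        ring
      simp only [e3]
      rw [integral_add (integrable_mul_MD hx (contDiff_update_slot hSs i hdiff) hxc)
        (integrable_mul_MD hx (contDiff_update_slot hSs i (hQ i)) hxc),
        integral_mul_MD_symm hSs i hx hdiff (Or.inl hxc)]
      have e4 : ∀ z, (T i z - Q i z) * MD (update S i x) z = 0 := by
        intro z
        rcases hck i z with h | h
        · rw [MD_update_eq_zero h, mul_zero]
        · rw [h.eq_of_nhds, zero_mul]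
      simp [e4]
  have h1 := key Finset.univ
  simp at h1
  rw [← h1]
  have h2 : ∀ z, MD Q z = d.factorial * ∏ l, c l := by
    intro z
    simp only [MD, Q, lev_quadratic, mdisc_smul_one, Complex.ofReal_re]
  change ∫ z, x z * MD Q z = _
  simp only [h2]
  rw [integral_mul_const, mul_comm]

lemma integral_cutoff_MD_le (hx : Smooth x) (hxc : HasCompactSupport x)
    (hx0 : ∀ z, 0 ≤ x z) (hT : ∀ l, Adm x t (T l)) :
    ∫ z, x z * MD T z ≤ d.factorial * t ^ d * ∫ z, x z := by
  choose c k hc0 hct hck using fun l => (hT l).quad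
  rw [integral_cutoff_MD_eq hx hxc (fun l => (hT l).smooth) hck]
  have h3 : ∏ l, c l ≤ t ^ d := by
    refine (Finset.prod_le_prod (fun l _ => hc0 l) fun l _ => hct l).trans_eq ?_
    simp
  have : 0 ≤ ∫ z, x z := integral_nonneg hx0
  gcongr

/-- `w` in the first `k` slots and `u` in the others. -/
def mixT (k : ℕ) (w u : Fn d) : Fin d → Fn d := fun i => if (i : ℕ) < k then w else u

lemma mixT_zero (w u : Fn d) : mixT 0 w u = fun _ => u := by ext i; simp [mixT]

lemma mixT_full (w u : Fn d) : mixT d w u = fun _ => w := by ext i; simp [mixT]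

lemma mixT_succ (hk : k < d) (w u : Fn d) : mixT (k + 1) w u = update (mixT k w u) ⟨k, hk⟩ w := by
  ext1 i
  by_cases h : i = ⟨k, hk⟩
  · subst h; simp [mixT]
  · have h' : (i : ℕ) ≠ k := fun h' => h (Fin.ext h')
    have : (i : ℕ) < k + 1 ↔ (i : ℕ) < k := by omega
    simp [mixT, update_of_ne h, this]

lemma mixT_self (hk : k < d) (w u : Fn d) : mixT k w u = update (mixT k w u) ⟨k, hk⟩ u := by
  ext1 i
  by_cases h : i = ⟨k, hk⟩
  · subst h; simp [mixT]
  · simp [update_of_ne h]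

lemma mixT_cases {P : (Fn d) → Prop} (hw : P w) (hu : P u) (k : ℕ)
    (i : Fin d) : P (mixT k w u i) := by
  unfold mixT
  split_ifs
  exacts [hw, hu]

/-- The energy of a function, cut off by `χ`. -/
def energy (x u : Fn d) : ℝ := ∫ z, (x z * u z) * MD (fun _ => fun y => x y * u y) z

lemma energy_sub (hx : Smooth x) (hxc : HasCompactSupport x)
    (hu : Smooth u) (hv : Smooth v) (huv : SuppIn x fun z => v z - u z) :
    energy x v - energy x u = ∑ k ∈ Finset.range (d + 1), ∫ z, (v z - u z) * MD (mixT k v u) z := by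
  set U : Fn d := fun y => x y * u y with hU
  set W : Fn d := fun y => x y * v y with hW
  have hUs : Smooth U := hx.mul hu
  have hWs : Smooth W := hx.mul hv
  have hUc : HasCompactSupport U := hxc.mul_right
  have hWc : HasCompactSupport W := hxc.mul_right
  have hmix : ∀ k l, Smooth (mixT k W U l) := fun k l => mixT_cases hWs hUs k l
  let F : ℕ → ℝ := fun k => ∫ z, W z * MD (mixT k W U) z
  let G : ℕ → ℝ := fun k => ∫ z, U z * MD (mixT k W U) z
  have h1 : ∀ k < d, F k = G (k + 1) := by
    intro k hk
    simp only [F, G]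
    rw [mixT_succ hk, integral_mul_MD_symm (hmix k) ⟨k, hk⟩ hUs hWs (Or.inl hUc), ← mixT_self hk]
  have h2 : ∀ k, F k - G k = ∫ z, (v z - u z) * MD (mixT k v u) z := by
    intro k
    simp only [F, G]
    rw [← integral_sub (integrable_mul_MD hWs (hmix k) hWc) (integrable_mul_MD hUs (hmix k) hUc)]
    refine integral_congr_ae (ae_of_all _ fun z => ?_)
    simp
    rcases huv z with h | h
    · have e1 : U =ᶠ[𝓝 z] u := by filter_upwards [h] with y hy; simp [hU, hy]
      have e2 : W =ᶠ[𝓝 z] v := by filter_upwards [h] with y hy; simp [hW, hy]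
      rw [e1.eq_of_nhds, e2.eq_of_nhds, MD_congr (S := mixT k W U) (T := mixT k v u), sub_mul]
      intro l
      unfold mixT
      split_ifs
      exacts [e2, e1]
    · have := h.eq_of_nhds
      have h3 : v z = u z := by linarith
      simp [hU, hW, h3]
  have h4 : energy x v = F d := by simp only [energy, F, mixT_full, hW]
  have h5 : energy x u = G 0 := by simp only [energy, G, mixT_zero, hU]
  simp only [← h2, Finset.sum_sub_distrib]
  rw [Finset.sum_range_succ, Finset.sum_range_succ', h4, h5,
    sum_congr rfl fun k hk => h1 k (Finset.mem_range.1 hk)]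
  ring

lemma integral_mul_MD_nonneg (hf : ∀ z, 0 ≤ f z)
    (hT : ∀ l, Smooth (T l)) (hp : ∀ l, PshOn (T l) univ) : 0 ≤ ∫ z, f z * MD T z :=
  integral_nonneg fun z => mul_nonneg (hf z) (MD_nonneg hT hp z)

lemma integral_MD_le_energy_sub (hx : Smooth x)
    (hxc : HasCompactSupport x) (hu : Adm x t u) (hv : Adm x t v) (huv : SuppIn x fun z => v z - u z)
    (hle : ∀ z, u z ≤ v z) :
    ∫ z, (v z - u z) * MD (fun _ => u) z ≤ energy x v - energy x u := by
  rw [energy_sub hx hxc hu.smooth hv.smooth huv, Finset.sum_range_succ']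
  rw [← mixT_zero v u]
  refine le_add_of_nonneg_left (Finset.sum_nonneg fun k _ => ?_)
  exact integral_mul_MD_nonneg (fun z => sub_nonneg.2 (hle z))
    (fun l => mixT_cases hv.smooth hu.smooth _ l) (fun l => mixT_cases (P := fun s => PshOn s univ) hv.psh hu.psh _ l)

lemma integral_MD_le_mass (hx : Smooth x) (hxc : HasCompactSupport x) (hx0 : ∀ z, 0 ≤ x z)
    (hT : ∀ l, Adm x t (T l)) (hf : Smooth f) (hfs : SuppIn x f) (hm : 0 ≤ m)
    (hfm : ∀ z, f z ≤ m) :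
    ∫ z, f z * MD T z ≤ m * (d.factorial * t ^ d * ∫ z, x z) := by
  have hTs : ∀ l, Smooth (T l) := fun l => (hT l).smooth
  calc ∫ z, f z * MD T z ≤ ∫ z, m * (x z * MD T z) := by
        refine integral_mono (integrable_mul_MD hf hTs (hfs.hasCompactSupport hxc))
          ((integrable_mul_MD hx hTs hxc).const_mul m) fun z => ?_
        simp
        rw [← mul_assoc]
        refine mul_le_mul_of_nonneg_right ?_ (MD_nonneg hTs (fun l => (hT l).psh) z)
        rcases hfs z with h | h
        · rw [h.eq_of_nhds, mul_one]; exact hfm z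
        · rw [h.eq_of_nhds]; exact mul_nonneg hm (hx0 z)
    _ = m * ∫ z, x z * MD T z := integral_const_mul _ _
    _ ≤ _ := mul_le_mul_of_nonneg_left (integral_cutoff_MD_le hx hxc hx0 hT) hm

lemma energy_sub_le (hx : Smooth x)
    (hxc : HasCompactSupport x) (hx0 : ∀ z, 0 ≤ x z) (hu : Adm x t u) (hv : Adm x t v)
    (huv : SuppIn x fun z => v z - u z) (hm : 0 ≤ m) (hle : ∀ z, v z - u z ≤ m) :
    energy x v - energy x u ≤ (d + 1) * (m * (d.factorial * t ^ d * ∫ z, x z)) := by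
  rw [energy_sub hx hxc hu.smooth hv.smooth huv]
  refine (Finset.sum_le_card_nsmul _ _ _ fun k _ => integral_MD_le_mass hx hxc hx0
    (fun l => mixT_cases hv hu k l) (hv.smooth.sub hu.smooth) huv hm hle).trans_eq ?_
  simp

/-- One step of the chain of estimates exchanging `u` for `w = b + g` in the slots. -/
lemma integral_MD_mixT_succ_le {b h : Fn d} (hx : Smooth x)
    (hxc : HasCompactSupport x) (hx0 : ∀ z, 0 ≤ x z) (hu : Adm x t u) (hv : Adm x t v)
    (hw : Adm x t w) (huv : SuppIn x fun z => v z - u z) (hle : ∀ z, u z ≤ v z)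
    (hb : Smooth b) (hbp : PshOn b univ) (hg : Smooth g) (hgs : SuppIn x g)
    (hg0 : ∀ z, g z ≤ 0) (hg1 : ∀ z, -1 ≤ g z) (hwg : ∀ z, w z = b z + g z)
    (hh : Smooth h) (hhp : PshOn h univ) (hub : ∀ z, u z = b z + h z) (hk : k < d) :
    ∫ z, (v z - u z) * MD (mixT (k + 1) w u) z ≤ (∫ z, (v z - u z) * MD (mixT k w u) z)
      + √((∫ z, (v z - u z) * MD (mixT k w u) z) * (d.factorial * t ^ d * ∫ z, x z)) := by
  set T := mixT k w u with hT
  set i : Fin d := ⟨k, hk⟩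
  set f : Fn d := fun z => v z - u z with hf
  set M := d.factorial * t ^ d * ∫ z, x z with hM
  have hTs : ∀ l, Smooth (T l) := fun l => mixT_cases hw.smooth hu.smooth k l
  have hTp : ∀ l, PshOn (T l) univ := fun l =>
    mixT_cases (P := fun s => PshOn s univ) hw.psh hu.psh k l
  have hTa : ∀ l, Adm x t (T l) := fun l => mixT_cases hw hu k l
  have hfs := hv.smooth.sub hu.smooth
  have hfc := huv.hasCompactSupport hxc
  have hgc := hgs.hasCompactSupport hxc
  have hf0 : ∀ z, 0 ≤ f z := fun z => sub_nonneg.2 (hle z)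
  have hus : ∀ {p : Fn d}, Smooth p → ∀ l, Smooth (update T i p l) :=
    fun hp => contDiff_update_slot hTs i hp
  have hup : ∀ {p : Fn d}, PshOn p univ → ∀ l, PshOn (update T i p l) univ := by
    intro p hp l
    by_cases hl : l = i
    · subst hl; simpa using hp
    · simpa [update_of_ne hl] using hTp l
  have hua : ∀ {p : Fn d}, Adm x t p → ∀ l, Adm x t (update T i p l) := by
    intro p hp l
    by_cases hl : l = i
    · subst hl; simpa using hp
    · simpa [update_of_ne hl] using hTa l
  have intf : ∀ {p : Fn d}, Smooth p →
      Integrable fun z => f z * MD (update T i p) z := fun hp =>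
    integrable_mul_MD hfs (hus hp) hfc
  have intg : ∀ {p : Fn d}, Smooth p →
      Integrable fun z => g z * MD (update T i p) z := fun hp =>
    integrable_mul_MD hg (hus hp) hgc
  set S := ∫ z, f z * MD T z with hS
  have hSu : S = ∫ z, f z * MD (update T i u) z := by rw [hS, hT, ← mixT_self hk]
  have hS0 := integral_mul_MD_nonneg hf0 hTs hTp
  -- the new slot
  have e1 : ∫ z, f z * MD (update T i w) z + f z * MD (update T i h) z
      = ∫ z, f z * MD (update T i u) z + f z * MD (update T i g) z := by
    refine integral_congr_ae (ae_of_all _ fun z => ?_)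
    simp
    rw [← mul_add, ← mul_add, ← MD_update_add T i hw.smooth hh, ← MD_update_add T i hu.smooth hg]
    congr 3
    ext y
    rw [hwg, hub]; ring
  rw [integral_add (intf hw.smooth) (intf hh), integral_add (intf hu.smooth) (intf hg), ← hSu] at e1
  have e2 := integral_mul_MD_nonneg hf0 (hus hh) (hup hhp)
  have e3 : -∫ z, f z * MD (update T i f) z ≤ S := by
    have h1 : ∫ z, f z * MD (update T i f) z + f z * MD (update T i u) z
        = ∫ z, f z * MD (update T i v) z := by
      refine integral_congr_ae (ae_of_all _ fun z => ?_)
      simp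
      rw [← mul_add, ← MD_update_add T i hfs hu.smooth]
      congr 3
      ext y
      simp
    rw [integral_add (intf hfs) (intf hu.smooth), ← hSu] at h1
    have := integral_mul_MD_nonneg hf0 (hus hv.smooth) (hup hv.psh)
    linarith
  have e4 : -∫ z, g z * MD (update T i g) z ≤ M := by
    have h1 : ∫ z, g z * MD (update T i g) z + g z * MD (update T i b) z
        = ∫ z, g z * MD (update T i w) z := by
      refine integral_congr_ae (ae_of_all _ fun z => ?_)
      simp
      rw [← mul_add, ← MD_update_add T i hg hb]
      congr 3
      ext y
      rw [hwg]; ring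
    rw [integral_add (intg hg) (intg hb)] at h1
    have h2 := integral_mul_MD_nonneg (f := fun z => -g z) (fun z => neg_nonneg.2 (hg0 z)) (hus hb)
      (hup hbp)
    have h3 := integral_MD_le_mass (f := fun z => -g z) (m := 1) hx hxc hx0 (hua hw) hg.neg
      (fun z => (hgs z).imp_right fun h => by filter_upwards [h] with y hy; rw [hy, neg_zero])
      zero_le_one (fun z => by linarith [hg1 z])
    simp only [neg_mul, integral_neg, one_mul] at h2 h3
    linarith
  have e5 := integral_mul_MD_cauchy_schwarz hTs hTp i hfs hg hfc hgc
  have e6 : (∫ z, f z * MD (update T i g) z) ^ 2 ≤ S * M := by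
    refine e5.trans (mul_le_mul e3 e4 ?_ hS0)
    exact neg_nonneg.2 (integral_mul_MD_self_nonpos hTs hTp i hg hgc)
  have e7 := Real.le_sqrt_of_sq_le e6
  rw [mixT_succ hk]
  linarith

/-- The chain of estimates: smallness of `∫ (v-u) (dd^c u)^d` implies smallness of
`∫ (v-u) (dd^c w)^d`. -/
lemma exists_chain_bound (d : ℕ) (M : ℝ) {ε : ℝ} (ha : 0 < ε) : ∃ a0 > 0, ∀ S : ℕ → ℝ,
    (∀ k < d, S (k + 1) ≤ S k + √(S k * M)) → (∀ k, 0 ≤ S k) → S 0 ≤ a0 → S d ≤ ε := by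
  induction d generalizing ε with
  | zero => exact ⟨ε, ha, fun S _ _ h => h⟩
  | succ d ih =>
    have hc : Continuous fun x : ℝ => x + √(x * M) := by fun_prop
    have h0 : ∀ᶠ x in 𝓝 (0 : ℝ), x + √(x * M) < ε :=
      hc.continuousAt.eventually (gt_mem_nhds (by simpa using ha))
    obtain ⟨η, hf, hb⟩ := Metric.eventually_nhds_iff.1 h0
    obtain ⟨a0, ha0, h⟩ := ih (half_pos hf)
    refine ⟨a0, ha0, fun S h1 h2 h3 => ?_⟩
    have h4 := h S (fun k hk => h1 k (by omega)) h2 h3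
    refine (h1 d (by omega)).trans (hb ?_).le
    rw [Real.dist_0_eq_abs, abs_of_nonneg (h2 d)]
    linarith

end Energy

/-! ### Second derivatives of mollifications -/

section MollifyDeriv

variable {d : ℕ}
variable {k u : Fn d} {a : ℝ}

lemma fderiv_convolution_apply (hk : Smooth k) (hkc : HasCompactSupport k)
    (hu : LocallyIntegrable u) (z v : Cn d) :
    fderiv ℝ (fun z => ∫ w, k w * u (z - w)) z v = ∫ w, fderiv ℝ k w v * u (z - w) := by
  have h1 := hkc.hasFDerivAt_convolution_left (ContinuousLinearMap.mul ℝ ℝ)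
    (hk.of_le (by norm_num)) hu z
  have h2 : (fun z => ∫ w, k w * u (z - w))
      = convolution k u (ContinuousLinearMap.mul ℝ ℝ) volume := rfl
  rw [h2, h1.fderiv, convolution_def]
  have hex := ((hkc.fderiv ℝ).convolutionExists_left
    ((ContinuousLinearMap.mul ℝ ℝ).precompL (Cn d)) (hk.continuous_fderiv (by norm_num)) hu z)
  rw [ContinuousLinearMap.integral_apply hex]
  rfl

lemma contDiff_fderiv_apply (hk : Smooth k) (v : Cn d) : Smooth fun w => fderiv ℝ k w v :=
  hk.fderiv_smooth.clm_apply contDiff_const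

lemma fderiv_fderiv_apply (hk : Smooth k) (z v w : Cn d) :
    D2 k z v w = fderiv ℝ (fun y => fderiv ℝ k y w) z v := by
  rw [fderiv_clm_apply (hk.fderiv_smooth.diff z) (differentiableAt_const w)]; simp

lemma mollify_smooth (ha : 0 < a) (hu : LocallyIntegrable u) :
    Smooth (mollify a u) := mollify_contDiff ha hu

lemma fderiv_fderiv_mollify (ha : 0 < a) (hu : LocallyIntegrable u)
    (z v v' : Cn d) : D2 (mollify a u) z v v' = ∫ w, D2 (moll a) w v v' * u (z - w) := by
  have hk : Smooth (moll (d := d) a) := moll_contDiff a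
  rw [fderiv_fderiv_apply (mollify_smooth ha hu)]
  have h1 : (fun y => fderiv ℝ (mollify a u) y v')
      = fun z => ∫ w, fderiv ℝ (moll a) w v' * u (z - w) := by
    ext y
    exact fderiv_convolution_apply hk (moll_hasCompactSupport ha) hu y v'
  rw [h1, fderiv_convolution_apply (contDiff_fderiv_apply hk v')
    ((moll_hasCompactSupport ha).fderiv_apply ℝ v') hu]
  simp only [fderiv_fderiv_apply hk]

lemma moll_eq_scale (ha : 0 < a) (w : Cn d) :
    moll a w = (a ^ Module.finrank ℝ (Cn d))⁻¹ * moll 1 (a⁻¹ • w) := by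
  have h1 : ∀ w : Cn d, preMoll a w = preMoll 1 (a⁻¹ • w) := by
    intro w
    have : sqn (a⁻¹ • w) = sqn w / a ^ 2 := by
      simp only [sqn, Pi.smul_apply, norm_smul, mul_pow, ← mul_sum]
      rw [norm_eq_abs, abs_of_pos (inv_pos.2 ha), inv_pow, inv_mul_eq_div]
    simp [preMoll, this]
  simp only [moll, h1]
  rw [Measure.integral_comp_inv_smul_of_nonneg _ _ ha.le, smul_eq_mul, mul_inv]
  ring

lemma fderiv_fderiv_scale (hk : Smooth k) (c a : ℝ) (w : Cn d) :
    D2 (fun w => c * k (a • w)) w = (c * a * a) • D2 k (a • w) := by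
  have hd : Differentiable ℝ fun w : Cn d => k (a • w) :=
    hk.diff.comp (differentiable_id.const_smul a)
  have hd' : Differentiable ℝ fun w : Cn d => fderiv ℝ k (a • w) :=
    hk.fderiv_smooth.diff.comp (differentiable_id.const_smul a)
  have e2 : (fderiv ℝ fun w => c * k (a • w)) = fun w => (c * a) • fderiv ℝ k (a • w) := by
    ext1 w
    rw [fderiv_const_mul (hd w), fderiv_comp_smul, smul_smul]
  rw [e2, fderiv_fun_const_smul (hd' w), fderiv_comp_smul, smul_smul]

lemma exists_bound_fderiv_fderiv {E : Type*} [NormedAddCommGroup E] [NormedSpace ℝ E] {k : E → ℝ}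
    (hk : Smooth k) (hkc : HasCompactSupport k) :
    ∃ K : ℝ, ∀ w v v' : E, |D2 k w v v'| ≤ K * ‖v‖ * ‖v'‖ := by
  have hc := (hk.fderiv_smooth.continuous_fderiv (by norm_num)).norm
  obtain ⟨K, hK⟩ := hkc.isCompact.exists_bound_of_continuousOn hc.continuousOn
  refine ⟨|K|, fun w v v' => ?_⟩
  by_cases hw : w ∈ tsupport k
  · refine ((D2 k w).le_opNorm₂ v v').trans ?_
    gcongr
    exact (le_abs_self _).trans ((hK w hw).trans (le_abs_self K))
  · have h1 := notMem_tsupport_iff_eventuallyEq.1 hw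
    rw [((h1.fderiv (𝕜 := ℝ)).fderiv (𝕜 := ℝ)).eq_of_nhds]
    simp
    positivity

lemma exists_fderiv_fderiv_moll_bound : ∃ K : ℝ, ∀ a > 0, ∀ w v v' : Cn d,
    |D2 (moll (d := d) a) w v v'|
      ≤ K * (a ^ Module.finrank ℝ (Cn d))⁻¹ * (a⁻¹) ^ 2 * ‖v‖ * ‖v'‖ := by
  have hk : Smooth (moll (d := d) 1) := moll_contDiff 1
  obtain ⟨K, hK⟩ := exists_bound_fderiv_fderiv hk (moll_hasCompactSupport one_pos)
  refine ⟨K, fun a ha w v v' => ?_⟩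
  rw [funext (moll_eq_scale ha), fderiv_fderiv_scale hk]
  simp only [smul_apply, smul_eq_mul]
  rw [abs_mul, abs_of_pos (by positivity)]
  have h4 := hK (a⁻¹ • w) v v'
  calc _ ≤ (a ^ Module.finrank ℝ (Cn d))⁻¹ * a⁻¹ * a⁻¹ * (K * ‖v‖ * ‖v'‖) := by gcongr
    _ = _ := by ring

/-- Second derivatives of `u^δ` at `z` are bounded by `δ⁻² sup |u|`. -/
lemma exists_fderiv_fderiv_mollify_bound : ∃ K : ℝ, 0 ≤ K ∧ ∀ a > 0, ∀ (u : Fn d),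
    LocallyIntegrable u → ∀ (m : ℝ) (z : Cn d), 0 ≤ m → (∀ w ∈ closedBall 0 a, |u (z - w)| ≤ m) →
    ∀ v v' : Cn d, |D2 (mollify a u) z v v'| ≤ K * m * (a⁻¹) ^ 2 * ‖v‖ * ‖v'‖ := by
  obtain ⟨K, hK⟩ := exists_fderiv_fderiv_moll_bound (d := d)
  refine ⟨|K| * volume.real (ball (0 : Cn d) 1), by positivity, fun a ha u hu m z hm hb v v' => ?_⟩
  rw [fderiv_fderiv_mollify ha hu]
  have hsupp : ∀ w, w ∉ closedBall (0 : Cn d) a → D2 (moll a) w v v' * u (z - w) = 0 := by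
    intro w hw
    have h1 : moll a =ᶠ[𝓝 w] fun _ => 0 :=
      mem_of_superset (isClosed_closedBall.isOpen_compl.mem_nhds hw) fun y hy => moll_eq_zero ha hy
    rw [((h1.fderiv (𝕜 := ℝ)).fderiv (𝕜 := ℝ)).eq_of_nhds]
    simp
  rw [← setIntegral_eq_integral_of_forall_compl_eq_zero hsupp]
  have h3 := norm_setIntegral_le_of_norm_le_const (μ := volume) (s := closedBall (0 : Cn d) a)
    (f := fun w => D2 (moll a) w v v' * u (z - w))
    (C := (|K| * (a ^ Module.finrank ℝ (Cn d))⁻¹ * (a⁻¹) ^ 2 * ‖v‖ * ‖v'‖) * m)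
    (isCompact_closedBall _ _).measure_lt_top (fun w hw => by
      rw [norm_mul]
      refine mul_le_mul ((hK a ha w v v').trans ?_) (hb w hw) (norm_nonneg _) (by positivity)
      gcongr
      exact le_abs_self K)
  refine h3.trans_eq ?_
  rw [measureReal_def, Measure.addHaar_closedBall _ _ ha.le, ENNReal.toReal_mul,
    ENNReal.toReal_ofReal (by positivity), ← measureReal_def]
  field_simp

lemma integral_moll_mul_linear (l : Cn d →L[ℝ] ℝ) : ∫ w, moll a w * l w = 0 := by
  have h := integral_unimodular_smul (c := -1) (by simp) fun w : Cn d => moll a w * l w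
  have h2 : ∀ w : Cn d, moll a ((-1 : ℂ) • w) * l ((-1 : ℂ) • w) = -(moll a w * l w) := by
    intro w
    rw [moll_smul a (by simp)]
    simp
  simp only [h2, integral_neg] at h
  linarith

lemma integrable_moll_cont (ha : 0 < a) {g : Fn d} (hg : Continuous g) :
    Integrable fun w => moll a w * g w :=
  ((moll_continuous a).mul hg).integrable_of_hasCompactSupport (moll_hasCompactSupport ha).mul_right

/-- Mollification changes a quadratic polynomial by a constant. -/
lemma mollify_quadratic (ha : 0 < a) (c : ℝ) (l : Cn d →L[ℝ] ℝ)
    (B : Bil d) (hB : ∀ v w, B v w = B w v) :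
    ∃ k : ℝ, ∀ z, mollify a (fun y => c + l y + B y y / 2) z = c + l z + B z z / 2 + k := by
  refine ⟨∫ w, moll a w * (B w w / 2), fun z => ?_⟩
  have e : ∀ w, moll a w * (c + l (z - w) + B (z - w) (z - w) / 2)
      = moll a w * (c + l z + B z z / 2) - moll a w * (l + B z) w + moll a w * (B w w / 2) := by
    intro w
    simp only [map_sub, sub_apply, add_apply, hB w z]
    ring
  simp only [mollify, e]
  have i1 := (moll_integrable (d := d) ha).mul_const (c + l z + B z z / 2)
  have i2 := integrable_moll_cont ha (l + B z).continuous
  have i3 : Integrable fun w => moll a w * (c + l z + B z z / 2) - moll a w * (l + B z) w :=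
    i1.sub i2
  rw [integral_add i3 (integrable_moll_cont ha (g := fun w => B w w / 2) (by fun_prop)),
    integral_sub i1 i2, integral_moll_mul_linear, integral_mul_const, moll_integral ha]
  ring

lemma fderiv_fderiv_quadratic (c : ℝ) (l : Cn d →L[ℝ] ℝ)
    (B : Bil d) (hB : ∀ v w, B v w = B w v) (z : Cn d) :
    D2 (fun y => c + l y + B y y / 2) z = B := by
  have h1 : ∀ y, HasFDerivAt (fun y => c + l y + B y y / 2) (l + B y) y := by
    intro y
    have e2 : HasFDerivAt (fun k => B k k / 2) (B y) y := by
      have := (B.hasFDerivAt (x := y)).clm_apply (hasFDerivAt_id y)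
      have := this.mul_const (1 / 2 : ℝ)
      refine (this.congr_fderiv ?_).congr_of_eventuallyEq (.of_forall fun y => ?_)
      · ext v
        simp [hB v y]
        ring
      · simp; ring
    exact ((l.hasFDerivAt).const_add c).add e2
  have h2 : fderiv ℝ (fun y => c + l y + B y y / 2) = fun y => l + B y := by
    ext1 y; exact (h1 y).fderiv
  rw [h2]
  exact ((B.hasFDerivAt (x := z)).const_add l).fderiv

/-- At a point with a second order expansion, the second derivatives of the mollifications
converge. -/
lemma tendsto_fderiv_fderiv_mollify (hu : Continuous u) {p : Cn d}
    {l : Cn d →L[ℝ] ℝ} {B : Bil d} (hB : ∀ v w, B v w = B w v)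
    (hT : ∀ ε > 0, ∀ᶠ h in 𝓝 (0 : Cn d), |u (p + h) - u p - l h - B h h / 2| ≤ ε * ‖h‖ ^ 2)
    (v v' : Cn d) : Tendsto (fun a => D2 (mollify a u) p v v') (𝓝[>] 0) (𝓝 (B v v')) := by
  obtain ⟨K, hK0, hK⟩ := exists_fderiv_fderiv_mollify_bound (d := d)
  let Q : Fn d := fun y => (u p - l p + B p p / 2) + (l - B p) y + B y y / 2
  have hQ : ∀ h, Q (p + h) = u p + l h + B h h / 2 := by
    intro h
    simp only [Q, map_add, add_apply, sub_apply, hB h p]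
    ring
  have hQs : Smooth Q := by fun_prop
  have hdc : Continuous fun y => u y - Q y := hu.sub hQs.continuous
  have hsplit : ∀ a > 0, D2 (mollify a u) p v v'
      = D2 (mollify a fun y => u y - Q y) p v v' + B v v' := by
    intro a ha
    obtain ⟨k, hk⟩ := mollify_quadratic ha (u p - l p + B p p / 2) (l - B p) B hB
    have e1 : mollify a u = fun z => mollify a (fun y => u y - Q y) z + (Q z + k) := by
      ext z
      rw [← hk z]
      change mollify a u z = mollify a (fun y => u y - Q y) z + mollify a Q z
      simp only [mollify]
      rw [← integral_add
        (integrable_moll_cont ha (g := fun w => u (z - w) - Q (z - w)) (hdc.comp (by fun_prop)))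
        (integrable_moll_cont ha (g := fun w => Q (z - w)) (hQs.continuous.comp (by fun_prop)))]
      congr 1
      ext w
      ring
    have hs1 := mollify_smooth ha hdc.locallyIntegrable
    have e2 : fderiv ℝ (mollify a u)
        = fun z => fderiv ℝ (mollify a fun y => u y - Q y) z + fderiv ℝ Q z := by
      ext1 z
      rw [e1, fderiv_fun_add (hs1.diff z) ((hQs.diff z).add_const k), fderiv_add_const]
    rw [e2, fderiv_fun_add (hs1.fderiv_smooth.diff p) (hQs.fderiv_smooth.diff p)]
    simp
    congr 1
    rw [fderiv_fderiv_quadratic _ _ _ hB]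
  rw [Metric.tendsto_nhds]
  intro ε hb
  set b' := ε / (K * ‖v‖ * ‖v'‖ + 1) with hb'
  have hb'0 : 0 < b' := by positivity
  obtain ⟨R, hR, hball⟩ := Metric.eventually_nhds_iff.1 (hT b' hb'0)
  filter_upwards [Ioo_mem_nhdsGT hR] with a ha
  rw [hsplit a ha.1, Real.dist_eq, add_sub_cancel_right]
  have h1 := hK a ha.1 (fun y => u y - Q y) hdc.locallyIntegrable (b' * a ^ 2) p
    (by positivity) (fun w hw => by
      have hw' : ‖w‖ ≤ a := by simpa using hw
      have h2 := hball (y := -w) (by simpa using hw'.trans_lt ha.2)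
      have h3 := hQ (-w)
      rw [sub_eq_add_neg p w]
      refine (le_of_eq ?_).trans (h2.trans ?_)
      · rw [h3]; congr 1; ring
      · rw [norm_neg]; gcongr) v v'
  refine h1.trans_lt ?_
  have : K * (b' * a ^ 2) * a⁻¹ ^ 2 * ‖v‖ * ‖v'‖ = b' * (K * ‖v‖ * ‖v'‖) := by
    have := ha.1.ne'
    field_simp
  rw [this, hb', div_mul_eq_mul_div, div_lt_iff₀ (by positivity)]
  nlinarith

end MollifyDeriv

/-! ### Functions with bounded second differences -/

section Regularity

lemma abs_bilin_le_of_diag {E : Type*} [NormedAddCommGroup E] [NormedSpace ℝ E]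
    {B : E →L[ℝ] E →L[ℝ] ℝ} (hB : ∀ v w, B v w = B w v) {M : ℝ} (h : ∀ v, |B v v| ≤ M * ‖v‖ ^ 2)
    (v w : E) : |B v w| ≤ 2 * M * ‖v‖ * ‖w‖ := by
  have hunit : ∀ v w : E, ‖v‖ = 1 → ‖w‖ = 1 → |B v w| ≤ 2 * M := by
    intro v w hv hw
    have h1 := abs_le.1 (h (v + w))
    have h2 := abs_le.1 (h (v - w))
    have h3 := norm_add_le v w
    have h4 := norm_sub_le v w
    rw [hv, hw] at h3 h4
    have hM : 0 ≤ M := by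
      have := (abs_nonneg _).trans (h v)
      rwa [hv, one_pow, mul_one] at this
    have h5 : M * ‖v + w‖ ^ 2 ≤ M * 2 ^ 2 := by gcongr; linarith
    have h6 : M * ‖v - w‖ ^ 2 ≤ M * 2 ^ 2 := by gcongr; linarith
    simp only [map_add, map_sub, add_apply, sub_apply, hB w v] at h1 h2
    rw [abs_le]
    constructor <;> linarith [h1.1, h1.2, h2.1, h2.2]
  by_cases hv : v = 0
  · simp [hv]
  by_cases hw : w = 0
  · simp [hw]
  have hv' := norm_pos_iff.2 hv
  have hw' := norm_pos_iff.2 hw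
  have h1 := hunit (‖v‖⁻¹ • v) (‖w‖⁻¹ • w) (by simp [norm_smul, hv'.ne']) (by simp [norm_smul, hw'.ne'])
  simp at h1
  have h2 : |B v w| = ‖v‖ * ‖w‖ * (‖w‖⁻¹ * (‖v‖⁻¹ * |B v w|)) := by field_simp
  rw [h2]
  calc _ ≤ ‖v‖ * ‖w‖ * (2 * M) := by gcongr
    _ = _ := by ring

/-- Limits of functions with uniformly bounded second derivatives are of class `C^{1,1}`. -/
lemma exists_lipschitz_deriv_of_tendsto {E : Type*} [NormedAddCommGroup E] [NormedSpace ℝ E]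
    [FiniteDimensional ℝ E] {f : ℝ → E → ℝ} {φ : E → ℝ} {L : ℝ} (hL : 0 ≤ L)
    (hf : ∀ a > 0, Smooth (f a))
    (hb : ∀ a > 0, ∀ z v w, |D2 (f a) z v w| ≤ L * ‖v‖ * ‖w‖)
    (hlim : ∀ z, Tendsto (fun a => f a z) (𝓝[>] 0) (𝓝 (φ z))) :
    ∃ b' : E → E →L[ℝ] ℝ, (∀ z, HasFDerivAt φ (b' z) z) ∧ LipschitzWith ⟨L, hL⟩ b' := by
  have hd : ∀ a > 0, Differentiable ℝ (fderiv ℝ (f a)) := fun a ha =>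
    ((hf a ha).fderiv_smooth).diff
  have hlip : ∀ a > 0, ∀ z w, ‖fderiv ℝ (f a) z - fderiv ℝ (f a) w‖ ≤ L * ‖z - w‖ := by
    intro a ha z w
    refine convex_univ.norm_image_sub_le_of_norm_fderiv_le (𝕜 := ℝ) (fun x _ => hd a ha x)
      (fun x _ => ?_) (mem_univ w) (mem_univ z)
    refine ContinuousLinearMap.opNorm_le_bound _ hL fun v => ?_
    exact ContinuousLinearMap.opNorm_le_bound _ (by positivity) fun w => hb a ha x v w
  have htay : ∀ a > 0, ∀ z h, |f a (z + h) - f a z - fderiv ℝ (f a) z h| ≤ L * ‖h‖ ^ 2 := by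
    intro a ha z h
    have := (convex_closedBall z ‖h‖).norm_image_sub_le_of_norm_fderiv_le' (𝕜 := ℝ) (f := f a)
      (φ := fderiv ℝ (f a) z) (C := L * ‖h‖) (x := z) (y := z + h)
      (fun x _ => (hf a ha).diff x)
      (fun x hx => (hlip a ha x z).trans (by
        rw [mem_closedBall, dist_eq_norm] at hx; gcongr)) (by simp) (by simp)
    simp at this
    exact this.trans_eq (by ring)
  let 𝒰 : Ultrafilter ℝ := Ultrafilter.of (𝓝[>] 0)
  have hU : (𝒰 : Filter ℝ) ≤ 𝓝[>] 0 := Ultrafilter.of_le _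
  have hpos : ∀ᶠ a in (𝒰 : Filter ℝ), 0 < a := hU self_mem_nhdsWithin
  have hlim' : ∀ z, Tendsto (fun a => f a z) 𝒰 (𝓝 (φ z)) := fun z => (hlim z).mono_left hU
  have hex : ∀ z, ∃ g : E →L[ℝ] ℝ, ∀ v, Tendsto (fun a => fderiv ℝ (f a) z v) 𝒰 (𝓝 (g v)) := by
    intro z
    have h1 : ∀ v, ∃ c, Tendsto (fun a => fderiv ℝ (f a) z v) 𝒰 (𝓝 c) := by
      intro v
      have h2 : ∀ᶠ a in (𝒰 : Filter ℝ), fderiv ℝ (f a) z v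
          ∈ closedBall (0 : ℝ) (|φ (z + v) - φ z| + 1 + L * ‖v‖ ^ 2) := by
        have h3 := ((hlim' (z + v)).sub (hlim' z)).abs.eventually_lt_const (lt_add_one _)
        filter_upwards [h3, hpos] with a h3 ha
        have h4 := abs_le.1 (htay a ha z v)
        have h5 := abs_lt.1 h3
        rw [mem_closedBall_zero_iff, norm_eq_abs, abs_le]
        constructor <;> linarith [h4.1, h4.2, h5.1, h5.2]
      obtain ⟨c, -, hc⟩ := (isCompact_closedBall (0 : ℝ) _).ultrafilter_le_nhds
        (𝒰.map fun a => fderiv ℝ (f a) z v) (le_principal_iff.2 h2)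
      exact ⟨c, hc⟩
    choose g hg using h1
    let gl : E →ₗ[ℝ] ℝ :=
      { toFun := g
        map_add' := fun v w => tendsto_nhds_unique (hg (v + w)) (by
          simpa using (hg v).add (hg w))
        map_smul' := fun c v => tendsto_nhds_unique (hg (c • v)) (by
          simpa using (hg v).const_smul c) }
    exact ⟨LinearMap.toContinuousLinearMap gl, hg⟩
  choose b' hb' using hex
  refine ⟨b', fun z => ?_, ?_⟩
  · have h1 : ∀ h, |φ (z + h) - φ z - b' z h| ≤ L * ‖h‖ ^ 2 := fun h =>
      le_of_tendsto ((((hlim' (z + h)).sub (hlim' z)).sub (hb' z h)).abs)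
        (hpos.mono fun a ha => htay a ha z h)
    rw [hasFDerivAt_iff_isLittleO_nhds_zero]
    have h2 : (fun h => φ (z + h) - φ z - b' z h) =O[𝓝 0] fun h : E => ‖h‖ ^ 2 :=
      Asymptotics.IsBigO.of_bound L (.of_forall fun h => by
        rw [norm_eq_abs, norm_pow, norm_norm]; exact h1 h)
    exact h2.trans_isLittleO (by simpa using Asymptotics.isLittleO_norm_pow_id (E' := E) one_lt_two)
  · refine LipschitzWith.of_dist_le_mul fun z w => ?_
    rw [dist_eq_norm, dist_eq_norm]
    refine ContinuousLinearMap.opNorm_le_bound _ (by positivity) fun v => ?_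
    refine le_of_tendsto (((hb' z v).sub (hb' w v)).norm) (hpos.mono fun a ha => ?_)
    have := ((fderiv ℝ (f a) z - fderiv ℝ (f a) w).le_opNorm v).trans
      (mul_le_mul_of_nonneg_right (hlip a ha z w) (norm_nonneg v))
    rw [sub_apply] at this
    exact this

variable {d : ℕ}
variable {B : Bil d} {c : ℝ} {u : Fn d} {p : Cn d}

lemma sqn_real_smul (t : ℝ) (v : Cn d) : sqn (t • v) = t ^ 2 * sqn v := by
  simp only [sqn, Pi.smul_apply, norm_smul, mul_pow, ← mul_sum, norm_eq_abs, sq_abs]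

/-- Second order expansion of `u` at `p` with quadratic part `B / 2`. -/
def HasTaylorTwo (u : Fn d) (B : Bil d) (p : Cn d) : Prop :=
  (∀ v w, B v w = B w v) ∧ ∃ l : Cn d →L[ℝ] ℝ,
    ∀ ε > 0, ∀ᶠ h in 𝓝 (0 : Cn d), |u (p + h) - u p - l h - B h h / 2| ≤ ε * ‖h‖ ^ 2

lemma HasTaylorTwo.le_of_second_difference
    (hT : HasTaylorTwo u B p) (hc : ∀ h, u (p + h) + u (p - h) ≤ 2 * u p + 2 * c * sqn h)
    (v : Cn d) : B v v ≤ 2 * c * sqn v := by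
  obtain ⟨-, l, hT⟩ := hT
  refine le_of_forall_pos_le_add fun η hb => ?_
  set ε := η / (2 * (‖v‖ ^ 2 + 1)) with ha
  have ha0 : 0 < ε := by positivity
  have h1 : Tendsto (fun t : ℝ => t • v) (𝓝[>] 0) (𝓝 0) := by
    have : Tendsto (fun t : ℝ => t • v) (𝓝 0) (𝓝 ((0 : ℝ) • v)) :=
      (continuous_id.smul continuous_const).tendsto 0
    rw [zero_smul] at this
    exact this.mono_left nhdsWithin_le_nhds
  have h2 : Tendsto (fun t : ℝ => -(t • v)) (𝓝[>] 0) (𝓝 0) := by simpa using h1.neg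
  obtain ⟨t, ht1, ht2, ht⟩ := ((h1.eventually (hT ε ha0)).and ((h2.eventually (hT ε ha0)).and
    self_mem_nhdsWithin)).exists
  have ht := ht
  have h3 := hc (t • v)
  rw [sqn_real_smul] at h3
  simp only [map_smul, map_neg, smul_apply, neg_apply, smul_eq_mul, norm_neg, norm_smul,
    norm_eq_abs, mul_pow, sq_abs, ← sub_eq_add_neg] at ht1 ht2
  have h4 := (abs_le.1 ht1).1
  have h5 := (abs_le.1 ht2).1
  have h6 : t ^ 2 * B v v ≤ t ^ 2 * (2 * c * sqn v + 2 * ε * ‖v‖ ^ 2) := by nlinarith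
  have h7 := le_of_mul_le_mul_left h6 (by positivity)
  have h8 : 2 * ε * ‖v‖ ^ 2 ≤ η := by
    have : 2 * ε * (‖v‖ ^ 2 + 1) = η := by rw [ha]; field_simp
    nlinarith
  linarith

lemma hasTaylorTwo_of_contDiff (hu : Smooth u) (z : Cn d) : HasTaylorTwo u (D2 u z) z := by
  have hd := hu.fderiv_smooth.diff
  have h1 : ∀ᶠ y in 𝓝 z, HasFDerivAt u (fderiv ℝ u y) y :=
    .of_forall fun y => (hu.diff y).hasFDerivAt
  have h2 := (hd z).hasFDerivAt
  exact ⟨second_derivative_symmetric_of_eventually h1 h2, fderiv ℝ u z,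
    fun ε ha => taylor_two h1 h2 ha⟩

lemma HasTaylorTwo.levi_nonneg
    (hT : HasTaylorTwo u B p) (hu : Continuous u) (hp : PshOn u univ) (v : Cn d) :
    0 ≤ B v v + B (I • v) (I • v) := by
  obtain ⟨-, l, hT⟩ := hT
  exact levi_nonneg_of_submean hu hT (hp.submean p (mem_univ _) v)

lemma HasTaylorTwo.abs_le
    (hT : HasTaylorTwo u B p) (hu : Continuous u) (hp : PshOn u univ) (hc0 : 0 ≤ c)
    (hc : ∀ h, u (p + h) + u (p - h) ≤ 2 * u p + 2 * c * sqn h)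
    (v w : Cn d) : |B v w| ≤ 4 * c * d * ‖v‖ * ‖w‖ := by
  have h1 : ∀ v, |B v v| ≤ 2 * c * d * ‖v‖ ^ 2 := by
    intro v
    have h2 := hT.le_of_second_difference hc v
    have h3 := hT.le_of_second_difference hc (I • v)
    have h4 := hT.levi_nonneg hu hp v
    rw [sqn_smul] at h3
    simp at h3
    have h5 := mul_le_mul_of_nonneg_left (sqn_le_norm_sq v) (by positivity)
    rw [_root_.abs_le]
    constructor <;> linarith
  exact (abs_bilin_le_of_diag hT.1 h1 v w).trans_eq (by ring)

lemma mollify_second_difference (hu : Continuous u)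
    (hc : ∀ z h, u (z + h) + u (z - h) ≤ 2 * u z + 2 * c * sqn h) {a : ℝ} (ha : 0 < a)
    (z h : Cn d) : mollify a u (z + h) + mollify a u (z - h)
      ≤ 2 * mollify a u z + 2 * c * sqn h := by
  have hi : ∀ g : Fn d, Continuous g → Integrable fun w => moll a w * g w := fun g hg =>
    ((moll_continuous a).mul hg).integrable_of_hasCompactSupport
      (moll_hasCompactSupport ha).mul_right
  have i1 := hi (fun w => u (z + h - w)) (by fun_prop)
  have i2 := hi (fun w => u (z - h - w)) (by fun_prop)
  have i3 := hi (fun w => u (z - w)) (by fun_prop)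
  have i4 : Integrable fun w : Cn d => 2 * (moll a w * u (z - w)) + moll a w * (2 * c * sqn h) :=
    (i3.const_mul 2).add ((moll_integrable ha).mul_const _)
  simp only [mollify]
  rw [← integral_add i1 i2]
  refine (integral_mono (i1.add i2) i4 fun w => ?_).trans_eq ?_
  · have h1 := hc (z - w) h
    rw [show z - w + h = z + h - w by abel, show z - w - h = z - h - w by abel] at h1
    have := mul_le_mul_of_nonneg_left h1 (moll_nonneg ha w)
    simp
    linarith
  · rw [integral_add (i3.const_mul 2) ((moll_integrable ha).mul_const _),
      integral_const_mul, integral_mul_const, moll_integral ha, one_mul]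

/-- Plurisubharmonic functions with second differences bounded above are twice differentiable
almost everywhere. -/
lemma PshOn.ae_hasTaylorTwo (hu : Continuous u) (hp : PshOn u univ)
    (hc0 : 0 ≤ c) (hc : ∀ z h, u (z + h) + u (z - h) ≤ 2 * u z + 2 * c * sqn h) :
    ∃ B : Cn d → Bil d, ∀ᵐ z, HasTaylorTwo u (B z) z := by
  obtain ⟨b', h1, h2⟩ := exists_lipschitz_deriv_of_tendsto (E := Cn d) (f := fun a => mollify a u)
    (φ := u) (L := 4 * c * d) (by positivity) (fun a ha => mollify_smooth ha hu.locallyIntegrable)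
    (fun a ha z v w => (hasTaylorTwo_of_contDiff (mollify_smooth ha hu.locallyIntegrable) z).abs_le
      (mollify_smooth ha hu.locallyIntegrable).continuous (hp.pshOn_mollify ha) hc0
      (fun h => mollify_second_difference hu hc ha z h) v w) (fun z => hp.tendsto_mollify z)
  refine ⟨fderiv ℝ b', ?_⟩
  filter_upwards [h2.ae_differentiableAt (μ := volume)] with z hz
  have h3 : ∀ᶠ y in 𝓝 z, HasFDerivAt u (b' y) y := .of_forall h1
  exact ⟨second_derivative_symmetric_of_eventually h3 hz.hasFDerivAt, b' z,
    fun ε hg => taylor_two h3 hz.hasFDerivAt hg⟩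

/-- The Monge–Ampère density of a quadratic form. -/
def maB (B : Bil d) : ℝ := (mdisc fun _ => levB B).re

lemma HasTaylorTwo.tendsto_MD (hu : Continuous u) (hT : HasTaylorTwo u B p) :
    Tendsto (fun a => MD (fun _ => mollify a u) p) (𝓝[>] 0) (𝓝 (maB B)) := by
  obtain ⟨hB, l, hT⟩ := hT
  have h1 := tendsto_fderiv_fderiv_mollify hu hB hT
  have h2 : ∀ j k, Tendsto (fun a => lev (mollify a u) p j k) (𝓝[>] 0) (𝓝 (levB B j k)) := by
    intro j k
    have h3 : Tendsto (fun a => levB (D2 (mollify a u) p) j k) (𝓝[>] 0) (𝓝 (levB B j k)) := by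
      simp only [levB, Matrix.of_apply]
      exact (((Complex.continuous_ofReal.tendsto _).comp ((h1 _ _).add (h1 _ _))).add
        (((Complex.continuous_ofReal.tendsto _).comp ((h1 _ _).sub (h1 _ _))).const_mul _)).div_const _
    refine h3.congr' ?_
    filter_upwards [self_mem_nhdsWithin] with a ha
    rw [lev_eq_levB (mollify_smooth ha hu.locallyIntegrable)]
  unfold MD maB mdisc
  refine (Complex.continuous_re.tendsto _).comp (tendsto_finsetSum _ fun s _ =>
    tendsto_finsetSum _ fun τ _ => (tendsto_finsetProd _ fun i _ => h2 _ _).const_mul _)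

lemma norm_levB_le {L : ℝ} (h : ∀ v w, |B v w| ≤ L * ‖v‖ * ‖w‖)
    (j k : Fin d) : ‖levB B j k‖ ≤ L := by
  have h1 : ∀ a b : ℂ, ‖a‖ = 1 → ‖b‖ = 1 → |B (single j a) (single k b)| ≤ L := by
    intro a b ha hb
    have := h (single j a) (single k b)
    rwa [Pi.norm_single, Pi.norm_single, ha, hb, mul_one, mul_one] at this
  have a1 := abs_le.1 (h1 1 1 (by simp) (by simp))
  have a2 := abs_le.1 (h1 I I (by simp) (by simp))
  have a3 := abs_le.1 (h1 1 I (by simp) (by simp))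
  have a4 := abs_le.1 (h1 I 1 (by simp) (by simp))
  simp only [levB, Matrix.of_apply, norm_div]
  rw [div_le_iff₀ (by simp)]
  refine (norm_add_le _ _).trans ?_
  rw [norm_mul, Complex.norm_I, one_mul, Complex.norm_real, Complex.norm_real, norm_eq_abs,
    norm_eq_abs]
  have b1 : |B (single j 1) (single k 1) + B (single j I) (single k I)|
      ≤ 2 * L := abs_le.2 ⟨by linarith [a1.1, a2.1], by linarith [a1.2, a2.2]⟩
  have b2 : |B (single j 1) (single k I) - B (single j I) (single k 1)|
      ≤ 2 * L := abs_le.2 ⟨by linarith [a3.1, a4.2], by linarith [a3.2, a4.1]⟩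
  have : ‖(4 : ℂ)‖ = 4 := by simp
  rw [this]
  linarith

lemma exists_MD_mollify_bound (hu : Continuous u) (hp : PshOn u univ)
    (hc0 : 0 ≤ c) (hc : ∀ z h, u (z + h) + u (z - h) ≤ 2 * u z + 2 * c * sqn h) :
    ∃ M : ℝ, ∀ a > 0, ∀ z, |MD (fun _ => mollify a u) z| ≤ M := by
  refine ⟨∑ _s : Equiv.Perm (Fin d), ∑ _t : Equiv.Perm (Fin d), ∏ _i : Fin d, 4 * c * d,
    fun a ha z => (Complex.abs_re_le_norm _).trans ?_⟩
  have hs := mollify_smooth ha hu.locallyIntegrable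
  refine (norm_sum_le _ _).trans (Finset.sum_le_sum fun s _ => (norm_sum_le _ _).trans
    (Finset.sum_le_sum fun τ _ => ?_))
  have hsgn : ∀ s : Equiv.Perm (Fin d), ‖((Equiv.Perm.sign s : ℤ) : ℂ)‖ = 1 := by
    intro s
    rcases Int.units_eq_one_or (Equiv.Perm.sign s) with h | h <;> simp [h]
  rw [norm_mul, norm_mul, hsgn, hsgn, one_mul, one_mul, norm_prod]
  refine Finset.prod_le_prod (fun _ _ => norm_nonneg _) fun i _ => ?_
  change ‖lev (mollify a u) z (s i) (τ i)‖ ≤ _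
  rw [lev_eq_levB hs]
  exact norm_levB_le (fun v w => (hasTaylorTwo_of_contDiff hs z).abs_le
    hs.continuous (hp.pshOn_mollify ha) hc0
      (fun h => mollify_second_difference hu hc ha z h) v w) _ _

end Regularity

/-! ### Envelopes below families of paraboloids -/

section Envelope

variable {d : ℕ}

lemma sqn_combination (x y : Cn d) (t : ℝ) :
    t * sqn x + (1 - t) * sqn y = sqn (t • x + (1 - t) • y) + t * (1 - t) * sqn (x - y) := by
  simp only [sqn, mul_sum, ← sum_add_distrib]
  refine sum_congr rfl fun i _ => ?_
  simp only [Pi.add_apply, Pi.smul_apply, Pi.sub_apply, Complex.sq_norm, Complex.normSq_apply,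
    Complex.add_re, Complex.add_im, Complex.smul_re, Complex.smul_im, Complex.sub_re, Complex.sub_im,
    smul_eq_mul]
  ring

lemma sqn_parallelogram (z h : Cn d) : sqn (z + h) + sqn (z - h) = 2 * sqn z + 2 * sqn h := by
  simp only [sqn, mul_sum, ← sum_add_distrib]
  refine sum_congr rfl fun i _ => ?_
  simp only [Pi.add_apply, Pi.sub_apply, Complex.sq_norm, Complex.normSq_apply,
    Complex.add_re, Complex.add_im, Complex.sub_re, Complex.sub_im]
  ring

lemma PshOn.translate {u : Fn d} (hu : PshOn u univ) (h : Cn d) : PshOn (fun z => u (z + h)) univ :=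
  hu.comp_holomorphic isOpen_univ isOpen_univ (f := fun z => z + h) (by fun_prop) (mapsTo_univ _ _)

/-- A continuous function whose average over the four points `z + i^k b` is at least its value at
`z` is plurisubharmonic. -/
lemma pshOn_of_four_points {q : Fn d} (hq : Continuous q)
    (h : ∀ z b, 4 * q z ≤ q (z + b) + q (z + I • b) + q (z - b) + q (z - I • b)) :
    PshOn q univ := by
  refine pshOn_of_continuousOn isOpen_univ hq.continuousOn fun z _ b => .of_forall fun r => ?_
  set F : ℂ → ℝ := fun w => q (z + w • b) with hF
  have hFc : ∀ c : ℂ, Continuous fun w => F (c * w) := fun c => by simp only [hF]; fun_prop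
  have hi : ∀ c : ℂ, CircleIntegrable (fun w => F (c * w)) 0 r := fun c =>
    (hFc c).continuousOn.circleIntegrable'
  have h1 := circleAverage_I_mul F r
  have h2 := circleAverage_I_mul (fun w => F (I * w)) r
  have h3 := circleAverage_I_mul (fun w => F (I * (I * w))) r
  have hi0 : CircleIntegrable F 0 r := by simpa using hi 1
  have hi1 := hi I
  have hi2 : CircleIntegrable (fun w => F (I * (I * w))) 0 r := by
    simpa only [mul_assoc] using hi (I * I)
  have hi3 : CircleIntegrable (fun w => F (I * (I * (I * w)))) 0 r := by
    simpa only [mul_assoc] using hi (I * (I * I))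
  have h4 : circleAverage (fun w => F w + F (I * w) + F (I * (I * w))
      + F (I * (I * (I * w)))) 0 r = 4 * circleAverage F 0 r := by
    have a1 := Real.circleAverage_add hi0 hi1
    have a2 := Real.circleAverage_add (hi0.add hi1) hi2
    have a3 := Real.circleAverage_add ((hi0.add hi1).add hi2) hi3
    refine a3.trans ?_
    linarith
  have h5 : 4 * q z ≤ circleAverage (fun w => F w + F (I * w)
      + F (I * (I * w)) + F (I * (I * (I * w)))) 0 r := by
    rw [← circleAverage_const (4 * q z) 0 r]
    refine circleAverage_mono (circleIntegrable_const (4 * q z) 0 r)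
      (((hi0.add hi1).add hi2).add hi3) fun w _ => ?_
    have := h z (w • b)
    simp only [hF]
    refine this.trans_eq ?_
    have e1 : I • w • b = (I * w) • b := smul_smul _ _ _
    have e2 : I * (I * w) = -w := by rw [← mul_assoc, Complex.I_mul_I]; ring
    rw [e2, e1, neg_smul, mul_neg, neg_smul, sub_eq_add_neg, sub_eq_add_neg]
  linarith

/-- Plurisubharmonic minorants of a family of functions. -/
def Minorants (G : Set (Fn d)) : Set (Fn d) := {p | PshOn p univ ∧ ∀ g ∈ G, ∀ z, p z ≤ g z}

/-- The plurisubharmonic envelope. -/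
def envelope (G : Set (Fn d)) (z : Cn d) : ℝ := sSup ((fun p : Fn d => p z) '' Minorants G)

/-- The members of the family are less convex than `C |z|²`. -/
def SemiconcaveFamily (C : ℝ) (G : Set (Fn d)) : Prop :=
  ∀ g ∈ G, ∀ x y : Cn d, ∀ t : ℝ, 0 ≤ t → t ≤ 1 →
    t * g x + (1 - t) * g y ≤ g (t • x + (1 - t) • y) + C * (t * (1 - t) * sqn (x - y))

variable {G : Set (Fn d)}
variable {B : Bil d} {u : Fn d} {C : ℝ} {p : Cn d}

lemma bddAbove_minorants (hG : G.Nonempty) (z : Cn d) :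
    BddAbove ((fun p : Fn d => p z) '' Minorants G) := by
  obtain ⟨g, hg⟩ := hG
  exact ⟨g z, by rintro _ ⟨p, hp, rfl⟩; exact hp.2 g hg z⟩

lemma le_envelope (hG : G.Nonempty) {p : Fn d} (hp : p ∈ Minorants G) (z : Cn d) :
    p z ≤ envelope G z := le_csSup (bddAbove_minorants hG z) ⟨p, hp, rfl⟩

lemma envelope_le (hM : (Minorants G).Nonempty) {c : ℝ} {z : Cn d}
    (h : ∀ p ∈ Minorants G, p z ≤ c) : envelope G z ≤ c :=
  csSup_le (hM.image _) (by rintro _ ⟨p, hp, rfl⟩; exact h p hp)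

lemma exists_minorant_gt (hM : (Minorants G).Nonempty) (z : Cn d) {ε : ℝ} (ha : 0 < ε) :
    ∃ p ∈ Minorants G, envelope G z - ε < p z := by
  obtain ⟨_, ⟨p, hp, rfl⟩, h⟩ := exists_lt_of_lt_csSup (hM.image fun p : Fn d => p z)
    (show envelope G z - ε < _ from sub_lt_self _ ha)
  exact ⟨p, hp, h⟩

lemma envelope_combination (hG : G.Nonempty) (hM : (Minorants G).Nonempty)
    (hC : SemiconcaveFamily C G) (x y : Cn d) {t : ℝ} (ht0 : 0 ≤ t) (ht1 : t ≤ 1) :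
    t * envelope G x + (1 - t) * envelope G y
      ≤ envelope G (t • x + (1 - t) • y) + C * (t * (1 - t) * sqn (x - y)) := by
  refine le_of_forall_pos_le_add fun ε ha => ?_
  obtain ⟨p1, h1, h1'⟩ := exists_minorant_gt hM x ha
  obtain ⟨p2, h2, h2'⟩ := exists_minorant_gt hM y ha
  set z := t • x + (1 - t) • y with hz
  have hmem : (fun w => t * p1 (w + (x - z)) + (1 - t) * p2 (w + (y - z))
      + -(C * (t * (1 - t) * sqn (x - y)))) ∈ Minorants G := by
    refine ⟨(((h1.1.translate _).const_mul ht0).add isOpen_univ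
      ((h2.1.translate _).const_mul (sub_nonneg.2 ht1))).add_const isOpen_univ _, fun g hg w => ?_⟩
    have h3 := hC g hg (w + (x - z)) (w + (y - z)) t ht0 ht1
    have e1 : t • (w + (x - z)) + (1 - t) • (w + (y - z)) = w := by rw [hz]; module
    have e2 : w + (x - z) - (w + (y - z)) = x - y := by abel
    rw [e1, e2] at h3
    have h4 := mul_le_mul_of_nonneg_left (h1.2 g hg (w + (x - z))) ht0
    have h5 := mul_le_mul_of_nonneg_left (h2.2 g hg (w + (y - z))) (sub_nonneg.2 ht1)
    simp
    linarith
  have h6 := le_envelope hG hmem z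
  simp at h6
  nlinarith

lemma envelope_continuous (hG : G.Nonempty) (hM : (Minorants G).Nonempty)
    (hC : SemiconcaveFamily C G) : Continuous (envelope G) := by
  have hconc : ConcaveOn ℝ univ fun z => envelope G z - C * sqn z := by
    refine ⟨convex_univ, fun x _ y _ a b ha hb hab => ?_⟩
    obtain rfl : b = 1 - a := by linarith
    have h1 := envelope_combination hG hM hC x y ha (by linarith)
    have h2 := sqn_combination x y a
    simp
    linear_combination h1 - C * h2
  have h2 : Continuous fun z => (envelope G z - C * sqn z) + C * sqn z :=
    (continuousOn_univ.1 (hconc.continuousOn isOpen_univ)).add (continuous_const.mul continuous_sqn)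
  simpa using h2

lemma envelope_second_difference (hG : G.Nonempty) (hM : (Minorants G).Nonempty)
    (hC : SemiconcaveFamily C G) (z h : Cn d) :
    envelope G (z + h) + envelope G (z - h) ≤ 2 * envelope G z + 2 * C * sqn h := by
  have h1 := envelope_combination hG hM hC (z + h) (z - h) (t := 1 / 2) (by norm_num) (by norm_num)
  have e1 : (1 / 2 : ℝ) • (z + h) + (1 - 1 / 2 : ℝ) • (z - h) = z := by module
  have e2 : z + h - (z - h) = (2 : ℝ) • h := by module
  rw [e1, e2, sqn_real_smul] at h1
  linarith

lemma envelope_pshOn (hG : G.Nonempty) (hM : (Minorants G).Nonempty)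
    (hC : SemiconcaveFamily C G) : PshOn (envelope G) univ := by
  have hcont := envelope_continuous hG hM hC
  refine pshOn_of_continuousOn isOpen_univ hcont.continuousOn fun a _ b => ?_
  filter_upwards [self_mem_nhdsWithin] with r hr
  refine envelope_le hM fun p hp => ?_
  refine (hp.1.le_circleAverage (b := b) hr fun _ _ => mem_univ _).trans ?_
  refine circleAverage_mono (hp.1.circleIntegrable fun _ _ => mem_univ _) ?_
    fun w _ => le_envelope hG hp _
  exact (Continuous.continuousOn (by fun_prop)).circleIntegrable'

open scoped ComplexOrder in
/-- If the density of a quadratic form with nonnegative Levi form does not vanish, the Levi form is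
bounded below. -/
lemma exists_levi_lower_bound (hB : ∀ v w, B v w = B w v)
    (h : ∀ b, 0 ≤ B b b + B (I • b) (I • b)) (hne : maB B ≠ 0) :
    ∃ ε > 0, ∀ b, 4 * ε * sqn b ≤ B b b + B (I • b) (I • b) := by
  have hdet : (levB B).det ≠ 0 := by
    intro h0
    exact hne (by rw [maB, mdisc_const, h0]; simp)
  have hpd := (levB_posSemidef hB h).posDef_iff_isUnit.2
    ((Matrix.isUnit_iff_isUnit_det _).2 (isUnit_iff_ne_zero.2 hdet))
  have hpos : ∀ b, b ≠ 0 → 0 < B b b + B (I • b) (I • b) := by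
    intro b hb
    have h1 := hpd.dotProduct_mulVec_pos (x := star b) (by simpa using hb)
    have h2 : star (star b) ⬝ᵥ (levB B).mulVec (star b)
        = ∑ j, ∑ k, b j * levB B j k * star (b k) := by
      simp only [dotProduct, Matrix.mulVec, mul_sum, Pi.star_apply, star_star, mul_assoc]
    rw [h2, levB_form hB, show (4 : ℂ) = ((4 : ℝ) : ℂ) by norm_num, ← Complex.ofReal_div,
      Complex.zero_lt_real] at h1
    linarith
  have hcont : Continuous fun b => B b b + B (I • b) (I • b) := by fun_prop
  rcases (sphere (0 : Cn d) 1).eq_empty_or_nonempty with hemp | hnon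
  · refine ⟨1, one_pos, fun b => ?_⟩
    by_cases hb : b = 0
    · simp [hb, sqn]
    · exact absurd (show (‖b‖⁻¹ : ℝ) • b ∈ sphere (0 : Cn d) 1 by
        simp [norm_smul, norm_ne_zero_iff.2 hb]) (by simp [hemp])
  · obtain ⟨b0, hb0, hmin⟩ := (isCompact_sphere (0 : Cn d) 1).exists_isMinOn hnon hcont.continuousOn
    have hb0' : b0 ≠ 0 := by rintro rfl; simp at hb0
    set m := B b0 b0 + B (I • b0) (I • b0) with hm
    have hm0 := hpos b0 hb0'
    refine ⟨m / (4 * (d + 1)), by positivity, fun b => ?_⟩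
    by_cases hb : b = 0
    · simp [hb, sqn]
    have hbn := norm_pos_iff.2 hb
    have h1 : m ≤ _ := hmin (show (‖b‖⁻¹ : ℝ) • b ∈ sphere (0 : Cn d) 1 by
        simp [norm_smul, hbn.ne'])
    simp only [smul_comm I (‖b‖⁻¹ : ℝ) b] at h1
    simp only [map_smul, smul_apply, smul_eq_mul] at h1
    have h2 : m * ‖b‖ ^ 2 ≤ B b b + B (I • b) (I • b) := by
      have := mul_le_mul_of_nonneg_right h1 (sq_nonneg ‖b‖)
      refine this.trans_eq ?_
      field_simp
    refine le_trans ?_ h2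
    have h3 := sqn_le_norm_sq b
    have h4 : m * sqn b ≤ m * ((d + 1) * ‖b‖ ^ 2) := by
      refine mul_le_mul_of_nonneg_left (h3.trans ?_) hm0.le
      nlinarith [sq_nonneg ‖b‖]
    rw [show 4 * (m / (4 * (d + 1))) * sqn b = m * sqn b / (d + 1) by field_simp,
      div_le_iff₀ (by positivity)]
    linarith

/-- Off the contact set, the density of the envelope vanishes. -/
lemma maB_envelope_eq_zero (hG : G.Nonempty) (hM : (Minorants G).Nonempty)
    (hC : SemiconcaveFamily C G) (hT : HasTaylorTwo (envelope G) B p) {η : ℝ} (hf : 0 < η)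
    (hgap : ∀ᶠ z in 𝓝 p, ∀ g ∈ G, envelope G z + η ≤ g z) : maB B = 0 := by
  classical
  by_contra hne
  set φ := envelope G with hi
  have hcont := envelope_continuous hG hM hC
  have hpsh := envelope_pshOn hG hM hC
  obtain ⟨ε, hc, hlow⟩ := exists_levi_lower_bound hT.1 (hT.levi_nonneg hcont hpsh) hne
  obtain ⟨hB, l, hT⟩ := hT
  have hev := (hT (ε / 4) (by positivity)).and
    (((continuous_const_add p).tendsto' 0 p (add_zero p)).eventually hgap)
  obtain ⟨r, hr, hball⟩ := Metric.eventually_nhds_iff.1 hev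
  set s := min (r / 2) (min 1 η / (ε + 1)) with hs
  have hs0 : 0 < s := by positivity
  have hsr : s < r := (min_le_left _ _).trans_lt (by linarith)
  have hs1 : ε * s ^ 2 ≤ η := by
    have h1 : s ≤ min 1 η / (ε + 1) := min_le_right _ _
    rw [le_div_iff₀ (by positivity)] at h1
    have h2 : s * (ε + 1) ≤ 1 := h1.trans (min_le_left _ _)
    have h3 := h1.trans (min_le_right _ _)
    nlinarith
  have hnorm : ∀ h : Cn d, sqn h ≤ s ^ 2 → ‖h‖ ≤ s := fun _ => norm_le_of_sqn_le hs0.le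
  let q : Fn d := fun z => φ p + l (z - p) + B (z - p) (z - p) / 2 - ε * sqn (z - p) + ε * s ^ 2 / 2
  have hqc : Continuous q := by
    have := continuous_sqn (d := d)
    fun_prop
  have hq : PshOn q univ := by
    refine pshOn_of_four_points hqc fun z b => ?_
    have h1 := hlow b
    have h2 := sqn_parallelogram (z - p) b
    have h3 := sqn_parallelogram (z - p) (I • b)
    rw [sqn_smul, Complex.norm_I, one_pow, one_mul] at h3
    have e : ∀ v : Cn d, z + v - p = z - p + v := fun v => by abel
    have e' : ∀ v : Cn d, z - v - p = z - p - v := fun v => by abel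
    simp only [q, e, e']
    simp only [map_add, map_sub, add_apply, sub_apply] at h1 ⊢
    rw [hB b, hB b, hB (I • b), hB (I • b)] at *
    nlinarith
  have hqle : ∀ z, sqn (z - p) ≤ s ^ 2 → q z ≤ φ z - 3 / 4 * ε * sqn (z - p) + ε * s ^ 2 / 2 := by
    intro z hz
    have h1 := (hball (y := z - p) (by simpa using (hnorm _ hz).trans_lt hsr)).1
    rw [add_sub_cancel] at h1
    have h2 := (abs_le.1 h1).1
    have h3 := norm_sq_le_sqn (z - p)
    simp only [q]
    nlinarith
  let W : Set (Cn d) := {z | sqn (z - p) < s ^ 2}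
  have hW : IsOpen W := isOpen_lt (continuous_sqn.comp (continuous_sub_right p)) continuous_const
  have hglue := PshOn.glue hW isOpen_univ (hq.mono (subset_univ _)) hpsh (fun x _ hx => by
    have h1 : s ^ 2 * (2 / 3) < sqn (x - p) := by
      have : s ^ 2 ≤ sqn (x - p) := not_lt.1 hx
      nlinarith [sq_pos_of_pos hs0]
    filter_upwards [(continuous_sqn.comp (continuous_sub_right p)).continuousAt.eventually
      (lt_mem_nhds h1)] with y hy hyW
    have h2 := hqle y (le_of_lt hyW)
    simp at hy
    nlinarith)
  have hmem : (fun z => if z ∈ W then max (q z) (φ z) else φ z) ∈ Minorants G := by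
    refine ⟨hglue, fun g hg z => ?_⟩
    have hle : ∀ z, φ z ≤ g z := fun z => envelope_le hM fun a ha => ha.2 g hg z
    by_cases hz : z ∈ W
    · simp only [hz, if_true]
      refine max_le ?_ (hle z)
      have h1 := hqle z (le_of_lt hz)
      have h2 := (hball (y := z - p) (by simpa using (hnorm _ (le_of_lt hz)).trans_lt hsr)).2 g hg
      rw [add_sub_cancel] at h2
      have h3 := mul_nonneg hc.le (sqn_nonneg (z - p))
      linarith
    · simp only [hz, if_false]
      exact hle z
  have h1 := le_envelope hG hmem p
  have hpW : p ∈ W := by simp only [W, mem_ofPred_eq, sub_self]; simpa [sqn] using pow_pos hs0 2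
  simp only [hpW, if_true] at h1
  have h2 := (le_max_left _ _).trans h1
  simp only [q, sub_self, map_zero, zero_div, add_zero] at h2
  have h3 : sqn (0 : Cn d) = 0 := by simp [sqn]
  rw [h3] at h2
  have : 0 < ε * s ^ 2 := by positivity
  linarith

open scoped ComplexOrder in
lemma mdisc_const_le {A P : Mat d} (hA : A.PosSemidef) (hP : P.PosSemidef)
    (h : (P - A).PosSemidef) : (mdisc fun _ => A) ≤ mdisc fun _ => P := by
  classical
  have key : ∀ s : Finset (Fin d), (mdisc fun l => if l ∈ s then A else P) ≤ mdisc fun _ => P := by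
    intro s
    induction s using Finset.induction_on with
    | empty => simp
    | insert i s hi ih =>
      refine le_trans ?_ ih
      set S : Fin d → Mat d := fun l => if l ∈ s then A else P with hS
      have hSp : ∀ l, (S l).PosSemidef := fun l => by
        by_cases h : l ∈ s <;> simp only [hS, h, if_true, if_false, hA, hP]
      have e1 : (fun l => if l ∈ insert i s then A else P) = update S i A := by
        ext1 l
        by_cases h : l = i
        · subst h; simp
        · simp [h, hS]
      have e2 : S = update S i (A + (P - A)) := by
        ext1 l
        by_cases h : l = i
        · subst h; simp [hS, hi]
        · simp [update_of_ne h]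
      rw [e1]
      conv_rhs => rw [e2]
      rw [mdisc_update_add]
      refine le_add_of_nonneg_right (mdisc_nonneg fun l => ?_)
      by_cases hl : l = i
      · subst hl; simpa using h
      · simpa [update_of_ne hl] using hSp l
  simpa using key Finset.univ

open scoped ComplexOrder in
/-- Where the envelope touches `τ|z|²` its density is at most that of `τ|z|²`. -/
lemma maB_le_of_second_difference (hu : Continuous u) (hp : PshOn u univ)
    (hT : HasTaylorTwo u B p) {τ : ℝ} (ht : 0 ≤ τ)
    (h : ∀ h, u (p + h) + u (p - h) ≤ 2 * u p + 2 * τ * sqn h) : maB B ≤ d.factorial * τ ^ d := by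
  have h1 := hT.le_of_second_difference h
  let Bs : Bil d := D2 (sqn : Fn d) 0
  have hBs : ∀ v w, Bs v w = ∑ i, 2 * (v i * star (w i)).re := fderiv_fderiv_sqn 0
  have hsym : ∀ v w, Bs v w = Bs w v := fun v w => by
    rw [hBs, hBs]; refine sum_congr rfl fun i _ => ?_
    simp; ring
  have hdiag : ∀ v, Bs v v = 2 * sqn v := fun v => by
    rw [hBs, sqn, mul_sum]; refine sum_congr rfl fun i _ => ?_
    rw [Complex.star_def, Complex.mul_conj, Complex.ofReal_re, Complex.normSq_eq_norm_sq]
  have hlev : levB Bs = 1 := by rw [← lev_eq_levB contDiff_sqn, lev_sqn]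
  have hsub : levB (τ • Bs - B) = (τ : ℂ) • (1 : Mat d) - levB B := by
    rw [← hlev]
    ext j k
    simp only [levB, Matrix.of_apply, Matrix.sub_apply, Matrix.smul_apply, sub_apply, smul_apply,
      smul_eq_mul]
    push_cast
    ring
  have h2 : (levB (τ • Bs - B)).PosSemidef := by
    refine levB_posSemidef (fun v w => by simp [hsym v w, hT.1 v w]) fun b => ?_
    have a1 := h1 b
    have a2 := h1 (I • b)
    simp only [sub_apply, smul_apply, smul_eq_mul, hdiag]
    linarith
  have h3 := mdisc_const_le (levB_posSemidef hT.1 (hT.levi_nonneg hu hp))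
    (P := (τ : ℂ) • (1 : Mat d))
    (Matrix.PosSemidef.one.smul (Complex.zero_le_real.2 ht)) (by rwa [← hsub])
  have h4 := mdisc_smul_one (d := d) fun _ => τ
  simp only [Finset.prod_const, Finset.card_univ, Fintype.card_fin] at h4
  rw [h4] at h3
  exact (Complex.le_def.1 h3).1

open scoped ComplexOrder in
lemma HasTaylorTwo.maB_nonneg (hu : Continuous u) (hp : PshOn u univ)
    (hT : HasTaylorTwo u B p) : 0 ≤ maB B :=
  (Complex.le_def.1 (mdisc_nonneg fun _ => levB_posSemidef hT.1 (hT.levi_nonneg hu hp))).1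

end Envelope

/-! ### Smallness of the density on the set of slow convergence -/

section Core

variable {d : ℕ}
variable {a e m ρ τ : ℝ} {u v x φ : Fn d} {B : Cn d → Bil d}

lemma mollify_quadratic_sqn (ha : 0 < a) (c e : ℝ) (z : Cn d) : mollify a (fun y => c * sqn y + e) z
      = c * sqn z + (c * (∫ w : Cn d, moll a w * sqn w) + e) := by
  have h : ∀ w, moll a w * (c * sqn (z - w) + e) = moll a w * (c * sqn z + e)
      - moll a w * (c • fderiv ℝ sqn z) w + c * (moll a w * sqn w) := fun w => by
    have : sqn (z - w) = sqn z - fderiv ℝ sqn z w + sqn w := by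
      simp only [fderiv_sqn, sqn, ← Finset.sum_sub_distrib, ← sum_add_distrib]
      refine sum_congr rfl fun i _ => ?_
      simp [Complex.sq_norm, Complex.normSq_apply]
      ring
    rw [this, smul_apply, smul_eq_mul]
    ring
  simp only [mollify, h]
  have i1 := (moll_integrable (d := d) ha).mul_const (c * sqn z + e)
  have i2 := integrable_moll_cont ha (c • fderiv ℝ sqn z).continuous
  have i3 : Integrable fun w => moll a w * (c * sqn z + e)
      - moll a w * (c • fderiv ℝ sqn z) w := i1.sub i2
  rw [integral_add i3 ((integrable_moll_cont ha continuous_sqn).const_mul c),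
    integral_sub i1 i2, integral_moll_mul_linear, integral_const_mul, integral_mul_const,
    moll_integral ha]
  ring

lemma mollify_sub_le (ha : 0 < a) (hu : PshOn u univ) (hv : PshOn v univ)
    (h : ∀ z, v z - u z ≤ m) (z : Cn d) : mollify a v z - mollify a u z ≤ m := by
  have h1 := mollify_mono ha hv (hu.add_const isOpen_univ m) (z := z) fun y _ => by linarith [h y]
  rw [mollify_add ha hu (pshOn_const m univ), mollify_const ha] at h1
  linarith

lemma mollify_eq_of_eq_off (ha : 0 < a) (ha1 : a ≤ 1)
    (h : ∀ z, ρ ≤ ‖z‖ → u z = v z) {z : Cn d} (hz : ρ + 1 ≤ ‖z‖) : mollify a u z = mollify a v z := by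
  refine mollify_congr ha fun y hy => h y ?_
  rw [mem_closedBall, dist_comm, dist_eq_norm] at hy
  linarith [norm_sub_norm_le z y]

lemma suppIn_mollify (ha : 0 < a) (ha1 : a ≤ 1)
    (hx1 : ∀ z : Cn d, ‖z‖ < ρ + 2 → x =ᶠ[𝓝 z] fun _ => 1) {c : ℝ}
    (h : ∀ z, ρ ≤ ‖z‖ → u z = c * sqn z + e) : SuppIn x fun z => mollify a u z
      - (c * sqn z + (c * (∫ w : Cn d, moll a w * sqn w) + e)) := by
  intro z
  by_cases hz : ‖z‖ < ρ + 2
  · exact Or.inl (hx1 z hz)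
  · right
    have : ∀ᶠ y : Cn d in 𝓝 z, ρ + 1 < ‖y‖ :=
      continuous_norm.continuousAt.eventually (lt_mem_nhds (by linarith))
    filter_upwards [this] with y hy
    rw [mollify_eq_of_eq_off ha ha1 h hy.le, mollify_quadratic_sqn ha, sub_self]

/-- The functions whose densities are estimated: `C^{1,1}` plurisubharmonic functions between
`τ|z|² - 1` and `τ|z|²`, equal to `τ|z|²` off a ball. -/
structure Capped (τ ρ : ℝ) (φ : Fn d) : Prop where
  cont : Continuous φ
  psh : PshOn φ univ
  second : ∃ C, 0 ≤ C ∧ ∀ z h, φ (z + h) + φ (z - h) ≤ 2 * φ z + 2 * C * sqn h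
  le : ∀ z, φ z ≤ τ * sqn z
  ge : ∀ z, τ * sqn z - 1 ≤ φ z
  off : ∀ z, ρ ≤ ‖z‖ → φ z = τ * sqn z

/-- A sequence of mollification radii. -/
def radius (n : ℕ) : ℝ := 1 / ((n : ℝ) + 1)

lemma radius_pos (n : ℕ) : 0 < radius n := Nat.one_div_pos_of_nat

lemma radius_le_one (n : ℕ) : radius n ≤ 1 := by
  rw [radius, div_le_one (by positivity)]
  linarith [n.cast_nonneg (α := ℝ)]

lemma tendsto_radius : Tendsto radius atTop (𝓝[>] 0) :=
  tendsto_nhdsWithin_iff.2 ⟨tendsto_one_div_add_atTop_nhds_zero_nat, .of_forall radius_pos⟩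

lemma Capped.ma_data (hf : Capped τ ρ φ)
    (hB : ∀ᵐ z, HasTaylorTwo φ (B z) z) :
    AEStronglyMeasurable (fun z => maB (B z)) ∧ ∃ M, 0 ≤ M ∧
      (∀ n z, |MD (fun _ => mollify (radius n) φ) z| ≤ M) ∧ (∀ᵐ z, |maB (B z)| ≤ M) ∧
      ∀ᵐ z, Tendsto (fun n => MD (fun _ => mollify (radius n) φ) z) atTop (𝓝 (maB (B z))) := by
  obtain ⟨C, hC0, hC⟩ := hf.second
  obtain ⟨M, hM⟩ := exists_MD_mollify_bound hf.cont hf.psh hC0 hC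
  have hlim : ∀ᵐ z, Tendsto (fun n => MD (fun _ => mollify (radius n) φ) z) atTop
      (𝓝 (maB (B z))) := by
    filter_upwards [hB] with z hz using (hz.tendsto_MD hf.cont).comp tendsto_radius
  refine ⟨aestronglyMeasurable_of_tendsto_ae atTop (fun n => ?_) hlim, M,
    (abs_nonneg _).trans (hM 1 one_pos 0), fun n z => hM _ (radius_pos n) z, ?_, hlim⟩
  · exact (MD_continuous fun _ => mollify_smooth (radius_pos n)
      hf.cont.locallyIntegrable).aestronglyMeasurable
  · filter_upwards [hlim] with z hz
    exact le_of_tendsto hz.abs (.of_forall fun n => hM _ (radius_pos n) z)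

lemma exists_cutoff (ρ : ℝ) (hr : 0 ≤ ρ) : ∃ x : Fn d, Smooth x ∧ HasCompactSupport x ∧
    (∀ z, 0 ≤ x z) ∧ ∀ z : Cn d, ‖z‖ < ρ + 2 → x =ᶠ[𝓝 z] fun _ => 1 := by
  let f : ContDiffBump (0 : Cn d) := ⟨ρ + 2, ρ + 3, by linarith, by linarith⟩
  exact ⟨f, f.contDiff, f.hasCompactSupport, fun z => f.nonneg, fun z hz =>
    f.eventuallyEq_one_of_mem_ball (by simpa [f] using hz)⟩

/-- The total mass of the density equals that of `τ|z|²`. -/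
lemma Capped.integral_maB (ha : Capped τ ρ φ)
    (hB : ∀ᵐ z, HasTaylorTwo φ (B z) z)
    (hx : Smooth x) (hxc : HasCompactSupport x)
    (hx1 : ∀ z : Cn d, ‖z‖ < ρ + 2 → x =ᶠ[𝓝 z] fun _ => 1) :
    ∫ z, x z * maB (B z) = ∫ z, x z * (d.factorial * τ ^ d) := by
  obtain ⟨-, M, hM0, hM, -, hlim⟩ := ha.ma_data hB
  have h1 : ∀ n, ∫ z, x z * MD (fun _ => mollify (radius n) φ) z
      = ∫ z, x z * (d.factorial * τ ^ d) := by
    intro n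
    rw [integral_cutoff_MD_eq hx hxc (fun _ => mollify_smooth (radius_pos n)
      ha.cont.locallyIntegrable) (c := fun _ => τ) (fun _ => suppIn_mollify (radius_pos n)
        (radius_le_one n) hx1 (e := 0) (by simpa using ha.off)), integral_mul_const]
    simp
    ring
  refine tendsto_nhds_unique (f := fun n => ∫ z, x z * MD (fun _ => mollify (radius n) φ) z)
    (l := atTop) ?_ (by simp only [h1]; exact tendsto_const_nhds)
  refine tendsto_integral_of_dominated_convergence (fun z => |x z| * M) (fun n => ?_) ?_
    (fun n => ae_of_all _ fun z => ?_) ?_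
  · exact (hx.continuous.mul (MD_continuous fun _ => mollify_smooth (radius_pos n)
      ha.cont.locallyIntegrable)).aestronglyMeasurable
  · exact (hx.continuous.integrable_of_hasCompactSupport hxc).abs.mul_const M
  · rw [norm_mul, norm_eq_abs, norm_eq_abs]
    exact mul_le_mul_of_nonneg_left (hM n z) (abs_nonneg _)
  · filter_upwards [hlim] with z hz using hz.const_mul _

/-- Along an increasing sequence of plurisubharmonic functions, `∫ (H - h i) ma(φ)` becomes small
uniformly in `φ`. -/
lemma exists_index_integral_le {ε : ℝ} (ht : 0 ≤ τ) (hr : 0 ≤ ρ) (hq : 0 < ε)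
    {h : ℕ → Fn d} {H : Fn d} (hpsh : ∀ i, PshOn (h i) univ)
    (hmono : ∀ z, Monotone fun i => h i z)
    (hout : ∀ i z, ρ ≤ ‖z‖ → h i z = 1 * sqn z + e)
    (hm : ∀ i j z, h j z - h i z ≤ m) (hlim : ∀ᵐ z, Tendsto (fun i => h i z) atTop (𝓝 (H z))) :
    ∃ i, ∀ φ : Fn d, Capped τ ρ φ → ∀ B : Cn d → Bil d,
      (∀ᵐ z, HasTaylorTwo φ (B z) z) →
      Integrable (fun z => (H z - h i z) * maB (B z)) ∧ ∫ z, (H z - h i z) * maB (B z) ≤ ε := by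
  obtain ⟨o, ho, hoc, ho0, ho1⟩ := exists_cutoff (d := d) ρ hr
  have hm0 : 0 ≤ m := by simpa using hm 0 0 0
  set M := d.factorial * (τ + 1) ^ d * ∫ z, o z with hM
  obtain ⟨q0, hq0, hchain⟩ := exists_chain_bound d M hq
  let κ : ℕ → ℝ := fun n => ∫ w : Cn d, moll (radius n) w * sqn w
  let b : ℕ → Fn d := fun n z => τ * sqn z + (τ * κ n + 0)
  let hh : ℕ → ℕ → Fn d := fun i n => mollify (radius n) (h i)
  let u : ℕ → ℕ → Fn d := fun i n z => b n z + hh i n z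
  have hbs : ∀ n, Smooth (b n) := fun n => contDiff_quadratic _ _
  have hbp : ∀ n, PshOn (b n) univ := fun n =>
    ((pshOn_sqn univ).const_mul ht).add_const isOpen_univ _
  have hhs : ∀ i n, Smooth (hh i n) := fun i n =>
    mollify_smooth (radius_pos n) (hpsh i).locallyIntegrable
  have hhp : ∀ i n, PshOn (hh i n) univ := fun i n => (hpsh i).pshOn_mollify (radius_pos n)
  have hhle : ∀ i j n z, i ≤ j → hh i n z ≤ hh j n z := fun i j n z hij =>
    mollify_mono (radius_pos n) (hpsh i) (hpsh j) fun y _ => hmono y hij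
  have hhm : ∀ i j n z, hh j n z - hh i n z ≤ m := fun i j n z =>
    mollify_sub_le (radius_pos n) (hpsh i) (hpsh j) (hm i j) z
  have hhsupp : ∀ i n, SuppIn o fun z => hh i n z - (1 * sqn z + (1 * κ n + e)) := fun i n =>
    suppIn_mollify (radius_pos n) (radius_le_one n) ho1 (hout i)
  have huadm : ∀ i n, Adm o (τ + 1) (u i n) := fun i n =>
    ⟨(hbs n).add (hhs i n), (hbp n).add isOpen_univ (hhp i n), τ + 1, τ * κ n + (κ n + e),
      by linarith, le_rfl, by
        convert hhsupp i n using 2 with z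
        simp; ring⟩
  have husupp : ∀ i j n, SuppIn o fun z => u j n z - u i n z := fun i j n => by
    convert (hhsupp j n).sub (hhsupp i n) using 2 with z
    simp only [u]; ring
  have hule : ∀ i j n z, i ≤ j → u i n z ≤ u j n z := fun i j n z hij => by
    simp only [u]; linarith [hhle i j n z hij]
  let E : ℕ → ℕ → ℝ := fun j n => energy o (u j n) - energy o (u 0 n)
  have hEmono : ∀ i j n, i ≤ j → E i n ≤ E j n := fun i j n hij => by
    have h1 := integral_MD_le_energy_sub ho hoc (huadm i n) (huadm j n) (husupp i j n)
      fun z => hule i j n z hij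
    have h2 := integral_mul_MD_nonneg (f := fun z => u j n z - u i n z)
      (fun z => sub_nonneg.2 (hule i j n z hij)) (T := fun _ => u i n)
      (fun _ => (huadm i n).smooth) fun _ => (huadm i n).psh
    simp
    linarith
  set K := (d + 1) * (m * M) with hK
  have hEle : ∀ j n, E j n ≤ K := fun j n =>
    energy_sub_le ho hoc ho0 (huadm 0 n) (huadm j n) (husupp 0 j n) hm0 fun z => by
      simp; linarith [hhm 0 j n z]
  have hE0 : ∀ j n, 0 ≤ E j n := fun j n => by
    have := hEmono 0 j n (Nat.zero_le _)
    simpa [E] using this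
  have hex : ∀ j, ∃ c ∈ Icc 0 K, Tendsto (E j) (hyperfilter ℕ : Filter ℕ) (𝓝 c) := fun j =>
    (isCompact_Icc (a := (0 : ℝ)) (b := K)).ultrafilter_le_nhds ((hyperfilter ℕ).map (E j))
      (le_principal_iff.2 (show ∀ᶠ n in (hyperfilter ℕ : Filter ℕ), E j n ∈ Icc 0 K from
        .of_forall fun n => ⟨hE0 j n, hEle j n⟩))
  choose El hEl hElim using hex
  have hElmono : Monotone El := fun i j hij =>
    le_of_tendsto_of_tendsto (hElim i) (hElim j) (.of_forall fun n => hEmono i j n hij)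
  have hbdd : BddAbove (range El) := ⟨K, by rintro _ ⟨j, rfl⟩; exact (hEl j).2⟩
  obtain ⟨i, hi⟩ := exists_lt_of_lt_ciSup (show (⨆ j, El j) - q0 < ⨆ j, El j by linarith)
  refine ⟨i, fun φ hp B hB => ?_⟩
  obtain ⟨hBm, M', hM'0, hMDb, hmab, hMDl⟩ := hp.ma_data hB
  let w : ℕ → Fn d := fun n => mollify (radius n) φ
  have hws : ∀ n, Smooth (w n) := fun n =>
    mollify_smooth (radius_pos n) hp.cont.locallyIntegrable
  have hwadm : ∀ n, Adm o (τ + 1) (w n) := fun n =>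
    ⟨hws n, hp.psh.pshOn_mollify (radius_pos n), τ, τ * κ n + 0, ht, by linarith,
      suppIn_mollify (radius_pos n) (radius_le_one n) ho1 (by simpa using hp.off)⟩
  have hbm : ∀ n z, b n z = mollify (radius n) (fun y => τ * sqn y + 0) z := fun n z =>
    (mollify_quadratic_sqn (radius_pos n) τ 0 z).symm
  have hbp' : PshOn (fun y : Cn d => τ * sqn y + 0) univ :=
    ((pshOn_sqn univ).const_mul ht).add_const isOpen_univ _
  have hS : ∀ j, i ≤ j → ∀ᶠ n in (hyperfilter ℕ : Filter ℕ),
      ∫ z, (hh j n z - hh i n z) * MD (fun _ => w n) z ≤ ε := by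
    intro j hij
    have h1 : El j - El i < q0 := by linarith [le_ciSup hbdd j]
    filter_upwards [((hElim j).sub (hElim i)).eventually (gt_mem_nhds h1)] with n hn
    have h2 := hchain (fun k => ∫ z, (u j n z - u i n z) * MD (mixT k (w n) (u i n)) z)
      (fun k hk => integral_MD_mixT_succ_le ho hoc ho0 (huadm i n) (huadm j n) (hwadm n)
        (husupp i j n) (fun z => hule i j n z hij) (hbs n) (hbp n)
        (g := fun z => w n z - b n z) ((hws n).sub (hbs n))
        (suppIn_mollify (radius_pos n) (radius_le_one n) ho1 (by simpa using hp.off))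
        (fun z => by
          rw [hbm, sub_nonpos]
          exact mollify_mono (radius_pos n) hp.psh hbp' fun y _ => by simpa using hp.le y)
        (fun z => by
          have := mollify_sub_le (radius_pos n) hp.psh hbp' (m := 1)
            (fun y => by linarith [hp.ge y]) z
          rw [hbm]; linarith) (fun z => by ring) (hhs i n) (hhp i n) (fun z => rfl) hk)
      (fun k => integral_mul_MD_nonneg (fun z => sub_nonneg.2 (hule i j n z hij))
        (fun l => mixT_cases (hws n) (huadm i n).smooth k l)
        (fun l => mixT_cases (P := fun s => PshOn s univ) (hwadm n).psh (huadm i n).psh k l)) (by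
        rw [mixT_zero]
        refine (integral_MD_le_energy_sub ho hoc (huadm i n) (huadm j n) (husupp i j n)
          fun z => hule i j n z hij).trans ?_
        simp only [E] at hn
        linarith)
    rw [mixT_full] at h2
    simpa only [u, add_sub_add_left_eq_sub] using h2
  have hind : Integrable (indicator (closedBall (0 : Cn d) (ρ + 1)) fun _ => m * M') :=
    (integrableOn_const (isCompact_closedBall _ _).measure_lt_top.ne).integrable_indicator
      measurableSet_closedBall
  have hdom : ∀ (x y : ℝ) (z : Cn d), 0 ≤ x → x ≤ m → |y| ≤ M' → (ρ + 1 < ‖z‖ → x = 0) →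
      ‖x * y‖ ≤ indicator (closedBall (0 : Cn d) (ρ + 1)) (fun _ => m * M') z := by
    intro x y z hx0 hxm hy hz
    by_cases hzb : z ∈ closedBall (0 : Cn d) (ρ + 1)
    · rw [indicator_of_mem hzb, norm_mul, norm_eq_abs, norm_eq_abs, abs_of_nonneg hx0]
      exact mul_le_mul hxm hy (abs_nonneg _) hm0
    · rw [indicator_of_notMem hzb, hz (by simpa using hzb)]
      simp
  have hS' : ∀ j, i ≤ j → ∫ z, (h j z - h i z) * maB (B z) ≤ ε := by
    intro j hij
    have h1 : Tendsto (fun n => ∫ z, (hh j n z - hh i n z) * MD (fun _ => w n) z) atTop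
        (𝓝 (∫ z, (h j z - h i z) * maB (B z))) := by
      refine tendsto_integral_of_dominated_convergence _ (fun n => ?_) hind
        (fun n => ae_of_all _ fun z => hdom _ _ z (sub_nonneg.2 (hhle i j n z hij)) (hhm i j n z)
          (hMDb n z) fun hz => sub_eq_zero.2 ?_) ?_
      · exact (((hhs j n).continuous.sub (hhs i n).continuous).mul
          (MD_continuous fun _ => hws n)).aestronglyMeasurable
      · exact mollify_eq_of_eq_off (radius_pos n) (radius_le_one n)
          (fun y hy => by rw [hout j y hy, hout i y hy]) hz.le
      · filter_upwards [hMDl] with z hz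
        exact ((((hpsh j).tendsto_mollify z).comp tendsto_radius).sub
          (((hpsh i).tendsto_mollify z).comp tendsto_radius)).mul hz
    exact le_of_tendsto (h1.mono_left Nat.hyperfilter_le_atTop) (hS j hij)
  have hF : ∀ j, i ≤ j → AEStronglyMeasurable (fun z => (h j z - h i z) * maB (B z)) := fun j _ =>
    ((hpsh j).measurable.sub (hpsh i).measurable).aestronglyMeasurable.mul hBm
  have hFd : ∀ j, i ≤ j → ∀ᵐ z, ‖(h j z - h i z) * maB (B z)‖
      ≤ indicator (closedBall (0 : Cn d) (ρ + 1)) (fun _ => m * M') z := fun j hij => by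
    filter_upwards [hmab] with z hz
    exact hdom _ _ z (sub_nonneg.2 (hmono z hij)) (hm i j z) hz fun hz' => by
      rw [hout j z (by linarith), hout i z (by linarith), sub_self]
  have hFl : ∀ᵐ z, Tendsto (fun j => (h j z - h i z) * maB (B z)) atTop
      (𝓝 ((H z - h i z) * maB (B z))) := by
    filter_upwards [hlim] with z hz using (hz.sub_const _).mul_const _
  have hFm : AEStronglyMeasurable (fun z => (H z - h i z) * maB (B z)) := by
    refine aestronglyMeasurable_of_tendsto_ae atTop
      (f := fun j z => (h (j + i) z - h i z) * maB (B z)) (fun j => hF _ (by omega)) ?_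
    filter_upwards [hFl] with z hz using hz.comp (tendsto_add_atTop_nat i)
  refine ⟨hind.mono' hFm ?_, ?_⟩
  · filter_upwards [hFl, ae_all_iff.2 fun j => hFd (j + i) (by omega)] with z hz hz'
    exact le_of_tendsto ((hz.comp (tendsto_add_atTop_nat i)).norm) (.of_forall hz')
  · have h1 : Tendsto (fun j => ∫ z, (h (j + i) z - h i z) * maB (B z)) atTop
        (𝓝 (∫ z, (H z - h i z) * maB (B z))) := by
      refine tendsto_integral_of_dominated_convergence _ (fun j => hF _ (by omega)) hind
        (fun j => hFd _ (by omega)) ?_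
      filter_upwards [hFl] with z hz using hz.comp (tendsto_add_atTop_nat i)
    exact le_of_tendsto h1 (.of_forall fun j => hS' _ (by omega))

end Core

/-! ### A capacity estimate for the set of slow convergence -/

section Capacity

variable {d : ℕ}

/-- The function `τ|z|²` together with paraboloids dipping below it near prescribed points. -/
def obst (τ : ℝ) (A : Set (Cn d × ℝ)) : Set (Fn d) :=
  insert (fun z => τ * sqn z) ((fun p z => τ * sqn z + p.2 * sqn (z - p.1) - 1) '' A)

/-- The centres lie in the unit ball, the steepnesses between `1` and `N`. -/
def Tame (N : ℝ) (A : Set (Cn d × ℝ)) : Prop := ∀ p ∈ A, ‖p.1‖ ≤ 1 ∧ 1 ≤ p.2 ∧ p.2 ≤ N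

lemma obst_nonempty (τ : ℝ) (A : Set (Cn d × ℝ)) : (obst τ A).Nonempty := insert_nonempty _ _

lemma mem_minorants_obst {τ : ℝ} {A : Set (Cn d × ℝ)} {a : Fn d} (ha : PshOn a univ)
    (h1 : ∀ z, a z ≤ τ * sqn z) (h2 : ∀ p ∈ A, ∀ z, a z ≤ τ * sqn z + p.2 * sqn (z - p.1) - 1) :
    a ∈ Minorants (obst τ A) := by
  refine ⟨ha, fun g hg z => ?_⟩
  rcases hg with rfl | ⟨p, hp, rfl⟩
  exacts [h1 z, h2 p hp z]

variable {τ ρ N : ℝ} {A : Set (Cn d × ℝ)}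
variable {O : Set (Cn d)} {a : Cn d} {μ : ℝ}

lemma sub_one_mem_minorants (ht : 0 ≤ τ) (hA : Tame N A) :
    (fun z => τ * sqn z + -1) ∈ Minorants (obst τ A) :=
  mem_minorants_obst (((pshOn_sqn univ).const_mul ht).add_const isOpen_univ _)
    (fun z => by linarith) fun p hp z => by
      have := mul_nonneg (zero_le_one.trans (hA p hp).2.1) (sqn_nonneg (z - p.1))
      linarith

lemma sqn_sub_combination (x y a : Cn d) (t : ℝ) : t * sqn (x - a) + (1 - t) * sqn (y - a)
      = sqn (t • x + (1 - t) • y - a) + t * (1 - t) * sqn (x - y) := by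
  rw [sqn_combination, show x - a - (y - a) = x - y by abel,
    show t • (x - a) + (1 - t) • (y - a) = t • x + (1 - t) • y - a by module]

lemma obst_semiconcave (hN : 0 ≤ N) (hA : Tame N A) :
    SemiconcaveFamily (τ + N) (obst τ A) := by
  intro g hg x y t ht0 ht1
  have h0 := sqn_combination x y t
  have h1 : 0 ≤ t * (1 - t) * sqn (x - y) :=
    mul_nonneg (mul_nonneg ht0 (sub_nonneg.2 ht1)) (sqn_nonneg _)
  rcases hg with rfl | ⟨p, hp, rfl⟩
  · simp
    linear_combination τ * h0 + mul_nonneg hN h1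
  · have h2 := sqn_sub_combination x y p.1 t
    have h3 := mul_le_mul_of_nonneg_right (hA p hp).2.2 h1
    simp
    linear_combination τ * h0 + p.2 * h2 + h3

lemma envelope_le_sqn (ht : 0 ≤ τ) (hA : Tame N A) (z : Cn d) :
    envelope (obst τ A) z ≤ τ * sqn z :=
  envelope_le ⟨_, sub_one_mem_minorants ht hA⟩ fun _ ha => ha.2 _ (mem_insert _ _) z

lemma pshOn_sqn_sub_sqn {a b : ℝ} (hab : b ≤ a) (p q : Cn d) (V : Set (Cn d)) :
    PshOn (fun z => a * sqn (z - p) - b * sqn (z - q)) V := by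
  have := continuous_sqn (d := d)
  refine PshOn.mono (V := univ) (pshOn_of_four_points (by fun_prop) fun z v => ?_) (subset_univ _)
  have h1 := sqn_parallelogram (z - p) v
  have h2 := sqn_parallelogram (z - p) (I • v)
  have h3 := sqn_parallelogram (z - q) v
  have h4 := sqn_parallelogram (z - q) (I • v)
  have e : ∀ v r : Cn d, z + v - r = z - r + v := fun v r => by abel
  have e' : ∀ v r : Cn d, z - v - r = z - r - v := fun v r => by abel
  rw [sqn_smul, Complex.norm_I, one_pow, one_mul] at h2 h4
  have h5 := mul_nonneg (sub_nonneg.2 hab) (sqn_nonneg v)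
  simp only [e, e']
  linear_combination 4 * h5 - a * (h1 + h2) + b * (h3 + h4)

/-- Affine minorants touching `τ|z|²` far away. -/
lemma envelope_eq_sqn (ht : 0 ≤ τ) (hA : Tame N A)
    (hr2 : 2 ≤ ρ) (hr : 1 ≤ τ * (ρ - 2) ^ 2) (ha : ρ ≤ ‖a‖) :
    envelope (obst τ A) a = τ * sqn a := by
  refine le_antisymm (envelope_le_sqn ht hA a) ?_
  have hc : (fun z => τ * sqn z - τ * sqn (z - a)) ∈ Minorants (obst τ A) := by
    refine mem_minorants_obst (by simpa using pshOn_sqn_sub_sqn le_rfl 0 a univ)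
      (fun z => by linarith [mul_nonneg ht (sqn_nonneg (z - a))]) fun p hp z => ?_
    obtain ⟨hp1, hp2, -⟩ := hA p hp
    have h2 := mul_nonneg ht (sqn_nonneg (z - a))
    rcases le_or_gt 1 (sqn (z - p.1)) with h3 | h3
    · nlinarith
    have h4 := norm_le_of_sqn_le zero_le_one (by simpa using h3.le)
    have h5 : ρ - 2 ≤ ‖z - a‖ := by
      rw [norm_sub_rev z a]
      linarith [norm_sub_norm_le a z, norm_sub_norm_le z p.1]
    have h6 := (pow_le_pow_left₀ (by linarith) h5 2).trans (norm_sq_le_sqn _)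
    linarith [mul_le_mul_of_nonneg_left h6 ht,
      mul_nonneg (zero_le_one.trans hp2) (sqn_nonneg (z - p.1))]
  simpa [sqn_zero] using le_envelope (obst_nonempty τ A) hc a

lemma capped_envelope (ht : 0 ≤ τ) (hN : 0 ≤ N) (hA : Tame N A)
    (hr2 : 2 ≤ ρ) (hr : 1 ≤ τ * (ρ - 2) ^ 2) : Capped τ ρ (envelope (obst τ A)) := by
  have hG := obst_nonempty τ A
  have hM : (Minorants (obst τ A)).Nonempty := ⟨_, sub_one_mem_minorants ht hA⟩
  have hC := obst_semiconcave (τ := τ) hN hA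
  exact ⟨envelope_continuous hG hM hC, envelope_pshOn hG hM hC,
    ⟨τ + N, by linarith, envelope_second_difference hG hM hC⟩, envelope_le_sqn ht hA,
    fun z => by simpa [sub_eq_add_neg] using le_envelope hG (sub_one_mem_minorants ht hA) z,
    fun z hz => envelope_eq_sqn ht hA hr2 hr hz⟩

lemma Capped.subset_ball {φ : Fn d} (hf : Capped τ ρ φ) : {z | φ z < τ * sqn z} ⊆ ball 0 ρ :=
  fun z hz => mem_ball_zero_iff.2 (not_le.1 fun h => hz.ne (hf.off z h))

/-- Off the dips and off the contact set the density of the envelope vanishes. -/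
lemma maB_envelope_obst_eq_zero (ht : 0 ≤ τ) (hN : 0 ≤ N)
    (hA : Tame N A) {z0 : Cn d}
    {B : Bil d} (hT : HasTaylorTwo (envelope (obst τ A)) B z0)
    (hlt : envelope (obst τ A) z0 < τ * sqn z0) (hoff : ∀ p ∈ A, 1 ≤ p.2 * sqn (z0 - p.1)) :
    maB B = 0 := by
  have hG := obst_nonempty τ A
  have hM : (Minorants (obst τ A)).Nonempty := ⟨_, sub_one_mem_minorants ht hA⟩
  have hC := obst_semiconcave (τ := τ) hN hA
  have hcont := envelope_continuous hG hM hC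
  have hs := continuous_sqn (d := d)
  set η := (τ * sqn z0 - envelope (obst τ A) z0) / 3 with hb
  have hb0 : 0 < η := by linarith
  have e1 : ∀ᶠ z in 𝓝 z0, envelope (obst τ A) z < τ * sqn z - 2 * η := by
    have hc : Continuous fun z => envelope (obst τ A) z - (τ * sqn z - 2 * η) := by fun_prop
    filter_upwards [hc.continuousAt.eventually (gt_mem_nhds
      (show envelope (obst τ A) z0 - (τ * sqn z0 - 2 * η) < 0 by linarith))] with z hz
    linarith
  have e2 : ∀ᶠ z in 𝓝 z0, ∀ a ∈ closedBall (0 : Cn d) 1, N * (sqn (z0 - a) - sqn (z - a)) < η := by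
    refine (isCompact_closedBall (0 : Cn d) 1).eventually_forall_of_forall_eventually fun a _ => ?_
    have hc : Continuous fun q : Cn d × Cn d => N * (sqn (z0 - q.2) - sqn (q.1 - q.2)) := by fun_prop
    exact hc.continuousAt.eventually (gt_mem_nhds (by simpa using hb0))
  refine maB_envelope_eq_zero hG hM hC hT hb0 ?_
  filter_upwards [e1, e2] with z h1 h2 g hg
  rcases hg with rfl | ⟨p, hp, rfl⟩
  · simp; linarith
  · obtain ⟨hp1, hp2, hp3⟩ := hA p hp
    have h3 := h2 p.1 (by simpa using hp1)
    have h4 := hoff p hp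
    have h5 : p.2 * (sqn (z0 - p.1) - sqn (z - p.1)) ≤ η := by
      rcases le_or_gt 0 (sqn (z0 - p.1) - sqn (z - p.1)) with h6 | h6
      · exact (mul_le_mul_of_nonneg_right hp3 h6).trans h3.le
      · nlinarith
    simp
    linarith

/-- The volume of the non-contact set is controlled by the mass of the dips. -/
lemma volume_noncontact_le (ht : 0 ≤ τ) (hN : 0 ≤ N)
    (hA : Tame N A) (hr2 : 2 ≤ ρ) (hr : 1 ≤ τ * (ρ - 2) ^ 2)
    (hO : MeasurableSet O) (hO1 : O ⊆ closedBall 0 1)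
    (hAO : ∀ p ∈ A, ∀ z, p.2 * sqn (z - p.1) < 1 → z ∈ O)
    {B : Cn d → Bil d} (hB : ∀ᵐ z, HasTaylorTwo (envelope (obst τ A)) (B z) z) :
    IntegrableOn (fun z => maB (B z)) O ∧
    d.factorial * τ ^ d * volume.real {z | envelope (obst τ A) z < τ * sqn z}
      ≤ ∫ z in O, maB (B z) := by
  have hf := capped_envelope ht hN hA hr2 hr
  set φ := envelope (obst τ A) with hfdef
  obtain ⟨x, hx, hxc, hx0, hx1⟩ := exists_cutoff (d := d) ρ (by linarith)
  obtain ⟨hBm, M, hM0, -, hmab, -⟩ := hf.ma_data hB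
  have hmass := hf.integral_maB hB hx hxc hx1
  have hx1' : ∀ z : Cn d, ‖z‖ < ρ + 2 → x z = 1 := fun z hz => (hx1 z hz).eq_of_nhds
  set c := d.factorial * τ ^ d with hc
  have hc0 : 0 ≤ c := by positivity
  have hxi := hx.continuous.integrable_of_hasCompactSupport (μ := volume) hxc
  set S := {z | φ z < τ * sqn z} with hS
  have hSm : MeasurableSet S :=
    (isOpen_lt hf.cont (continuous_const.mul continuous_sqn)).measurableSet
  have hSb : S ⊆ ball 0 ρ := hf.subset_ball
  have i1 : Integrable fun z => x z * c := hxi.mul_const c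
  have i2 : Integrable fun z => x z * maB (B z) := by
    refine (hxi.mul_const M).mono' (hx.continuous.aestronglyMeasurable.mul hBm) ?_
    filter_upwards [hmab] with z hz
    rw [norm_mul, norm_of_nonneg (hx0 z)]
    exact mul_le_mul_of_nonneg_left hz (hx0 z)
  have i3 : IntegrableOn (fun z => maB (B z)) O := by
    refine Measure.integrableOn_of_bounded (M := M)
      ((measure_mono hO1).trans_lt (isCompact_closedBall _ _).measure_lt_top).ne
      hBm ((ae_restrict_of_ae hmab).mono fun z hz => hz)
  refine ⟨i3, ?_⟩
  have i12 : Integrable fun z => x z * c - x z * maB (B z) := i1.sub i2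
  have i4 : Integrable (S.indicator fun _ => c) :=
    (integrableOn_const ((measure_mono hSb).trans_lt measure_ball_lt_top).ne).integrable_indicator hSm
  have key : ∫ z, S.indicator (fun _ => c) z
      ≤ ∫ z, ((x z * c - x z * maB (B z)) + O.indicator (fun z => maB (B z)) z) := by
    refine integral_mono_ae i4 (i12.add (i3.integrable_indicator hO)) ?_
    filter_upwards [hB] with z hz
    have hnn : 0 ≤ maB (B z) := hz.maB_nonneg hf.cont hf.psh
    by_cases hzS : z ∈ S
    · rw [indicator_of_mem hzS, hx1' z (by linarith [mem_ball_zero_iff.1 (hSb hzS)])]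
      by_cases hzO : z ∈ O
      · rw [indicator_of_mem hzO]; linarith
      · rw [indicator_of_notMem hzO, maB_envelope_obst_eq_zero ht hN hA hz hzS fun p hp =>
          not_lt.1 fun h => hzO (hAO p hp z h)]
        linarith
    · rw [indicator_of_notMem hzS]
      have heq : φ z = τ * sqn z := le_antisymm (hf.le z) (not_lt.1 hzS)
      have hle : maB (B z) ≤ c := maB_le_of_second_difference hf.cont hf.psh hz ht fun v => by
        have h1 := hf.le (z + v)
        have h2 := hf.le (z - v)
        rw [heq]
        linear_combination h1 + h2 + τ * sqn_parallelogram z v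
      have h1 := mul_le_mul_of_nonneg_left hle (hx0 z)
      have h2 : 0 ≤ O.indicator (fun z => maB (B z)) z := indicator_apply_nonneg fun _ => hnn
      linarith
  rw [integral_indicator hSm, setIntegral_const, smul_eq_mul, mul_comm] at key
  have e : ∫ z, ((x z * c - x z * maB (B z)) + O.indicator (fun z => maB (B z)) z)
      = ∫ z in O, maB (B z) := by
    rw [integral_add i12 (i3.integrable_indicator hO), integral_sub i1 i2, integral_indicator hO,
      hmass, sub_self, zero_add]
  rwa [e] at key

/-- Decreasing limits of plurisubharmonic functions, locally bounded below. -/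
lemma pshOn_of_antitone_tendsto {u : ℕ → Fn d} {v m : Fn d} (hu : ∀ n, PshOn (u n) univ)
    (hanti : ∀ z, Antitone fun n => u n z) (hm : Continuous m) (hmu : ∀ n z, m z ≤ u n z)
    (hlim : ∀ z, Tendsto (fun n => u n z) atTop (𝓝 (v z))) : PshOn v univ := by
  have hvu : ∀ n z, v z ≤ u n z := fun n z => (hanti z).le_of_tendsto (hlim z) n
  have hmv : ∀ z, m z ≤ v z := fun z => ge_of_tendsto (hlim z) (.of_forall fun n => hmu n z)
  refine ⟨fun z _ c hc => ?_, fun z _ => ⟨m z - 1, ?_⟩, fun a _ b => ?_⟩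
  · obtain ⟨n, hn⟩ := ((hlim z).eventually (gt_mem_nhds hc)).exists
    filter_upwards [(hu n).usc z (mem_univ _) c hn] with y hy using (hvu n y).trans_lt hy
  · filter_upwards [hm.continuousAt.eventually (lt_mem_nhds (show m z - 1 < m z by linarith))]
      with y hy using hy.le.trans (hmv y)
  · filter_upwards [self_mem_nhdsWithin] with r hr
    have hi : ∀ n, CircleIntegrable (fun w => u n (a + w • b)) 0 r := fun n =>
      (hu n).circleIntegrable fun _ _ => mem_univ _
    have hmi : CircleIntegrable (fun w => m (a + w • b)) 0 r :=
      (Continuous.continuousOn (by fun_prop)).circleIntegrable'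
    have h1 : Tendsto (fun n => circleAverage (fun w => u n (a + w • b)) 0 r) atTop
        (𝓝 (circleAverage (fun w => v (a + w • b)) 0 r)) := by
      simp only [Real.circleAverage_def]
      refine Tendsto.const_smul ?_ _
      refine intervalIntegral.tendsto_integral_filter_of_dominated_convergence
        (fun t => |u 0 (a + circleMap 0 r t • b)| + |m (a + circleMap 0 r t • b)|)
        (.of_forall fun n => ?_) (.of_forall fun n => ae_of_all _ fun t _ => ?_)
        ?_ (ae_of_all _ fun t _ => hlim _)
      · exact (hi n).aestronglyMeasurable.mono_set (by rw [uIoc_of_le Real.two_pi_pos.le])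
      · rw [norm_eq_abs, abs_le]
        set y := a + circleMap 0 r t • b
        have h2 : u n y ≤ u 0 y := hanti y (Nat.zero_le n)
        constructor <;> linarith [hmu n y, le_abs_self (u 0 y), abs_nonneg (u 0 y),
          abs_nonneg (m y), neg_abs_le (m y)]
      · exact (IntervalIntegrable.abs (hi 0)).add (IntervalIntegrable.abs hmi)
    exact le_of_tendsto_of_tendsto (hlim a) h1
      (.of_forall fun n => (hu n).le_circleAverage hr fun _ _ => mem_univ _)

/-- The dips of depth one supported in an open set. -/
def dips (O : Set (Cn d)) (n : ℕ) : Set (Cn d × ℝ) :=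
  {p | 1 ≤ p.2 ∧ p.2 ≤ n + 1 ∧ ∀ z, p.2 * sqn (z - p.1) < 1 → z ∈ O}

lemma envelope_anti {G G' : Set (Fn d)} (h : G ⊆ G') (hG : G.Nonempty)
    (hM : (Minorants G').Nonempty) (z : Cn d) : envelope G' z ≤ envelope G z :=
  envelope_le hM fun _ hp => le_envelope hG ⟨hp.1, fun g hg => hp.2 g (h hg)⟩ z

lemma exists_dip (hO : IsOpen O) (ha : a ∈ O) : ∃ n K, (a, K) ∈ dips O n := by
  obtain ⟨r, hr, hb⟩ := Metric.isOpen_iff.1 hO a ha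
  set K := max 1 (1 / r ^ 2) with hK
  obtain ⟨n, hn⟩ := exists_nat_ge K
  refine ⟨n, K, le_max_left _ _, hn.trans (by simp), fun z hz => hb ?_⟩
  have h1 : 1 / r ^ 2 ≤ K := le_max_right _ _
  rw [div_le_iff₀ (by positivity)] at h1
  have hK0 : 0 < K := zero_lt_one.trans_le (le_max_left _ _)
  have h2 := mul_le_mul_of_nonneg_left (norm_sq_le_sqn (z - a)) hK0.le
  rw [mem_ball, dist_eq_norm]
  by_contra hcon
  have h3 := pow_le_pow_left₀ hr.le (not_lt.1 hcon) 2
  have h4 := mul_le_mul_of_nonneg_left h3 hK0.le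
  simp at hz
  linarith

/-- If every capped function has small mass on an open set `O`, there is a plurisubharmonic function
at most `-1` on `O` and close to zero in measure. -/
lemma exists_pshOn_of_mass_le (hO : IsOpen O) (hO1 : O ⊆ {z | sqn z < 1})
    (hc : 0 < μ) (hr2 : 2 ≤ ρ) (hr : 1 ≤ μ / 2 * (ρ - 2) ^ 2)
    (hmass : ∀ φ : Fn d, Capped (μ / 2) ρ φ → ∀ B : Cn d → Bil d,
      (∀ᵐ z, HasTaylorTwo φ (B z) z) → IntegrableOn (fun z => maB (B z)) O →
      ∫ z in O, maB (B z) ≤ d.factorial * (μ / 2) ^ d * μ) :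
    ∃ p : Fn d, PshOn p univ ∧ (∀ z, sqn z < 1 → p z ≤ 0) ∧ (∀ z ∈ O, p z ≤ -1) ∧
      volume {z | sqn z < 1 ∧ p z < -μ} ≤ ENNReal.ofReal μ := by
  set τ := μ / 2 with hbdef
  have hb : 0 < τ := by positivity
  have hO1' : O ⊆ closedBall 0 1 := fun z hz => by
    simpa using norm_le_of_sqn_le zero_le_one (by simpa using (hO1 hz).le)
  have hA : ∀ n : ℕ, Tame (n + 1) (dips O n) := fun n p hp =>
    ⟨mem_closedBall_zero_iff.1 (hO1' (hp.2.2 p.1 (by simp [sqn_zero]))), hp.1, hp.2.1⟩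
  have hN : ∀ n : ℕ, (0 : ℝ) ≤ (n : ℝ) + 1 := fun n => by positivity
  let φ : ℕ → Fn d := fun n => envelope (obst τ (dips O n))
  have hf : ∀ n, Capped τ ρ (φ n) := fun n => capped_envelope hb.le (hN n) (hA n) hr2 hr
  have hanti : ∀ z, Antitone fun n => φ n z := fun z m n hmn =>
    have hsub : dips O m ⊆ dips O n := fun p hp => ⟨hp.1, hp.2.1.trans (by gcongr), hp.2.2⟩
    envelope_anti (insert_subset_insert (image_mono hsub)) (obst_nonempty _ _)
      ⟨_, sub_one_mem_minorants hb.le (hA n)⟩ z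
  have hbdd : ∀ z, BddBelow (range fun n => φ n z) := fun z =>
    ⟨τ * sqn z - 1, by rintro _ ⟨n, rfl⟩; exact (hf n).ge z⟩
  have hlim : ∀ z, Tendsto (fun n => φ n z) atTop (𝓝 (⨅ n, φ n z)) := fun z =>
    tendsto_atTop_ciInf (hanti z) (hbdd z)
  have ha := pshOn_of_antitone_tendsto (fun n => (hf n).psh) hanti
    (m := fun z => τ * sqn z - 1) ((continuous_const.mul continuous_sqn).sub continuous_const)
    (fun n z => (hf n).ge z) hlim
  refine ⟨fun z => (⨅ n, φ n z) + -τ, ha.add_const isOpen_univ _, fun z hz => ?_, fun z hz => ?_, ?_⟩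
  · have h1 := ciInf_le (hbdd z) 0
    have h2 := (hf 0).le z
    nlinarith
  · obtain ⟨n, K, hnK⟩ := exists_dip hO hz
    have h1 := ciInf_le (hbdd z) n
    have h2 : φ n z ≤ τ * sqn z + K * sqn (z - z) - 1 :=
      envelope_le ⟨_, sub_one_mem_minorants hb.le (hA n)⟩ fun a ha =>
        ha.2 _ (mem_insert_of_mem _ ⟨(z, K), hnK, rfl⟩) z
    have h3 : sqn z < 1 := hO1 hz
    rw [sub_self, sqn_zero, mul_zero, add_zero] at h2
    nlinarith
  · have hsub : {z : Cn d | sqn z < 1 ∧ (⨅ n, φ n z) + -τ < -μ} ⊆ ⋃ n, {z | φ n z < τ * sqn z} := by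
      rintro z ⟨-, hz⟩
      have h1 : (⨅ n, φ n z) < 0 := by linarith
      obtain ⟨n, hn⟩ := exists_lt_of_ciInf_lt h1
      exact mem_iUnion.2 ⟨n, hn.trans_le (mul_nonneg hb.le (sqn_nonneg z))⟩
    refine (measure_mono hsub).trans ?_
    have hmon : Monotone fun n => {z | φ n z < τ * sqn z} := fun m n hmn z hz =>
      lt_of_le_of_lt (hanti z hmn) hz
    rw [hmon.measure_iUnion]
    refine iSup_le fun n => ?_
    obtain ⟨C, hC0, hC⟩ := (hf n).second
    obtain ⟨B, hB⟩ := (hf n).psh.ae_hasTaylorTwo (hf n).cont hC0 hC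
    obtain ⟨h1, h2⟩ := volume_noncontact_le hb.le (hN n) (hA n) hr2 hr hO.measurableSet hO1'
      (fun p hp z hz => hp.2.2 z hz) hB
    have h3 := h2.trans (hmass (φ n) (hf n) B hB h1)
    have h4 : volume.real {z | φ n z < τ * sqn z} ≤ μ := le_of_mul_le_mul_left h3 (by positivity)
    rw [← ENNReal.ofReal_toReal
      ((measure_mono (hf n).subset_ball).trans_lt measure_ball_lt_top).ne]
    exact ENNReal.ofReal_le_ofReal h4

/-- The capacity estimate: an increasing sequence of plurisubharmonic functions converges
quasi-uniformly. -/
theorem exists_index_capacity {h : ℕ → Fn d} {H : Fn d}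
    (hpsh : ∀ i, PshOn (h i) {z | sqn z < 9}) (h0 : ∀ i z, sqn z < 9 → 0 ≤ h i z)
    (h1 : ∀ i z, sqn z < 9 → h i z ≤ 1) (hmono : ∀ z, sqn z < 9 → Monotone fun i => h i z)
    (hlim : ∀ᵐ z, sqn z < 9 → Tendsto (fun i => h i z) atTop (𝓝 (H z)))
    (hle : ∀ i z, sqn z < 9 → h i z ≤ H z)
    (hH : ContinuousOn H {z | sqn z < 9}) {η : ℝ} (ha : 0 < η) (hb : 0 < μ) :
    ∃ i, ∃ p : Fn d, PshOn p univ ∧ (∀ z, sqn z < 1 → p z ≤ 0) ∧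
      (∀ z, sqn z < 1 → h i z < H z - η → p z ≤ -1) ∧
      volume {z | sqn z < 1 ∧ p z < -μ} ≤ ENNReal.ofReal μ := by
  classical
  have hs := continuous_sqn (d := d)
  let W : Set (Cn d) := {z | sqn z < 8}
  have hW : IsOpen W := isOpen_lt hs continuous_const
  let q : Fn d := fun z => 1 * sqn z + -4
  let k : ℕ → Fn d := fun i z => if z ∈ W then max (h i z) (q z) else q z
  let L : Fn d := fun z => if z ∈ W then max (H z) (q z) else q z
  have hW9 : ∀ z ∈ W, sqn z < 9 := fun z hz => lt_trans hz (by norm_num)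
  have hk : ∀ i, PshOn (k i) univ := fun i => by
    refine PshOn.glue hW isOpen_univ ((hpsh i).mono hW9)
      (((pshOn_sqn univ).const_mul zero_le_one).add_const isOpen_univ _) fun x _ hx => ?_
    have hx' : 8 ≤ sqn x := not_lt.1 hx
    filter_upwards [hs.continuousAt.eventually (lt_mem_nhds (show 5 < sqn x by linarith))]
      with y hy hyW
    have := h1 i y (hW9 y hyW)
    linarith
  have hkm : ∀ z, Monotone fun i => k i z := fun z i j hij => by
    by_cases hz : z ∈ W
    · simp only [k, hz, if_true]
      exact max_le_max_right _ (hmono z (hW9 z hz) hij)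
    · simp only [k, hz, if_false, le_refl]
  have hk1 : ∀ i j z, k j z - k i z ≤ 1 := fun i j z => by
    by_cases hz : z ∈ W
    · simp only [k, hz, if_true]
      have a1 := h0 i z (hW9 z hz)
      have a2 := h1 j z (hW9 z hz)
      have a3 := le_max_left (h i z) (q z)
      have a4 := le_max_right (h i z) (q z)
      rcases max_cases (h j z) (q z) with ⟨e, -⟩ | ⟨e, -⟩ <;> rw [e] <;> linarith
    · simp only [k, hz, if_false]; linarith
  have hkl : ∀ᵐ z, Tendsto (fun i => k i z) atTop (𝓝 (L z)) := by
    filter_upwards [hlim] with z hz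
    by_cases hzW : z ∈ W
    · simp only [k, L, hzW, if_true]
      exact (hz (hW9 z hzW)).max tendsto_const_nhds
    · simp only [k, L, hzW, if_false]
      exact tendsto_const_nhds
  set τ := μ / 2 with ht
  have ht0 : 0 < τ := by positivity
  set ρ := 3 + 1 / τ with hr
  have ht1 : 0 < 1 / τ := by positivity
  have hr3 : 3 ≤ ρ := by linarith
  have hr1 : 1 ≤ τ * (ρ - 2) ^ 2 := by
    have e : τ * (ρ - 2) ^ 2 = τ + 2 + 1 / τ := by rw [hr]; field_simp; ring
    linarith
  obtain ⟨i, hi⟩ := exists_index_integral_le (d := d) (τ := τ) (ρ := ρ) (m := 1)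
    (ε := η * (d.factorial * τ ^ d * μ)) ht0.le (by linarith) (by positivity) hk hkm (e := -4)
    (fun i z hz => by
      have h5 : 5 ≤ sqn z := by nlinarith [norm_sq_le_sqn z]
      by_cases hzW : z ∈ W
      · simp only [k, hzW, if_true, q]
        exact max_eq_right (by linarith [h1 i z (hW9 z hzW)])
      · simp only [k, hzW, if_false, q]) hk1 hkl
  let O : Set (Cn d) := {z | sqn z < 1 ∧ h i z < H z - η}
  have hO : IsOpen O := by
    rw [isOpen_iff_mem_nhds]
    rintro z ⟨hz1, hz2⟩
    have hz9 : z ∈ {z : Cn d | sqn z < 9} := lt_trans hz1 (by norm_num)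
    have ho : IsOpen {z : Cn d | sqn z < 9} := isOpen_lt hs continuous_const
    obtain ⟨c, hc1, hc2⟩ := exists_between hz2
    have e1 := (hpsh i).usc z hz9 c hc1
    rw [ho.nhdsWithin_eq hz9] at e1
    have e2 := (hH.continuousAt (ho.mem_nhds hz9)).eventually (lt_mem_nhds (show c + η < H z by linarith))
    filter_upwards [e1, e2, (isOpen_lt hs continuous_const).mem_nhds hz1] with y a1 a2 a3
    exact ⟨a3, by linarith⟩
  have hkh : ∀ z, sqn z < 1 → k i z = h i z ∧ L z = H z := fun z hz => by
    have hzW : z ∈ W := lt_trans hz (by norm_num)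
    have a1 := h0 i z (hW9 z hzW)
    have a2 := hle i z (hW9 z hzW)
    simp only [k, L, hzW, if_true, q]
    exact ⟨max_eq_left (by linarith), max_eq_left (by linarith)⟩
  obtain ⟨p, hp, hp0, hp1, hpv⟩ := exists_pshOn_of_mass_le hO (fun z hz => hz.1) hb
    (show 2 ≤ ρ by linarith) hr1 fun φ hf B hB hint => by
      obtain ⟨a1, a2⟩ := hi φ hf B hB
      have hnn : ∀ᵐ z, 0 ≤ (L z - k i z) * maB (B z) := by
        filter_upwards [hkl, hB] with z hz hzB
        exact mul_nonneg (sub_nonneg.2 ((hkm z).ge_of_tendsto hz i)) (hzB.maB_nonneg hf.cont hf.psh)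
      have a3 : ∫ z in O, η * maB (B z) ≤ ∫ z in O, (L z - k i z) * maB (B z) := by
        refine setIntegral_mono_on_ae (hint.const_mul η) a1.integrableOn hO.measurableSet ?_
        filter_upwards [hB] with z hzB hzO
        obtain ⟨e1, e2⟩ := hkh z hzO.1
        rw [e1, e2]
        exact mul_le_mul_of_nonneg_right (by linarith [hzO.2]) (hzB.maB_nonneg hf.cont hf.psh)
      have a4 := setIntegral_le_integral (s := O) a1 hnn
      rw [integral_const_mul] at a3
      exact le_of_mul_le_mul_left (a3.trans (a4.trans a2)) ha
  exact ⟨i, p, hp, hp0, fun z hz hz' => hp1 z ⟨hz, hz'⟩, hpv⟩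

end Capacity

section Holomorphic

variable {E F G : Type*} [NormedAddCommGroup E] [NormedSpace ℂ E]
  [NormedAddCommGroup F] [NormedSpace ℂ F] [NormedAddCommGroup G] [NormedSpace ℂ G]
variable {f g : E → F} {r : ℝ} {V : Set E} {x : E}

/-- `f` is holomorphic on a neighbourhood of `x`. -/
def HolAt (f : E → F) (x : E) : Prop := ∀ᶠ y in 𝓝 x, DifferentiableAt ℂ f y

lemma DifferentiableOn.holAt (hf : DifferentiableOn ℂ f V) (hV : IsOpen V)
    (hx : x ∈ V) : HolAt f x := by
  filter_upwards [hV.mem_nhds hx] with y hy using hf.differentiableAt (hV.mem_nhds hy)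

lemma HolAt.eventually (hf : HolAt f x) : ∀ᶠ y in 𝓝 x, HolAt f y := eventually_eventually_nhds.2 hf

lemma HolAt.continuousAt (hf : HolAt f x) : ContinuousAt f x := hf.self_of_nhds.continuousAt

lemma HolAt.mul {f g : E → ℂ} (hf : HolAt f x) (hg : HolAt g x) : HolAt (fun y => f y * g y) x := by
  filter_upwards [hf, hg] with y h1 h2 using h1.mul h2

lemma HolAt.prodMk {g : E → G} (hf : HolAt f x) (hg : HolAt g x) :
    HolAt (fun y => (f y, g y)) x := by filter_upwards [hf, hg] with y h1 h2 using h1.prodMk h2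

lemma HolAt.comp {f : F → G} (hf : HolAt f (g x)) (hg : HolAt g x) :
    HolAt (fun y => f (g y)) x := by
  filter_upwards [hg, hg.continuousAt.eventually hf] with y h1 h2 using h2.comp y h1

lemma Differentiable.holAt (hf : Differentiable ℂ f) (x : E) : HolAt f x := .of_forall fun y => hf y

lemma HolAt.comp_eq {f : F → G} {z : F} (hf : HolAt f z) (hg : HolAt g x)
    (hz : g x = z) : HolAt (fun y => f (g y)) x := by subst hz; exact hf.comp hg

lemma HolAt.analyticAt {f : ℂ → ℂ} {x : ℂ} (hf : HolAt f x) : AnalyticAt ℂ f x :=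
  Complex.analyticAt_iff_eventually_differentiableAt.2 hf

lemma norm_fderiv_le_of_forall_norm_le {f : E → ℂ} {M : ℝ} (hr : 0 < r)
    (hf : DifferentiableOn ℂ f (ball x r)) (hM : ∀ y ∈ ball x r, ‖f y‖ ≤ M) :
    ‖fderiv ℂ f x‖ ≤ 2 * M / r := by
  refine Complex.norm_fderiv_le_div_of_mapsTo_ball hf (fun y hy => ?_) hr
  rw [mem_closedBall, dist_eq_norm]
  have h1 := hM y hy
  have h2 := hM x (mem_ball_self hr)
  have := norm_sub_le (f y) (f x)
  linarith

lemma continuousOn_fderiv_of_differentiableOn [FiniteDimensional ℂ E] {f : E → ℂ}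
    (hV : IsOpen V) (hf : DifferentiableOn ℂ f V) : ContinuousOn (fderiv ℂ f) V := by
  have := FiniteDimensional.proper ℂ E
  intro x hx
  refine ContinuousAt.continuousWithinAt ?_
  obtain ⟨r, hr, hrV⟩ := Metric.nhds_basis_closedBall.mem_iff.1 (hV.mem_nhds hx)
  have huc := (isCompact_closedBall x r).uniformContinuousOn_of_continuous
    (hf.continuousOn.mono hrV)
  rw [Metric.continuousAt_iff']
  intro ε hc
  set C : ℝ := ε * r / 16 with hC
  have hCpos : 0 < C := by positivity
  obtain ⟨a, ha, ha'⟩ := Metric.uniformContinuousOn_iff.1 huc C hCpos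
  filter_upwards [ball_mem_nhds x (lt_min ha (half_pos hr))] with y hy
  obtain ⟨hy1, hy2⟩ := lt_min_iff.1 (mem_ball.1 hy)
  have hsub : ∀ v ∈ ball (0 : E) (r / 2), y + v ∈ closedBall x r ∧ x + v ∈ closedBall x r := by
    intro v hv
    rw [mem_ball_zero_iff] at hv
    rw [dist_eq_norm] at hy2
    constructor <;> rw [mem_closedBall, dist_eq_norm]
    · calc ‖y + v - x‖ = ‖(y - x) + v‖ := by congr 1; abel
        _ ≤ ‖y - x‖ + ‖v‖ := norm_add_le _ _
        _ ≤ r := by linarith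
    · simp; linarith
  have hd : ∀ p v, p + v ∈ closedBall x r → HasFDerivAt (fun v => f (p + v)) (fderiv ℂ f (p + v)) v :=
    fun p v hp => by
    have h := (hf.differentiableAt (hV.mem_nhds (hrV hp))).hasFDerivAt.comp v
      ((hasFDerivAt_id v).const_add p)
    rwa [ContinuousLinearMap.comp_id] at h
  have hd' : ∀ v ∈ ball (0 : E) (r / 2), HasFDerivAt (fun v => (f (y + v) - f (x + v)) / C)
      ((C : ℂ)⁻¹ • (fderiv ℂ f (y + v) - fderiv ℂ f (x + v))) v := fun v hv => by
    simp only [div_eq_inv_mul]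
    exact ((hd y v (hsub v hv).1).sub (hd x v (hsub v hv).2)).const_mul (C : ℂ)⁻¹
  have hb := norm_fderiv_le_of_forall_norm_le (M := 1) (half_pos hr)
    (fun v hv => (hd' v hv).differentiableAt.differentiableWithinAt) (fun v hv => by
      rw [norm_div, Complex.norm_real, norm_of_nonneg hCpos.le, div_le_one hCpos, ← dist_eq_norm]
      refine (ha' _ (hsub v hv).1 _ (hsub v hv).2 ?_).le
      simpa using hy1)
  rw [(hd' 0 (mem_ball_self (half_pos hr))).fderiv, norm_smul, norm_inv, Complex.norm_real,
    norm_of_nonneg hCpos.le, add_zero, add_zero, inv_mul_le_iff₀ hCpos] at hb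
  rw [dist_eq_norm]
  refine hb.trans_lt ?_
  have : C * (2 * 1 / (r / 2)) = ε * (4 / 16) := by rw [hC]; field_simp; ring
  rw [this]; linarith

lemma differentiableOn_circleIntegral [FiniteDimensional ℂ E] {φ : ℂ × E → ℂ} {Ω : Set (ℂ × E)}
    (hO : IsOpen Ω) (hf : DifferentiableOn ℂ φ Ω) {P : Set E} (hP : IsOpen P) (hr : 0 ≤ r)
    (hsub : sphere (0 : ℂ) r ×ˢ P ⊆ Ω) :
    DifferentiableOn ℂ (fun y => ∮ t in C(0, r), φ (t, y)) P := by
  have := FiniteDimensional.proper ℂ E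
  intro y₀ hy0
  refine DifferentiableAt.differentiableWithinAt ?_
  obtain ⟨ε, hb, hbP⟩ := Metric.nhds_basis_closedBall.mem_iff.1 (hP.mem_nhds hy0)
  have hmem : ∀ a : ℝ, ∀ y ∈ closedBall y₀ ε, (circleMap 0 r a, y) ∈ Ω := fun a y hy =>
    hsub ⟨circleMap_mem_sphere 0 hr a, hbP hy⟩
  have hC : IsCompact (sphere (0 : ℂ) r ×ˢ closedBall y₀ ε) :=
    (isCompact_sphere 0 r).prod (isCompact_closedBall y₀ ε)
  have hcont := continuousOn_fderiv_of_differentiableOn hO hf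
  have hsub' : sphere (0 : ℂ) r ×ˢ closedBall y₀ ε ⊆ Ω := fun p hp => hsub ⟨hp.1, hbP hp.2⟩
  obtain ⟨M, hM⟩ := (hC.image_of_continuousOn (hcont.mono hsub')).isBounded.exists_norm_le
  have hcm : ∀ y ∈ closedBall y₀ ε, Continuous fun a => φ (circleMap 0 r a, y) := fun y hy =>
    hf.continuousOn.comp_continuous ((continuous_circleMap 0 r).prodMk continuous_const)
      fun a => hmem a y hy
  have hderiv : Continuous fun a => deriv (circleMap 0 r) a := by simp; fun_prop
  have hy0' : y₀ ∈ closedBall y₀ ε := mem_closedBall_self hb.le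
  refine HasFDerivAt.differentiableAt (𝕜 := ℂ) (f' := ∫ a in (0 : ℝ)..2 * Real.pi,
    deriv (circleMap 0 r) a • (fderiv ℂ φ (circleMap 0 r a, y₀)).comp
      (ContinuousLinearMap.inr ℂ ℂ E)) ?_
  simp only [circleIntegral, intervalIntegral.integral_of_le Real.two_pi_pos.le]
  refine hasFDerivAt_integral_of_dominated_of_fderiv_le (𝕜 := ℂ) (bound := fun _ => r * M)
    (F' := fun y a => deriv (circleMap 0 r) a • (fderiv ℂ φ (circleMap 0 r a, y)).comp
      (ContinuousLinearMap.inr ℂ ℂ E)) (closedBall_mem_nhds y₀ hb) ?_ ?_ ?_ ?_ ?_ ?_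
  · filter_upwards [closedBall_mem_nhds y₀ hb] with y hy
    exact (hderiv.smul (hcm y hy)).aestronglyMeasurable
  · exact ((hderiv.smul (hcm y₀ hy0')).integrableOn_Icc).mono_set Ioc_subset_Icc_self
  · refine (hderiv.smul ?_).aestronglyMeasurable
    exact (hcont.comp_continuous ((continuous_circleMap 0 r).prodMk continuous_const)
      fun a => hmem a y₀ hy0').clm_comp continuous_const
  · refine .of_forall fun a y hy => ?_
    rw [norm_smul]
    have h1 : ‖deriv (circleMap 0 r) a‖ = r := by simp [abs_of_nonneg hr]
    have h2 := hM _ ⟨(circleMap 0 r a, y), ⟨circleMap_mem_sphere 0 hr a, hy⟩, rfl⟩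
    have h3 := ContinuousLinearMap.opNorm_comp_le (fderiv ℂ φ (circleMap 0 r a, y))
      (ContinuousLinearMap.inr ℂ ℂ E)
    have h4 := ContinuousLinearMap.norm_inr_le_one ℂ ℂ E
    have h5 := mul_le_mul_of_nonneg_left h4 (norm_nonneg (fderiv ℂ φ (circleMap 0 r a, y)))
    rw [h1]
    exact mul_le_mul_of_nonneg_left (by linarith) hr
  · exact integrable_const _
  · refine .of_forall fun a y hy => ?_
    have h := (hf.differentiableAt (hO.mem_nhds (hmem a y hy))).hasFDerivAt
    exact (h.comp y (hasFDerivAt_prodMk_right (circleMap 0 r a) y)).const_smul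
      (deriv (circleMap 0 r) a)

/-- The derivative of `f` in the direction `v`. -/
def dirDeriv (v : E) (f : E → ℂ) (x : E) : ℂ := fderiv ℂ f x v

lemma HolAt.dirDeriv [FiniteDimensional ℂ E] {f : E → ℂ} (hf : HolAt f x) (v : E) :
    HolAt (dirDeriv v f) x := by
  obtain ⟨V, hVsub, hV, hxV⟩ := _root_.mem_nhds_iff.1 hf
  have hfV : DifferentiableOn ℂ f V := fun y hy => (hVsub hy).differentiableWithinAt
  have hO0 : IsOpen {p : ℂ × E | p.2 + p.1 • v ∈ V} := hV.preimage (by fun_prop)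
  have hcomp := isCompact_singleton (x := (0 : ℂ))
  have hev : ∀ᶠ p : ℂ × E in 𝓝 (0, x), p.2 + p.1 • v ∈ V := hO0.mem_nhds (by simpa using hxV)
  rw [nhds_prod_eq] at hev
  obtain ⟨pa, hpa, pb, hpb, hab⟩ := eventually_prod_iff.1 hev
  obtain ⟨r, hr, hrs⟩ := Metric.nhds_basis_closedBall.mem_iff.1 hpa
  obtain ⟨P, hPsub, hP, hxP⟩ := _root_.mem_nhds_iff.1 hpb
  have hint := differentiableOn_circleIntegral (E := E)
    (φ := fun p => (p.1 ^ 2)⁻¹ * f (p.2 + p.1 • v))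
    (Ω := {p : ℂ × E | p.2 + p.1 • v ∈ V} ∩ {p | p.1 ≠ 0})
    (hO0.inter (isOpen_ne_fun (by fun_prop) (by fun_prop))) (fun p hp => by
      refine DifferentiableAt.differentiableWithinAt ?_
      have h1 := hfV.differentiableAt (hV.mem_nhds hp.1)
      refine ((differentiableAt_fst.pow 2).inv (pow_ne_zero 2 hp.2)).mul ?_
      exact h1.comp p (by fun_prop : DifferentiableAt ℂ (fun p : ℂ × E => p.2 + p.1 • v) p))
    hP hr.le (fun p hp => ⟨hab (hrs (sphere_subset_closedBall hp.1)) (hPsub hp.2), fun h => by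
      have := hp.1; rw [mem_sphere_zero_iff_norm, h, norm_zero] at this; exact hr.ne this⟩)
  have hevP : ∀ y ∈ P, _root_.dirDeriv v f y =
      (2 * Real.pi * I : ℂ)⁻¹ * ∮ t in C(0, r), (t ^ 2)⁻¹ * f (y + t • v) := by
    intro y hy
    have hg : DifferentiableOn ℂ (fun t : ℂ => f (y + t • v)) {t | y + t • v ∈ V} := fun t ht =>
      ((hfV.differentiableAt (hV.mem_nhds ht)).comp t
        (by fun_prop : DifferentiableAt ℂ (fun t : ℂ => y + t • v) t)).differentiableWithinAt
    have h1 := Complex.cderiv_eq_deriv (U := {t | y + t • v ∈ V}) (z := 0)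
      (hV.preimage (by fun_prop)) hg hr (fun t ht => hab (hrs ht) (hPsub hy))
    have h2 : HasDerivAt (fun t : ℂ => f (y + t • v)) (fderiv ℂ f y v) 0 := by
      have h3 : HasFDerivAt f (fderiv ℂ f y) (y + (0 : ℂ) • v) := by
        rw [zero_smul, add_zero]
        exact (hVsub (by simpa using hab (hrs (mem_closedBall_self hr.le)) (hPsub hy))).hasFDerivAt
      have h4 : HasDerivAt (fun t : ℂ => y + t • v) v 0 := by
        simpa using ((hasDerivAt_id (0 : ℂ)).smul_const v).const_add y
      exact h3.comp_hasDerivAt 0 h4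
    rw [h2.deriv] at h1
    rw [_root_.dirDeriv, ← h1, Complex.cderiv]
    simp [smul_eq_mul]
  refine DifferentiableOn.holAt (V := P) ?_ hP hxP
  exact (hint.const_mul (2 * Real.pi * I : ℂ)⁻¹).congr hevP

end Holomorphic

lemma AnalyticOnNhd.exists_eq_prod_sub_mul {f : ℂ → ℂ} {R : ℝ} (hR : 0 < R)
    (hf : AnalyticOnNhd ℂ f (closedBall 0 R)) (hne : ∃ t ∈ closedBall (0 : ℂ) R, f t ≠ 0) :
    ∃ (m : ℕ) (s : Fin m → ℂ) (q : ℂ → ℂ), AnalyticOnNhd ℂ q (closedBall 0 R) ∧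
      (∀ t ∈ closedBall (0 : ℂ) R, q t ≠ 0) ∧ (∀ i, s i ∈ closedBall (0 : ℂ) R) ∧
      ∀ t ∈ closedBall (0 : ℂ) R, f t = (∏ i, (t - s i)) * q t := by
  obtain ⟨t₀, ht0, hft0⟩ := hne
  have hfin := (MeromorphicOn.divisor f (closedBall 0 R)).finiteSupport (isCompact_closedBall 0 R)
  obtain ⟨q, hq, hq0, hfq⟩ := MeromorphicOn.extract_zeros_poles (U := closedBall 0 R)
    hf.meromorphicOn (fun u => by
      refine MeromorphicOn.meromorphicOrderAt_ne_top_of_isPreconnected hf.meromorphicOn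
        (convex_closedBall 0 R).isPreconnected ht0 u.2 ?_
      rw [(hf t₀ ht0).meromorphicOrderAt_eq, ((hf t₀ ht0).analyticOrderAt_eq_zero).2 hft0]
      simp) hfin
  set D := MeromorphicOn.divisor f (closedBall (0 : ℂ) R)
  have hD : ∀ u, ((D u).toNat : ℤ) = D u := fun u => Int.toNat_of_nonneg (MeromorphicOn.AnalyticOnNhd.divisor_nonneg hf u)
  set a := Σ u : hfin.toFinset, Fin (D u).toNat
  let e := Fintype.equivFin a
  refine ⟨Fintype.card a, fun i => (e.symm i).1, q, hq, fun t ht => hq0 ⟨t, ht⟩,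
    fun i => D.supportWithinDomain (hfin.mem_toFinset.1 (e.symm i).1.2), ?_⟩
  have hprod : ∀ t, (∏ᶠ u, (· - u) ^ D u : ℂ → ℂ) t = ∏ i, (t - (e.symm i).1) := by
    intro t
    rw [Function.FactorizedRational.finprod_eq_fun hfin]
    change ∏ᶠ u, (t - u) ^ D u = _
    rw [e.symm.prod_comp (fun i : a => t - (i.1 : ℂ)), Fintype.prod_sigma,
      finprod_eq_prod_of_mulSupport_subset (s := hfin.toFinset), ← Finset.prod_coe_sort]
    · refine Finset.prod_congr rfl fun u _ => ?_
      change _ = ∏ _y : Fin (D u).toNat, (t - (u : ℂ))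
      rw [Finset.prod_const, Finset.card_univ, Fintype.card_fin, ← zpow_natCast, hD]
    · intro u
      contrapose
      simp_all
  have hcont : ∀ x ∈ closedBall (0 : ℂ) R, ContinuousAt
      (fun t => (∏ i, (t - ((e.symm i).1 : ℂ))) * q t) x := fun x hx =>
    (continuous_finsetProd _ fun i _ => continuous_id.sub continuous_const).continuousAt.mul
      (hq x hx).continuousAt
  refine Set.EqOn.of_subset_closure (s := ball 0 R) (fun t ht => ?_) hf.continuousOn
    (fun x hx => (hcont x hx).continuousWithinAt) ball_subset_closedBall
    (closure_ball (0 : ℂ) hR.ne').ge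
  have htc := ball_subset_closedBall ht
  have hev : ∀ᶠ x in 𝓝[≠] t, f x = (∏ i, (x - ((e.symm i).1 : ℂ))) * q x := by
    filter_upwards [mem_codiscreteWithin_iff_forall_mem_nhdsNE.1 hfq t htc, nhdsWithin_le_nhds (isOpen_ball.mem_nhds ht)] with x hx hxb
    rcases hx with hx | hx
    · rw [← hprod x]; exact hx
    · exact absurd (ball_subset_closedBall hxb) hx
  exact tendsto_nhds_unique_of_eventuallyEq ((hf t htc).continuousAt.mono_left nhdsWithin_le_nhds)
    ((hcont t htc).mono_left nhdsWithin_le_nhds) hev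

lemma exists_roots {f : ℂ → ℂ} {r R : ℝ} (hr : 0 < r) (hrR : r < R)
    (hf : AnalyticOnNhd ℂ f (closedBall 0 R)) (hne : ∀ t : ℂ, r ≤ ‖t‖ → ‖t‖ ≤ R → f t ≠ 0) :
    ∃ (m : ℕ) (s : Fin m → ℂ), (∀ i, ‖s i‖ < r) ∧
      (∀ t ∈ closedBall (0 : ℂ) r, f t = 0 ↔ ∃ i, s i = t) ∧
      (∀ i j, i ≠ j → s i = s j → deriv f (s i) = 0) ∧
      ∀ G : ℂ → ℂ, (∀ t ∈ closedBall (0 : ℂ) r, DifferentiableAt ℂ G t) →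
        (2 * Real.pi * I : ℂ)⁻¹ * (∮ t in C(0, r), G t * (deriv f t / f t)) = ∑ i, G (s i) := by
  have hR := hr.trans hrR
  have hRR : (R : ℂ) ∈ closedBall (0 : ℂ) R := by simp [abs_of_pos hR]
  obtain ⟨m, s, q, hq, hq0, hsR, hfq⟩ := hf.exists_eq_prod_sub_mul hR
    ⟨R, hRR, hne R (by simp [abs_of_pos hR, hrR.le]) (by simp [abs_of_pos hR])⟩
  have hs0 : ∀ i, f (s i) = 0 := fun i => by
    rw [hfq _ (hsR i), Finset.prod_eq_zero (Finset.mem_univ i) (sub_self _), zero_mul]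
  have hsr : ∀ i, ‖s i‖ < r := fun i => by
    by_contra! h
    exact hne _ h (mem_closedBall_zero_iff.1 (hsR i)) (hs0 i)
  have hrsub : closedBall (0 : ℂ) r ⊆ ball 0 R := closedBall_subset_ball hrR
  have hev : ∀ t ∈ closedBall (0 : ℂ) r, f =ᶠ[𝓝 t] fun t => (∏ i, (t - s i)) * q t := fun t ht => by
    filter_upwards [isOpen_ball.mem_nhds (hrsub ht)] with x hx using hfq x (ball_subset_closedBall hx)
  refine ⟨m, s, hsr, fun t ht => ⟨fun h => ?_, ?_⟩, fun i j hij hsij => ?_, fun G hG => ?_⟩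
  · have htR := ball_subset_closedBall (hrsub ht)
    rw [hfq t htR, mul_eq_zero, or_iff_left (hq0 t htR), Finset.prod_eq_zero_iff] at h
    obtain ⟨i, -, hi⟩ := h
    exact ⟨i, (sub_eq_zero.1 hi).symm⟩
  · rintro ⟨i, rfl⟩; exact hs0 i
  · have hi := mem_closedBall_zero_iff.2 (hsr i).le
    have hj : j ∈ Finset.univ.erase i := by simp [hij.symm]
    rw [(hev _ hi).deriv_eq]
    let g : ℂ → ℂ := fun t => ∏ k ∈ (Finset.univ.erase i).erase j, (t - s k)
    have h1 : ∀ t, (∏ k, (t - s k)) * q t = (t - s i) * ((t - s i) * (g t * q t)) := fun t => by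
      rw [← Finset.mul_prod_erase _ _ (Finset.mem_univ i), ← Finset.mul_prod_erase _ _ hj, hsij]
      ring
    simp only [h1]
    have hg : DifferentiableAt ℂ g (s i) := by fun_prop
    have h2 : DifferentiableAt ℂ (fun t => (t - s i) * (g t * q t)) (s i) :=
      (by fun_prop : DifferentiableAt ℂ (fun t => t - s i) (s i)).mul
        (hg.mul (hq _ (hsR i)).differentiableAt)
    have h3 := (((hasDerivAt_id (s i)).sub_const (s i)).mul h2.hasDerivAt).deriv
    simp at h3
    exact h3
  · have hsph : ∀ t ∈ sphere (0 : ℂ) r, ∀ i, t - s i ≠ 0 := fun t ht i h => by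
      have := hsr i
      rw [← sub_eq_zero.1 h, mem_sphere_zero_iff_norm.1 ht] at this
      exact this.false
    have hqr : ∀ t ∈ closedBall (0 : ℂ) r, AnalyticAt ℂ q t ∧ q t ≠ 0 := fun t ht =>
      ⟨hq _ (ball_subset_closedBall (hrsub ht)), hq0 _ (ball_subset_closedBall (hrsub ht))⟩
    have hlog : ∀ t ∈ sphere (0 : ℂ) r,
        G t * (deriv f t / f t) = (∑ i, (t - s i)⁻¹ * G t) + G t * (deriv q t / q t) := by
      intro t ht
      have htc := sphere_subset_closedBall ht
      have h1 : logDeriv f t = logDeriv (fun t => (∏ i, (t - s i)) * q t) t := by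
        rw [logDeriv_apply, logDeriv_apply, (hev t htc).deriv_eq, (hev t htc).eq_of_nhds]
      rw [← logDeriv_apply, h1, logDeriv_mul t
        (Finset.prod_ne_zero_iff.2 fun i _ => hsph t ht i) (hqr t htc).2 (by fun_prop)
        (hqr t htc).1.differentiableAt, logDeriv_prod (fun i _ => hsph t ht i)
        (fun i _ => by fun_prop), mul_add, mul_sum]
      congr 1
      refine sum_congr rfl fun i _ => ?_
      rw [logDeriv_apply, deriv_sub_const, deriv_id'', one_div, mul_comm]
    have hGc : DiffContOnCl ℂ G (ball 0 r) := DifferentiableOn.diffContOnCl (by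
        rw [closure_ball _ hr.ne']; exact fun t ht => (hG t ht).differentiableWithinAt)
    have hq' : DifferentiableOn ℂ (fun t => G t * (deriv q t / q t)) (closedBall 0 r) := fun t ht =>
      ((hG t ht).mul ((hqr t ht).1.deriv.differentiableAt.div (hqr t ht).1.differentiableAt
          (hqr t ht).2)).differentiableWithinAt
    have hq'' : DiffContOnCl ℂ (fun t => G t * (deriv q t / q t)) (ball 0 r) :=
      DifferentiableOn.diffContOnCl (by rwa [closure_ball _ hr.ne'])
    have hint : ∀ i, CircleIntegrable (fun t => (t - s i)⁻¹ * G t) 0 r := fun i =>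
      ContinuousOn.circleIntegrable hr.le (ContinuousOn.mul (ContinuousOn.inv₀ (by fun_prop)
        fun t ht => hsph t ht i) fun t ht =>
          (hG t (sphere_subset_closedBall ht)).continuousAt.continuousWithinAt)
    rw [circleIntegral.integral_congr hr.le hlog, circleIntegral.integral_add
      (CircleIntegrable.fun_sum _ fun i _ => hint i)
      ((hq'.continuousOn.mono sphere_subset_closedBall).circleIntegrable hr.le),
      hq''.circleIntegral_eq_zero hr.le, add_zero, circleIntegral.integral_fun_sum fun i _ => hint i, mul_sum]
    refine sum_congr rfl fun i _ => ?_
    simpa using hGc.two_pi_i_inv_smul_circleIntegral_sub_inv_smul (mem_ball_zero_iff.2 (hsr i))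

section Roots

lemma eventually_forall_mem_compact {E : Type*} [TopologicalSpace E] {K : Set ℂ} (hK : IsCompact K)
    {p : ℂ × E → Prop} {y₀ : E} (h : ∀ t ∈ K, ∀ᶠ q in 𝓝 (t, y₀), p q) :
    ∀ᶠ y in 𝓝 y₀, ∀ t ∈ K, p (t, y) := hK.eventually_forall_of_forall_eventually fun t ht =>
    (continuous_swap.tendsto (y₀, t)).eventually (h t ht)

variable {E : Type*} [NormedAddCommGroup E] [NormedSpace ℂ E]

/-- `s y` enumerates, with multiplicities, the zeros of `F (·, y)` in the disc of radius `r`. -/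
structure RootSystem (F : ℂ × E → ℂ) (r : ℝ) (P : Set E) (m : ℕ) (s : E → Fin m → ℂ) : Prop where
  pos : 0 < r
  isOpen : IsOpen P
  holAt : ∀ y ∈ P, ∀ t : ℂ, ‖t‖ ≤ r → HolAt F (t, y)
  norm_lt : ∀ y ∈ P, ∀ i, ‖s y i‖ < r
  eq_zero_iff : ∀ y ∈ P, ∀ t : ℂ, ‖t‖ ≤ r → (F (t, y) = 0 ↔ ∃ i, s y i = t)
  simple : ∀ y ∈ P, ∀ i j, i ≠ j → s y i = s y j → dirDeriv (1, 0) F (s y i, y) = 0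
  holAt_sum : ∀ H : ℂ × E → ℂ, ∀ y ∈ P, (∀ t : ℂ, ‖t‖ ≤ r → HolAt H (t, y)) →
    HolAt (fun y => ∑ i, H (s y i, y)) y

variable {F : ℂ × E → ℂ} {t : ℂ} {y y₀ : E}

lemma deriv_slice (h : DifferentiableAt ℂ F (t, y)) :
    deriv (fun t => F (t, y)) t = dirDeriv (1, 0) F (t, y) :=
  (h.hasFDerivAt.comp_hasDerivAt t ((hasDerivAt_id t).prodMk (hasDerivAt_const t y))).deriv

lemma DifferentiableAt.slice (h : DifferentiableAt ℂ F (t, y)) :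
    DifferentiableAt ℂ (fun t => F (t, y)) t :=
  h.comp t (by fun_prop : DifferentiableAt ℂ (fun t : ℂ => (t, y)) t)

lemma HolAt.slice (h : HolAt F (t, y)) :
    HolAt (fun t => F (t, y)) t :=
  HolAt.comp (g := fun t : ℂ => (t, y)) h (Differentiable.holAt (by fun_prop) t)

lemma RootSystem.eventually_norm_lt {r : ℝ} {P : Set E} {m : ℕ} {s : E → Fin m → ℂ}
    (h : RootSystem F r P m s) (hy0 : y₀ ∈ P)
    (h0 : ∀ t : ℂ, ‖t‖ ≤ r → t ≠ 0 → F (t, y₀) ≠ 0) {ε : ℝ} (ha : 0 < ε) :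
    ∀ᶠ y in 𝓝 y₀, ∀ t : ℂ, ‖t‖ ≤ r → F (t, y) = 0 → ‖t‖ < ε := by
  have := eventually_forall_mem_compact ((isCompact_closedBall (0 : ℂ) r).diff
    (isOpen_ball (x := (0 : ℂ)) (ε := ε))) (p := fun q => F q ≠ 0) (y₀ := y₀) fun t ht =>
    (h.holAt y₀ hy0 t (by simpa using ht.1)).continuousAt.eventually_ne
      (h0 t (by simpa using ht.1) (by rintro rfl; exact ht.2 (mem_ball_self ha)))
  filter_upwards [this] with y hy t ht hF
  by_contra hlt
  exact hy t ⟨by simpa using ht, by simpa using hlt⟩ hF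

variable [FiniteDimensional ℂ E]

lemma exists_rootSystem (hF : HolAt F (0, y₀))
    (h0 : ∀ᶠ t in 𝓝[≠] 0, F (t, y₀) ≠ 0) {N : Set (ℂ × E)} (hN : N ∈ 𝓝 (0, y₀)) :
    ∃ (r : ℝ) (P : Set E) (m : ℕ) (s : E → Fin m → ℂ), RootSystem F r P m s ∧ y₀ ∈ P ∧
      closedBall 0 r ×ˢ P ⊆ N ∧ ∀ t : ℂ, ‖t‖ ≤ r → t ≠ 0 → F (t, y₀) ≠ 0 := by
  have hev : ∀ᶠ t : ℂ in 𝓝 0, (t ≠ 0 → F (t, y₀) ≠ 0) ∧ HolAt F (t, y₀) ∧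
      ∀ᶠ q in 𝓝 (t, y₀), q ∈ N := by
    have hc : Tendsto (fun t : ℂ => (t, y₀)) (𝓝 0) (𝓝 (0, y₀)) := by
      apply Continuous.tendsto' (by fun_prop); rfl
    filter_upwards [eventually_nhdsWithin_iff.1 h0, hc.eventually hF.eventually,
      hc.eventually (eventually_eventually_nhds.2 hN)] with t h1 h2 h3 using ⟨h1, h2, h3⟩
  obtain ⟨R, hR, hRs⟩ := Metric.nhds_basis_closedBall.mem_iff.1 hev
  have hr : 0 < R / 2 := by positivity
  have hrR : R / 2 < R := by linarith
  have e1 := eventually_forall_mem_compact ((isCompact_closedBall 0 R).diff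
    (isOpen_ball (x := 0) (ε := R / 2))) (p := fun q => F q ≠ 0) (y₀ := y₀) fun t ht =>
    (hRs ht.1).2.1.continuousAt.eventually_ne ((hRs ht.1).1 (by
      rintro rfl; exact ht.2 (mem_ball_self hr)))
  have e2 := eventually_forall_mem_compact (isCompact_closedBall 0 R)
    (p := fun q => HolAt F q ∧ q ∈ N) (y₀ := y₀) fun t ht =>
    (hRs ht).2.1.eventually.and (hRs ht).2.2
  obtain ⟨ε, hg, hgs⟩ := Metric.nhds_basis_ball.mem_iff.1 (e1.and e2)
  have hne : ∀ y ∈ ball y₀ ε, ∀ t : ℂ, R / 2 ≤ ‖t‖ → ‖t‖ ≤ R → F (t, y) ≠ 0 := fun y hy t h1 h2 =>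
    (hgs hy).1 t ⟨by simpa using h2, by simpa using h1⟩
  have hhol : ∀ y ∈ ball y₀ ε, ∀ t : ℂ, ‖t‖ ≤ R → HolAt F (t, y) := fun y hy t ht =>
    ((hgs hy).2 t (by simpa using ht)).1
  have hder : ∀ y ∈ ball y₀ ε, ∀ t : ℂ, ‖t‖ ≤ R / 2 →
      deriv (fun t => F (t, y)) t = dirDeriv (1, 0) F (t, y) := fun y hy t ht =>
    deriv_slice (hhol y hy t (by linarith)).self_of_nhds
  choose! m s hs1 hs2 hs3 hs4 using fun (y : E) (hy : y ∈ ball y₀ ε) =>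
    exists_roots (f := fun t => F (t, y)) hr hrR
      (fun t ht => ((hhol y hy t (by simpa using ht)).slice).analyticAt) (hne y hy)
  have hsum : ∀ H : ℂ × E → ℂ, ∀ y ∈ ball y₀ ε, (∀ t : ℂ, ‖t‖ ≤ R / 2 → HolAt H (t, y)) →
      HolAt (fun y => ∑ i, H (s y i, y)) y := by
    intro H y hy hH
    set φ : ℂ × E → ℂ := fun p => H p * (dirDeriv (1, 0) F p / F p) with hk
    have e3 := eventually_forall_mem_compact (isCompact_sphere (0 : ℂ) (R / 2))
      (p := fun q => HolAt φ q) (y₀ := y) fun t ht => by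
        rw [mem_sphere_zero_iff_norm] at ht
        have h1 := hhol y hy t (by linarith)
        refine HolAt.eventually ?_
        filter_upwards [hH t ht.le, h1, h1.dirDeriv (1, 0), h1.continuousAt.eventually_ne
          (hne y hy t ht.ge (by linarith))] with q a b c d
        simp only [hk, div_eq_mul_inv]
        exact a.mul (c.mul (b.inv d))
    have e4 := eventually_forall_mem_compact (isCompact_closedBall (0 : ℂ) (R / 2))
      (p := fun q => HolAt H q) (y₀ := y) fun t ht => (hH t (by simpa using ht)).eventually
    obtain ⟨P', hP's, hP', hyP'⟩ := _root_.mem_nhds_iff.1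
      ((e3.and e4).and (isOpen_ball.mem_nhds hy))
    have hd := differentiableOn_circleIntegral (φ := φ) (Ω := {q | HolAt φ q})
      (isOpen_iff_eventually.2 fun q hq => HolAt.eventually hq)
      (fun q hq => (HolAt.eventually hq).self_of_nhds.self_of_nhds.differentiableWithinAt)
      hP' hr.le (fun q hq => (hP's hq.2).1.1 q.1 hq.1)
    refine DifferentiableOn.holAt (V := P') ?_ hP' hyP'
    refine (hd.const_mul (2 * Real.pi * I : ℂ)⁻¹).congr fun z hz => ?_
    have hz' := hP's hz
    rw [← hs4 z hz'.2 (fun t => H (t, z)) fun t ht => (hz'.1.2 t ht).slice.self_of_nhds]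
    congr 1
    refine circleIntegral.integral_congr hr.le fun t ht => ?_
    simp only [hk]
    rw [hder z hz'.2 t (mem_sphere_zero_iff_norm.1 ht).le]
  have hm : ∀ y ∈ ball y₀ ε, m y = m y₀ := by
    have hcont : ContinuousOn (fun y => (m y : ℂ)) (ball y₀ ε) := fun y hy => by
      have := (hsum (fun _ => 1) y hy fun t _ => Differentiable.holAt (by fun_prop) _).continuousAt
      simpa using this.continuousWithinAt
    intro y hy
    have hcont' : ContinuousOn m (ball y₀ ε) :=
      Nat.isClosedEmbedding_coe_real.isInducing.continuousOn_iff.2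
        (Complex.continuous_re.comp_continuousOn hcont)
    exact (convex_ball y₀ ε).isPreconnected.constant hcont' hy (mem_ball_self hg)
  have hcast : ∀ y ∈ ball y₀ ε, ∃ s' : Fin (m y₀) → ℂ, ∃ e : Fin (m y₀) ≃ Fin (m y),
      s' = s y ∘ e := fun y hy => ⟨_, finCongr (hm y hy).symm, rfl⟩
  choose! s' e he using hcast
  have hse : ∀ y (hy : y ∈ ball y₀ ε), ∀ i, s' y i = s y (e y hy i) := fun y hy i => by rw [he y hy]; rfl
  refine ⟨R / 2, ball y₀ ε, m y₀, s', ⟨hr, isOpen_ball, fun y hy t ht => hhol y hy t (by linarith),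
    fun y hy i => ?_, fun y hy t ht => ?_, fun y hy i j hij h => ?_, fun H y hy hH => ?_⟩,
    mem_ball_self hg, fun q hq => ?_, fun t ht ht0 => ?_⟩
  · rw [hse y hy]; exact hs1 y hy _
  · rw [hs2 y hy t (by simpa using ht)]
    simp only [hse y hy]
    exact ((e y hy).surjective.exists (p := fun i => s y i = t))
  · rw [hse y hy] at h ⊢
    rw [hse y hy] at h
    rw [← hder y hy _ (hs1 y hy _).le]
    exact hs3 y hy _ _ ((e y hy).injective.ne hij) h
  · have h1 := hsum H y hy hH
    have h2 : (fun y => ∑ i, H (s' y i, y)) =ᶠ[𝓝 y] fun y => ∑ i, H (s y i, y) := by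
      filter_upwards [isOpen_ball.mem_nhds hy] with z hz
      simp only [hse z hz]
      exact (e z hz).sum_comp fun i => H (s z i, z)
    filter_upwards [h1, h2.eventuallyEq_nhds] with z a b using a.congr_of_eventuallyEq b
  · exact ((hgs hq.2).2 q.1 (closedBall_subset_closedBall hrR.le hq.1)).2
  · exact (hRs (by simpa using ht.trans hrR.le)).1 ht0

lemma exists_implicit_function {t₀ : ℂ} (hF : HolAt F (t₀, y₀))
    (h0 : F (t₀, y₀) = 0) (h1 : dirDeriv (1, 0) F (t₀, y₀) ≠ 0) :
    ∃ a : E → ℂ, HolAt a y₀ ∧ a y₀ = t₀ ∧ ∀ᶠ q : ℂ × E in 𝓝 (t₀, y₀), (F q = 0 ↔ q.1 = a q.2) := by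
  set F' : ℂ × E → ℂ := fun q => F (t₀ + q.1, q.2) with hF'
  have hmap : Differentiable ℂ fun q : ℂ × E => (t₀ + q.1, q.2) := by fun_prop
  have hhol : HolAt F' (0, y₀) := HolAt.comp_eq hF (hmap.holAt _) (by simp)
  have hd : HasDerivAt (fun t => F' (t, y₀)) (dirDeriv (1, 0) F (t₀, y₀)) 0 := by
    have h2 : HasDerivAt (fun t => F (t, y₀)) (dirDeriv (1, 0) F (t₀, y₀)) (t₀ + 0) := by
      rw [add_zero, ← deriv_slice hF.self_of_nhds]
      exact hF.self_of_nhds.slice.hasDerivAt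
    simpa [hF'] using h2.comp_const_add t₀ 0
  have hne : ∀ᶠ t in 𝓝[≠] 0, F' (t, y₀) ≠ 0 := hd.eventually_ne h1
  obtain ⟨r, P, m, s, hs, hyP, -, hiso⟩ := exists_rootSystem hhol hne univ_mem
  have hd' : dirDeriv (1, 0) F' (0, y₀) ≠ 0 := by
    rwa [← deriv_slice hhol.self_of_nhds, hd.deriv]
  have hs0 : ∀ i, s y₀ i = 0 := fun i => by
    by_contra hi
    exact hiso _ (hs.norm_lt y₀ hyP i).le hi
      ((hs.eq_zero_iff y₀ hyP _ (hs.norm_lt y₀ hyP i).le).2 ⟨i, rfl⟩)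
  have hsub : Subsingleton (Fin m) := ⟨fun i j => by
    by_contra hij
    have := hs.simple y₀ hyP i j hij (by rw [hs0, hs0])
    rw [hs0] at this
    exact hd' this⟩
  obtain ⟨i, -⟩ := (hs.eq_zero_iff y₀ hyP 0 (by simpa using hs.pos.le)).1 (by simpa [hF'] using h0)
  have hsum : ∀ y, ∑ j, s y j = s y i := fun y => Fintype.sum_subsingleton _ i
  refine ⟨fun y => t₀ + s y i, ?_, by simp [hs0], ?_⟩
  · have := hs.holAt_sum Prod.fst y₀ hyP fun t _ => Differentiable.holAt (by fun_prop) _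
    simp only [hsum] at this
    filter_upwards [this] with y hy using hy.const_add t₀
  · have hc : Tendsto (fun q : ℂ × E => q.1 - t₀) (𝓝 (t₀, y₀)) (𝓝 0) := by
      apply Continuous.tendsto' (by fun_prop); simp
    filter_upwards [hc.eventually (closedBall_mem_nhds 0 hs.pos),
      (continuous_snd.tendsto (t₀, y₀)).eventually (hs.isOpen.mem_nhds hyP)] with q h2 h3
    have h4 := hs.eq_zero_iff q.2 h3 (q.1 - t₀) (by simpa using h2)
    simp only [hF', add_sub_cancel] at h4
    rw [show F q = F (q.1, q.2) from rfl, h4]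
    constructor
    · rintro ⟨j, hj⟩
      rw [Subsingleton.elim i j, hj]; ring
    · intro h; exact ⟨i, by rw [h]; ring⟩

end Roots

section Counting

open Finset in
lemma le_card_zeros_iff {m : ℕ} (a : Fin m → ℂ) (k : ℕ) :
    k ≤ #{i | a i = 0} ↔ ∀ q ≤ m, m < q + k → ∑ S ∈ powersetCard q univ, ∏ i ∈ S, a i = 0 := by
  have hcard : #{i | a i = 0} + #{i | a i ≠ 0} = m := by
    rw [card_filter_add_card_filter_not, card_univ, Fintype.card_fin]
  constructor
  · intro h q _ hq
    refine sum_eq_zero fun S hS => ?_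
    by_contra hne
    have hsub : S ⊆ univ.filter fun i => a i ≠ 0 := fun i hi =>
      mem_filter.2 ⟨mem_univ i, (prod_ne_zero_iff.1 hne) i hi⟩
    have := Finset.card_le_card hsub
    rw [(mem_powersetCard.1 hS).2] at this
    omega
  · intro h
    by_contra! hlt
    have h0 := h _ (by omega) (by omega : m < #{i | a i ≠ 0} + k)
    rw [sum_eq_single (univ.filter fun i => a i ≠ 0)] at h0
    · exact (prod_ne_zero_iff.2 fun i hi => (mem_filter.1 hi).2) h0
    · intro S hS hne
      by_contra hp
      refine hne (eq_of_subset_of_card_le (fun i hi => mem_filter.2 ⟨mem_univ i,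
        (prod_ne_zero_iff.1 hp) i hi⟩) (mem_powersetCard.1 hS).2.ge)
    · intro hn
      exact absurd (mem_powersetCard.2 ⟨subset_univ _, rfl⟩) hn

lemma exists_separating_parameter {m p : ℕ} (v : Fin m → Fin p → ℂ) :
    ∃ x : Fin (m * p + 1), ∀ i, ∑ j, v i j * ((x : ℕ) : ℂ) ^ (j : ℕ) = 0 → v i = 0 := by
  classical
  set Q : Fin m → Polynomial ℂ := fun i => if v i = 0 then 1 else Polynomial.ofFn p (v i) with hQ
  have hQ0 : ∀ i, Q i ≠ 0 := fun i => by
    simp only [hQ]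
    split_ifs with h
    · exact one_ne_zero
    · exact fun h' => h (Polynomial.injective_ofFn p (h'.trans (Polynomial.ofFn_zero p).symm))
  have hdeg : ∀ i, (Q i).natDegree ≤ p := fun i => by
    simp only [hQ]
    split_ifs with h
    · simp
    · exact Polynomial.natDegree_le_of_degree_le (Polynomial.ofFn_degree_lt _).le
  by_contra! hcon
  refine Finset.prod_ne_zero_iff.2 (fun i _ => hQ0 i) (Polynomial.eq_zero_of_natDegree_lt_card_of_eval_eq_zero
    (∏ i, Q i) (f := fun x : Fin (m * p + 1) => ((x : ℕ) : ℂ)) (fun x y h => by simpa [Fin.ext_iff] using h)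
    (fun x => ?_) ?_)
  · obtain ⟨i, hi, hi0⟩ := hcon x
    rw [Polynomial.eval_prod]
    refine Finset.prod_eq_zero (Finset.mem_univ i) ?_
    simp only [hQ, if_neg hi0]
    rw [Polynomial.ofFn_eq_sum_monomial, Polynomial.eval_finsetSum]
    simpa using hi
  · rw [Fintype.card_fin]
    refine Nat.lt_succ_of_le ((Polynomial.natDegree_prod_le _ _).trans ?_)
    exact (Finset.sum_le_sum fun i _ => hdeg i).trans (by simp)

/-- The number of roots `s y i` at which all the functions `H j` vanish. -/
def rootCount {E : Type*} {m p : ℕ} (H : Fin p → ℂ × E → ℂ) (s : E → Fin m → ℂ) (y : E) : ℕ :=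
  open Classical in (Finset.univ.filter fun i => ∀ j, H j (s y i, y) = 0).card

lemma rootCount_le {E : Type*} {m p : ℕ} (H : Fin p → ℂ × E → ℂ) (s : E → Fin m → ℂ) (y : E) : rootCount H s y ≤ m := by
  classical
  exact (Finset.card_le_univ _).trans_eq (Fintype.card_fin m)

variable {E : Type*} [NormedAddCommGroup E] [NormedSpace ℂ E] {F : ℂ × E → ℂ} {r : ℝ} {P : Set E}
  {m : ℕ} {s : E → Fin m → ℂ}
variable {p : ℕ}

lemma RootSystem.holAt_esymm (h : RootSystem F r P m s) {G : ℂ × E → ℂ} {y : E} (hy : y ∈ P)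
    (hG : ∀ t : ℂ, ‖t‖ ≤ r → HolAt G (t, y)) (q : ℕ) :
    HolAt (fun y => ∑ S ∈ Finset.powersetCard q Finset.univ, ∏ i ∈ S, G (s y i, y)) y := by
  induction q using Nat.strong_induction_on with
  | _ q ih =>
  rcases Nat.eq_zero_or_pos q with rfl | hq
  · simpa using Differentiable.holAt (differentiable_const (1 : ℂ)) y
  have key : ∀ y, ∑ S ∈ Finset.powersetCard q Finset.univ, ∏ i ∈ S, G (s y i, y) =
      (q : ℂ)⁻¹ * ((-1) ^ (q + 1) * ∑ a ∈ Finset.HasAntidiagonal.antidiagonal q with a.1 < q, (-1) ^ a.1 *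
        (∑ S ∈ Finset.powersetCard a.1 Finset.univ, ∏ i ∈ S, G (s y i, y)) *
          ∑ i, G (s y i, y) ^ a.2) := by
    intro y
    have := congrArg (MvPolynomial.aeval fun i => G (s y i, y))
      (MvPolynomial.mul_esymm_eq_sum (Fin m) ℂ q)
    simp only [MvPolynomial.esymm, MvPolynomial.psum, map_mul, map_sum, map_prod, map_pow,
      MvPolynomial.aeval_X, map_neg, map_one, map_natCast] at this
    rw [← this, inv_mul_cancel_left₀ (Nat.cast_ne_zero.2 hq.ne')]
  have hp : ∀ n : ℕ, HolAt (fun y => ∑ i, G (s y i, y) ^ n) y := fun n =>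
    h.holAt_sum (fun q => G q ^ n) y hy fun t ht => by
      filter_upwards [hG t ht] with z hz using hz.pow n
  have hall : ∀ᶠ z in 𝓝 y, ∀ a ∈ (Finset.HasAntidiagonal.antidiagonal q).filter (fun a => a.1 < q),
      DifferentiableAt ℂ (fun y => (-1) ^ a.1 *
        (∑ S ∈ Finset.powersetCard a.1 Finset.univ, ∏ i ∈ S, G (s y i, y)) *
          ∑ i, G (s y i, y) ^ a.2) z := by
    refine (Finset.eventually_all _).2 fun a ha => ?_
    filter_upwards [ih a.1 (Finset.mem_filter.1 ha).2, hp a.2] with z h1 h2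
    exact (h1.const_mul _).mul h2
  filter_upwards [hall] with z hz
  simp only [key]
  exact ((DifferentiableAt.fun_sum hz).const_mul _).const_mul _

lemma RootSystem.exists_family (h : RootSystem F r P m s) {H : Fin p → ℂ × E → ℂ}
    (hH : ∀ y ∈ P, ∀ t : ℂ, ‖t‖ ≤ r → ∀ j, HolAt (H j) (t, y)) (k : ℕ) :
    ∃ (q : ℕ) (A : Fin q → E → ℂ), (∀ l, ∀ y ∈ P, HolAt (A l) y) ∧
      ∀ y, (∀ l, A l y = 0) ↔ k ≤ rootCount H s y := by
  classical
  set G : Fin (m * p + 1) → ℂ × E → ℂ := fun x q => ∑ j, H j q * ((x : ℕ) : ℂ) ^ (j : ℕ) with hGdef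
  have hG : ∀ y ∈ P, ∀ t : ℂ, ‖t‖ ≤ r → ∀ x, HolAt (G x) (t, y) := fun y hy t ht x => by
    filter_upwards [eventually_all.2 (hH y hy t ht)] with z hz
    exact DifferentiableAt.fun_sum fun j _ => (hz j).mul_const _
  let A : Fin (m * p + 1) × Fin (m + 1) → E → ℂ := fun l y =>
    if m < l.2 + k then ∑ S ∈ Finset.powersetCard l.2 Finset.univ, ∏ i ∈ S, G l.1 (s y i, y) else 0
  have hcount : ∀ y, (∀ l, A l y = 0) ↔ k ≤ rootCount H s y := by
    intro y
    have h1 : (∀ l, A l y = 0) ↔ ∀ x, k ≤ (Finset.univ.filter fun i => G x (s y i, y) = 0).card := by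
      simp only [Prod.forall, le_card_zeros_iff, A]
      refine forall_congr' fun x => ⟨fun h q hq hqk => ?_, fun h q => ?_⟩
      · simpa [hqk] using h ⟨q, Nat.lt_succ_of_le hq⟩
      · split_ifs with hqk
        · exact h q (Nat.le_of_lt_succ q.2) hqk
        · rfl
    rw [h1]
    constructor
    · intro h2
      obtain ⟨x, hx⟩ := exists_separating_parameter fun i j => H j (s y i, y)
      refine (h2 x).trans (Finset.card_le_card fun i hi => ?_)
      simp at hi ⊢
      exact fun j => congrFun (hx i hi) j
    · intro h2 x
      refine h2.trans (Finset.card_le_card fun i hi => ?_)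
      simp at hi ⊢
      simp [hGdef, hi]
  let e := Fintype.equivFin (Fin (m * p + 1) × Fin (m + 1))
  refine ⟨_, fun l => A (e.symm l), fun l y hy => ?_, fun y => ?_⟩
  · by_cases hl : m < (e.symm l).2 + k
    · simpa only [A, if_pos hl] using h.holAt_esymm hy (fun t ht => hG y hy t ht _) _
    · simpa only [A, if_neg hl] using Differentiable.holAt (differentiable_const (0 : ℂ)) y
  · rw [← hcount y, e.symm.forall_congr_right (q := fun l => A l y = 0)]

lemma RootSystem.eventually_ultrafilter_iff (h : RootSystem F r P m s)
    {H : Fin p → ℂ × E → ℂ} (hH : ∀ y ∈ P, ∀ t : ℂ, ‖t‖ ≤ r → ∀ j, HolAt (H j) (t, y))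
    {α : Type*} {𝒰 : Ultrafilter α} {Y : α → E} {τ : α → ℂ} {y₀ : E} {t₀ : ℂ} (hy0 : y₀ ∈ P)
    (hY : Tendsto Y 𝒰 (𝓝 y₀)) (hb : Tendsto τ 𝒰 (𝓝 t₀)) (hroot : ∀ᶠ x in 𝒰, ∃ i, s (Y x) i = τ x)
    (hcount : ∀ᶠ x in 𝒰, rootCount H s (Y x) = rootCount H s y₀) :
    (∀ᶠ x in 𝒰, ∀ j, H j (τ x, Y x) = 0) ↔ ∀ j, H j (t₀, y₀) = 0 := by
  classical
  have hYP := hY.eventually (h.isOpen.mem_nhds hy0)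
  have hlim : ∀ i, ∃ a : ℂ, ‖a‖ ≤ r ∧ Tendsto (fun x => s (Y x) i) 𝒰 (𝓝 a) := by
    intro i
    obtain ⟨a, ha, hle⟩ := (isCompact_closedBall (0 : ℂ) r).ultrafilter_le_nhds
      (𝒰.map fun x => s (Y x) i) (by
        rw [le_principal_iff]
        refine Ultrafilter.mem_map.2 ?_
        refine mem_of_superset hYP fun x hx => ?_
        exact mem_closedBall_zero_iff.2 (h.norm_lt _ hx i).le)
    exact ⟨a, mem_closedBall_zero_iff.1 ha, hle⟩
  choose a har ha using hlim
  have hHc : ∀ i j, Tendsto (fun x => H j (s (Y x) i, Y x)) 𝒰 (𝓝 (H j (a i, y₀))) := fun i j =>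
    (hH y₀ hy0 _ (har i) j).continuousAt.tendsto.comp ((ha i).prodMk_nhds hY)
  have hpoly : ∀ Q : Polynomial ℂ, ∑ i, Q.eval (a i) = ∑ i, Q.eval (s y₀ i) := by
    intro Q
    have h1 := (h.holAt_sum (fun q => Q.eval q.1) y₀ hy0 fun t _ =>
      Differentiable.holAt (Q.differentiable.comp differentiable_fst) _).continuousAt.tendsto.comp hY
    have h2 : Tendsto (fun x => ∑ i, Q.eval (s (Y x) i)) 𝒰 (𝓝 (∑ i, Q.eval (a i))) :=
      tendsto_finsetSum _ fun i _ => (Q.continuous.tendsto (a i)).comp (ha i)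
    exact tendsto_nhds_unique h2 h1
  have hcard : (Finset.univ.filter fun i => ∀ j, H j (a i, y₀) = 0).card = rootCount H s y₀ := by
    set nodes : Finset ℂ := Finset.univ.image a ∪ Finset.univ.image (s y₀)
    have hQ : ∀ t ∈ nodes, (Lagrange.interpolate nodes id fun t =>
        if ∀ j, H j (t, y₀) = 0 then (1 : ℂ) else 0).eval t = if ∀ j, H j (t, y₀) = 0 then 1 else 0 :=
      fun t ht => Lagrange.eval_interpolate_at_node (v := id) _ (Function.injective_id.injOn) ht
    have h1 := hpoly (Lagrange.interpolate nodes id fun t =>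
        if ∀ j, H j (t, y₀) = 0 then (1 : ℂ) else 0)
    rw [sum_congr rfl fun i _ => hQ (a i) (by simp [nodes]),
      sum_congr rfl fun i _ => hQ (s y₀ i) (by simp [nodes]), Finset.sum_boole,
      Finset.sum_boole, Nat.cast_inj] at h1
    rw [h1, rootCount]
  have hsub : (Finset.univ.filter fun i => ∀ᶠ x in 𝒰, ∀ j, H j (s (Y x) i, Y x) = 0) ⊆
      Finset.univ.filter fun i => ∀ j, H j (a i, y₀) = 0 := fun i hi => by
    simp only [Finset.mem_filter, Finset.mem_univ, true_and] at hi ⊢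
    intro j
    refine tendsto_nhds_unique (hHc i j) (tendsto_const_nhds.congr' ?_)
    filter_upwards [hi] with x hx using (hx j).symm
  have hfix : ∀ᶠ x in 𝒰, ∀ i, ((∀ j, H j (s (Y x) i, Y x) = 0) ↔
      ∀ᶠ x in 𝒰, ∀ j, H j (s (Y x) i, Y x) = 0) := by
    refine eventually_all.2 fun i => ?_
    by_cases hi : ∀ᶠ x in 𝒰, ∀ j, H j (s (Y x) i, Y x) = 0
    · filter_upwards [hi] with x hx using iff_of_true hx hi
    · filter_upwards [Ultrafilter.eventually_not.2 hi] with x hx using iff_of_false hx hi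
  have heq := Finset.eq_of_subset_of_card_le hsub (by
    obtain ⟨x, hx1, hx2⟩ := (hfix.and hcount).exists
    rw [hcard, ← hx2, rootCount]
    refine Finset.card_le_card fun i hi => ?_
    simp only [Finset.mem_filter, Finset.mem_univ, true_and] at hi ⊢
    exact (hx1 i).1 hi)
  obtain ⟨i, hi⟩ : ∃ i, ∀ᶠ x in 𝒰, s (Y x) i = τ x := by
    by_contra! hcon
    obtain ⟨x, hx1, hx2⟩ := (hroot.and (eventually_all.2 fun i => hcon i)).exists
    obtain ⟨i, hi⟩ := hx1
    exact hx2 i hi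
  have hai := tendsto_nhds_unique (ha i) (hb.congr' (by
    filter_upwards [hi] with x hx using hx.symm))
  have hiff := Finset.ext_iff.1 heq i
  simp only [Finset.mem_filter, Finset.mem_univ, true_and, hai] at hiff
  rw [← hiff]
  exact eventually_congr (by filter_upwards [hi] with x hx; rw [hx])

end Counting

lemma exists_min_frequently {α : Type*} {l : Filter α} {f : α → ℕ} {m : ℕ} (hf : ∀ x, f x ≤ m)
    {p : α → Prop} (h : ∃ᶠ x in l, p x) :
    ∃ k, (∃ᶠ x in l, p x ∧ f x = k) ∧ ∀ᶠ x in l, p x → k ≤ f x := by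
  classical
  have hex : ∃ k, ∃ᶠ x in l, p x ∧ f x = k := by
    have : ∃ᶠ x in l, ∃ k : Fin (m + 1), p x ∧ f x = k := h.mono fun x hx =>
      ⟨⟨f x, Nat.lt_succ_of_le (hf x)⟩, hx, rfl⟩
    obtain ⟨k, hk⟩ := frequently_exists.1 this
    exact ⟨k, hk⟩
  refine ⟨Nat.find hex, Nat.find_spec hex, ?_⟩
  have : ∀ᶠ x in l, ∀ k : Fin (Nat.find hex), ¬(p x ∧ f x = k) :=
    eventually_all.2 fun k => not_frequently.1 (Nat.find_min hex k.2)
  filter_upwards [this] with x hx hpx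
  by_contra! hlt
  exact hx ⟨f x, hlt⟩ ⟨hpx, rfl⟩

section Multidisc

variable {E : Type*} [NormedAddCommGroup E] [NormedSpace ℂ E]
variable {p : ℕ} {g0 : E → ℂ}

/-- Near `y` the set `Z` is the graph of a holomorphic map over a linear projection. -/
def IsGraphPoint (Z : Set E) (y : E) : Prop :=
  ∃ (d : ℕ) (R : E →L[ℂ] Cn d) (s : Cn d → E), HolAt s (R y) ∧ s (R y) = y ∧
    (∀ᶠ x in 𝓝 y, x ∈ Z ↔ s (R x) = x) ∧ ∀ᶠ v in 𝓝 (R y), R (s v) = v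

/-- A multivalued holomorphic disc with values in `A` which is centred at the origin. -/
structure IsMultidisc (𝒢 : Set (ℂ × E)) (ρ : ℝ) (A : Set E) : Prop where
  pos : 0 < ρ
  nonempty : ∀ ζ : ℂ, 0 < ‖ζ‖ → ‖ζ‖ < ρ → ∃ y, (ζ, y) ∈ 𝒢
  mem : ∀ q ∈ 𝒢, q.2 ∈ A
  closed : ∀ q ∈ closure 𝒢, 0 < ‖q.1‖ → ‖q.1‖ < ρ → q ∈ 𝒢
  exists_section : ∀ q ∈ 𝒢, ∃ γ : ℂ → E, HolAt γ q.1 ∧ γ q.1 = q.2 ∧ ∀ᶠ ξ in 𝓝 q.1, (ξ, γ ξ) ∈ 𝒢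
  small : ∀ V ∈ 𝓝 (0 : E), ∃ δ > 0, ∀ q ∈ 𝒢, ‖q.1‖ < δ → q.2 ∈ V

/-- Near the origin, the part of `{H = 0}` outside a hypersurface `{g = 0}` consists of graph
points where `g₀` does not vanish, and it contains a multivalued disc centred at the origin. -/
def HasMultidisc {p : ℕ} (H : Fin p → E → ℂ) (g0 : E → ℂ) : Prop := ∃ g : E → ℂ, HolAt g 0 ∧
    (∀ᶠ y in 𝓝 0, (∀ j, H j y = 0) → g y ≠ 0 → g0 y ≠ 0 ∧ IsGraphPoint {x | ∀ j, H j x = 0} y) ∧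
    ∃ (G : Set (ℂ × E)) (ρ : ℝ), IsMultidisc G ρ {y | (∀ j, H j y = 0) ∧ g y ≠ 0}

lemma HolAt.eventually_ne_line {g : E → ℂ} (hg : HolAt g 0) (h : ∃ᶠ y in 𝓝 0, g y ≠ 0) :
    ∃ v : E, ∀ᶠ w : ℂ in 𝓝[≠] 0, g (w • v) ≠ 0 := by
  obtain ⟨ε, ha, hball⟩ := Metric.nhds_basis_ball.mem_iff.1 hg
  obtain ⟨v, hv, hvb⟩ := (h.and_eventually (ball_mem_nhds (0 : E) ha)).exists
  have hline : AnalyticOnNhd ℂ (fun w : ℂ => g (w • v)) {w | w • v ∈ ball (0 : E) ε} := by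
    refine DifferentiableOn.analyticOnNhd (fun w hw => ?_) (isOpen_ball.preimage (by fun_prop))
    have hd : DifferentiableAt ℂ g (w • v) := hball hw
    exact (hd.comp w
      (by fun_prop : DifferentiableAt ℂ (fun w : ℂ => w • v) w)).differentiableWithinAt
  have hpre : IsPreconnected {w : ℂ | w • v ∈ ball (0 : E) ε} := by
    refine Convex.isPreconnected ?_
    have : Convex ℝ ((LinearMap.toSpanSingleton ℂ E v).restrictScalars ℝ ⁻¹' ball (0 : E) ε) :=
      (convex_ball (0 : E) ε).linear_preimage _
    exact this
  refine ⟨v, ?_⟩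
  rcases (hline 0 (by simpa using ha)).eventually_eq_zero_or_eventually_ne_zero with h0 | h0
  · refine absurd ?_ hv
    have := hline.eqOn_zero_of_preconnected_of_eventuallyEq_zero hpre (by simpa using ha) h0
      (by simpa using hvb : (1 : ℂ) ∈ {w : ℂ | w • v ∈ ball (0 : E) ε})
    simpa using this
  · exact h0

lemma hasMultidisc_of_eventually_eq_zero [FiniteDimensional ℂ E] {H : Fin p → E → ℂ}
    (hg : HolAt g0 0) (hH : ∀ᶠ y in 𝓝 0, ∀ j, H j y = 0)
    (hfreq : ∃ᶠ y in 𝓝 0, g0 y ≠ 0) : HasMultidisc H g0 := by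
  obtain ⟨v, hv⟩ := hg.eventually_ne_line hfreq
  have hc : Continuous fun w : ℂ => w • v := by fun_prop
  have hc0 : Tendsto (fun w : ℂ => w • v) (𝓝 0) (𝓝 0) := by simpa using hc.tendsto 0
  obtain ⟨ρ, hr, hrs⟩ := Metric.nhds_basis_ball.mem_iff.1
    ((eventually_nhdsWithin_iff.1 hv).and (hc0.eventually hH))
  refine ⟨g0, hg, ?_, {q | q.2 = q.1 • v ∧ 0 < ‖q.1‖ ∧ ‖q.1‖ < ρ}, ρ, hr, fun w h1 h2 =>
    ⟨w • v, rfl, h1, h2⟩, ?_, ?_, ?_, ?_⟩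
  · filter_upwards [eventually_eventually_nhds.2 hH] with y hy _ hgy
    have e : E ≃L[ℂ] Cn (Module.finrank ℂ E) := ContinuousLinearEquiv.ofFinrankEq (by simp)
    refine ⟨hgy, _, e, e.symm, e.symm.differentiable.holAt _, by simp, ?_, by simp⟩
    filter_upwards [hy] with x hx
    simpa using hx
  · rintro q ⟨hq, h1, h2⟩
    have h := hrs (mem_ball_zero_iff.2 h2)
    rw [hq]
    exact ⟨h.2, h.1 (norm_pos_iff.1 h1)⟩
  · intro q hq h1 h2
    refine ⟨?_, h1, h2⟩
    have hcl : IsClosed {q : ℂ × E | q.2 = q.1 • v} := isClosed_eq (by fun_prop) (by fun_prop)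
    exact closure_minimal (fun q hq => hq.1) hcl hq
  · rintro q ⟨hq, h1, h2⟩
    refine ⟨fun w => w • v, Differentiable.holAt (by fun_prop) _, hq.symm, ?_⟩
    have ho : IsOpen {w : ℂ | 0 < ‖w‖ ∧ ‖w‖ < ρ} :=
      (isOpen_lt continuous_const continuous_norm).inter (isOpen_lt continuous_norm continuous_const)
    filter_upwards [ho.mem_nhds ⟨h1, h2⟩] with a ha using ⟨rfl, ha⟩
  · intro V hV
    obtain ⟨d, hd, hds⟩ := Metric.nhds_basis_ball.mem_iff.1 (hc0 hV)
    refine ⟨d, hd, ?_⟩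
    rintro q ⟨hq, -⟩ h
    rw [hq]
    exact hds (mem_ball_zero_iff.2 h)

lemma HasMultidisc.of_equiv {E' : Type*} [NormedAddCommGroup E'] [NormedSpace ℂ E'] (e : E ≃L[ℂ] E')
    {H : Fin p → E → ℂ}
    (h : HasMultidisc (fun j y => H j (e.symm y)) fun y => g0 (e.symm y)) : HasMultidisc H g0 := by
  obtain ⟨g, hg, hev, G, ρ, hG⟩ := h
  have he0 : Tendsto e (𝓝 0) (𝓝 0) := by simpa using e.continuous.tendsto 0
  have hmap : Continuous fun q : ℂ × E => (q.1, e q.2) := by fun_prop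
  refine ⟨fun y => g (e y), hg.comp_eq (e.differentiable.holAt 0) (by simp), ?_,
    {q | (q.1, e q.2) ∈ G}, ρ, hG.pos, fun w h1 h2 => ?_, fun q hq => ?_, fun q hq h1 h2 => ?_,
    fun q hq => ?_, fun V hV => ?_⟩
  · filter_upwards [he0.eventually hev] with y hy hHy hgy
    obtain ⟨h1, d, R, s, hs, hsy, hZ, hR⟩ := hy (by simpa using hHy) hgy
    refine ⟨by simpa using h1, d, R.comp (e : E →L[ℂ] E'), fun v => e.symm (s v), ?_, ?_, ?_, ?_⟩
    · exact HolAt.comp (e.symm.differentiable.holAt _) hs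
    · simpa using (e.symm_apply_eq.2 hsy)
    · filter_upwards [e.continuous.continuousAt.eventually hZ] with x hx
      simp at hx
      simpa [e.symm_apply_eq] using hx
    · filter_upwards [hR] with v hv
      simpa using hv
  · obtain ⟨y, hy⟩ := hG.nonempty w h1 h2
    exact ⟨e.symm y, by simpa using hy⟩
  · simpa using hG.mem _ hq
  · exact hG.closed (q.1, e q.2) (map_mem_closure (f := fun q : ℂ × E => (q.1, e q.2)) hmap hq
      fun _ h => h) h1 h2
  · obtain ⟨c, h1, h2, h3⟩ := hG.exists_section _ hq
    refine ⟨fun w => e.symm (c w), HolAt.comp (e.symm.differentiable.holAt _) h1,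
      e.symm_apply_eq.2 h2, ?_⟩
    filter_upwards [h3] with b hb
    simpa using hb
  · obtain ⟨a, ha, h⟩ := hG.small (e.symm ⁻¹' V)
      (e.symm.continuous.continuousAt.preimage_mem_nhds (by simpa using hV))
    exact ⟨a, ha, fun q hq hlt => by simpa using h _ hq hlt⟩

end Multidisc

section Step

variable {E : Type*} [NormedAddCommGroup E] [NormedSpace ℂ E] [FiniteDimensional ℂ E]

lemma HasMultidisc.lift {p : ℕ} {H : Fin p → ℂ × E → ℂ} {g0 F : ℂ × E → ℂ}
    (hH : ∀ j, HolAt (H j) 0) (hg0 : HolAt g0 0) (hF : HolAt F 0)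
    (hvan : ∀ᶠ q in 𝓝 0, (∀ j, H j q = 0) → g0 q ≠ 0 → F q = 0)
    (hiso : ∀ᶠ t in 𝓝[≠] (0 : ℂ), F (t, 0) ≠ 0)
    (hfreq : ∃ᶠ q in 𝓝 0, (∀ j, H j q = 0) ∧ g0 q * dirDeriv (1, 0) F q ≠ 0)
    (ih : ∀ {p' : ℕ} (H' : Fin p' → E → ℂ) (g' : E → ℂ), (∀ j, HolAt (H' j) 0) → HolAt g' 0 →
      (∃ᶠ y in 𝓝 0, (∀ j, H' j y = 0) ∧ g' y ≠ 0) → HasMultidisc H' g') : HasMultidisc H g0 := by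
  set g1 : ℂ × E → ℂ := fun q => g0 q * dirDeriv (1, 0) F q with hg₁def
  have hg1 : HolAt g1 0 := hg0.mul (hF.dirDeriv _)
  obtain ⟨r, P, m, s, hs, h0P, hN, hiso'⟩ := exists_rootSystem hF hiso
    (N := {q | (∀ j, HolAt (H j) q) ∧ HolAt g1 q ∧ ((∀ j, H j q = 0) → g0 q ≠ 0 → F q = 0)})
    ((eventually_all.2 fun j => (hH j).eventually).and (hg1.eventually.and hvan))
  have hmemN : ∀ y ∈ P, ∀ t : ℂ, ‖t‖ ≤ r → (∀ j, HolAt (H j) (t, y)) ∧ HolAt g1 (t, y) ∧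
      ((∀ j, H j (t, y) = 0) → g0 (t, y) ≠ 0 → F (t, y) = 0) := fun y hy t ht =>
    hN ⟨mem_closedBall_zero_iff.2 ht, hy⟩
  set K : Fin (p + 1) → ℂ × E → ℂ := Fin.cons g1 H with hK
  have hK0 : ∀ q, (∀ j, K j q = 0) ↔ g1 q = 0 ∧ ∀ j, H j q = 0 := fun q => by
    simp [hK, Fin.forall_fin_succ]
  have hHhol : ∀ y ∈ P, ∀ t : ℂ, ‖t‖ ≤ r → ∀ j, HolAt (H j) (t, y) := fun y hy t ht =>
    (hmemN y hy t ht).1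
  have hKhol : ∀ y ∈ P, ∀ t : ℂ, ‖t‖ ≤ r → ∀ j, HolAt (K j) (t, y) := fun y hy t ht =>
    Fin.forall_fin_succ.2 ⟨(hmemN y hy t ht).2.1, hHhol y hy t ht⟩
  have hzero : ∀ y ∈ P, ∀ t : ℂ, ‖t‖ ≤ r → (∀ j, H j (t, y) = 0) → g1 (t, y) ≠ 0 → F (t, y) = 0 :=
    fun y hy t ht h1 h2 => (hmemN y hy t ht).2.2 h1 (left_ne_zero_of_mul h2)
  have hTiff : ∀ y ∈ P, rootCount K s y < rootCount H s y ↔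
      ∃ t : ℂ, ‖t‖ ≤ r ∧ (∀ j, H j (t, y) = 0) ∧ g1 (t, y) ≠ 0 := by
    classical
    intro y hy
    have hsub : (Finset.univ.filter fun i => ∀ j, K j (s y i, y) = 0) ⊆
        Finset.univ.filter fun i => ∀ j, H j (s y i, y) = 0 := fun i hi => by
      simp only [Finset.mem_filter, Finset.mem_univ, true_and, hK0] at hi ⊢
      exact hi.2
    constructor
    · intro hlt
      obtain ⟨i, hi1, hi2⟩ := Finset.exists_mem_notMem_of_card_lt_card hlt
      simp only [Finset.mem_filter, Finset.mem_univ, true_and, hK0] at hi1 hi2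
      exact ⟨s y i, (hs.norm_lt y hy i).le, hi1, fun h => hi2 ⟨h, hi1⟩⟩
    · rintro ⟨t, ht, h1, h2⟩
      obtain ⟨i, rfl⟩ := (hs.eq_zero_iff y hy t ht).1 (hzero y hy t ht h1 h2)
      refine Finset.card_lt_card ((Finset.ssubset_iff_of_subset hsub).2 ⟨i, ?_, ?_⟩)
      · simpa using h1
      · simpa [hK0] using fun h => absurd h h2
  have hTfreq : ∃ᶠ y in 𝓝 (0 : E), y ∈ P ∧ rootCount K s y < rootCount H s y := by
    have hsnd : Tendsto (Prod.snd : ℂ × E → E) (𝓝 0) (𝓝 0) := continuous_snd.tendsto 0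
    refine hsnd.frequently ((hfreq.and_eventually ((hsnd.eventually (hs.isOpen.mem_nhds h0P)).and
      ((continuous_fst.tendsto (0 : ℂ × E)).eventually (closedBall_mem_nhds 0 hs.pos)))).mono ?_)
    rintro ⟨t, y⟩ ⟨⟨h1, h2⟩, h3, h4⟩
    exact ⟨h3, (hTiff y h3).2 ⟨t, by simpa using h4, h1, h2⟩⟩
  obtain ⟨k, hkfreq, hkmin⟩ := exists_min_frequently (rootCount_le H s) hTfreq
  obtain ⟨l, hlfreq, hlmin⟩ := exists_min_frequently (rootCount_le K s) hkfreq
  obtain ⟨p', C, hChol, hC⟩ := hs.exists_family hHhol k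
  obtain ⟨pa, Ca, hahol, hCa⟩ := hs.exists_family hHhol (k + 1)
  obtain ⟨pb, Cb, hbhol, hCb⟩ := hs.exists_family hKhol (l + 1)
  have hlk : l < k := by
    obtain ⟨y, ⟨⟨-, h1⟩, h2⟩, h3⟩ := hlfreq.exists
    omega
  obtain ⟨i, j, hij⟩ : ∃ i j, ∃ᶠ y in 𝓝 0, (∀ l, C l y = 0) ∧ Ca i y * Cb j y ≠ 0 := by
    simp only [← frequently_exists]
    refine hlfreq.mono ?_
    rintro y ⟨⟨⟨-, h1⟩, h2⟩, h3⟩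
    have ha : ¬ ∀ i, Ca i y = 0 := fun h => by have := (hCa y).1 h; omega
    have hb : ¬ ∀ i, Cb i y = 0 := fun h => by have := (hCb y).1 h; omega
    push Not at ha hb
    obtain ⟨i, hi⟩ := ha
    obtain ⟨j, hj⟩ := hb
    exact ⟨i, j, (hC y).2 h2.ge, mul_ne_zero hi hj⟩
  set g' : E → ℂ := fun y => Ca i y * Cb j y with hg'def
  have hg'hol : ∀ y ∈ P, HolAt g' y := fun y hy => (hahol i y hy).mul (hbhol j y hy)
  obtain ⟨g'', hg'', hev, G, ρ, hG⟩ := ih C g' (fun l => hChol l 0 h0P) (hg'hol 0 h0P) hij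
  have hPev : ∀ᶠ y in 𝓝 (0 : E), y ∈ P := hs.isOpen.mem_nhds h0P
  obtain ⟨Q, hQs, hQ, h0Q⟩ := _root_.mem_nhds_iff.1 ((hPev.and (hkmin.and hlmin)).and hev)
  have hQP : ∀ y ∈ Q, y ∈ P := fun y hy => (hQs hy).1.1
  have hcounts : ∀ y ∈ Q, (∀ l, C l y = 0) → g' y ≠ 0 →
      rootCount H s y = k ∧ rootCount K s y = l := by
    intro y hy hCy hgy
    have h1 := (hC y).1 hCy
    have h2 : ¬ k + 1 ≤ rootCount H s y := fun h => left_ne_zero_of_mul hgy ((hCa y).2 h i)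
    have h3 : ¬ l + 1 ≤ rootCount K s y := fun h => right_ne_zero_of_mul hgy ((hCb y).2 h j)
    have h4 := (hQs hy).1.2.2 ⟨⟨hQP y hy, by omega⟩, by omega⟩
    omega
  have hCmem : ∀ y ∈ Q, ∀ t : ℂ, ‖t‖ ≤ r → (∀ j, H j (t, y) = 0) → g1 (t, y) ≠ 0 →
      ∀ l, C l y = 0 := fun y hy t ht h1 h2 =>
    (hC y).2 ((hQs hy).1.2.1 ⟨hQP y hy, (hTiff y (hQP y hy)).2 ⟨t, ht, h1, h2⟩⟩)
  have hsec : ∀ y₀ ∈ Q, (∀ l, C l y₀ = 0) → g' y₀ ≠ 0 → ∀ t₀ : ℂ, ‖t₀‖ ≤ r →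
      (∀ j, H j (t₀, y₀) = 0) → g1 (t₀, y₀) ≠ 0 →
      ∃ n : E → ℂ, HolAt n y₀ ∧ n y₀ = t₀ ∧ (∀ᶠ q : ℂ × E in 𝓝 (t₀, y₀), (F q = 0 ↔ q.1 = n q.2)) ∧
        ∀ᶠ y in 𝓝 y₀, (∀ l, C l y = 0) → ‖n y‖ ≤ r ∧ (∀ j, H j (n y, y) = 0) ∧ g1 (n y, y) ≠ 0 := by
    intro y₀ hy0 hC0 hg0' t₀ ht0 hHt hgt
    have hy₀P := hQP y₀ hy0
    have hFt := hzero y₀ hy₀P t₀ ht0 hHt hgt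
    obtain ⟨n, hn, hn0, hFn⟩ := exists_implicit_function (hs.holAt y₀ hy₀P t₀ ht0) hFt
      (right_ne_zero_of_mul hgt)
    refine ⟨n, hn, hn0, hFn, ?_⟩
    have hpair : Tendsto (fun y => (n y, y)) (𝓝 y₀) (𝓝 (t₀, y₀)) := by
      have := hn.continuousAt.tendsto
      rw [hn0] at this
      exact this.prodMk_nhds tendsto_id
    have ht₀r : ‖t₀‖ < r := by
      obtain ⟨i, rfl⟩ := (hs.eq_zero_iff y₀ hy₀P t₀ ht0).1 hFt
      exact hs.norm_lt y₀ hy₀P i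
    have hnr : ∀ᶠ y in 𝓝 y₀, ‖n y‖ ≤ r := by
      have := hn.continuousAt.norm.eventually_lt_const (by rwa [hn0] : ‖n y₀‖ < r)
      exact this.mono fun y hy => hy.le
    have hgne := hpair.eventually ((hmemN y₀ hy₀P t₀ ht0).2.1.continuousAt.eventually_ne hgt)
    have hHev : ∀ᶠ y in 𝓝 y₀, (∀ l, C l y = 0) → ∀ j, H j (n y, y) = 0 := by
      by_contra hcon
      rw [not_eventually, frequently_iff_neBot] at hcon
      obtain ⟨𝒰, hU⟩ := exists_ultrafilter_iff.2 hcon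
      have hUy := hU.trans inf_le_left
      have hUn := hU.trans inf_le_right (mem_principal_self _)
      have hiff := hs.eventually_ultrafilter_iff hHhol (𝒰 := 𝒰) (Y := id) (τ := n) (t₀ := t₀) hy₀P
        hUy (hn0 ▸ hn.continuousAt.tendsto.mono_left hUy) (hUy (by
          filter_upwards [hnr, hs.isOpen.mem_nhds hy₀P, hpair.eventually hFn] with y h1 h2 h3
          exact (hs.eq_zero_iff y h2 _ h1).1 (h3.2 rfl))) (by
          filter_upwards [hUn, hUy (hQ.mem_nhds hy0),
            hUy ((hg'hol y₀ hy₀P).continuousAt.eventually_ne hg0')] with y h1 h2 h3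
          push Not at h1
          rw [(hcounts y₀ hy0 hC0 hg0').1]
          exact (hcounts y h2 h1.1 h3).1)
      obtain ⟨y, hy1, hy2⟩ := ((hiff.2 hHt).and hUn).exists
      exact hy2 fun _ => hy1
    filter_upwards [hnr, hgne, hHev] with y h1 h2 h3 h4 using ⟨h1, h3 h4, h2⟩
  refine ⟨fun q => g1 q * g'' q.2, hg1.mul (HolAt.comp_eq hg''
    (Differentiable.holAt (by fun_prop) _) rfl), ?_, ?_⟩
  · have hQev := ((continuous_snd.tendsto (0 : ℂ × E)).eventually (hQ.mem_nhds h0Q)).and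
        (((continuous_fst.tendsto (0 : ℂ × E)).eventually (closedBall_mem_nhds 0 hs.pos)).mono
          fun q hq => by simpa using hq)
    filter_upwards [hQev]
    rintro ⟨t₀, y₀⟩ ⟨hy0, ht0⟩ hHt hgne
    have hgt : g1 (t₀, y₀) ≠ 0 := left_ne_zero_of_mul hgne
    refine ⟨left_ne_zero_of_mul hgt, ?_⟩
    have hC0 := hCmem y₀ hy0 t₀ ht0 hHt hgt
    obtain ⟨hg'y, d, R, s', hs', hs'y, hZ, hR⟩ := (hQs hy0).2 hC0 (right_ne_zero_of_mul hgne)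
    obtain ⟨n, hn, hn0, hFn, hnev⟩ := hsec y₀ hy0 hC0 hg'y t₀ ht0 hHt hgt
    refine ⟨d, R.comp (ContinuousLinearMap.snd ℂ ℂ E), fun v => (n (s' v), s' v),
      (HolAt.comp_eq hn hs' hs'y).prodMk hs', ?_, ?_, ?_⟩
    · simp only [ContinuousLinearMap.comp_apply, ContinuousLinearMap.coe_snd', hs'y, hn0]
    · have hr' := (hmemN y₀ (hQP y₀ hy0) t₀ ht0).2.1.continuousAt.eventually_ne hgt
      have ht₀r : ‖t₀‖ < r := by
        obtain ⟨i, rfl⟩ := (hs.eq_zero_iff y₀ (hQP y₀ hy0) t₀ ht0).1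
          (hzero y₀ (hQP y₀ hy0) t₀ ht0 hHt hgt)
        exact hs.norm_lt y₀ (hQP y₀ hy0) i
      have hsnd : Tendsto (Prod.snd : ℂ × E → E) (𝓝 (t₀, y₀)) (𝓝 y₀) := continuous_snd.tendsto _
      filter_upwards [hFn, hr', hsnd.eventually hnev, hsnd.eventually hZ,
        hsnd.eventually (hQ.mem_nhds hy0), (continuous_fst.tendsto (t₀, y₀)).norm.eventually_lt_const
          ht₀r] with q h1 h2 h3 h4 h5 h6
      simp at h4 ⊢
      rw [Prod.ext_iff]
      constructor
      · intro hq
        have hy := h4.1 (hCmem q.2 h5 q.1 h6.le hq h2)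
        exact ⟨by simpa only [hy] using (h1.1 (hzero q.2 (hQP _ h5) q.1 h6.le hq h2)).symm, hy⟩
      · rintro ⟨hq1, hq2⟩
        replace hq1 : n (s' (R q.2)) = q.1 := hq1
        have := (h3 (h4.2 hq2)).2.1
        rw [show s' (R q.2) = q.2 from hq2] at hq1
        rwa [hq1] at this
    · filter_upwards [hR] with v hv using hv
  obtain ⟨u, hu, huQ⟩ := hG.small Q (hQ.mem_nhds h0Q)
  have hGmem : ∀ (w : ℂ) (y : E), (w, y) ∈ G → ‖w‖ < min ρ u → y ∈ Q ∧ (∀ l, C l y = 0) ∧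
      g'' y ≠ 0 ∧ g' y ≠ 0 := fun w y hq hlt => by
    have h1 := huQ _ hq (hlt.trans_le (min_le_right _ _))
    have h2 := hG.mem _ hq
    exact ⟨h1, h2.1, h2.2, ((hQs h1).2 h2.1 h2.2).1⟩
  refine ⟨{q | (q.1, q.2.2) ∈ G ∧ ‖q.1‖ < min ρ u ∧ ‖q.2.1‖ ≤ r ∧ (∀ j, H j q.2 = 0) ∧ g1 q.2 ≠ 0},
    min ρ u, lt_min hG.pos hu, fun w h1 h2 => ?_, ?_, ?_, ?_, ?_⟩
  · obtain ⟨y, hy⟩ := hG.nonempty w h1 (h2.trans_le (min_le_left _ _))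
    obtain ⟨hyQ, hCy, -, hgy⟩ := hGmem w y hy h2
    have hc := hcounts y hyQ hCy hgy
    obtain ⟨t, ht⟩ := (hTiff y (hQP y hyQ)).1 (by rw [hc.1, hc.2]; exact hlk)
    exact ⟨(t, y), hy, h2, ht⟩
  · rintro q ⟨h1, h2, h3, h4, h5⟩
    exact ⟨h4, mul_ne_zero h5 (hGmem _ _ h1 h2).2.2.1⟩
  · intro q0 hq0 hpos hlt
    have hmap : Continuous fun q : ℂ × ℂ × E => (q.1, q.2.2) := by fun_prop
    have hq₀G := hG.closed _ (map_mem_closure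
      (f := fun q : ℂ × ℂ × E => (q.1, q.2.2)) hmap hq0 fun q hq => hq.1) hpos
      (hlt.trans_le (min_le_left _ _))
    obtain ⟨hyQ, hCy, -, hgy⟩ := hGmem _ _ hq₀G hlt
    have hr0 := closure_minimal (fun q hq => hq.2.2.1)
      (isClosed_le (by fun_prop) continuous_const : IsClosed {q : ℂ × ℂ × E | ‖q.2.1‖ ≤ r}) hq0
    obtain ⟨𝒰, hUm, hU⟩ := mem_closure_iff_ultrafilter.1 hq0
    have hY := (continuous_snd.comp continuous_snd).continuousAt.tendsto.mono_left hU
    have hz := (continuous_fst.comp continuous_snd).continuousAt.tendsto.mono_left hU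
    have hroot : ∀ᶠ q : ℂ × ℂ × E in 𝒰, ∃ i, s q.2.2 i = q.2.1 := by
      filter_upwards [hUm] with q hq
      have hqQ := hQP _ (hGmem _ _ hq.1 hq.2.1).1
      exact (hs.eq_zero_iff _ hqQ _ hq.2.2.1).1 (hzero _ hqQ _ hq.2.2.1 hq.2.2.2.1 hq.2.2.2.2)
    have hcnt : ∀ᶠ q : ℂ × ℂ × E in 𝒰, rootCount H s q.2.2 = rootCount H s q0.2.2 ∧
        rootCount K s q.2.2 = rootCount K s q0.2.2 := by
      filter_upwards [hUm] with q hq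
      have h1 := hGmem _ _ hq.1 hq.2.1
      have h2 := hcounts _ h1.1 h1.2.1 h1.2.2.2
      have h3 := hcounts _ hyQ hCy hgy
      exact ⟨h2.1.trans h3.1.symm, h2.2.trans h3.2.symm⟩
    have hiffH := hs.eventually_ultrafilter_iff hHhol (hQP _ hyQ) hY hz hroot (hcnt.mono fun _ h => h.1)
    have hiffK := hs.eventually_ultrafilter_iff hKhol (hQP _ hyQ) hY hz hroot (hcnt.mono fun _ h => h.2)
    have hHq := hiffH.1 (mem_of_superset hUm fun q hq => hq.2.2.2.1)
    refine ⟨hq₀G, hlt, hr0, hHq, fun hg => ?_⟩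
    obtain ⟨q, hq1, hq2⟩ := ((hiffK.2 ((hK0 _).2 ⟨hg, hHq⟩)).and hUm).exists
    exact hq2.2.2.2.2 ((hK0 _).1 hq1).1
  · rintro ⟨w, t, y⟩ ⟨h1, h2, h3, h4, h5⟩
    obtain ⟨hyQ, hCy, -, hgy⟩ := hGmem _ _ h1 h2
    obtain ⟨o, ho, ho0, hoev⟩ := hG.exists_section _ h1
    obtain ⟨n, hn, hn0, -, hnev⟩ := hsec y hyQ hCy hgy t h3 h4 h5
    refine ⟨fun a => (n (o a), o a), (HolAt.comp_eq hn ho ho0).prodMk ho,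
      Prod.ext ((congrArg n ho0).trans hn0) ho0, ?_⟩
    have hot : Tendsto o (𝓝 w) (𝓝 y) := by
      have := ho.continuousAt.tendsto
      rwa [ho0] at this
    filter_upwards [hoev, hot.eventually hnev, continuous_norm.continuousAt.eventually_lt_const h2]
      with a a1 a2 a3
    exact ⟨a1, a3, a2 (hGmem _ _ a1 a3).2.1⟩
  · intro V hV
    rw [show (0 : ℂ × E) = (0, 0) from rfl, nhds_prod_eq] at hV
    obtain ⟨A, hA, B, hB, hAB⟩ := mem_prod_iff.1 hV
    obtain ⟨ε, hx, hxA⟩ := Metric.nhds_basis_ball.mem_iff.1 hA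
    obtain ⟨u', hu', hu's⟩ := hG.small _ (inter_mem hB (hs.eventually_norm_lt h0P hiso' hx))
    refine ⟨u', hu', fun q hq hlt => hAB ?_⟩
    have h1 := hu's _ hq.1 hlt
    have hqQ := hQP _ (hGmem _ _ hq.1 hq.2.1).1
    exact ⟨hxA (mem_ball_zero_iff.2 (h1.2 _ hq.2.2.1
      (hzero _ hqQ _ hq.2.2.1 hq.2.2.2.1 hq.2.2.2.2))), h1.1⟩

/-- The zero set of finitely many holomorphic functions has a multivalued disc at each point. -/
theorem hasMultidisc (n : ℕ) : ∀ (E : Type) [NormedAddCommGroup E] [NormedSpace ℂ E]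
    [FiniteDimensional ℂ E], Module.finrank ℂ E = n → ∀ {p : ℕ} (H : Fin p → E → ℂ) (g0 : E → ℂ),
    (∀ j, HolAt (H j) 0) → HolAt g0 0 → (∃ᶠ y in 𝓝 0, (∀ j, H j y = 0) ∧ g0 y ≠ 0) →
    HasMultidisc H g0 := by
  classical
  induction n using Nat.strong_induction_on with
  | _ n ih =>
  intro E _ _ _ hn p H g0 hH hg0 hfreq
  by_cases hall : ∀ᶠ y in 𝓝 0, ∀ j, H j y = 0
  · exact hasMultidisc_of_eventually_eq_zero hg0 hall (hfreq.mono fun y hy => hy.2)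
  have hex : ∃ m : ℕ, ∃ (F : E → ℂ) (v : E), HolAt F 0 ∧
      (∀ᶠ y in 𝓝 0, (∀ j, H j y = 0) → g0 y ≠ 0 → F y = 0) ∧
      analyticOrderAt (fun t : ℂ => F (t • v)) 0 = m := by
    rw [eventually_all] at hall
    push Not at hall
    obtain ⟨j, hj⟩ := hall
    obtain ⟨v, hv⟩ := (hH j).eventually_ne_line hj
    obtain ⟨m, hm⟩ := ENat.ne_top_iff_exists.1
        (show analyticOrderAt (fun t : ℂ => H j (t • v)) 0 ≠ ⊤ from fun htop => by
      obtain ⟨t, h1, h2⟩ := (hv.and ((analyticOrderAt_eq_top.1 htop).filter_mono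
        nhdsWithin_le_nhds)).exists
      exact h1 h2)
    exact ⟨m, H j, v, hH j, .of_forall fun y hy _ => hy j, hm.symm⟩
  obtain ⟨F, v, hF, hvan, hord⟩ := Nat.find_spec hex
  set m := Nat.find hex with hm
  have hF0 : F 0 = 0 := by
    by_contra hne
    obtain ⟨y, ⟨h1, h2⟩, h3, h4⟩ :=
      (hfreq.and_eventually (hvan.and (hF.continuousAt.eventually_ne hne))).exists
    exact h4 (h3 h1 h2)
  have han := (hF.comp_eq (g := fun t : ℂ => t • v) (Differentiable.holAt (by fun_prop) _)
      (zero_smul ℂ v)).analyticAt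
  have hne : ∀ᶠ t in 𝓝[≠] (0 : ℂ), F (t • v) ≠ 0 := by
    refine han.eventually_eq_zero_or_eventually_ne_zero.resolve_left fun h => ?_
    rw [analyticOrderAt_eq_top.2 h] at hord
    exact ENat.top_ne_natCast m hord
  have hv : v ≠ 0 := by
    rintro rfl
    obtain ⟨t, ht⟩ := hne.exists
    rw [smul_zero] at ht
    exact ht hF0
  obtain ⟨f, hf⟩ := SeparatingDual.exists_eq_one (R := ℂ) hv
  let e := ContinuousLinearEquiv.equivOfRightInverse f (ContinuousLinearMap.toSpanSingleton ℂ v)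
    (fun t => by simp [hf])
  have he : ∀ t : ℂ, e.symm (t, 0) = t • v := fun t => by
    simp [e, ContinuousLinearEquiv.equivOfRightInverse_symm_apply]
  have he' : ∀ t : ℂ, e (t • v) = (t, 0) := fun t => by rw [← he, e.apply_symm_apply]
  have hrank : Module.finrank ℂ f.ker < n := by
    have := e.toLinearEquiv.finrank_eq
    rw [Module.finrank_prod, Module.finrank_self] at this
    omega
  have hcomp : ∀ {g : E → ℂ}, HolAt g 0 → HolAt (fun q => g (e.symm q)) 0 := fun hg =>
    hg.comp_eq (e.symm.differentiable.holAt 0) (map_zero _)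
  have he0 : Tendsto e.symm (𝓝 0) (𝓝 0) := by simpa using e.symm.continuous.tendsto 0
  have hF' := hcomp hF
  refine HasMultidisc.of_equiv e (HasMultidisc.lift (F := fun q => F (e.symm q))
    (fun j => hcomp (hH j)) (hcomp hg0) hF' (he0.eventually hvan) (by simpa only [he] using hne) ?_
    fun H' g' => ih _ hrank _ rfl H' g')
  by_contra hcon
  rw [not_frequently] at hcon
  have he1 : Tendsto e (𝓝 0) (𝓝 0) := by simpa using e.continuous.tendsto 0
  have hslice : ∀ᶠ t in 𝓝 (0 : ℂ), dirDeriv (1, 0) (fun q => F (e.symm q)) (e (t • v)) =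
      deriv (fun t : ℂ => F (t • v)) t := by
    have hc : Tendsto (fun t : ℂ => ((t, 0) : ℂ × f.ker)) (𝓝 0) (𝓝 0) := by
      apply Continuous.tendsto' (by fun_prop); rfl
    filter_upwards [hc.eventually hF'] with t ht
    rw [he', ← deriv_slice ht]
    simp only [he]
  have hadd := han.analyticOrderAt_deriv_add_one
  simp only [zero_smul, hF0, sub_zero] at hadd
  have hm0 : m ≠ 0 := fun h0 => by
    rw [hord, h0] at hadd
    simp at hadd
  refine Nat.find_min hex (Nat.sub_one_lt hm0) ⟨fun y => dirDeriv (1, 0)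
    (fun q => F (e.symm q)) (e y), v, (hF'.dirDeriv (1, 0)).comp_eq (e.differentiable.holAt 0)
    (map_zero e), ?_, ?_⟩
  · filter_upwards [he1.eventually hcon] with y hy h1 h2
    simp only [e.symm_apply_apply, not_and, not_not] at hy
    exact (mul_eq_zero.1 (hy h1)).resolve_left h2
  · rw [analyticOrderAt_congr hslice]
    rw [hord] at hadd
    refine ENat.add_left_injective_of_ne_top ENat.one_ne_top ?_
    simp only [hadd]
    rw [← hm]
    exact_mod_cast (Nat.sub_add_cancel (Nat.one_le_iff_ne_zero.2 hm0)).symm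

end Step

section MaximumPrinciple

variable {d : ℕ} {𝒢 : Set (ℂ × Cn d)} {ρ : ℝ} {A V : Set (Cn d)}
variable {C r : ℝ} {w : Fn d}

lemma IsMultidisc.isCompact_annulus (hG : IsMultidisc 𝒢 ρ A) {a : ℝ} (ha : 0 < a) (hr : r < ρ)
    (hC : ∀ q ∈ 𝒢, ‖q.1‖ ≤ r → ‖q.2‖ ≤ C) : IsCompact {q ∈ 𝒢 | a ≤ ‖q.1‖ ∧ ‖q.1‖ ≤ r} := by
  have hcl : IsClosed {q ∈ 𝒢 | a ≤ ‖q.1‖ ∧ ‖q.1‖ ≤ r} := by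
    refine isClosed_of_closure_subset fun q hq => ?_
    have hcl' : IsClosed {q : ℂ × Cn d | a ≤ ‖q.1‖ ∧ ‖q.1‖ ≤ r} :=
      (isClosed_le continuous_const continuous_fst.norm).inter
        (isClosed_le continuous_fst.norm continuous_const)
    have h1 := closure_minimal (fun q hq => hq.2) hcl' hq
    exact ⟨hG.closed q (closure_mono (fun q hq => hq.1) hq) (ha.trans_le h1.1) (h1.2.trans_lt hr), h1⟩
  refine Metric.isCompact_of_isClosed_isBounded hcl
    ((Metric.isBounded_closedBall (x := (0 : ℂ × Cn d)) (r := max r C)).subset fun q hq => ?_)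
  rw [mem_closedBall_zero_iff, Prod.norm_def]
  exact max_le_max hq.2.2 (hC q hq.1 hq.2.2)

lemma IsMultidisc.le_of_continuousAt (hG : IsMultidisc 𝒢 ρ A) {M : ℝ} (hr0 : 0 < r) (hr : r < ρ)
    (hC : ∀ q ∈ 𝒢, ‖q.1‖ ≤ r → ‖q.2‖ ≤ C) (hV : IsOpen V) (hGV : ∀ q ∈ 𝒢, ‖q.1‖ ≤ r → q.2 ∈ V)
    (hw : PshOn w V) (hw0 : ContinuousAt w 0) (hM : ∀ q ∈ 𝒢, ‖q.1‖ = r → w q.2 ≤ M) : w 0 ≤ M := by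
  have key : ∀ ε > 0, ∀ q ∈ 𝒢, 0 < ‖q.1‖ → ‖q.1‖ ≤ r →
      w q.2 + ε * Real.log (‖q.1‖ / r) + ε * (‖q.1‖ ^ 2 - r ^ 2) ≤ M := by
    intro ε hk q1 hq1 hpos hle
    by_contra! hlt
    set f : ℂ × Cn d → ℝ := fun q => w q.2 + ε * Real.log (‖q.1‖ / r) + ε * (‖q.1‖ ^ 2 - r ^ 2) with hf
    have hlog : Tendsto (fun a : ℝ => w 0 + 1 + ε * Real.log (a / r)) (𝓝[>] 0) atBot := by
      refine tendsto_atBot_add_const_left _ _ (Tendsto.const_mul_atBot hk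
        (Real.tendsto_log_nhdsGT_zero.comp ?_))
      refine tendsto_nhdsWithin_iff.2 ⟨?_, eventually_nhdsWithin_of_forall fun a ha => div_pos ha hr0⟩
      have : Tendsto (fun a : ℝ => a / r) (𝓝 0) (𝓝 0) := by
        simpa using (continuous_id.div_const r).tendsto 0
      exact this.mono_left nhdsWithin_le_nhds
    obtain ⟨i, hi, hiw⟩ := hG.small {y | w y < w 0 + 1} (hw0.eventually_lt_const (by linarith))
    obtain ⟨a, ⟨ha1, ha2⟩, ha0, ha3⟩ := (((hlog.eventually_lt_atBot M).and
      (nhdsWithin_le_nhds (Iio_mem_nhds hi))).and ((eventually_mem_nhdsWithin).and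
        (nhdsWithin_le_nhds (Iio_mem_nhds hpos)))).exists
    replace ha0 : 0 < a := ha0
    have hcomp := hG.isCompact_annulus ha0 hr hC
    have husc : UpperSemicontinuousOn f {q ∈ 𝒢 | a ≤ ‖q.1‖ ∧ ‖q.1‖ ≤ r} := by
      refine ((hw.usc.comp continuous_snd.continuousOn fun q hq => hGV q hq.1 hq.2.2).add
        (ContinuousOn.upperSemicontinuousOn ?_)).add (ContinuousOn.upperSemicontinuousOn ?_)
      · refine ContinuousOn.mul continuousOn_const (ContinuousOn.log (by fun_prop) fun q hq => ?_)
        exact (div_pos (ha0.trans_le hq.2.1) hr0).ne'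
      · fun_prop
    have hne : {q ∈ 𝒢 | a ≤ ‖q.1‖ ∧ ‖q.1‖ ≤ r}.Nonempty := ⟨q1, hq1, ha3.le, hle⟩
    obtain ⟨q2, hq2, hmax⟩ := UpperSemicontinuousOn.exists_isMaxOn hne hcomp husc
    have hq₂M := hlt.trans_le (hmax ⟨hq1, ha3.le, hle⟩)
    have hg0 := ha0.trans_le hq2.2.1
    have hne1 := lt_of_le_of_ne hq2.2.2 fun h => by
      have := hM q2 hq2.1 h
      simp only [hf, h, div_self hr0.ne', Real.log_one] at hq₂M
      linarith
    have hne2 := lt_of_le_of_ne hq2.2.1 fun h => by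
      have h1 : w q2.2 < w 0 + 1 := hiw q2 hq2.1 (h ▸ ha2)
      have h2 : ‖q2.1‖ ^ 2 ≤ r ^ 2 := pow_le_pow_left₀ hg0.le hq2.2.2 2
      simp only [hf, ← h] at hq₂M ha1 h2
      nlinarith
    obtain ⟨j, hj, hj0, hjev⟩ := hG.exists_section q2 hq2.1
    have hopen : IsOpen {x : ℂ | a < ‖x‖ ∧ ‖x‖ < r} :=
      (isOpen_lt continuous_const continuous_norm).inter (isOpen_lt continuous_norm continuous_const)
    obtain ⟨O, hOs, hO, hqO⟩ := _root_.mem_nhds_iff.1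
      ((hj.and hjev).and (hopen.mem_nhds ⟨hne2, hne1⟩))
    have hp : PshOn (fun x => w (j x) + ε * Real.log ‖x‖) O :=
      (hw.comp_holomorphic hV hO (fun x hx => (hOs hx).1.1.differentiableWithinAt)
        fun x hx => hGV _ (hOs hx).1.2 (hOs hx).2.2.le).add hO
        ((pshOn_log_norm (f := id) hO differentiableOn_id fun x hx =>
          norm_pos_iff.1 (ha0.trans (hOs hx).2.1)).const_mul hk.le)
    obtain ⟨t, ht, htO⟩ := Metric.nhds_basis_closedBall.mem_iff.1 (hO.mem_nhds hqO)
    have hmem : ∀ g ∈ closedBall (0 : ℂ) t, q2.1 + g • (1 : ℂ) ∈ O := fun g hg =>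
      htO (by simpa using hg)
    have h1 := hp.le_circleAverage (b := (1 : ℂ)) ht hmem
    have h2 : circleAverage (fun g => w (j (q2.1 + g • (1 : ℂ))) +
        ε * Real.log ‖q2.1 + g • (1 : ℂ)‖) 0 t ≤ circleAverage (fun g =>
          (w (j q2.1) + ε * Real.log ‖q2.1‖ + ε * ‖q2.1‖ ^ 2) + (-ε) * ‖g - (-q2.1)‖ ^ 2) 0 t := by
      refine circleAverage_mono (hp.circleIntegrable fun g hg =>
        hmem g (sphere_subset_closedBall (by rwa [abs_of_pos ht] at hg)))
        (ContinuousOn.circleIntegrable ht.le (by fun_prop)) fun g hg => ?_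
      rw [abs_of_pos ht] at hg
      have hO' := hOs (hmem g (sphere_subset_closedBall hg))
      have := hmax ⟨hO'.1.2, hO'.2.1.le, hO'.2.2.le⟩
      simp only [hf, mem_ofPred_eq, ← hj0] at this
      rw [Real.log_div (ha0.trans hO'.2.1).ne' hr0.ne', Real.log_div hg0.ne' hr0.ne'] at this
      rw [show g - -q2.1 = q2.1 + g • (1 : ℂ) by simp [add_comm]]
      linarith
    rw [circleAverage_fun_add (circleIntegrable_const _ _ _)
      (ContinuousOn.circleIntegrable ht.le (by fun_prop)), circleAverage_const,
      circleAverage_const_mul, circleAverage_norm_sq_sub, zero_sub, neg_neg] at h2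
    have := mul_pos hk (pow_pos ht 2)
    linarith
  have hall : ∀ q ∈ 𝒢, 0 < ‖q.1‖ → ‖q.1‖ ≤ r → w q.2 ≤ M := by
    intro q hq h0 hle
    have hc : Continuous fun ε : ℝ =>
        w q.2 + ε * Real.log (‖q.1‖ / r) + ε * (‖q.1‖ ^ 2 - r ^ 2) := by fun_prop
    have := le_of_tendsto ((hc.tendsto 0).mono_left (nhdsWithin_le_nhds (s := Ioi 0)))
      (eventually_nhdsWithin_of_forall fun ε hk => key ε hk q hq h0 hle)
    simpa using this
  by_contra! hlt
  obtain ⟨i, hi, hiw⟩ := hG.small {y | M < w y} (hw0.eventually_const_lt hlt)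
  have hm : 0 < min i r / 2 := by positivity
  have hnorm : ‖((min i r / 2 : ℝ) : ℂ)‖ = min i r / 2 := by
    rw [Complex.norm_real, norm_of_nonneg hm.le]
  obtain ⟨y, hy⟩ := hG.nonempty ((min i r / 2 : ℝ) : ℂ) (by rw [hnorm]; exact hm)
    (by rw [hnorm]; linarith [min_le_right i r])
  exact absurd (hall _ hy (by rw [hnorm]; exact hm) (by rw [hnorm]; linarith [min_le_right i r]))
    (not_le.2 (hiw _ hy (by rw [hnorm]; linarith [min_le_left i r])))

lemma IsMultidisc.exists_ge (hG : IsMultidisc 𝒢 ρ A) (hV : IsOpen V) (h0 : (0 : Cn d) ∈ V)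
    (hw : PshOn w V) {N : Set (Cn d)} (hN : N ∈ 𝓝 0) : ∃ y ∈ A, y ∈ N ∧ w 0 ≤ w y := by
  obtain ⟨v, hv, hvw⟩ := hw.exists_global hV h0
  obtain ⟨a, ha, has⟩ := hG.small (N ∩ {y | v y = w y} ∩ ball 0 1)
    (inter_mem (inter_mem hN hvw) (ball_mem_nhds 0 one_pos))
  have hr0 : 0 < min a ρ / 2 := by have := hG.pos; positivity
  set r := min a ρ / 2 with hrdef
  have hrb : r < ρ := by linarith [min_le_right a ρ]
  have hra : r < a := by linarith [min_le_left a ρ]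
  have hC : ∀ q ∈ 𝒢, ‖q.1‖ ≤ r → ‖q.2‖ ≤ 1 := fun q hq hle =>
    (mem_ball_zero_iff.1 (has q hq (hle.trans_lt hra)).2).le
  have hcomp := (hG.isCompact_annulus hr0 hrb hC).image continuous_snd
  have hnr : ‖(r : ℂ)‖ = r := by rw [Complex.norm_real, norm_of_nonneg hr0.le]
  obtain ⟨y1, hy1⟩ := hG.nonempty (r : ℂ) (by rwa [hnr]) (by rwa [hnr])
  have hne : (Prod.snd '' {q ∈ 𝒢 | r ≤ ‖q.1‖ ∧ ‖q.1‖ ≤ r}).Nonempty :=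
    ⟨y1, (↑r, y1), ⟨hy1, hnr.ge, hnr.le⟩, rfl⟩
  obtain ⟨_, ⟨q, hq, rfl⟩, hmax⟩ := UpperSemicontinuousOn.exists_isMaxOn hne hcomp
    (hv.upperSemicontinuous.upperSemicontinuousOn _)
  have hqa := has q hq.1 (hq.2.2.trans_lt hra)
  refine ⟨q.2, hG.mem q hq.1, hqa.1.1, ?_⟩
  rw [← hvw.self_of_nhds, ← show v q.2 = w q.2 from hqa.1.2]
  refine le_of_forall_pos_le_add fun η hc => ?_
  obtain ⟨t, ht, hts⟩ := hcomp.exists_cthickening_subset_open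
    (t := {y | v y < v q.2 + η}) (hv.upperSemicontinuous.isOpen_preimage _) fun y hy =>
      lt_of_le_of_lt (hmax hy) (lt_add_of_pos_right _ hc)
  refine (hv.le_mollify ht 0).trans (hG.le_of_continuousAt hr0 hrb hC isOpen_univ
    (fun _ _ _ => mem_univ _) (hv.pshOn_mollify ht)
    (mollify_contDiff ht hv.locallyIntegrable (n := 0)).continuous.continuousAt fun p hp hpr => ?_)
  rw [← mollify_const (d := d) ht (v q.2 + η) p.2]
  refine moll_integral_mono ht (hv.integrable_moll ht _)
    ((moll_integrable ht).mul_const _) fun x hx => le_of_lt (hts ?_)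
  refine mem_cthickening_of_dist_le _ p.2 _ _ ⟨p, ⟨hp, hpr.ge, hpr.le⟩, rfl⟩ ?_
  rw [dist_eq_norm, sub_sub_cancel_left, norm_neg]
  simpa using hx

end MaximumPrinciple

section LocalMaximality

variable {d : ℕ}
variable {𝒱 : Set (Fn d)} {H : Fn d}

/-- A family of plurisubharmonic functions stable under maxima, whose upper regularized supremum is
at least `H`, contains an increasing sequence converging to `H` almost everywhere. -/
lemma exists_monotone_seq_ae {O : Set (Cn d)} (hO : IsOpen O)
    (hOv : volume O ≠ ⊤) (hne : 𝒱.Nonempty)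
    (hext : ∀ v ∈ 𝒱, ∃ V : Fn d, PshOn V univ ∧ ∀ z ∈ O, V z = v z)
    (h01 : ∀ v ∈ 𝒱, ∀ z ∈ O, 0 ≤ v z ∧ v z ≤ 1)
    (hsup : ∀ v ∈ 𝒱, ∀ v' ∈ 𝒱, (fun z => max (v z) (v' z)) ∈ 𝒱) (hle : ∀ v ∈ 𝒱, ∀ z ∈ O, v z ≤ H z)
    (hH : ∀ z ∈ O, ∀ ε > 0, ∀ N ∈ 𝓝 z, ∃ z' ∈ N, ∃ v ∈ 𝒱, H z - ε < v z') :
    ∃ h : ℕ → Fn d, (∀ i, h i ∈ 𝒱) ∧ Monotone h ∧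
      ∀ᵐ z, z ∈ O → Tendsto (fun i => h i z) atTop (𝓝 (H z)) := by
  have hmeas : ∀ v ∈ 𝒱, AEStronglyMeasurable v (volume.restrict O) := fun v hv => by
    obtain ⟨V, hV, hVv⟩ := hext v hv
    refine hV.measurable.aestronglyMeasurable.congr ?_
    exact (ae_restrict_iff' hO.measurableSet).2 (ae_of_all _ hVv)
  have hconst : Integrable (fun _ : Cn d => (1 : ℝ)) (volume.restrict O) := integrableOn_const hOv
  have hae : ∀ {p : Cn d → Prop}, (∀ z ∈ O, p z) → ∀ᵐ z ∂volume.restrict O, p z := fun h =>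
    (ae_restrict_iff' hO.measurableSet).2 (ae_of_all _ h)
  have hb1 : ∀ v ∈ 𝒱, ∀ z ∈ O, ‖v z‖ ≤ 1 := fun v hv z hz => by
    rw [norm_of_nonneg (h01 v hv z hz).1]; exact (h01 v hv z hz).2
  have hint : ∀ v ∈ 𝒱, Integrable v (volume.restrict O) := fun v hv =>
    hconst.mono' (hmeas v hv) (hae (hb1 v hv))
  set J : (Fn d) → ℝ := fun v => ∫ z in O, v z with hJ
  have hbdd : BddAbove (J '' 𝒱) := ⟨∫ _ in O, (1 : ℝ), by
    rintro _ ⟨v, hv, rfl⟩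
    exact integral_mono_ae (hint v hv) hconst (hae fun z hz => (h01 v hv z hz).2)⟩
  have hex : ∀ j : ℕ, ∃ v ∈ 𝒱, sSup (J '' 𝒱) - 1 / ((j : ℝ) + 1) < J v := fun j => by
    obtain ⟨_, ⟨v, hv, rfl⟩, h⟩ := exists_lt_of_lt_csSup (hne.image J)
      (sub_lt_self _ (Nat.one_div_pos_of_nat (n := j)) : sSup (J '' 𝒱) - 1 / ((j : ℝ) + 1) < _)
    exact ⟨v, hv, h⟩
  choose f hfA hfI using hex
  let h : ℕ → Fn d := fun i => Nat.rec (f 0) (fun j g z => max (g z) (f (j + 1) z)) i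
  have hh : ∀ i, h i ∈ 𝒱 := fun i => by
    induction i with
    | zero => exact hfA 0
    | succ j ih => exact hsup _ ih _ (hfA _)
  have hmono : Monotone h := monotone_nat_of_le_succ fun i z => le_max_left _ _
  have hfh : ∀ i z, f i z ≤ h i z := fun i z => by
    cases i with
    | zero => exact le_rfl
    | succ j => exact le_max_right _ _
  set g : Fn d := fun z => ⨆ i, h i z with hg
  have hlim : ∀ z ∈ O, Tendsto (fun i => h i z) atTop (𝓝 (g z)) := fun z hz =>
    tendsto_atTop_ciSup (fun i j hij => hmono hij z)
      ⟨1, by rintro _ ⟨i, rfl⟩; exact (h01 _ (hh i) z hz).2⟩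
  have hg01 : ∀ z ∈ O, 0 ≤ g z ∧ g z ≤ 1 := fun z hz =>
    ⟨ge_of_tendsto' (hlim z hz) fun i => (h01 _ (hh i) z hz).1,
      le_of_tendsto' (hlim z hz) fun i => (h01 _ (hh i) z hz).2⟩
  have hgi : Integrable g (volume.restrict O) := by
    refine hconst.mono' (aestronglyMeasurable_of_tendsto_ae atTop (fun i => hmeas _ (hh i))
      (hae hlim)) (hae fun z hz => ?_)
    rw [norm_of_nonneg (hg01 z hz).1]; exact (hg01 z hz).2
  have hgS : sSup (J '' 𝒱) ≤ ∫ z in O, g z := by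
    refine le_of_tendsto' (f := fun j : ℕ => sSup (J '' 𝒱) - 1 / ((j : ℝ) + 1)) (x := atTop)
      (by simpa using tendsto_const_nhds.sub (tendsto_one_div_add_atTop_nhds_zero_nat (𝕜 := ℝ)))
      fun j => (hfI j).le.trans (integral_mono_ae (hint _ (hfA j)) hgi (hae fun z hz => ?_))
    have hm : Monotone fun i => h i z := fun i j hij => hmono hij z
    exact (hfh j z).trans (hm.ge_of_tendsto (hlim z hz) j)
  have hvg : ∀ v ∈ 𝒱, ∀ᵐ z ∂volume.restrict O, v z ≤ g z := fun v hv => by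
    have h1 : ∫ z in O, max (v z) (g z) ≤ sSup (J '' 𝒱) := by
      refine le_of_tendsto' (tendsto_integral_of_dominated_convergence (fun _ => 1)
        (F := fun i z => max (v z) (h i z)) (fun i => hmeas _ (hsup v hv _ (hh i))) hconst
        (fun i => hae (hb1 _ (hsup v hv _ (hh i))))
        (hae fun z hz => tendsto_const_nhds.max (hlim z hz))) fun i => ?_
      exact le_csSup hbdd ⟨_, hsup v hv _ (hh i), rfl⟩
    have h2 := (integral_eq_iff_of_ae_le hgi ((hint v hv).sup hgi)
      (ae_of_all _ fun z => le_max_right (v z) (g z))).1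
      (le_antisymm (integral_mono hgi ((hint v hv).sup hgi) fun z => le_max_right (v z) (g z))
        (h1.trans hgS))
    filter_upwards [h2] with z hz
    rw [hz]
    exact le_max_left (v z) (g z)
  have hGi := (integrable_indicator_iff hO.measurableSet).2 hgi
  refine ⟨h, hh, hmono, ?_⟩
  filter_upwards [IsUnifLocDoublingMeasure.ae_tendsto_average volume hGi.locallyIntegrable 1]
    with z hz hzO
  suffices hs : H z ≤ g z by
    rw [le_antisymm hs (le_of_tendsto' (hlim z hzO) fun i => hle _ (hh i) z hzO)]
    exact hlim z hzO
  have hch : ∀ j : ℕ, ∃ z' ∈ closedBall z (radius j), ∃ v ∈ 𝒱, H z - radius j < v z' := fun j =>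
    hH z hzO _ (radius_pos j) _ (closedBall_mem_nhds z (radius_pos j))
  choose y hy v hvA hv using hch
  have hl := hz y radius tendsto_radius (.of_forall fun j => by
    rw [one_mul, mem_closedBall_comm]; exact hy j)
  rw [indicator_of_mem hzO] at hl
  have hrad := tendsto_radius.mono_right nhdsWithin_le_nhds
  obtain ⟨t, ht, htO⟩ := Metric.isOpen_iff.1 hO z hzO
  refine le_of_tendsto_of_tendsto (by simpa using tendsto_const_nhds.sub hrad) hl ?_
  filter_upwards [hrad.eventually_lt_const (half_pos ht)] with j hj
  have hsub : closedBall (y j) (radius j) ⊆ O := fun x hx => htO <| by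
    have := dist_triangle x (y j) z
    have h1 := mem_closedBall.1 (hy j)
    rw [mem_closedBall] at hx
    rw [mem_ball]
    linarith
  obtain ⟨V, hV, hVv⟩ := hext _ (hvA j)
  refine (hv j).le.trans ?_
  rw [← hVv _ (hsub (mem_closedBall_self (radius_pos j).le))]
  refine (hV.le_setAverage_closedBall (radius_pos j) _).trans ?_
  rw [setAverage_eq, setAverage_eq]
  refine smul_le_smul_of_nonneg_left (integral_mono_ae
    (hV.locallyIntegrable.integrableOn_isCompact (isCompact_closedBall _ _)) hGi.integrableOn ?_)
    (by positivity)
  filter_upwards [ae_mono (Measure.restrict_mono hsub le_rfl) (hvg _ (hvA j)),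
    ae_restrict_mem measurableSet_closedBall] with x hx hxb
  rwa [hVv x (hsub hxb), indicator_of_mem (hsub hxb)]

/-- The envelope of a family of plurisubharmonic functions stable under maxima and gluing is not
touched from above strictly by a plurisubharmonic function. -/
theorem not_strict_touching {w : Fn d} {τ m c : ℝ} (hne : 𝒱.Nonempty)
    (hpsh : ∀ v ∈ 𝒱, PshOn v {z | sqn z < 36}) (h01 : ∀ v ∈ 𝒱, ∀ z, sqn z < 36 → 0 ≤ v z ∧ v z ≤ 1)
    (hsup : ∀ v ∈ 𝒱, ∀ v' ∈ 𝒱, (fun z => max (v z) (v' z)) ∈ 𝒱)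
    (hle : ∀ v ∈ 𝒱, ∀ z, sqn z < 36 → v z ≤ H z)
    (hH : ∀ z, sqn z < 36 → ∀ ε > 0, ∀ N ∈ 𝓝 z, ∃ z' ∈ N, ∃ v ∈ 𝒱, H z - ε < v z')
    (hHc : ContinuousOn H {z | sqn z < 36})
    (hglue : ∀ v ∈ 𝒱, ∀ q, PshOn q {z | sqn z < 1} → (∀ z, sqn z < 1 → q z ≤ 1) →
      (∀ z, 1 / 2 < sqn z → sqn z < 1 → q z ≤ v z) → ∃ v' ∈ 𝒱, ∀ z, sqn z < 1 → q z ≤ v' z)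
    (hf : 0 < τ) (hH1 : ∀ z, sqn z < 1 → H z ≤ 1 - τ) (hw : PshOn w {z | sqn z < 1}) (hc : 0 < c)
    (hwm : ∀ z, sqn z < 1 → w z - H z ≤ m - c * sqn z) (hw0 : w 0 - H 0 = m) : False := by
  classical
  have hs := continuous_sqn (d := d)
  have hopen : ∀ r : ℝ, IsOpen {z : Cn d | sqn z < r} := fun r => isOpen_lt hs continuous_const
  have h9 : ({z | sqn z < 9} : Set (Cn d)) ⊆ {z | sqn z < 36} := fun z hz =>
    lt_trans (show sqn z < 9 from hz) (by norm_num)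
  have h1 : ({z | sqn z < 1} : Set (Cn d)) ⊆ {z | sqn z < 36} := fun z hz =>
    lt_trans (show sqn z < 1 from hz) (by norm_num)
  have hvol : volume ({z | sqn z < 9} : Set (Cn d)) ≠ ⊤ := by
    refine ((measure_mono fun z hz => ?_).trans_lt
      (measure_closedBall_lt_top (x := (0 : Cn d)) (r := 3))).ne
    exact mem_closedBall_zero_iff.2
      (norm_le_of_sqn_le (by norm_num) (hz.out.le.trans (by norm_num)))
  have hext : ∀ v ∈ 𝒱, ∃ V : Fn d, PshOn V univ ∧ ∀ z ∈ {z | sqn z < 9}, V z = v z := by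
    intro v hv
    refine ⟨_, ((hpsh v hv).mono (W := {z | sqn z < 27}) fun z hz =>
      lt_trans (show sqn z < 27 from hz) (by norm_num)).glue (hopen 27) isOpen_univ
      (((pshOn_sqn univ).const_mul (c := 1 / 9) (by norm_num)).add_const isOpen_univ (-1))
      fun x _ hx => ?_, fun z hz => ?_⟩
    · have hx' : 18 < sqn x := by
        have : ¬ sqn x < 27 := hx
        linarith
      filter_upwards [(isOpen_lt continuous_const hs).mem_nhds hx'] with y hy hy27
      have h2 := (h01 v hv y (lt_trans (show sqn y < 27 from hy27) (by norm_num))).2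
      have hy' := hy
      linarith
    · have hz' : sqn z < 9 := hz
      rw [if_pos (show z ∈ {z | sqn z < 27} from by rw [mem_ofPred_eq]; linarith), max_eq_left]
      have := (h01 v hv z (by linarith)).1
      linarith
  obtain ⟨h, hhA, hmono, hlim⟩ := exists_monotone_seq_ae (hopen 9) hvol hne hext
    (fun v hv z hz => h01 v hv z (h9 hz)) hsup (fun v hv z hz => hle v hv z (h9 hz))
    (fun z hz => hH z (h9 hz))
  obtain ⟨t, ht0, htf, ht1, htc⟩ : ∃ t, 0 < t ∧ t ≤ τ ∧ t ≤ 1 ∧ t ≤ c / 4 :=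
    ⟨min τ (min 1 (c / 4)), by positivity, min_le_left _ _, (min_le_right _ _).trans (min_le_left _ _),
      (min_le_right _ _).trans (min_le_right _ _)⟩
  have h00 : (0 : Cn d) ∈ {z : Cn d | sqn z < 1} := by simp [sqn_zero]
  have hPpos : 0 < volume {z : Cn d | sqn z < 1 ∧ m - t / 2 < w z - H z} := by
    obtain ⟨W, hW, hWw⟩ := hw.exists_global (hopen 1) h00
    have hHc0 : ∀ᶠ z in 𝓝 (0 : Cn d), H z < H 0 + t / 2 :=
      (hHc.continuousAt ((hopen 36).mem_nhds (h1 h00))).eventually_lt_const (by linarith)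
    obtain ⟨a, ha, has⟩ := Metric.nhds_basis_closedBall.mem_iff.1
      ((hWw.and hHc0).and ((hopen 1).mem_nhds h00))
    refine lt_of_lt_of_le (measure_setAverage_le_pos (measure_closedBall_pos volume 0 ha).ne'
      measure_closedBall_lt_top.ne
      (hW.locallyIntegrable.integrableOn_isCompact (isCompact_closedBall 0 a)))
      (measure_mono fun z hz => ⟨(has hz.1).2, ?_⟩)
    have h3 := (hW.le_setAverage_closedBall ha 0).trans hz.2
    rw [hWw.self_of_nhds, (has hz.1).1.1] at h3
    linarith [(has hz.1).1.2]
  obtain ⟨μ, hb0, hbP⟩ : ∃ μ : ℝ, 0 < μ ∧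
      ENNReal.ofReal μ < volume {z : Cn d | sqn z < 1 ∧ m - t / 2 < w z - H z} := by
    obtain ⟨r, hr, hrP⟩ := ENNReal.lt_iff_exists_nnreal_btwn.1 hPpos
    exact ⟨r, by exact_mod_cast hr, by simpa using hrP⟩
  obtain ⟨i, p, hp, hp0, hp1, hpv⟩ := exists_index_capacity (fun i => (hpsh _ (hhA i)).mono h9)
    (fun i z hz => (h01 _ (hhA i) z (h9 hz)).1) (fun i z hz => (h01 _ (hhA i) z (h9 hz)).2)
    (fun z _ i j hij => hmono hij z) hlim (fun i z hz => hle _ (hhA i) z (h9 hz)) (hHc.mono h9)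
    (η := c / 4) (μ := min μ (t / 4)) (by positivity) (by positivity)
  obtain ⟨v', hv', hq⟩ := hglue (h i) (hhA i) (fun z => w z + 2 * p z + (t - m))
    ((hw.add (hopen 1) ((hp.mono (subset_univ _)).const_mul zero_le_two)).add_const (hopen 1) _)
    (fun z hz => by linarith [hwm z hz, hp0 z hz, hH1 z hz, mul_nonneg hc.le (sqn_nonneg z)])
    fun z hz2 hz => by
      have h2 := hwm z hz
      have h3 : c * (1 / 2) ≤ c * sqn z := by gcongr
      rcases lt_or_ge (h i z) (H z - c / 4) with h4 | h4
      · linarith [hp1 z hz h4, hH1 z hz, (h01 _ (hhA i) z (h1 hz)).1]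
      · linarith [hp0 z hz]
  have hsub : {z : Cn d | sqn z < 1 ∧ m - t / 2 < w z - H z} ⊆
      {z | sqn z < 1 ∧ p z < -min μ (t / 4)} := fun z hz => ⟨hz.1, ?_⟩
  · exact absurd (hbP.trans_le ((measure_mono hsub).trans hpv))
      (not_lt.2 (ENNReal.ofReal_le_ofReal (min_le_left _ _)))
  have h2 := (hq z hz.1).trans (hle v' hv' z (h1 hz.1))
  have h3 := hz.2
  have h4 := min_le_right μ (t / 4)
  linarith

end LocalMaximality

section SpaceGerms

variable {X : Type*} [TopologicalSpace X] {S : CSpace X}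
  {E G : Type*} [NormedAddCommGroup E] [NormedSpace ℂ E] [NormedAddCommGroup G] [NormedSpace ℂ G]
variable {v v' : X → ℝ} {D : Set X} {w w' : E → ℝ} {p : E} {x : X}

/-- Plurisubharmonicity in a neighbourhood of a point. -/
def PshNear (w : E → ℝ) (p : E) : Prop := ∃ V, IsOpen V ∧ p ∈ V ∧ PshOn w V

lemma PshOn.pshNear (hw : PshOn w univ) : PshNear w p := ⟨univ, isOpen_univ, mem_univ p, hw⟩

lemma PshNear.add : PshNear w p → PshNear w' p → PshNear (fun y => w y + w' y) p :=
  fun ⟨V, hV, hp, hw⟩ ⟨V', hV', hp', hw'⟩ => ⟨V ∩ V', hV.inter hV', ⟨hp, hp'⟩,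
    (hw.mono inter_subset_left).add (hV.inter hV') (hw'.mono inter_subset_right)⟩

lemma PshNear.sup : PshNear w p → PshNear w' p → PshNear (fun y => max (w y) (w' y)) p :=
  fun ⟨V, hV, hp, hw⟩ ⟨V', hV', hp', hw'⟩ => ⟨V ∩ V', hV.inter hV', ⟨hp, hp'⟩,
    (hw.mono inter_subset_left).sup (hV.inter hV') (hw'.mono inter_subset_right)⟩

lemma PshNear.comp [FiniteDimensional ℂ G] {w : G → ℝ} {F : E → G}
    (hF : HolAt F p) : PshNear w (F p) → PshNear (fun y => w (F y)) p := by
  rintro ⟨V, hV, hp, hw⟩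
  obtain ⟨O, hOs, hO, hpO⟩ := _root_.mem_nhds_iff.1
    (hF.and (hF.continuousAt.eventually (hV.mem_nhds hp)))
  exact ⟨O, hO, hpO, hw.comp_holomorphic hV hO
    (fun y hy => (hOs hy).1.differentiableWithinAt) fun y hy => (hOs hy).2⟩

lemma pshOn_norm_sq_self (V : Set E) : PshOn (fun z : E => ‖z‖ ^ 2) V := by
  refine PshOn.mono (V := univ) (pshOn_of_re_support isOpen_univ (by fun_prop) fun a _ => ?_)
    (subset_univ _)
  obtain ⟨l, hl, hla⟩ := exists_dual_vector'' ℂ a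
  refine ⟨fun z => ((2 * ‖a‖ : ℝ) : ℂ) * l z - (‖a‖ ^ 2 : ℝ),
    ((l.differentiable.const_mul _).sub_const _).differentiableOn, ?_, fun z _ => ?_⟩ <;>
    simp only [Complex.sub_re, Complex.re_ofReal_mul, Complex.ofReal_re]
  · rw [hla]
    exact (show 2 * ‖a‖ * ‖a‖ - ‖a‖ ^ 2 = ‖a‖ ^ 2 by ring)
  · have h1 := (Complex.re_le_norm _).trans ((l.le_of_opNorm_le hl z).trans_eq (one_mul _))
    nlinarith [norm_nonneg a, sq_nonneg (‖z‖ - ‖a‖)]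

lemma CChart.continuousAt (c : CChart X) (hx : x ∈ c.U) : ContinuousAt c.φ x :=
  c.contOn.continuousAt (c.openU.mem_nhds hx)

/-- Holomorphy of a vector-valued map near a point of a complex space. -/
def HolX (S : CSpace X) (A : X → G) (x : X) : Prop :=
  ∃ c ∈ S.atlas, x ∈ c.U ∧ ∃ F : c.E → G, HolAt F (c.φ x) ∧ ∀ᶠ y in 𝓝 x, A y = F (c.φ y)

/-- Plurisubharmonicity of a real-valued function near a point of a complex space. -/
def PshAt (S : CSpace X) (v : X → ℝ) (x : X) : Prop :=
  ∃ c ∈ S.atlas, x ∈ c.U ∧ ∃ w : c.E → ℝ, PshNear w (c.φ x) ∧ ∀ᶠ y in 𝓝 x, v y = w (c.φ y)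

lemma CSpace.exists_transition {c d : CChart X} (hc : c ∈ S.atlas) (hd : d ∈ S.atlas)
    (hxc : x ∈ c.U) (hxd : x ∈ d.U) :
    ∃ F : d.E → c.E, HolAt F (d.φ x) ∧ ∀ᶠ y in 𝓝 x, c.φ y = F (d.φ y) := by
  obtain ⟨W, hW, hxW, F, hF, hFe⟩ := S.compat d hd c hc x ⟨hxd, hxc⟩
  refine ⟨F, hF.holAt hW hxW, ?_⟩
  filter_upwards [(d.continuousAt hxd).eventually (hW.mem_nhds hxW), c.openU.mem_nhds hxc,
    d.openU.mem_nhds hxd] with y h1 h2 h3 using (hFe y ⟨h3, h2⟩ h1).symm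

lemma HolX.in_chart {A : X → G} {d : CChart X} (hd : d ∈ S.atlas) (hx : x ∈ d.U) :
    HolX S A x → ∃ F : d.E → G, HolAt F (d.φ x) ∧ ∀ᶠ y in 𝓝 x, A y = F (d.φ y) := by
  rintro ⟨c, hc, hxc, F, hF, hFe⟩
  obtain ⟨T, hT, hTe⟩ := CSpace.exists_transition hc hd hxc hx
  refine ⟨fun y => F (T y), hF.comp_eq hT hTe.self_of_nhds.symm, ?_⟩
  filter_upwards [hFe, hTe] with y h1 h2 using by rw [h1, h2]

lemma PshAt.in_chart {d : CChart X} (hd : d ∈ S.atlas) (hx : x ∈ d.U) :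
    PshAt S v x → ∃ w : d.E → ℝ, PshNear w (d.φ x) ∧ ∀ᶠ y in 𝓝 x, v y = w (d.φ y) := by
  rintro ⟨c, hc, hxc, w, hw, hwe⟩
  obtain ⟨T, hT, hTe⟩ := CSpace.exists_transition hc hd hxc hx
  refine ⟨fun y => w (T y), PshNear.comp hT (hTe.self_of_nhds ▸ hw), ?_⟩
  filter_upwards [hwe, hTe] with y h1 h2 using by rw [h1, h2]

lemma HolX.continuousAt {A : X → G} : HolX S A x → ContinuousAt A x := by
  rintro ⟨c, -, hxc, F, hF, hFe⟩
  exact (hF.continuousAt.comp (f := c.φ) (c.continuousAt hxc)).congr (EventuallyEq.symm hFe)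

lemma HolX.comp {G' : Type*} [NormedAddCommGroup G'] [NormedSpace ℂ G'] {A : X → G}
    {g : G → G'} (hg : HolAt g (A x)) : HolX S A x → HolX S (fun y => g (A y)) x := by
  rintro ⟨c, hc, hxc, F, hF, hFe⟩
  refine ⟨c, hc, hxc, fun y => g (F y), hg.comp_eq hF hFe.self_of_nhds.symm, ?_⟩
  filter_upwards [hFe] with y h1 using by rw [h1]

lemma HolX.pi {k : ℕ} {f : X → Cn k} (h : ∀ i, HolX S (fun y => f y i) x) : HolX S f x := by
  obtain ⟨c, hc, hxc⟩ := S.chart_cover x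
  choose F hF hFe using fun i => (h i).in_chart hc hxc
  refine ⟨c, hc, hxc, fun p i => F i p, ?_, ?_⟩
  · filter_upwards [eventually_all.2 hF] with p hp using differentiableAt_pi.2 hp
  · filter_upwards [eventually_all.2 hFe] with y hy using funext hy

lemma PshNear.pshAt [FiniteDimensional ℂ G] {w : G → ℝ} {A : X → G} (hA : HolX S A x)
    (hw : PshNear w (A x)) : PshAt S (fun y => w (A y)) x := by
  obtain ⟨c, hc, hxc, F, hF, hFe⟩ := hA
  refine ⟨c, hc, hxc, fun y => w (F y), PshNear.comp hF (hFe.self_of_nhds ▸ hw), ?_⟩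
  filter_upwards [hFe] with y h1 using by rw [h1]

lemma PshAt.congr (h : ∀ᶠ y in 𝓝 x, v' y = v y) : PshAt S v x → PshAt S v' x :=
  fun ⟨c, hc, hxc, w, hw, hwe⟩ => ⟨c, hc, hxc, w, hw, by
    filter_upwards [h, hwe] with y h1 h2 using h1.trans h2⟩

lemma PshAt.add (h : PshAt S v x) (h' : PshAt S v' x) : PshAt S (fun y => v y + v' y) x := by
  obtain ⟨c, hc, hxc, w, hw, hwe⟩ := h
  obtain ⟨w', hw', hwe'⟩ := h'.in_chart hc hxc
  exact ⟨c, hc, hxc, _, hw.add hw', by filter_upwards [hwe, hwe'] with y h1 h2 using by rw [h1, h2]⟩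

lemma PshAt.sup (h : PshAt S v x) (h' : PshAt S v' x) : PshAt S (fun y => max (v y) (v' y)) x := by
  obtain ⟨c, hc, hxc, w, hw, hwe⟩ := h
  obtain ⟨w', hw', hwe'⟩ := h'.in_chart hc hxc
  exact ⟨c, hc, hxc, _, hw.sup hw', by filter_upwards [hwe, hwe'] with y h1 h2 using by rw [h1, h2]⟩

lemma PshAt.const_mul {a : ℝ} (ha : 0 ≤ a) : PshAt S v x → PshAt S (fun y => a * v y) x :=
  fun ⟨c, hc, hxc, w, ⟨V, hV, hp, hw⟩, hwe⟩ => ⟨c, hc, hxc, _, ⟨V, hV, hp, hw.const_mul ha⟩, by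
    filter_upwards [hwe] with y h1 using by rw [h1]⟩

lemma pshAt_const (b : ℝ) (x : X) : PshAt S (fun _ => b) x := by
  obtain ⟨c, hc, hxc⟩ := S.chart_cover x
  exact ⟨c, hc, hxc, fun _ => b, (pshOn_const b univ).pshNear, .of_forall fun _ => rfl⟩

lemma PshAt.upperSemicontinuousAt : PshAt S v x → UpperSemicontinuousAt v x := by
  rintro ⟨c, -, hxc, w, ⟨V, hV, hp, hw⟩, hwe⟩ b hb
  have h1 := hw.usc _ hp b (show w (c.φ x) < b by rw [← hwe.self_of_nhds]; exact hb)
  rw [hV.nhdsWithin_eq hp] at h1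
  filter_upwards [(c.continuousAt hxc).eventually h1, hwe] with y h2 h3
  show v y < b
  rwa [h3]

lemma SpacePSHOn.pshAt {u : X → EReal} (hu : SpacePSHOn S u D) (hx : x ∈ D)
    (m : ℝ) : PshAt S (fun y => (max (u y) m).toReal) x := by
  obtain ⟨c, hc, hxc, V, hV, -, hxV, -, p, hp, he⟩ := hu.2.2 x hx
  refine ⟨c, hc, hxc, _, ⟨V, hV, hxV, hp.pshOn_max_toReal hV m⟩, ?_⟩
  filter_upwards [c.openU.mem_nhds hxc, (c.continuousAt hxc).eventually (hV.mem_nhds hxV)] with y h1 h2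
    using by rw [he y h1 h2]

lemma spacePSHOn_of_pshAt (hD : IsOpen D) (hv : ∀ x ∈ D, PshAt S v x) :
    SpacePSHOn S (fun x => (v x : EReal)) D := by
  refine ⟨fun x _ => EReal.coe_lt_top _, fun C hC => hC.1.2.1.imp fun x hx =>
    ⟨hx, EReal.coe_ne_bot _⟩, fun x hx => ?_⟩
  obtain ⟨c, hc, hxc, w, ⟨V, hV, hxV, hw⟩, hwe⟩ := hv x hx
  obtain ⟨W, hWs, hW, hxW⟩ := _root_.mem_nhds_iff.1
    (inter_mem hwe (inter_mem (c.openU.mem_nhds hxc) (hD.mem_nhds hx)))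
  obtain ⟨V', hV', himg⟩ := c.open_image W (fun y hy => (hWs hy).2.1) hW
  have hmem : ∀ y ∈ c.U, c.φ y ∈ V' → y ∈ W := fun y hy hyV => by
    have : c.φ y ∈ c.φ '' W := himg ▸ ⟨c.mapsToB y hy, hyV⟩
    obtain ⟨y', hy', he⟩ := this
    rwa [← c.injOn (hWs hy').2.1 hy he]
  refine ⟨c, hc, hxc, c.V ∩ (V ∩ V'), c.subvariety.1.inter (hV.inter hV'), inter_subset_left,
    ⟨c.subvariety.2.1 (c.mapsToB x hxc), hxV, ?_⟩, fun y hy => (hWs (hmem y hy.1 hy.2.2.2)).2.2, _,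
    (hw.mono fun y hy => hy.2.1).toPSHOnE, fun y hy hyV => ?_⟩
  · have : c.φ x ∈ c.φ '' W := ⟨x, hxW, rfl⟩
    exact (himg ▸ this).2
  · exact congrArg _ (hWs (hmem y hy hyV.2.2)).1.symm

lemma SpaceHolOn.holX {f : X → ℂ} (hf : SpaceHolOn S f univ) (x : X) : HolX S f x := by
  obtain ⟨c, hc, hxc, V, hV, -, hxV, -, F, hF, he⟩ := hf x (mem_univ x)
  refine ⟨c, hc, hxc, F, hF.holAt hV hxV, ?_⟩
  filter_upwards [c.openU.mem_nhds hxc, (c.continuousAt hxc).eventually (hV.mem_nhds hxV)] with y h1 h2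
    using (he y h1 h2).symm

lemma SpaceRealAnalyticOn.continuous {p : X → ℝ} (hp : SpaceRealAnalyticOn S p univ) :
    Continuous p := continuous_iff_continuousAt.2 fun x => by
  obtain ⟨c, hc, hxc, V, hV, -, hxV, -, g, hg, he⟩ := hp x (mem_univ x)
  refine ((hg _ hxV).continuousAt.comp (f := c.φ) (c.continuousAt hxc)).congr ?_
  filter_upwards [c.openU.mem_nhds hxc, (c.continuousAt hxc).eventually (hV.mem_nhds hxV)] with y h1 h2
    using he y h1 h2

lemma SpaceStronglyPSHOn.pshAt {p : X → ℝ} (hp : SpaceStronglyPSHOn S p univ) (hc : Continuous p)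
    (x : X) : PshAt S p x := by
  obtain ⟨c, hcS, hxc, V, hV, -, hxV, -, g, hg, he⟩ := hp x (mem_univ x)
  obtain ⟨ε, ha, W, hW, hxW, -, hgW⟩ := hg _ hxV
  set m := p x - ε * ‖c.φ x‖ ^ 2 - 1
  refine ⟨c, hcS, hxc, _, ⟨W, hW, hxW, (hgW.pshOn_max_toReal hW m).add hW
    ((pshOn_norm_sq_self W).const_mul ha.le)⟩, ?_⟩
  have hca := c.continuousAt hxc
  have h0 : ∀ᶠ y in 𝓝 x, m < p y - ε * ‖c.φ y‖ ^ 2 :=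
    (hc.continuousAt.sub (continuousAt_const.mul (hca.norm.pow 2))).eventually_const_lt (sub_one_lt _)
  filter_upwards [c.openU.mem_nhds hxc, hca.eventually (hV.mem_nhds hxV), h0] with y h1 h2 h3
  rw [he y h1 h2, max_eq_left (EReal.coe_le_coe_iff.2 h3.le), EReal.toReal_coe]
  ring

end SpaceGerms

section Coordinates

variable {X : Type*} [TopologicalSpace X] {S : CSpace X}

/-- `Φ` identifies the open set `O` of the complex space with `V ∩ Z`, with inverse `θ`. -/
structure IsCoord (S : CSpace X) {N : ℕ} (O : Set X) (V Z : Set (Cn N)) (Φ : X → Cn N)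
    (θ : Cn N → X) : Prop where
  isOpen : IsOpen O
  isOpen' : IsOpen V
  map_mem : ∀ x ∈ O, Φ x ∈ V ∩ Z
  inv_mem : ∀ y ∈ V ∩ Z, θ y ∈ O
  right_inv : ∀ y ∈ V ∩ Z, Φ (θ y) = y
  left_inv : ∀ x ∈ O, θ (Φ x) = x
  hol : ∀ x ∈ O, HolX S Φ x
  cont : ContinuousOn θ (V ∩ Z)
  psh : ∀ x ∈ O, ∀ v, PshAt S v x → ∃ f, PshNear f (Φ x) ∧ ∀ᶠ x' in 𝓝 x, v x' = f (Φ x')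

variable {N : ℕ} {O : Set X} {V Z : Set (Cn N)} {Φ : X → Cn N} {θ : Cn N → X}
variable {x : X}

lemma IsCoord.continuousOn (h : IsCoord S O V Z Φ θ) : ContinuousOn Φ O :=
  fun x hx => (h.hol x hx).continuousAt.continuousWithinAt

lemma CChart.exists_isCoord {c : CChart X} (hc : c ∈ S.atlas) (e : c.E ≃L[ℂ] Cn N)
    (hx : x ∈ c.U) : ∃ (O : Set X) (V : Set (Cn N)) (θ : Cn N → X) (p : ℕ) (H : Fin p → Cn N → ℂ),
      x ∈ O ∧ (∀ j, DifferentiableOn ℂ (H j) V) ∧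
      IsCoord S O V {y | ∀ j, H j y = 0} (fun y => e (c.φ y - c.φ x)) θ := by
  have : Nonempty X := ⟨x⟩
  obtain ⟨-, hBV, hB⟩ := c.subvariety
  obtain ⟨W, hW, hxW, hWV, p, F, hF, hFB⟩ := hB _ (hBV (c.mapsToB x hx))
  set q : Cn N → c.E := fun y => e.symm y + c.φ x with hq
  have hqd : Differentiable ℂ q := e.symm.differentiable.add_const _
  have hqe : ∀ y, q (e (c.φ y - c.φ x)) = c.φ y := fun y => by simp [hq]
  let θ : Cn N → X := fun y => Function.invFunOn c.φ c.U (q y)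
  have hinv : ∀ y ∈ q ⁻¹' W ∩ {y | ∀ j, F j (q y) = 0}, θ y ∈ c.U ∧ c.φ (θ y) = q y := fun y hy => by
    have h1 : q y ∈ c.B ∩ W := hFB ▸ ⟨hy.1, hy.2⟩
    have h2 := c.image_eq ▸ h1.1
    exact ⟨Function.invFunOn_mem h2, Function.invFunOn_eq h2⟩
  have hmem : ∀ y ∈ c.U, c.φ y ∈ W → ∀ j, F j (c.φ y) = 0 := fun y hy hyW => by
    have : c.φ y ∈ {w ∈ W | ∀ i, F i w = 0} := hFB ▸ ⟨c.mapsToB y hy, hyW⟩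
    exact this.2
  refine ⟨c.U ∩ c.φ ⁻¹' W, q ⁻¹' W, θ, p, fun j y => F j (q y), ⟨hx, hxW⟩,
    fun j => (hF j).comp hqd.differentiableOn fun y hy => hy,
    c.contOn.isOpen_inter_preimage c.openU hW, hW.preimage hqd.continuous,
    fun y hy => ⟨by rw [mem_preimage, hqe]; exact hy.2, fun j => by
      simpa only [hqe] using hmem y hy.1 hy.2 j⟩,
    fun y hy => ⟨(hinv y hy).1, by rw [mem_preimage, (hinv y hy).2]; exact hy.1⟩,
    fun y hy => by simp [(hinv y hy).2, hq],
    fun y hy => ?_, fun y hy => ⟨c, hc, hy.1, fun p => e (p - c.φ x), ?_, .of_forall fun _ => rfl⟩,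
    fun y hy => ?_, fun y hy v hv => ?_⟩
  · have h := hinv (e (c.φ y - c.φ x)) ⟨by rw [mem_preimage, hqe]; exact hy.2, fun j => by
      rw [hqe]; exact hmem y hy.1 hy.2 j⟩
    exact c.injOn h.1 hy.1 (by rw [h.2, hqe])
  · exact (e.differentiable.comp (differentiable_id.sub_const _)).holAt _
  · refine tendsto_nhds.2 fun T hT hyT => ?_
    obtain ⟨V', hV', himg⟩ := c.open_image (T ∩ c.U) inter_subset_right (hT.inter c.openU)
    have h1 : c.φ (θ y) ∈ c.B ∩ V' := himg ▸ ⟨θ y, ⟨hyT, (hinv y hy).1⟩, rfl⟩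
    have h2 := (hV'.preimage hqd.continuous).mem_nhds (by
      rw [mem_preimage, ← (hinv y hy).2]; exact h1.2)
    filter_upwards [nhdsWithin_le_nhds h2, self_mem_nhdsWithin] with z hz hzm
    have h3 : c.φ (θ z) ∈ c.φ '' (T ∩ c.U) := himg ▸
      ⟨c.mapsToB _ (hinv z hzm).1, by rw [(hinv z hzm).2]; exact hz⟩
    obtain ⟨z', hz', he⟩ := h3
    rw [mem_preimage, ← c.injOn hz'.2 (hinv z hzm).1 he]
    exact hz'.1
  · obtain ⟨w, hw, hwe⟩ := hv.in_chart hc hy.1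
    refine ⟨fun z => w (q z), PshNear.comp (hqd.holAt _) (by rwa [hqe]), ?_⟩
    filter_upwards [hwe] with z hz using by rw [hqe, hz]

/-- Near a graph point, a complex space has honest coordinates. -/
lemma IsCoord.exists_of_isGraphPoint (h : IsCoord S O V Z Φ θ) (hx : x ∈ O)
    (hg : IsGraphPoint Z (Φ x)) {T : Set X} (hT : T ∈ 𝓝 x) :
    ∃ (d : ℕ) (O' : Set X) (F' : X → Cn d) (a' : Cn d → X) (b : ℝ), 0 < b ∧ O' ⊆ T ∧ a' 0 = x ∧
      IsCoord S O' {z | sqn z < 36} univ F' a' ∧ ∀ y ∈ O', b * sqn (F' y) ≤ sqn (Φ y - Φ x) := by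
  obtain ⟨d, R, s, hs, hsx, hZ, hR⟩ := hg
  obtain ⟨V1, hV₁s, hV1, hxV1⟩ := _root_.mem_nhds_iff.1 hZ
  have hxV := h.map_mem x hx
  have hnear : ∀ᶠ y in 𝓝 (Φ x), y ∈ V ∩ Z → θ y ∈ T :=
    eventually_nhdsWithin_iff.1 (h.cont _ hxV (by rwa [h.left_inv x hx]))
  have hsc := hs.continuousAt.eventually (by
      rw [hsx]; exact inter_mem (h.isOpen'.mem_nhds hxV.1) (inter_mem (hV1.mem_nhds hxV1) hnear))
  obtain ⟨r, hr, hrs⟩ := Metric.mem_nhds_iff.1 (hsc.and (hs.and hR))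
  set l : ℝ := r / 6 with hl
  have hl0 : 0 < l := by positivity
  have hlc : (l : ℂ) ≠ 0 := by exact_mod_cast hl0.ne'
  set t : Cn d → Cn d := fun z => R (Φ x) + (l : ℂ) • z with ht
  set F' : X → Cn d := fun y => (l : ℂ)⁻¹ • (R (Φ y) - R (Φ x)) with hF'
  have htF : ∀ y, t (F' y) = R (Φ y) := fun y => by
    simp only [ht, hF', smul_inv_smul₀ hlc]; abel
  have htd : Differentiable ℂ t := by fun_prop
  have hball : ∀ z, sqn z < 36 → t z ∈ ball (R (Φ x)) r := fun z hz => by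
    have h1 := norm_sq_le_sqn z
    have h2 : ‖z‖ < 6 := by nlinarith [norm_nonneg z]
    simp only [ht, mem_ball, dist_eq_norm, add_sub_cancel_left, norm_smul, Complex.norm_real,
      norm_of_nonneg hl0.le]
    nlinarith
  have hmem : ∀ z, sqn z < 36 → s (t z) ∈ V ∩ Z := fun z hz =>
    ⟨(hrs (hball z hz)).1.1, (hV₁s (hrs (hball z hz)).1.2.1).2 (by rw [(hrs (hball z hz)).2.2])⟩
  have hsF : ∀ y ∈ O, Φ y ∈ V1 → s (t (F' y)) = Φ y := fun y hy hyV => by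
    rw [htF]; exact (hV₁s hyV).1 (h.map_mem y hy).2
  have hFa : ∀ z, sqn z < 36 → F' (θ (s (t z))) = z := fun z hz => by
    simp only [hF', h.right_inv _ (hmem z hz), (hrs (hball z hz)).2.2]
    simp only [ht, add_sub_cancel_left, inv_smul_smul₀ hlc]
  have hF'd : Differentiable ℂ fun p : Cn N => (l : ℂ)⁻¹ • (R p - R (Φ x)) := by fun_prop
  have hF'c := hF'd.continuous.comp_continuousOn h.continuousOn
  have hopen : IsOpen {z : Cn d | sqn z < 36} := isOpen_lt continuous_sqn continuous_const
  have hO1 := h.continuousOn.isOpen_inter_preimage h.isOpen hV1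
  refine ⟨d, (O ∩ Φ ⁻¹' V1) ∩ F' ⁻¹' {z | sqn z < 36}, F', fun z => θ (s (t z)),
    l ^ 2 / (d * (‖R‖ ^ 2 + 1) + 1), by positivity, fun y hy => ?_,
    by simp [ht, hsx, h.left_inv x hx], ⟨(hF'c.mono inter_subset_left).isOpen_inter_preimage hO1 hopen,
    hopen, fun y hy => ⟨hy.2, mem_univ _⟩, fun z hz => ?_, fun z hz => ?_, fun y hy => ?_,
    fun y hy => HolX.comp (g := fun p => (l : ℂ)⁻¹ • (R p - R (Φ x))) (hF'd.holAt _)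
      (h.hol y hy.1.1), ?_, fun y hy v hv => ?_⟩, fun y hy => ?_⟩
  · have := (hrs (hball _ hy.2)).1.2.2 (hmem _ hy.2)
    rwa [hsF y hy.1.1 hy.1.2, h.left_inv y hy.1.1] at this
  · have h1 := hmem z hz.1
    refine ⟨⟨h.inv_mem _ h1, ?_⟩, ?_⟩
    · rw [mem_preimage, h.right_inv _ h1]; exact (hrs (hball z hz.1)).1.2.1
    · rw [mem_preimage, hFa z hz.1]; exact hz.1
  · exact hFa z hz.1
  · simp only [hsF y hy.1.1 hy.1.2, h.left_inv y hy.1.1]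
  · refine h.cont.comp (fun z hz => ContinuousAt.continuousWithinAt ?_) fun z hz => hmem z hz.1
    exact ContinuousAt.comp (f := t) (hrs (hball z hz.1)).2.1.continuousAt htd.continuous.continuousAt
  · obtain ⟨f, hf, hfe⟩ := h.psh y hy.1.1 v hv
    have hst := HolAt.comp (f := s) (by
        filter_upwards [isOpen_ball.mem_nhds (hball _ hy.2)] with z hz using (hrs hz).2.1)
        (htd.holAt _)
    refine ⟨fun z => f (s (t z)), PshNear.comp hst (by rwa [hsF y hy.1.1 hy.1.2]), ?_⟩
    filter_upwards [hfe, hO1.mem_nhds hy.1] with y' h1 h2 using by rw [hsF y' h2.1 h2.2, h1]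
  · have h1 : sqn (F' y) ≤ l⁻¹ ^ 2 * (d * (‖R‖ ^ 2 * sqn (Φ y - Φ x))) := by
      rw [show F' y = (l : ℂ)⁻¹ • R (Φ y - Φ x) by rw [map_sub], sqn_smul, norm_inv,
        Complex.norm_real, norm_of_nonneg hl0.le]
      gcongr
      refine (sqn_le_norm_sq _).trans ?_
      gcongr
      refine (pow_le_pow_left₀ (norm_nonneg _) (R.le_opNorm _) 2).trans ?_
      rw [mul_pow]
      gcongr
      exact norm_sq_le_sqn _
    have h2 := sqn_nonneg (Φ y - Φ x)
    rw [div_mul_eq_mul_div, div_le_iff₀ (by positivity)]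
    calc l ^ 2 * sqn (F' y) ≤ l ^ 2 * (l⁻¹ ^ 2 * (d * (‖R‖ ^ 2 * sqn (Φ y - Φ x)))) := by gcongr
      _ = d * ‖R‖ ^ 2 * sqn (Φ y - Φ x) := by field_simp
      _ ≤ _ := by nlinarith [mul_nonneg (Nat.cast_nonneg (α := ℝ) d) h2]

/-- The competitors for the relative extremal function of `K` in `D`. -/
def Competitors (S : CSpace X) (K D : Set X) : Set (X → ℝ) :=
  {v | (∀ x ∈ D, PshAt S v x) ∧ (∀ x ∈ D, 0 ≤ v x ∧ v x ≤ 1) ∧ ∀ x ∈ K, v x ≤ 0}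

/-- `h` is the upper regularization of the supremum of the competitors, and is continuous. -/
structure IsEnvelope (S : CSpace X) (K D : Set X) (h : X → ℝ) : Prop where
  isOpen : IsOpen D
  le : ∀ v ∈ Competitors S K D, ∀ x ∈ D, v x ≤ h x
  approx : ∀ x ∈ D, ∀ ε > 0, ∀ T ∈ 𝓝 x, ∃ x' ∈ T, ∃ v ∈ Competitors S K D, h x - ε < v x'
  cont : ContinuousOn h D

lemma IsEnvelope.not_touching_of_isCoord [T2Space X] {K D : Set X} {h : X → ℝ}
    (hh : IsEnvelope S K D h) (hF : IsCoord S O {z : Cn N | sqn z < 36} univ Φ θ) (hOD : O ⊆ D \ K)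
    {τ m ε : ℝ} (hb : 0 < τ) (ha : 0 < ε) {W : X → ℝ} (hW : ∀ x ∈ O, PshAt S W x)
    (hh1 : ∀ x ∈ O, h x ≤ 1 - τ) (hWm : ∀ x ∈ O, W x - h x ≤ m - ε * sqn (Φ x))
    (hW0 : W (θ 0) - h (θ 0) = m) : False := by
  classical
  have ht : ∀ {z}, sqn z < 36 → θ z ∈ O := fun hz => hF.inv_mem _ ⟨hz, mem_univ _⟩
  have hr : ∀ {z}, sqn z < 36 → Φ (θ z) = z := fun hz => hF.right_inv _ ⟨hz, mem_univ _⟩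
  have h36 : ∀ {z : Cn N}, sqn z < 1 → sqn z < 36 := fun hz => hz.trans (by norm_num)
  have hopen : ∀ r : ℝ, IsOpen {z : Cn N | sqn z < r} := fun r => isOpen_lt continuous_sqn continuous_const
  have hcont := hF.cont.mono fun z hz => ⟨hz, mem_univ _⟩
  have hpull : ∀ v : X → ℝ, (∀ x ∈ O, PshAt S v x) → PshOn (fun z => v (θ z)) {z | sqn z < 36} :=
    fun v hv => PshOn.of_local fun z hz => by
      obtain ⟨f, ⟨V', hV', hzV', hf⟩, hfe⟩ := hF.psh _ (ht hz) v (hv _ (ht hz))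
      rw [hr hz] at hzV'
      obtain ⟨T, hTs, hT, hzT⟩ := _root_.mem_nhds_iff.1 (inter_mem (inter_mem (hV'.mem_nhds hzV')
        ((hcont.continuousAt ((hopen 36).mem_nhds hz)).eventually hfe)) ((hopen 36).mem_nhds hz))
      refine ⟨T, hT, hzT, (hf.mono fun y hy => (hTs hy).1.1).congr hT fun y hy => ?_⟩
      rw [show v (θ y) = f (Φ (θ y)) from (hTs hy).1.2, hr (hTs hy).2]
  refine not_strict_touching (𝒱 := (fun v z => v (θ z)) '' Competitors S K D)
    (H := fun z => h (θ z)) (w := fun z => W (θ z)) (τ := τ) (m := m) (c := ε)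
    ⟨_, fun _ => 0, ⟨fun x _ => pshAt_const 0 x, fun x _ => ⟨le_rfl, zero_le_one⟩,
      fun x _ => le_rfl⟩, rfl⟩ ?_ ?_ ?_ ?_ ?_ ?_ ?_ hb (fun z hz => hh1 _ (ht (h36 hz)))
    ((hpull W hW).mono fun z hz => h36 hz) ha
    (fun z hz => by have := hWm _ (ht (h36 hz)); rwa [hr (h36 hz)] at this) hW0
  · rintro _ ⟨v, hv, rfl⟩
    exact hpull v fun x hx => hv.1 x (hOD hx).1
  · rintro _ ⟨v, hv, rfl⟩ z hz
    exact hv.2.1 _ (hOD (ht hz)).1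
  · rintro _ ⟨v, hv, rfl⟩ _ ⟨v', hv', rfl⟩
    exact ⟨_, ⟨fun x hx => (hv.1 x hx).sup (hv'.1 x hx), fun x hx => ⟨(hv.2.1 x hx).1.trans
      (le_max_left _ _), max_le (hv.2.1 x hx).2 (hv'.2.1 x hx).2⟩,
      fun x hx => max_le (hv.2.2 x hx) (hv'.2.2 x hx)⟩, rfl⟩
  · rintro _ ⟨v, hv, rfl⟩ z hz
    exact hh.le v hv _ (hOD (ht hz)).1
  · intro z hz ε ha T hT
    obtain ⟨x', hx', v, hv, hlt⟩ := hh.approx _ (hOD (ht hz)).1 ε ha (O ∩ Φ ⁻¹' T) (inter_mem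
      (hF.isOpen.mem_nhds (ht hz)) ((hF.hol _ (ht hz)).continuousAt (by rwa [hr hz])))
    exact ⟨Φ x', hx'.2, _, ⟨v, hv, rfl⟩, by simpa only [hF.left_inv x' hx'.1] using hlt⟩
  · exact hh.cont.comp hcont fun z hz => (hOD (ht hz)).1
  · rintro _ ⟨v, hv, rfl⟩ q hq hq1 hqv
    set A : Set X := O ∩ Φ ⁻¹' {z | sqn z < 1} with hA
    have hC : IsClosed (θ '' {z | sqn z ≤ 1 / 2}) := by
      refine IsCompact.isClosed (IsCompact.image_of_continuousOn ?_ (hcont.mono fun z hz =>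
        lt_of_le_of_lt (show sqn z ≤ 1 / 2 from hz) (by norm_num)))
      refine (isCompact_closedBall (0 : Cn N) 1).of_isClosed_subset
        (isClosed_le continuous_sqn continuous_const) fun z hz => ?_
      rw [mem_closedBall_zero_iff]
      have : sqn z ≤ 1 / 2 := hz
      nlinarith [norm_sq_le_sqn z, norm_nonneg z]
    have hAD : ∀ x ∈ A, q (Φ x) ≤ 1 := fun x hx => hq1 _ hx.2
    refine ⟨_, ⟨fun x => if x ∈ A then max (v x) (q (Φ x)) else v x, ⟨fun x hx => ?_, fun x hx => ?_,
      fun x hx => ?_⟩, rfl⟩, fun z hz => ?_⟩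
    · by_cases hxA : x ∈ A
      · refine ((hv.1 x hx).sup (PshNear.pshAt (hF.hol x hxA.1)
          ⟨_, hopen 1, hxA.2, hq⟩)).congr ?_
        filter_upwards [(hF.continuousOn.isOpen_inter_preimage hF.isOpen (hopen 1)).mem_nhds hxA]
          with y hy using if_pos hy
      · refine (hv.1 x hx).congr ?_
        have hxC : x ∉ θ '' {z | sqn z ≤ 1 / 2} := by
          rintro ⟨z, hz, rfl⟩
          have hz1 : sqn z < 1 := lt_of_le_of_lt (show sqn z ≤ 1 / 2 from hz) (by norm_num)
          exact hxA ⟨ht (h36 hz1), by rw [mem_preimage, hr (h36 hz1)]; exact hz1⟩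
        filter_upwards [hC.isOpen_compl.mem_nhds hxC] with y hy
        split_ifs with hyA
        · refine max_eq_left ?_
          have := hqv (Φ y) (not_le.1 fun hle => hy ⟨_, hle, hF.left_inv y hyA.1⟩) hyA.2
          simpa only [hF.left_inv y hyA.1] using this
        · rfl
    · have h1 := hv.2.1 x hx
      beta_reduce
      split_ifs with hxA
      · exact ⟨h1.1.trans (le_max_left _ _), max_le h1.2 (hAD x hxA)⟩
      · exact h1
    · exact (if_neg fun hxA : x ∈ A => (hOD hxA.1).2 hx).trans_le (hv.2.2 x hx)
    · have hzA : θ z ∈ A := ⟨ht (h36 hz), by rw [mem_preimage, hr (h36 hz)]; exact hz⟩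
      simp only [if_pos hzA, hr (h36 hz)]
      exact le_max_right _ _

end Coordinates

section Touching

variable {X : Type*} [TopologicalSpace X] {S : CSpace X}

lemma IsEnvelope.not_touching [T2Space X] {K D O T : Set X} {h W : X → ℝ} {N p : ℕ}
    {V : Set (Cn N)} {H : Fin p → Cn N → ℂ} {F : X → Cn N} {t : Cn N → X} {x1 : X} {m ε : ℝ}
    (hh : IsEnvelope S K D h) (hH : ∀ j, DifferentiableOn ℂ (H j) V)
    (hF : IsCoord S O V {y | ∀ j, H j y = 0} F t) (hx1 : x1 ∈ O) (hFx : F x1 = 0) (hT : T ∈ 𝓝 x1)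
    (hTD : T ⊆ D \ K) (hl : 0 < ε) (hW : ∀ x ∈ T, ∀ b, PshAt S (fun y => W y - ε * sqn (F y - b)) x)
    (hWm : ∀ x ∈ T, W x - h x ≤ m - ε * sqn (F x)) (hW0 : W x1 - h x1 = m) (hh1 : h x1 < 1) :
    False := by
  have hs := continuous_sqn (d := N)
  set Z : Set (Cn N) := {y | ∀ j, H j y = 0} with hZ
  have h0 := hF.map_mem x1 hx1
  have ht0 := hF.left_inv x1 hx1
  rw [hFx] at h0 ht0
  have hD1 := hh.isOpen.mem_nhds (hTD (mem_of_mem_nhds hT)).1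
  have hhc := hh.cont.continuousAt hD1
  obtain ⟨τ, hu, huh⟩ : ∃ τ > 0, h x1 < 1 - τ := ⟨(1 - h x1) / 2, by linarith, by linarith⟩
  obtain ⟨T', hT's, hT', hxT'⟩ := _root_.mem_nhds_iff.1
    (inter_mem (inter_mem hT (hF.isOpen.mem_nhds hx1)) (hhc.eventually_lt_const huh))
  have hW' : ∀ x ∈ T', PshAt S W x := fun x hx => by
    refine ((hW x (hT's hx).1.1 0).add (PshNear.pshAt (w := fun y => ε * sqn (y - 0))
      (hF.hol x (hT's hx).1.2) ((pshOn_sqn_sub 0 univ).const_mul hl.le).pshNear)).congr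
      (.of_forall fun y => ?_)
    ring
  have htT : ∀ {P : X → Prop}, (∀ᶠ x in 𝓝 x1, P x) → ∀ᶠ y in 𝓝 0, y ∈ V ∩ Z → P (t y) := fun hP =>
    eventually_nhdsWithin_iff.1 (hF.cont 0 h0 (by rwa [ht0]))
  obtain ⟨g, hg, hgr, G, ρ, hG⟩ := hasMultidisc N (Cn N) (by simp) H (fun _ => 1)
    (fun j => (hH j).holAt hF.isOpen' h0.1) ((differentiable_const 1).holAt 0)
    (fun hc => hc.self_of_nhds ⟨h0.2, one_ne_zero⟩)
  set A := ‖g 0‖ + 1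
  have hgood : ∀ᶠ y in 𝓝 (0 : Cn N), (y ∈ V ∧ (y ∈ V ∩ Z → t y ∈ T')) ∧ DifferentiableAt ℂ g y ∧
      ‖g y‖ < A ∧ (y ∈ Z → g y ≠ 0 → IsGraphPoint Z y) := by
    filter_upwards [hF.isOpen'.mem_nhds h0.1, htT (hT'.mem_nhds hxT'), hg,
      hg.continuousAt.norm.eventually_lt_const (lt_add_one _), hgr] with y h1 h2 h3 h4 h5
      using ⟨⟨h1, h2⟩, h3, h4, fun h6 h7 => (h5 h6 h7).2⟩
  obtain ⟨r, hr, hrs⟩ := Metric.nhds_basis_closedBall.mem_iff.1 hgood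
  have hmem : ∀ {y}, y ∈ closedBall 0 r → y ∈ Z → y ∈ V ∩ Z ∧ t y ∈ T' := fun hy hyZ =>
    have h1 : _ ∈ V ∩ Z := ⟨(hrs hy).1.1, hyZ⟩
    ⟨h1, (hrs hy).1.2 h1⟩
  set η := ε * r ^ 2 / 4 with hn
  have hn0 : 0 < η := by positivity
  obtain ⟨f, ⟨V', hV', h0V', hf⟩, hfe⟩ := hF.psh x1 hx1 W (hW' x1 hxT')
  rw [hFx] at h0V'
  obtain ⟨y, ⟨hyZ, hgy⟩, ⟨hyN, hyr⟩, hfy⟩ := hG.exists_ge hV' h0V' hf (inter_mem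
    (htT (hfe.and (hhc.eventually_lt_const (show h x1 < h x1 + η by linarith))))
    (closedBall_mem_nhds 0 hr))
  obtain ⟨hyVZ, hyT⟩ := hmem hyr hyZ
  obtain ⟨hfy', hhy⟩ := hyN hyVZ
  have hval : m - η ≤ W (t y) - h (t y) := by
    rw [hfy', hF.right_inv y hyVZ]
    have := hfe.self_of_nhds
    rw [hFx] at this
    linarith
  have hgy0 := norm_pos_iff.2 hgy
  have hlog : ∀ {z}, z ∈ closedBall 0 r → 0 < ‖g z‖ → Real.log ‖g z‖ ≤ A := fun hz hgz =>
    (Real.log_le_sub_one_of_pos hgz).trans (by linarith [(hrs hz).2.2.1])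
  obtain ⟨i, hi, hin⟩ : ∃ i > 0, i * (A - Real.log ‖g y‖) ≤ η := by
    have h1 := sub_nonneg.2 (hlog hyr hgy0)
    refine ⟨η / (A - Real.log ‖g y‖ + 1), by positivity, ?_⟩
    rw [div_mul_eq_mul_div, div_le_iff₀ (by positivity)]
    nlinarith
  set κ := ‖g y‖ * Real.exp (-(η / i) - 1) with hk
  have hk0 : 0 < κ := by positivity
  have hgc : ContinuousOn g (closedBall 0 r) := fun z hz => (hrs hz).2.1.continuousAt.continuousWithinAt
  set C : Set (Cn N) := {z ∈ closedBall 0 r | z ∈ Z ∧ κ ≤ ‖g z‖} with hC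
  have hCc : IsCompact C := by
    have h1 := (continuousOn_pi.2 fun j => (hH j).continuousOn.mono fun z hz => (hrs hz).1.1).prodMk hgc.norm
    have h2 := h1.preimage_isClosed_of_isClosed isClosed_closedBall
      ((isClosed_eq continuous_fst continuous_const).inter (isClosed_le continuous_const continuous_snd) :
        IsClosed ({q | q.1 = 0} ∩ {q : (Fin p → ℂ) × ℝ | κ ≤ q.2}))
    have h3 : C = closedBall 0 r ∩ (fun z => ((fun j => H j z : Fin p → ℂ), ‖g z‖)) ⁻¹'
        ({q | q.1 = 0} ∩ {q | κ ≤ q.2}) :=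
      Set.ext fun z => and_congr_right fun _ => and_congr_left fun _ => funext_iff.symm
    exact (isCompact_closedBall 0 r).of_isClosed_subset (h3 ▸ h2) fun z hz => hz.1
  set P : Cn N → ℝ := fun z => W (t z) + (-h (t z) + i * Real.log ‖g z‖) with hP
  have hCg : ∀ z ∈ C, 0 < ‖g z‖ := fun z hz => hk0.trans_le hz.2.2
  have husc : UpperSemicontinuousOn P C := by
    have h1 : UpperSemicontinuousOn (fun z => W (t z)) C := fun z hz b hb =>
      ((hF.cont z (hmem hz.1 hz.2.1).1).mono fun z' hz' => (hmem hz'.1 hz'.2.1).1).eventually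
        ((hW' _ (hmem hz.1 hz.2.1).2).upperSemicontinuousAt b hb)
    have h2 : ContinuousOn (fun z => -h (t z) + i * Real.log ‖g z‖) C := by
      refine (hh.cont.comp (hF.cont.mono fun z hz => (hmem hz.1 hz.2.1).1) fun z hz =>
        (hTD (hT's (hmem hz.1 hz.2.1).2).1.1).1).neg.add (continuousOn_const.mul
        ((hgc.mono fun z hz => hz.1).norm.log fun z hz => (hCg z hz).ne'))
    exact h1.add h2.upperSemicontinuousOn
  have hyC : y ∈ C := ⟨hyr, hyZ, mul_le_of_le_one_right hgy0.le
    (Real.exp_le_one_iff.2 (by have := div_pos hn0 hi; linarith))⟩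
  obtain ⟨y2, hy2, hmax⟩ := UpperSemicontinuousOn.exists_isMaxOn ⟨y, hyC⟩ hCc husc
  have hPy : P y ≤ P y2 := hmax hyC
  obtain ⟨hy₂V, hy₂T⟩ := hmem hy2.1 hy2.2.1
  have hr2 := hF.right_inv y2 hy₂V
  have h₂m := hWm _ (hT's hy₂T).1.1
  rw [hr2] at h₂m
  simp only [hP] at hPy
  have hg2 : κ < ‖g y2‖ := by
    rw [← Real.log_lt_log_iff hk0 (hCg y2 hy2), hk, Real.log_mul hgy0.ne' (Real.exp_pos _).ne',
      Real.log_exp]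
    have h1 : -η ≤ i * (Real.log ‖g y2‖ - Real.log ‖g y‖) := by
      linarith [mul_nonneg hl.le (sqn_nonneg y2)]
    have h2 : -(η / i) ≤ Real.log ‖g y2‖ - Real.log ‖g y‖ := by
      rw [← neg_div, div_le_iff₀ hi]; linarith
    linarith
  have hb2 : y2 ∈ ball (0 : Cn N) r := by
    rw [mem_ball_zero_iff]
    have h1 := mul_le_mul_of_nonneg_left (hlog hy2.1 (hCg y2 hy2)) hi.le
    have h2 := mul_le_mul_of_nonneg_left (norm_sq_le_sqn y2) hl.le
    have h3 : ε * ‖y2‖ ^ 2 ≤ ε * (r ^ 2 / 2) := by rw [hn] at *; linarith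
    have h4 := le_of_mul_le_mul_left h3 hl
    nlinarith [norm_nonneg y2]
  have hx2 := (hT's hy₂T).1.2
  have hnear : ∀ᶠ x in 𝓝 (t y2), x ∈ T' ∧ F x ∈ ball 0 r ∧ κ < ‖g (F x)‖ := by
    have hc := (hF.hol _ hx2).continuousAt
    have h1 : ∀ᶠ z in 𝓝 (F (t y2)), z ∈ ball 0 r ∧ κ < ‖g z‖ := by
      rw [hr2]
      exact (isOpen_ball.eventually_mem hb2).and
        ((hrs hy2.1).2.1.continuousAt.norm.eventually_const_lt hg2)
    exact inter_mem (hT'.mem_nhds hy₂T) (hc.eventually h1)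
  obtain ⟨d, O', F', t', b, hb, hO', ht'0, hco, hbd⟩ := hF.exists_of_isGraphPoint hx2
    (hr2.symm ▸ (hrs hy2.1).2.2.2 hy2.2.1 (norm_pos_iff.1 (hCg y2 hy2))) hnear
  refine hh.not_touching_of_isCoord hco (fun x hx => hTD (hT's (hO' hx).1).1.1) hu (mul_pos hl hb)
    (W := fun x => (W x - ε * sqn (F x - y2)) + i * Real.log ‖g (F x)‖) (m := P y2)
    (fun x hx => ?_) (fun x hx => (hT's (hO' hx).1).2.le) (fun x hx => ?_) ?_
  · obtain ⟨hxT, hxb, hxg⟩ := hO' hx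
    refine (hW x (hT's hxT).1.1 y2).add (PshNear.pshAt (w := fun z => i * Real.log ‖g z‖)
      (hF.hol x (hT's hxT).1.2) ?_)
    have ho := hgc.norm.mono ball_subset_closedBall |>.isOpen_inter_preimage isOpen_ball
      (isOpen_Ioi (a := κ))
    exact ⟨_, ho, ⟨hxb, hxg⟩, (pshOn_log_norm ho (fun z hz =>
      (hrs (ball_subset_closedBall hz.1)).2.1.differentiableWithinAt) fun z hz =>
        norm_pos_iff.1 (hk0.trans hz.2)).const_mul hi.le⟩
  · obtain ⟨hxT, hxb, hxg⟩ := hO' hx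
    have h1 : P (F x) ≤ P y2 := hmax ⟨ball_subset_closedBall hxb, (hF.map_mem x (hT's hxT).1.2).2, hxg.le⟩
    have h2 := mul_le_mul_of_nonneg_left (hbd x hx) hl.le
    rw [hr2] at h2
    simp only [hP, hF.left_inv x (hT's hxT).1.2] at h1 ⊢
    linarith
  · simp only [ht'0, hr2, hP, sub_self, sqn_zero]
    ring

end Touching

section Comparison

variable {X : Type*} [TopologicalSpace X] {S : CSpace X}
variable {D K : Set X} {x : X}

lemma coe_le_relExt (hD : IsOpen D) {v : X → ℝ} (hv : v ∈ Competitors S K D)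
    (hx : x ∈ D) : (v x : EReal) ≤ relExt S K D x := by
  refine le_limsup_of_frequently_le (Frequently.filter_mono (frequently_pure.2 ?_)
    (pure_le_nhdsWithin hx))
  have hm : (fun y => (v y : EReal)) ∈ {u : X → EReal | SpacePSHOn S u D ∧ (∀ x ∈ D, u x ≤ 1) ∧
      ∀ x ∈ K, u x ≤ 0} := ⟨spacePSHOn_of_pshAt hD hv.1,
    fun y hy => EReal.coe_le_coe_iff.2 (hv.2.1 y hy).2, fun y hy => EReal.coe_le_coe_iff.2 (hv.2.2 y hy)⟩
  exact le_iSup₂ (f := fun (u : X → EReal) _ => u x) _ hm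

lemma relExt_nonneg_le_one (hD : IsOpen D) (hx : x ∈ D) :
    0 ≤ relExt S K D x ∧ relExt S K D x ≤ 1 := by
  refine ⟨coe_le_relExt hD (v := fun _ => 0) ⟨fun y _ => pshAt_const 0 y, by simp, by simp⟩ hx,
    limsup_le_of_le (by isBoundedDefault) ?_⟩
  filter_upwards [self_mem_nhdsWithin] with y hy using iSup₂_le fun u hu => hu.2.1 y hy

lemma coe_toReal_relExt (hD : IsOpen D) (hx : x ∈ D) :
    ((relExt S K D x).toReal : EReal) = relExt S K D x := by
  obtain ⟨h1, h2⟩ := relExt_nonneg_le_one (S := S) (K := K) hD hx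
  exact EReal.coe_toReal (h2.trans_lt (EReal.coe_lt_top 1)).ne ((EReal.bot_lt_coe 0).trans_le h1).ne'

lemma isEnvelope_relExt (hD : IsOpen D) (hKD : K ⊆ D)
    (hcont : ContinuousOn (relExt S K D) D) : IsEnvelope S K D fun x => (relExt S K D x).toReal where
  isOpen := hD
  le v hv x hx := by
    rw [← EReal.coe_le_coe_iff, coe_toReal_relExt hD hx]
    exact coe_le_relExt hD hv hx
  approx x hx ε ha T hT := by
    have h1 : (((relExt S K D x).toReal - ε : ℝ) : EReal) < relExt S K D x := by
      rw [← coe_toReal_relExt hD hx, EReal.coe_lt_coe_iff, EReal.toReal_coe]; linarith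
    obtain ⟨y, hy, hyT, hyD⟩ := ((frequently_lt_of_lt_limsup (by isBoundedDefault) h1).and_eventually
      (inter_mem (nhdsWithin_le_nhds hT) self_mem_nhdsWithin)).exists
    simp only [relExtRaw, lt_iSup_iff] at hy
    obtain ⟨u, ⟨hu, hu1, hu0⟩, hlt⟩ := hy
    have hcoe : ∀ z ∈ D, ((max (u z) (0 : ℝ)).toReal : EReal) = max (u z) (0 : ℝ) := fun z hz =>
      EReal.coe_toReal (max_lt ((hu1 z hz).trans_lt (EReal.coe_lt_top 1)) (EReal.coe_lt_top 0)).ne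
        ((EReal.bot_lt_coe 0).trans_le (le_max_right _ _)).ne'
    refine ⟨y, hyT, fun z => (max (u z) (0 : ℝ)).toReal, ⟨fun z hz => hu.pshAt hz 0,
      fun z hz => ⟨EReal.toReal_nonneg (le_max_right _ _), ?_⟩, fun z hz => ?_⟩, ?_⟩
    · rw [← EReal.coe_le_coe_iff, hcoe z hz]
      exact max_le (hu1 z hz) (by simp)
    · rw [← EReal.coe_le_coe_iff, hcoe z (hKD hz)]
      exact max_le (hu0 z hz) le_rfl
    · rw [← EReal.coe_lt_coe_iff, hcoe y hyD]
      exact hlt.trans_le (le_max_left _ _)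
  cont := EReal.continuousOn_toReal.comp hcont fun x hx => by rw [← coe_toReal_relExt hD hx]; simp

/-- Finitely many holomorphic functions separate the points of a compact set up to charts. -/
lemma IsSteinIn.exists_separating [T2Space X] (hS : IsSteinIn S univ) {L : Set X} (hL : IsCompact L) :
    ∃ (k : ℕ) (f : X → Cn k), (∀ x, HolX S f x) ∧
      ∀ x ∈ L, ∃ d ∈ S.atlas, x ∈ d.U ∧ ∀ y ∈ L, f y = f x → y ∈ d.U := by
  choose ch hch hxch using S.chart_cover
  obtain ⟨t, -, ht⟩ := hL.elim_nhds_subcover (fun x => (ch x).U)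
    fun x _ => (ch x).openU.mem_nhds (hxch x)
  obtain ⟨C, hC, hCU, hLC⟩ := hL.finite_compact_cover t (fun x => (ch x).U) (fun x _ => (ch x).openU) ht
  set Y : Set (X × X) := ⋃ i ∈ t, C i ×ˢ (L \ (ch i).U) with hY
  have hYc := t.isCompact_biUnion fun i _ => (hC i).prod (hL.diff (ch i).openU)
  have hex : ∀ q ∈ Y, ∃ f : X → ℂ, SpaceHolOn S f univ ∧ f q.1 ≠ f q.2 := fun q hq => by
    obtain ⟨i, -, h1, h2⟩ := mem_iUnion₂.1 hq
    exact hS.2 _ (mem_univ _) _ (mem_univ _) fun he => h2.2 (he ▸ hCU i h1)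
  choose! f hf hfne using hex
  have hfc : ∀ q ∈ Y, Continuous (f q) := fun q hq =>
    continuous_iff_continuousAt.2 fun x => ((hf q hq).holX x).continuousAt
  obtain ⟨s, hsY, hs⟩ := hYc.elim_nhds_subcover (fun q => {p | f q p.1 ≠ f q p.2}) fun q hq =>
    (isOpen_ne_fun ((hfc q hq).comp continuous_fst) ((hfc q hq).comp continuous_snd)).mem_nhds (hfne q hq)
  refine ⟨s.card, fun x i => f (s.equivFin.symm i) x, fun x => HolX.pi fun i =>
    (hf _ (hsY _ (s.equivFin.symm i).2)).holX x, fun x hx => ?_⟩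
  obtain ⟨i, hi, hxi⟩ := mem_iUnion₂.1 (hLC ▸ hx)
  refine ⟨ch i, hch i, hCU i hxi, fun y hy he => by_contra fun hyU => ?_⟩
  obtain ⟨q, hq, hne⟩ := mem_iUnion₂.1 (hs (mem_iUnion₂.2 ⟨i, hi, hxi, hy, hyU⟩ : (x, y) ∈ Y))
  have := congrFun he (s.equivFin ⟨q, hq⟩)
  simp at this
  exact hne this.symm

lemma IsEnvelope.not_superlevel [T2Space X] (hS : IsSteinIn S univ) {U : Set X} {h u : X → ℝ}
    (hh : IsEnvelope S K D h) (hU : IsOpen U) (hUD : U ⊆ D \ K) (hu : ∀ x ∈ U, PshAt S u x)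
    (hu1 : ∀ x ∈ U, u x ≤ 1) {e : ℝ} (he : 0 < e) (hL : IsCompact {x ∈ U | e / 2 ≤ u x - h x})
    {z : X} (hz : z ∈ U) (hze : u z - h z = e) : False := by
  set L := {x ∈ U | e / 2 ≤ u x - h x} with hLdef
  obtain ⟨k, f, hf, hsep⟩ := hS.exists_separating hL
  have hfc : Continuous f := continuous_iff_continuousAt.2 fun x => (hf x).continuousAt
  have hs : ∀ k, Continuous (sqn : Cn k → ℝ) := fun _ => continuous_sqn
  have husc : ∀ {L' : Set X} {g : X → ℝ}, L' ⊆ U → ContinuousOn g L' →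
      UpperSemicontinuousOn (fun x => u x + (-h x + g x)) L' := fun hL' hg =>
    UpperSemicontinuousOn.add (fun x hx b hb =>
      ((hu x (hL' hx)).upperSemicontinuousAt b hb).filter_mono nhdsWithin_le_nhds)
      ((hh.cont.mono fun x hx => (hUD (hL' hx)).1).neg.add hg).upperSemicontinuousOn
  have hzL : z ∈ L := ⟨hz, by linarith⟩
  obtain ⟨B, hB⟩ := hL.bddAbove_image ((hs _).comp hfc).continuousOn
  have hB' : ∀ x ∈ L, sqn (f x) ≤ B := fun x hx => hB ⟨x, hx, rfl⟩
  have hB0 : 0 ≤ B := (sqn_nonneg _).trans (hB' z hzL)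
  obtain ⟨i, hi, hiB⟩ : ∃ i > 0, i * B ≤ e / 8 := ⟨e / 8 / (B + 1), by positivity, by
    rw [div_mul_eq_mul_div, div_le_iff₀ (by positivity)]; nlinarith⟩
  obtain ⟨x0, hx0, hmax0⟩ := UpperSemicontinuousOn.exists_isMaxOn ⟨z, hzL⟩ hL
    (husc (fun x hx => hx.1) (continuousOn_const.mul ((hs _).comp hfc).continuousOn :
      ContinuousOn (fun x => i * sqn (f x)) L))
  obtain ⟨d, hd, hx₀d, hfib⟩ := hsep x0 hx0
  set s : X → ℝ := fun x => i / 2 * sqn (f x - f x0) with hsdef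
  have hsc : Continuous s := continuous_const.mul ((hs _).comp (hfc.sub continuous_const))
  obtain ⟨j', hj', hj's⟩ := (hL.diff d.openU).exists_forall_le' (a := 0) hsc.continuousOn fun x hx => by
    have : f x - f x0 ≠ 0 := fun h0 => hx.2 (hfib x hx.1 (sub_eq_zero.1 h0))
    have h1 := norm_sq_le_sqn (f x - f x0)
    have h2 := norm_pos_iff.2 this
    have : 0 < sqn (f x - f x0) := by nlinarith
    positivity
  obtain ⟨η, hj, hje, hjj⟩ : ∃ η > 0, η ≤ e / 8 ∧ η < j' :=
    ⟨min (e / 8) (j' / 2), by positivity, min_le_left _ _, (min_le_right _ _).trans_lt (by linarith)⟩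
  set L1 := L ∩ {x | s x ≤ η} with hL1
  have hL₁c : IsCompact L1 := hL.inter_right (isClosed_le hsc continuous_const)
  have hL₁d : L1 ⊆ d.U := fun x hx => by_contra fun hxd =>
    absurd (hj's x ⟨hx.1, hxd⟩) (not_le.2 (lt_of_le_of_lt hx.2 hjj))
  let em : d.E ≃L[ℂ] Cn (Module.finrank ℂ d.E) := ContinuousLinearEquiv.ofFinrankEq (by simp)
  set c : X → Cn (Module.finrank ℂ d.E) := fun x => em (d.φ x) with hc
  have hcc : ContinuousOn (fun x => sqn (c x)) d.U :=
    (hs _).comp_continuousOn (em.continuous.comp_continuousOn d.contOn)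
  obtain ⟨A, hA⟩ := hL₁c.bddAbove_image (hcc.mono hL₁d)
  have hA' : ∀ x ∈ L1, sqn (c x) ≤ A := fun x hx => hA ⟨x, hx, rfl⟩
  have hx0L1 : x0 ∈ L1 := ⟨hx0, by simp [hsdef, hj.le]⟩
  have hA0 := (sqn_nonneg _).trans (hA' x0 hx0L1)
  obtain ⟨ε, hl, hlA⟩ : ∃ ε > 0, ε * A < η := ⟨η / (A + 1), by positivity, by
    rw [div_mul_eq_mul_div, div_lt_iff₀ (by positivity)]; nlinarith⟩
  have hgc : ContinuousOn (fun x => i * sqn (f x) - s x + ε * sqn (c x)) d.U :=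
    ((continuous_const.mul ((hs _).comp hfc)).sub hsc).continuousOn.add (continuousOn_const.mul hcc)
  obtain ⟨x1, hx1, hmax1⟩ := UpperSemicontinuousOn.exists_isMaxOn ⟨x0, hx0L1⟩ hL₁c
    (husc (fun x hx => hx.1.1) (hgc.mono hL₁d))
  have hx₁d := hL₁d hx1
  have hs0 : s x0 = 0 := by simp [hsdef]
  have e1 : u z + (-h z + i * sqn (f z)) ≤ u x0 + (-h x0 + i * sqn (f x0)) := hmax0 hzL
  have e2 : u x1 + (-h x1 + i * sqn (f x1)) ≤ u x0 + (-h x0 + i * sqn (f x0)) := hmax0 hx1.1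
  have e3 : u x0 + (-h x0 + (i * sqn (f x0) - s x0 + ε * sqn (c x0))) ≤
      u x1 + (-h x1 + (i * sqn (f x1) - s x1 + ε * sqn (c x1))) := hmax1 hx0L1
  have e4 := mul_nonneg hl.le (sqn_nonneg (c x0))
  have e5 := mul_le_mul_of_nonneg_left (hA' x1 hx1) hl.le
  have e6 := mul_nonneg hi.le (sqn_nonneg (f z))
  have e7 := mul_le_mul_of_nonneg_left (hB' x1 hx1.1) hi.le
  have e8 : 0 ≤ s x1 := by have := sqn_nonneg (f x1 - f x0); positivity
  have hs1 : s x1 < η := by linarith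
  have hF1 : e / 2 < u x1 - h x1 := by linarith
  obtain ⟨O, V, t, p, H, hxO, hH, hF⟩ := CChart.exists_isCoord hd em hx₁d
  set F : X → Cn (Module.finrank ℂ d.E) := fun y => em (d.φ y - d.φ x1) with hFdef
  have hcF : ∀ x, c x = F x - (-c x1) := fun x => by simp [hc, hFdef]
  have hnear : ∀ᶠ x in 𝓝 x1, (x ∈ O ∧ x ∈ U) ∧ u x + (-h x + (i * sqn (f x) - s x + ε * sqn (c x))) ≤
      u x1 + (-h x1 + (i * sqn (f x1) - s x1 + ε * sqn (c x1))) := by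
    filter_upwards [hF.isOpen.mem_nhds hxO, hU.mem_nhds hx1.1.1,
      hsc.continuousAt.eventually_lt_const hs1,
      (hgc.continuousAt (d.openU.mem_nhds hx₁d)).eventually_lt_const (lt_add_of_pos_right _
        (sub_pos.2 hF1))] with x h1 h2 h3 h4
    refine ⟨⟨h1, h2⟩, ?_⟩
    by_cases hxL : e / 2 ≤ u x - h x
    · exact hmax1 ⟨⟨h2, hxL⟩, h3.le⟩
    · linarith
  refine hh.not_touching hH hF hxO (by simp [hFdef]) hnear (fun x hx => hUD hx.1.2)
    (ε := ε / 4) (by positivity)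
    (W := fun x => u x + (i * sqn (f x) - s x + ε * sqn (c x)) - ε / 2 * sqn (F x))
    (fun x hx b => ?_) (fun x hx => ?_) rfl (by linarith [hu1 x1 hx1.1.1])
  · refine (((hu x hx.1.2).add (PshNear.pshAt (hf x) (pshOn_sqn_sub_sqn (a := i) (b := i / 2)
      (by linarith) 0 (f x0) univ).pshNear)).add (PshNear.pshAt (hF.hol x hx.1.1)
      ((pshOn_sqn_sub_sqn (a := ε / 2) (b := ε / 2) le_rfl (-c x1) 0 univ).add isOpen_univ
        (pshOn_sqn_sub_sqn (a := ε / 2) (b := ε / 4) (by linarith) (-c x1) b univ)).pshNear)).congr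
      (.of_forall fun y => ?_)
    simp only [hsdef, hcF y, sub_zero]
    ring
  · have h1 := hx.2
    have h2 := mul_nonneg hl.le (sqn_nonneg (F x))
    have h3 : F x1 = 0 := by simp [hFdef]
    simp only [h3, sqn_zero]
    linarith

end Comparison

/-- Theorem 2.17.  Let `X` be a Stein space of pure dimension `n`,
`D = {ψ < c}`, `K ⋐ D` compact and `U ⊆ D \ K` open.  Assume `h*_{K,D}` is continuous,
and let `u ∈ PSH(U) ∩ L^∞(U)`, `u ≤ 1`, with
`liminf_{U ∋ z → z₀} (h*_{K,D}(z) - u(z)) ≥ 0` for every `z₀ ∈ ∂U ∩ D`.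
Then `u ≤ h*_{K,D}` on `U`. -/
theorem comparison_with_relative_extremal {X : Type*} [TopologicalSpace X] [T2Space X]
    [SecondCountableTopology X] (S : CSpace X) (n : ℕ)
    (hdim : PureDimensionIn S univ n) (hStein : IsSteinIn S univ)
    (ψ : X → ℝ) (hψan : SpaceRealAnalyticOn S ψ univ)
    (hψpsh : SpaceStronglyPSHOn S ψ univ) (hψexh : IsExhaustionOn ψ univ) (c : ℝ)
    (K : Set X) (hKcpt : IsCompact K) (hKD : K ⊆ {x : X | ψ x < c})
    (U : Set X) (hUopen : IsOpen U) (hUD : U ⊆ {x : X | ψ x < c} \ K)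
    (hcont : ContinuousOn (relExt S K {x : X | ψ x < c}) {x : X | ψ x < c})
    (u : X → EReal) (hu : SpacePSHOn S u U) (hub : BoundedOn u U)
    (hu1 : ∀ z ∈ U, u z ≤ 1)
    (hbd : ∀ z₀ ∈ frontier U ∩ {x : X | ψ x < c},
      (0 : EReal) ≤ liminf (fun z => relExt S K {x : X | ψ x < c} z - u z) (𝓝[U] z₀)) :
    ∀ z ∈ U, u z ≤ relExt S K {x : X | ψ x < c} z := by
  have hψc := hψan.continuous
  set D : Set X := {x : X | ψ x < c} with hDdef
  have hD : IsOpen D := isOpen_lt hψc continuous_const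
  have hco : ∀ x ∈ D, ((relExt S K D x).toReal : EReal) = relExt S K D x := fun x hx =>
    coe_toReal_relExt hD hx
  have henv := isEnvelope_relExt (S := S) hD hKD hcont
  set h : X → ℝ := fun x => (relExt S K D x).toReal with hh
  obtain ⟨m, M, hmM⟩ := hub
  set v : X → ℝ := fun x => (max (u x) m).toReal with hv
  have hvu : ∀ x ∈ U, (v x : EReal) = u x := fun x hx => by
    simp only [hv, max_eq_left (hmM x hx).1]
    exact EReal.coe_toReal ((hu1 x hx).trans_lt (EReal.coe_lt_top 1)).ne
      ((EReal.bot_lt_coe m).trans_le (hmM x hx).1).ne'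
  have hvp : ∀ x ∈ U, PshAt S v x := fun x hx => hu.pshAt hx m
  have hv1 : ∀ x ∈ U, v x ≤ 1 := fun x hx => by
    rw [← EReal.coe_le_coe_iff, hvu x hx]; exact hu1 x hx
  intro z hz
  by_contra! hlt
  have he : 0 < v z - h z := by
    rw [← hco z (hUD hz).1, ← hvu z hz, EReal.coe_lt_coe_iff] at hlt
    exact sub_pos.2 hlt
  set e := v z - h z
  obtain ⟨t, ht, htK⟩ : ∃ t > 0, ∀ x ∈ K, 1 + t * (ψ x - c) ≤ 0 := by
    obtain ⟨a, ha, haK⟩ := hKcpt.exists_forall_le' (f := fun x => c - ψ x) (a := 0)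
      (continuous_const.sub hψc).continuousOn fun x hx => sub_pos.2 (hKD hx)
    refine ⟨a⁻¹, inv_pos.2 ha, fun x hx => ?_⟩
    have h1 := mul_le_mul_of_nonneg_left (haK x hx) (inv_pos.2 ha).le
    rw [inv_mul_cancel₀ ha.ne'] at h1
    linarith
  have hbar : ∀ x ∈ D, 1 + t * (ψ x - c) ≤ h x := fun x hx => by
    refine (le_max_left _ 0).trans (henv.le (fun y => max (1 + t * (ψ y - c)) 0)
      ⟨fun y _ => PshAt.sup ?_ (pshAt_const 0 y), fun y hy => ⟨le_max_right _ _, max_le ?_ zero_le_one⟩,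
        fun y hy => max_le (htK y hy) le_rfl⟩ x hx)
    · refine (((hψpsh.pshAt hψc y).const_mul ht.le).add (pshAt_const (1 - t * c) y)).congr
        (Eventually.of_forall fun y => ?_)
      ring
    · have : ψ y < c := hy
      nlinarith
  have hLψ : ∀ x ∈ {x ∈ U | e / 2 ≤ v x - h x}, ψ x ≤ c - e / (2 * t) := fun x hx => by
    have h1 : t * (ψ x - c) ≤ -(e / 2) := by linarith [hbar x (hUD hx.1).1, hv1 x hx.1, hx.2]
    have h2 : e / (2 * t) = e / 2 / t := by rw [div_div]
    have h3 : ψ x - c ≤ -(e / 2) / t := by rw [le_div_iff₀ ht]; linarith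
    rw [neg_div] at h3
    linarith
  have het : 0 < e / (2 * t) := by positivity
  refine henv.not_superlevel hStein hUopen hUD hvp hv1 he ?_ hz rfl
  refine (hψexh c).1.of_isClosed_subset (isClosed_of_closure_subset fun x hx => ?_) fun x hx =>
    subset_closure ⟨mem_univ x, (hLψ x hx).trans_lt (by linarith)⟩
  have hxD : x ∈ D := lt_of_le_of_lt
    (closure_minimal hLψ (isClosed_le hψc continuous_const) hx : ψ x ≤ c - e / (2 * t))
    (sub_lt_self c het)
  have hfr := mem_closure_iff_frequently.1 hx
  by_cases hxU : x ∈ U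
  · refine ⟨hxU, not_lt.1 fun hlt' => hfr ?_⟩
    have h1 : UpperSemicontinuousAt (fun y => v y + -h y) x := (hvp x hxU).upperSemicontinuousAt.add
      (henv.cont.continuousAt (hD.mem_nhds hxD)).neg.upperSemicontinuousAt
    filter_upwards [h1 (e / 2) (by linarith)] with y hy hyL
    linarith [hyL.2]
  · have hxf : x ∈ frontier U :=
      ⟨closure_mono (fun y hy => hy.1) hx, fun hi => hxU (interior_subset hi)⟩
    have h1 : ((-(e / 2) : ℝ) : EReal) < liminf (fun z => relExt S K D z - u z) (𝓝[U] x) :=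
      lt_of_lt_of_le (EReal.coe_lt_coe_iff.2 (by linarith : -(e / 2) < 0)) (hbd x ⟨hxf, hxD⟩)
    refine absurd ((eventually_nhdsWithin_iff.1 (eventually_lt_of_lt_liminf h1)).mono
      fun y hy hyL => ?_) hfr
    have h2 := hy hyL.1
    rw [← hco y (hUD hyL.1).1, ← hvu y hyL.1, ← EReal.coe_sub, EReal.coe_lt_coe_iff] at h2
    linarith [hyL.2]
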